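/- Under the stated assumptions, for every bounded Borel set E ⊂ ℝ^d, the random variables √(πt/2)·M_t(E) converge in probability, as t → ∞, to D̄_∞(E) := limsup_{t→∞} D_t(E). -/

import Mathlib

open MeasureTheory ProbabilityTheory Filter Real
open Set (Icc univ Iic Ici Ioc indicator Ioi Ico mem_ofPred_eq indicator_of_mem
  indicator_of_notMem mem_Ici mem_inter_iff mem_union mem_iUnion mem_iInter univ_inter
  mem_empty_iff_false mem_Iic mem_Icc indicator_le_self' Ioc_subset_Icc_self mem_compl_iff
  inter_indicator_one disjoint_sdiff_right nonempty_Icc)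
open ENNReal (ofReal ofReal_mul ofReal_le_ofReal ofReal_ne_top ofReal_add ofReal_one
  continuous_ofReal ofReal_lt_ofReal_iff le_div_iff_mul_le tendsto_nhds_zero ofReal_ofNat
  ofReal_natCast ofReal_div_of_pos ofReal_sum_of_nonneg ofReal_pow ofReal_zero ofReal_of_nonpos
  ofReal_eq_zero ofReal_add_le toReal_le_toReal toReal_ofReal)

section

variable {Ω : Type*} {mΩ : MeasurableSpace Ω} {P Q : Measure Ω} {B : ℝ → Ω → ℝ}
  {F : ℝ → MeasurableSpace Ω}

/-! ### Running suprema -/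

/-- The supremum of the path `s ↦ Z s ω` over `[a, b]`. -/
noncomputable def runSup (Z : ℝ → Ω → ℝ) (a b : ℝ) (ω : Ω) : ℝ :=
  sSup ((fun s => Z s ω) '' Icc a b)

section runSup

variable {Z : ℝ → Ω → ℝ} {a b : ℝ}

theorem runSup_le_iff (hab : a ≤ b) {ω : Ω} (hc : Continuous fun s => Z s ω) {c : ℝ} :
    runSup Z a b ω ≤ c ↔ ∀ s ∈ Icc a b, Z s ω ≤ c := by
  have hbdd : BddAbove ((fun s => Z s ω) '' Icc a b) :=
    (isCompact_Icc.image hc).bddAbove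
  have hne : ((fun s => Z s ω) '' Icc a b).Nonempty :=
    (nonempty_Icc.2 hab).image _
  unfold runSup
  rw [csSup_le_iff hbdd hne]
  exact Set.forall_mem_image

theorem le_runSup {ω : Ω} (hc : Continuous fun s => Z s ω) {s : ℝ} (hs : s ∈ Icc a b) :
    Z s ω ≤ runSup Z a b ω :=
  le_csSup (isCompact_Icc.image hc).bddAbove ⟨s, hs, rfl⟩

theorem forall_Icc_iff_rat (hab : a ≤ b) {g : ℝ → ℝ} (hc : Continuous g) {c : ℝ} :
    (∀ s ∈ Icc a b, g s ≤ c) ↔ ∀ q : ℚ, g (max a (min b (q : ℝ))) ≤ c := by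
  constructor
  · intro h q
    exact h _ ⟨le_max_left _ _, max_le hab (min_le_left _ _)⟩
  · intro h s hs
    have hcl : IsClosed {r : ℝ | g (max a (min b r)) ≤ c} :=
      isClosed_le (by fun_prop) continuous_const
    have : s ∈ {r : ℝ | g (max a (min b r)) ≤ c} := by
      refine (hcl.closure_subset_iff (s := Set.range ((↑) : ℚ → ℝ))).2 ?_
        (Rat.denseRange_cast s)
      rintro _ ⟨q, rfl⟩
      exact h q
    simpa [min_eq_right hs.2, max_eq_right hs.1] using this

theorem measurable_runSup {m : MeasurableSpace Ω} (hab : a ≤ b)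
    (hm : ∀ s ∈ Icc a b, Measurable[m] (Z s)) (hc : ∀ ω, Continuous fun s => Z s ω) :
    Measurable[m] (runSup Z a b) := by
  refine measurable_of_Iic fun c => ?_
  have : runSup Z a b ⁻¹' Iic c = ⋂ q : ℚ, {ω | Z (max a (min b (q : ℝ))) ω ≤ c} := by
    ext ω
    simp only [Set.mem_preimage, mem_Iic, mem_iInter, mem_ofPred_eq]
    rw [runSup_le_iff hab (hc ω), forall_Icc_iff_rat hab (hc ω)]
  rw [this]
  refine MeasurableSet.iInter fun q => ?_
  exact measurableSet_le
    (hm _ ⟨le_max_left _ _, max_le hab (min_le_left _ _)⟩) measurable_const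

theorem measurableSet_forall_le {m : MeasurableSpace Ω} (hab : a ≤ b)
    (hm : ∀ s ∈ Icc a b, Measurable[m] (Z s)) (hc : ∀ ω, Continuous fun s => Z s ω)
    {f : ℝ → ℝ} (hf : Continuous f) : MeasurableSet[m] {ω | ∀ s ∈ Icc a b, Z s ω ≤ f s} := by
  have h := measurable_runSup (m := m) (Z := fun s ω => Z s ω - f s) hab
    (fun s hs => (hm s hs).sub_const _) (fun ω => (hc ω).sub hf)
  have := measurableSet_le h (measurable_const (a := (0 : ℝ)))
  convert this using 1
  ext ω
  simp only [mem_ofPred_eq]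
  rw [runSup_le_iff (Z := fun s ω => Z s ω - f s) hab ((hc ω).sub hf)]
  simp

end runSup

/-! ### Conditioning on an independent σ-algebra -/

theorem lintegral_indep {Ω α β : Type*} {m₁ m₂ : MeasurableSpace Ω} {m : MeasurableSpace Ω} [MeasurableSpace α]
    [MeasurableSpace β] {Q : Measure Ω} [IsProbabilityMeasure Q] (h : Indep m₁ m₂ Q)
    (h₁ : m₁ ≤ m) (h₂ : m₂ ≤ m) {U : Ω → α} {V : Ω → β} (hU : Measurable[m₁] U)
    (hV : Measurable[m₂] V) {F : α → β → ENNReal} (hF : Measurable (Function.uncurry F)) :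
    ∫⁻ ω, F (U ω) (V ω) ∂Q = ∫⁻ ω, ∫⁻ ω', F (U ω) (V ω') ∂Q ∂Q := by
  have hU' : Measurable U := hU.mono h₁ le_rfl
  have hV' : Measurable V := hV.mono h₂ le_rfl
  have hi : IndepFun U V Q := by
    rw [IndepFun_iff_Indep]
    exact indep_of_indep_of_le_left (indep_of_indep_of_le_right h hV.comap_le) hU.comap_le
  have hp := (indepFun_iff_map_prod_eq_prod_map_map hU'.aemeasurable hV'.aemeasurable).1 hi
  have e1 : ∫⁻ ω, F (U ω) (V ω) ∂Q
      = ∫⁻ p, Function.uncurry F p ∂(Q.map fun ω => (U ω, V ω)) := by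
    rw [lintegral_map hF (hU'.prodMk hV')]; rfl
  have : IsProbabilityMeasure (Q.map V) := Measure.isProbabilityMeasure_map hV'.aemeasurable
  rw [e1, hp, lintegral_prod _ hF.aemeasurable, lintegral_map _ hU']
  · refine lintegral_congr fun ω => ?_
    exact lintegral_map (hF.comp measurable_prodMk_left) hV'
  · exact hF.lintegral_prod_right'

/-! ### Gaussian tilting -/

/-- Exponential tilting of a one-dimensional Gaussian variable is a shift. -/
theorem lintegral_exp_gaussianReal (v : NNReal) {F : ℝ → ENNReal} (hF : Measurable F) :
    ∫⁻ x, ofReal (exp (x - v / 2)) * F x ∂(gaussianReal 0 v)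
      = ∫⁻ x, F (x + v) ∂(gaussianReal 0 v) := by
  by_cases hv : v = 0
  · subst hv
    simp
  have hsh : (gaussianReal 0 v).map (fun x => x + (v : ℝ)) = gaussianReal (v : ℝ) v := by
    simpa using gaussianReal_map_add_const (μ := 0) (v := v) (v : ℝ)
  have e : ∫⁻ x, F (x + v) ∂(gaussianReal 0 v) = ∫⁻ x, F x ∂(gaussianReal (v : ℝ) v) := by
    rw [← hsh, lintegral_map hF (by fun_prop)]
  rw [e, gaussianReal_of_var_ne_zero _ hv, gaussianReal_of_var_ne_zero _ hv,
    lintegral_withDensity_eq_lintegral_mul _ (measurable_gaussianPDF _ _) (by fun_prop),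
    lintegral_withDensity_eq_lintegral_mul _ (measurable_gaussianPDF _ _) hF]
  refine lintegral_congr fun x => ?_
  simp only [Pi.mul_apply, ← mul_assoc]
  congr 1
  unfold gaussianPDF
  rw [← ofReal_mul (gaussianPDFReal_nonneg _ _ _)]
  congr 1
  unfold gaussianPDFReal
  rw [mul_assoc, ← exp_add]
  congr 2
  have : (v : ℝ) ≠ 0 := by exact_mod_cast hv
  field_simp
  ring

/-- The Cameron–Martin formula for a Gaussian process `G` and one of its linear functionals `H`. -/
theorem lintegral_exp_gaussian {Ω T : Type*} {mΩ : MeasurableSpace Ω} {P : Measure Ω}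
    {G : T → Ω → ℝ} {H : Ω → ℝ}
    (hG : IsGaussianProcess (Option.elim · H G) P) (hGm : ∀ t, Measurable (G t))
    (hHm : Measurable H) (hH0 : P[H] = 0) {F : (T → ℝ) → ENNReal} (hF : Measurable F) :
    ∫⁻ ω, ofReal (exp (H ω - Var[H; P] / 2)) * F (fun t => G t ω) ∂P
      = ∫⁻ ω, F (fun t => G t ω + cov[G t, H; P]) ∂P := by
  have hP : IsProbabilityMeasure P := hG.isProbabilityMeasure
  have hHg : HasGaussianLaw H P := hG.hasGaussianLaw_eval none
  have hGg : ∀ t, HasGaussianLaw (G t) P := fun t => hG.hasGaussianLaw_eval (some t)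
  have hmap : P.map H = gaussianReal 0 (Var[H; P]).toNNReal := by
    rw [hHg.map_eq_gaussianReal, hH0]
  have hH2 : MemLp H 2 P := hHg.memLp_two
  have hG2 : ∀ t, MemLp (G t) 2 P := fun t => (hGg t).memLp_two
  set v := Var[H; P] with hv
  have hv0 : 0 ≤ v := variance_nonneg _ _
  by_cases hvz : v = 0
  · have hH : H =ᵐ[P] fun _ => 0 := by
      have := ae_eq_integral_of_variance_eq_zero hH2 hvz
      filter_upwards [this] with ω hω
      rw [hω, hH0]
    have hc : ∀ t, cov[G t, H; P] = 0 := by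
      intro t
      refine integral_eq_zero_of_ae ?_
      filter_upwards [hH] with ω hω
      simp [hω, hH0]
    refine lintegral_congr_ae ?_
    filter_upwards [hH] with ω hω
    simp [hω, hc, hvz]
  · set c : T → ℝ := fun t => cov[G t, H; P] / v with hc
    let G' : T → Ω → ℝ := fun t ω => G t ω - c t * H ω
    have hpr : IsGaussianProcess (Sum.elim G' (fun _ : Unit => H)) P := by
      classical
      refine hG.of_isGaussianProcess fun s => ?_
      rcases s with t | u
      · refine ⟨{none, some t},
          (ContinuousLinearMap.proj (R := ℝ)
              (⟨some t, by simp⟩ : ({none, some t} : Finset (Option T)))) -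
            c t • (ContinuousLinearMap.proj (R := ℝ)
              (⟨none, by simp⟩ : ({none, some t} : Finset (Option T)))), fun ω => ?_⟩
        simp [G']
      · refine ⟨{none},
          (ContinuousLinearMap.proj (R := ℝ)
              (⟨none, by simp⟩ : ({none} : Finset (Option T)))), fun ω => ?_⟩
        simp
    have hG'm : ∀ t, Measurable (G' t) := fun t => (hGm t).sub (hHm.const_mul _)
    have hind : IndepFun (fun ω t => G' t ω) (fun ω (_ : Unit) => H ω) P := by
      refine hpr.indepFun_of_covariance_eq_zero (fun t => (hG'm t).aemeasurable)
        (fun _ => hHm.aemeasurable) fun t _ => ?_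
      have : cov[G' t, H; P] = cov[G t, H; P] - c t * cov[H, H; P] := by
        have h1 : G' t = G t - (fun ω => c t * H ω) := rfl
        rw [h1, covariance_sub_left (hG2 t) (hH2.const_mul _) hH2, covariance_const_mul_left]
      rw [this, covariance_self hHm.aemeasurable, ← hv, hc]
      field_simp
      ring
    have hind2 : IndepFun (fun ω t => G' t ω) H P :=
      hind.comp (φ := id) (ψ := fun f : Unit → ℝ => f ()) measurable_id (measurable_pi_apply _)
    have hG'mm : Measurable (fun ω t => G' t ω) := measurable_pi_lambda _ hG'm
    have key : ∀ Φ : (T → ℝ) → ℝ → ENNReal, Measurable (Function.uncurry Φ) →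
        ∫⁻ ω, Φ (fun t => G' t ω) (H ω) ∂P
          = ∫⁻ ω, ∫⁻ x, Φ (fun t => G' t ω) x ∂(gaussianReal 0 v.toNNReal) ∂P := by
      intro Φ hΦ
      rw [lintegral_indep ((IndepFun_iff_Indep _ _ _).1 hind2) hG'mm.comap_le hHm.comap_le
        (comap_measurable _) (comap_measurable _) hΦ]
      refine lintegral_congr fun ω => ?_
      rw [← hmap]
      exact (lintegral_map (hΦ.comp measurable_prodMk_left) hHm).symm
    have hadd : Measurable fun p : (T → ℝ) × ℝ => fun t => p.1 t + c t * p.2 :=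
      measurable_pi_lambda _ fun t =>
        ((measurable_pi_apply t).comp measurable_fst).add (measurable_snd.const_mul _)
    have hadd2 : Measurable fun p : (T → ℝ) × ℝ => fun t => p.1 t + c t * (p.2 + v) :=
      measurable_pi_lambda _ fun t =>
        ((measurable_pi_apply t).comp measurable_fst).add
          ((measurable_snd.add_const _).const_mul _)
    have hΦ₁ : Measurable (Function.uncurry fun (g : T → ℝ) (x : ℝ) =>
        ofReal (exp (x - v / 2)) * F (fun t => g t + c t * x)) := by
      have h1 : Measurable fun p : (T → ℝ) × ℝ => ofReal (exp (p.2 - v / 2)) := by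
        fun_prop
      have h2 : Measurable fun p : (T → ℝ) × ℝ => F fun t => p.1 t + c t * p.2 := hF.comp hadd
      exact h1.mul h2
    have hΦ₂ : Measurable (Function.uncurry fun (g : T → ℝ) (x : ℝ) =>
        F (fun t => g t + c t * (x + v))) := hF.comp hadd2
    have k1 := key _ hΦ₁
    have k2 := key _ hΦ₂
    have e1 : ∀ t ω, G' t ω + c t * H ω = G t ω := fun t ω => by simp [G']
    have e2 : ∀ t ω, G' t ω + c t * (H ω + v) = G t ω + cov[G t, H; P] := fun t ω => by
      have : c t * v = cov[G t, H; P] := by rw [hc]; field_simp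
      rw [mul_add, ← add_assoc, e1, this]
    simp only [e1] at k1
    simp only [e2] at k2
    rw [k1, k2]
    refine lintegral_congr fun ω => ?_
    have hvv : ((v.toNNReal : NNReal) : ℝ) = v := Real.coe_toNNReal _ hv0
    have := lintegral_exp_gaussianReal v.toNNReal
      (F := fun x => F (fun t => G' t ω + c t * x)) (hF.comp (hadd.comp measurable_prodMk_left))
    rw [hvv] at this
    exact this

/-! ### Brownian motion -/

/-- A real Brownian motion with continuous paths started at `0`, indexed by real times
(only nonnegative times matter). -/
structure IsBM (B : ℝ → Ω → ℝ) (Q : Measure Ω) : Prop where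
  pre : IsPreBrownianReal (fun s : NNReal => B s) Q
  meas : ∀ s, Measurable (B s)
  cont : ∀ ω, Continuous fun s => B s ω
  zero : ∀ ω, B 0 ω = 0

/-- The σ-algebra generated by the path up to time `u`. -/
def pastσ (B : ℝ → Ω → ℝ) (u : ℝ) : MeasurableSpace Ω :=
  MeasurableSpace.comap (fun ω (s : Icc (0 : ℝ) u) => B s ω) MeasurableSpace.pi

/-- The σ-algebra generated by the increments after time `u`. -/
def futσ (B : ℝ → Ω → ℝ) (u : ℝ) : MeasurableSpace Ω :=
  MeasurableSpace.comap (fun ω (s : NNReal) => B (u + s) ω - B u ω) MeasurableSpace.pi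

theorem measurable_pastσ (B : ℝ → Ω → ℝ) {s u : ℝ} (hs : s ∈ Icc 0 u) :
    Measurable[pastσ B u] (B s) :=
  (measurable_pi_apply (⟨s, hs⟩ : Icc (0 : ℝ) u)).comp
    (comap_measurable fun ω (s : Icc (0 : ℝ) u) => B s ω)

theorem measurable_futσ (B : ℝ → Ω → ℝ) {s u : ℝ} (hs : 0 ≤ s) :
    Measurable[futσ B u] (fun ω => B (u + s) ω - B u ω) :=
  (measurable_pi_apply (⟨s, hs⟩ : NNReal)).comp
    (comap_measurable fun ω (s : NNReal) => B (u + s) ω - B u ω)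

theorem pastσ_mono (B : ℝ → Ω → ℝ) {s u : ℝ} (hs : s ≤ u) : pastσ B s ≤ pastσ B u := by
  rw [pastσ, ← measurable_iff_comap_le]
  exact @measurable_pi_lambda _ _ _ (pastσ B u) _ _ fun r =>
    measurable_pastσ B ⟨r.2.1, r.2.2.trans hs⟩

namespace IsBM

theorem isProbabilityMeasure (hB : IsBM B Q) : IsProbabilityMeasure Q :=
  hB.pre.isGaussianProcess.isProbabilityMeasure

theorem past_le (hB : IsBM B Q) (u : ℝ) : pastσ B u ≤ mΩ := by
  rw [pastσ, ← measurable_iff_comap_le]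
  exact measurable_pi_lambda _ fun s => hB.meas s

theorem fut_le (hB : IsBM B Q) (u : ℝ) : futσ B u ≤ mΩ := by
  rw [futσ, ← measurable_iff_comap_le]
  exact measurable_pi_lambda _ fun s => (hB.meas _).sub (hB.meas _)

theorem indep (hB : IsBM B Q) {u : ℝ} (hu : 0 ≤ u) : Indep (pastσ B u) (futσ B u) Q := by
  have h := (hB.pre.indepFun_shift ⟨u, hu⟩).symm
  have h2 := h.comp (φ := fun g (s : Icc (0 : ℝ) u) =>
      g ⟨⟨s.1, s.2.1⟩, s.2.2⟩) (ψ := id)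
    (measurable_pi_lambda _ fun s => measurable_pi_apply _) measurable_id
  exact (IndepFun_iff_Indep _ _ _).1 h2

theorem shift (hB : IsBM B Q) {u : ℝ} (hu : 0 ≤ u) : IsBM (fun s ω => B (u + s) ω - B u ω) Q where
  pre := by
    have := hB.pre.shift ⟨u, hu⟩
    exact this
  meas s := (hB.meas _).sub (hB.meas _)
  cont ω := ((hB.cont ω).comp (continuous_const.add continuous_id)).sub continuous_const
  zero ω := by simp

theorem map_eq (hB : IsBM B Q) {t : ℝ} (ht : 0 ≤ t) : Q.map (B t) = gaussianReal 0 t.toNNReal := by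
  have h := (hB.pre.hasLaw_eval ⟨t, ht⟩).map_eq
  rw [show t.toNNReal = ⟨t, ht⟩ from Real.toNNReal_of_nonneg ht]
  exact h

theorem map_sub_eq (hB : IsBM B Q) {u t : ℝ} (hu : 0 ≤ u) (ht : u ≤ t) :
    Q.map (fun ω => B t ω - B u ω) = gaussianReal 0 (t - u).toNNReal := by
  have := (hB.shift hu).map_eq (sub_nonneg.2 ht)
  simpa using this

theorem integral_comp (hB : IsBM B Q) {t : ℝ} (ht : 0 ≤ t) {φ : ℝ → ℝ} (hφ : Measurable φ) :
    ∫ ω, φ (B t ω) ∂Q = ∫ x, φ x ∂(gaussianReal 0 t.toNNReal) := by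
  rw [← hB.map_eq ht, integral_map (hB.meas t).aemeasurable hφ.aestronglyMeasurable]

theorem integrable_exp (hB : IsBM B Q) {t : ℝ} (ht : 0 ≤ t) (c : ℝ) :
    Integrable (fun ω => exp (c * B t ω)) Q := by
  have := integrable_exp_mul_gaussianReal (μ := 0) (v := t.toNNReal) c
  rw [← hB.map_eq ht] at this
  exact this.comp_measurable (hB.meas t)

theorem integral_exp (hB : IsBM B Q) {t : ℝ} (ht : 0 ≤ t) (c : ℝ) :
    ∫ ω, exp (c * B t ω) ∂Q = exp (t * c ^ 2 / 2) := by
  have := mgf_gaussianReal (hB.map_eq ht) c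
  simpa [mgf, Real.coe_toNNReal _ ht] using this

/-- The fourth moment of the positive part is at most a multiple of `t ^ 2`. -/
theorem pow_four_le (hB : IsBM B Q) {t : ℝ} (ht : 0 < t) :
    Integrable (fun ω => B t ω ^ 4) Q ∧ ∫ ω, B t ω ^ 4 ∂Q ≤ 96 * t ^ 2 := by
  have := hB.isProbabilityMeasure
  set c := (√t)⁻¹ with hc
  have hc0 : 0 < c := by positivity
  have hct : c ^ 2 * t = 1 := by
    rw [hc, inv_pow, Real.sq_sqrt ht.le]; field_simp
  have i1 := hB.integrable_exp ht.le c
  have i2 := hB.integrable_exp ht.le (-c)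
  have hpt : ∀ x : ℝ, x ^ 4 ≤ t ^ 2 * (24 * (exp (c * x) + exp (-c * x))) := by
    intro x
    have hy : ∀ y : ℝ, y ^ 4 ≤ 24 * (exp y + exp (-y)) := by
      have h0 : ∀ y : ℝ, 0 ≤ y → y ^ 4 ≤ 24 * (exp y + exp (-y)) := by
        intro y hy
        have := Real.pow_div_factorial_le_exp y hy 4
        have h24 : ((Nat.factorial 4 : ℕ) : ℝ) = 24 := by norm_num [Nat.factorial]
        rw [h24, div_le_iff₀ (by norm_num)] at this
        have := exp_pos (-y)
        linarith
      intro y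
      rcases le_total 0 y with h | h
      · exact h0 y h
      · have := h0 (-y) (by linarith)
        rw [neg_neg] at this
        calc y ^ 4 = (-y) ^ 4 := by ring
          _ ≤ _ := this
          _ = _ := by ring
    have := hy (c * x)
    have h4 : (c * x) ^ 4 * t ^ 2 = x ^ 4 := by
      have : (c * x) ^ 4 * t ^ 2 = (c ^ 2 * t) ^ 2 * x ^ 4 := by ring
      rw [this, hct]; ring
    rw [← h4, mul_comm, neg_mul]
    exact mul_le_mul_of_nonneg_left this (by positivity)
  have idom : Integrable (fun ω => t ^ 2 * (24 * (exp (c * B t ω) + exp (-c * B t ω)))) Q :=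
    ((i1.add i2).const_mul 24).const_mul _
  have i4 : Integrable (fun ω => B t ω ^ 4) Q := by
    refine idom.mono' ((hB.meas t).pow_const 4).aestronglyMeasurable (ae_of_all _ fun ω => ?_)
    rw [Real.norm_of_nonneg (by positivity)]
    exact hpt _
  refine ⟨i4, (integral_mono i4 idom fun ω => hpt _).trans ?_⟩
  rw [integral_const_mul, integral_const_mul, integral_add i1 i2, hB.integral_exp ht.le,
    hB.integral_exp ht.le]
  have h2 : t * c ^ 2 / 2 = 1 / 2 := by rw [mul_comm t, hct]
  have h3 : t * (-c) ^ 2 / 2 = 1 / 2 := by rw [neg_sq, h2]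
  rw [h2, h3]
  have he : exp (1 / 2) ≤ 2 := by
    have h := Real.exp_one_lt_d9
    have : exp (1 / 2) ^ 2 = exp 1 := by rw [← exp_nat_mul]; norm_num
    nlinarith [exp_pos (1 / 2 : ℝ)]
  nlinarith [sq_nonneg t, he, ht]

theorem integrable (hB : IsBM B Q) {t : ℝ} (ht : 0 ≤ t) : Integrable (B t) Q :=
  hB.pre.integrable_eval ⟨t, ht⟩

theorem integral_eq_zero (hB : IsBM B Q) {t : ℝ} (ht : 0 ≤ t) : ∫ ω, B t ω ∂Q = 0 :=
  hB.pre.integral_eval ⟨t, ht⟩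

/-- The increment after time `u` may be reflected without changing its joint law with the past. -/
theorem map_prod_neg (hB : IsBM B Q) {α : Type*} [MeasurableSpace α] {u t : ℝ} (hu : 0 ≤ u)
    (ht : u ≤ t) {U : Ω → α} (hU : Measurable[pastσ B u] U) :
    Q.map (fun ω => (U ω, B t ω - B u ω)) = Q.map (fun ω => (U ω, -(B t ω - B u ω))) := by
  have := hB.isProbabilityMeasure
  have hU' : Measurable U := hU.mono (hB.past_le u) le_rfl
  have hV : Measurable[futσ B u] (fun ω => B t ω - B u ω) := by
    have := measurable_futσ B (u := u) (sub_nonneg.2 ht)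
    simpa using this
  have hV' : Measurable (fun ω => B t ω - B u ω) := hV.mono (hB.fut_le u) le_rfl
  have hi : IndepFun U (fun ω => B t ω - B u ω) Q := by
    rw [IndepFun_iff_Indep]
    exact indep_of_indep_of_le_left (indep_of_indep_of_le_right (hB.indep hu) hV.comap_le)
      hU.comap_le
  have hi2 : IndepFun U (fun ω => -(B t ω - B u ω)) Q :=
    hi.comp (φ := id) (ψ := fun x : ℝ => -x) measurable_id measurable_neg
  have hV'n : Measurable (fun ω => -(B t ω - B u ω)) := hV'.neg
  rw [(indepFun_iff_map_prod_eq_prod_map_map hU'.aemeasurable hV'.aemeasurable).1 hi,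
    (indepFun_iff_map_prod_eq_prod_map_map hU'.aemeasurable hV'n.aemeasurable).1 hi2]
  congr 1
  have hn : Q.map (fun ω => -(B t ω - B u ω)) = (Q.map fun ω => B t ω - B u ω).map (fun x => -x) := by
    rw [Measure.map_map measurable_neg hV']; rfl
  rw [hn, hB.map_sub_eq hu ht, gaussianReal_map_neg, neg_zero]

/-- One step of the discrete reflection argument. -/
theorem abs_integral_odd_le (hB : IsBM B Q) {φ : ℝ → ℝ} {L : ℝ} (hL : 0 ≤ L)
    (hφ : ∀ x y, |φ x - φ y| ≤ L * |x - y|) {z : ℝ} (hodd : ∀ y, φ (2 * z - y) = -φ y)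
    {r u t : ℝ} (hr : 0 ≤ r) (hru : r < u) (hut : u ≤ t) {A : Set Ω}
    (hA : MeasurableSet[pastσ B u] A) (hA1 : ∀ ω ∈ A, B r ω ≤ z) (hA2 : ∀ ω ∈ A, z < B u ω)
    {ε : ℝ} (hε : 0 < ε) :
    |∫ ω in A, φ (B t ω) ∂Q| ≤ L * (ε * Q.real A + ε⁻¹ ^ 3 * (96 * (u - r) ^ 2)) := by
  have := hB.isProbabilityMeasure
  have hu : 0 ≤ u := hr.trans hru.le
  have ht : 0 ≤ t := hu.trans hut
  have hA' : MeasurableSet A := hB.past_le u _ hA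
  have hφc : Continuous φ := by
    refine (LipschitzWith.of_dist_le_mul (K := L.toNNReal) fun x y => ?_).continuous
    rw [Real.dist_eq, Real.dist_eq, Real.coe_toNNReal _ hL]
    exact hφ x y
  have hφ0 : φ z = 0 := by
    have := hodd z
    rw [show 2 * z - z = z by ring] at this
    linarith
  have hbd : ∀ y, |φ y| ≤ L * |y - z| := fun y => by simpa [hφ0] using hφ y z
  let f : ℝ × ℝ → ℝ := fun p => φ (p.1 + p.2)
  have hf : Continuous f := by fun_prop
  classical
  let U : Ω → ℝ × ℝ := fun ω => (A.indicator (fun _ => 1) ω, B u ω)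
  have hU : Measurable[pastσ B u] U := by
    refine Measurable.prodMk ?_ (measurable_pastσ B ⟨hu, le_rfl⟩)
    exact (@measurable_const _ _ _ (pastσ B u) (1 : ℝ)).indicator hA
  have hU' : Measurable U := hU.mono (hB.past_le u) le_rfl
  have hmap := hB.map_prod_neg hu hut hU
  let g : (ℝ × ℝ) × ℝ → ℝ := fun q => q.1.1 * φ (q.1.2 + q.2)
  have hg : Measurable g := by
    have := hφc.measurable
    fun_prop
  have hm1 : Measurable fun ω => (U ω, B t ω - B u ω) :=
    hU'.prodMk ((hB.meas _).sub (hB.meas _))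
  have hm2 : Measurable fun ω => (U ω, -(B t ω - B u ω)) :=
    hU'.prodMk ((hB.meas _).sub (hB.meas _)).neg
  have hind : ∀ h : Ω → ℝ, (fun ω => A.indicator (fun _ => (1 : ℝ)) ω * h ω) = A.indicator h := by
    intro h
    ext ω
    by_cases hω : ω ∈ A <;> simp [hω]
  have key : ∫ ω in A, φ (B t ω) ∂Q = ∫ ω in A, φ (2 * B u ω - B t ω) ∂Q := by
    rw [← integral_indicator hA', ← integral_indicator hA', ← hind (fun ω => φ (B t ω)),
      ← hind (fun ω => φ (2 * B u ω - B t ω))]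
    have e1 := integral_map (μ := Q) hm1.aemeasurable (f := g) hg.aestronglyMeasurable
    have e2 := integral_map (μ := Q) hm2.aemeasurable (f := g) hg.aestronglyMeasurable
    rw [hmap, e2] at e1
    simp only [g, U] at e1
    have a1 : ∀ ω, B u ω + (B t ω - B u ω) = B t ω := fun ω => by ring
    have a2 : ∀ ω, B u ω + -(B t ω - B u ω) = 2 * B u ω - B t ω := fun ω => by ring
    simp only [a1, a2] at e1
    exact e1.symm
  have iB : ∀ {s}, 0 ≤ s → Integrable (B s) Q := fun h => hB.integrable h
  have i1 : Integrable (fun ω => φ (B t ω)) Q := by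
    refine Integrable.mono' (((iB ht).sub (integrable_const z)).abs.const_mul L)
      (hφc.measurable.comp (hB.meas t)).aestronglyMeasurable (ae_of_all _ fun ω => hbd _)
  have i2 : Integrable (fun ω => φ (2 * B u ω - B t ω)) Q := by
    refine Integrable.mono'
      (((((iB hu).const_mul 2).sub (iB ht)).sub (integrable_const z)).abs.const_mul L)
      (hφc.measurable.comp (((hB.meas u).const_mul 2).sub (hB.meas t))).aestronglyMeasurable
      (ae_of_all _ fun ω => hbd _)
  have i3 : Integrable (fun ω => (B u ω - B r ω) ^ 4) Q ∧
      ∫ ω, (B u ω - B r ω) ^ 4 ∂Q ≤ 96 * (u - r) ^ 2 := by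
    have := (hB.shift hr).pow_four_le (sub_pos.2 hru)
    simpa using this
  have hsum : 2 * ∫ ω in A, φ (B t ω) ∂Q
      = ∫ ω in A, (φ (B t ω) + φ (2 * B u ω - B t ω)) ∂Q := by
    rw [integral_add i1.integrableOn i2.integrableOn, ← key]; ring
  have idom : Integrable (fun ω => 2 * L * (ε + ε⁻¹ ^ 3 * (B u ω - B r ω) ^ 4)) Q :=
    ((integrable_const ε).add (i3.1.const_mul _)).const_mul _
  have hle : |∫ ω in A, (φ (B t ω) + φ (2 * B u ω - B t ω)) ∂Q|
      ≤ ∫ ω in A, 2 * L * (ε + ε⁻¹ ^ 3 * (B u ω - B r ω) ^ 4) ∂Q := by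
    rw [← Real.norm_eq_abs]
    refine (norm_integral_le_integral_norm _).trans ?_
    refine setIntegral_mono_on (i1.add i2).norm.integrableOn idom.integrableOn hA' fun ω hω => ?_
    have h1 := hφ (2 * B u ω - B t ω) (2 * z - B t ω)
    rw [hodd] at h1
    have hz1 := hA1 ω hω
    have hz2 := hA2 ω hω
    have e : |2 * B u ω - B t ω - (2 * z - B t ω)| = 2 * (B u ω - z) := by
      rw [abs_of_nonneg] <;> linarith
    rw [e] at h1
    rw [Real.norm_eq_abs, add_comm]
    have h2 : B u ω - z ≤ ε + ε⁻¹ ^ 3 * (B u ω - B r ω) ^ 4 := by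
      set D := B u ω - B r ω with hD
      have hD0 : 0 ≤ D := by linarith
      have : D ≤ ε + ε⁻¹ ^ 3 * D ^ 4 := by
        rcases le_total D ε with h | h
        · have : 0 ≤ ε⁻¹ ^ 3 * D ^ 4 := by positivity
          linarith
        · have h3 : 1 ≤ ε⁻¹ ^ 3 * D ^ 3 := by
            rw [← mul_pow]
            refine one_le_pow₀ ?_
            rw [inv_mul_eq_div, one_le_div hε]; exact h
          have : D * 1 ≤ D * (ε⁻¹ ^ 3 * D ^ 3) := mul_le_mul_of_nonneg_left h3 hD0
          nlinarith
      linarith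
    calc |φ (2 * B u ω - B t ω) + φ (B t ω)| ≤ L * (2 * (B u ω - z)) := by simpa using h1
      _ ≤ L * (2 * (ε + ε⁻¹ ^ 3 * (B u ω - B r ω) ^ 4)) := by gcongr
      _ = _ := by ring
  have hfin : ∫ ω in A, 2 * L * (ε + ε⁻¹ ^ 3 * (B u ω - B r ω) ^ 4) ∂Q
      ≤ 2 * (L * (ε * Q.real A + ε⁻¹ ^ 3 * (96 * (u - r) ^ 2))) := by
    rw [integral_const_mul, integral_add (integrable_const ε).integrableOn
      (i3.1.const_mul _).integrableOn, integral_const_mul]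
    have h5 : ∫ ω in A, (B u ω - B r ω) ^ 4 ∂Q ≤ 96 * (u - r) ^ 2 :=
      (setIntegral_le_integral i3.1 (ae_of_all _ fun ω => by positivity)).trans i3.2
    have h6 : ε⁻¹ ^ 3 * ∫ ω in A, (B u ω - B r ω) ^ 4 ∂Q ≤ ε⁻¹ ^ 3 * (96 * (u - r) ^ 2) := by
      gcongr
    have h7 : ∫ _ in A, ε ∂Q = ε * Q.real A := by simp [mul_comm]
    rw [h7, mul_assoc]
    have : L * (ε * Q.real A + ε⁻¹ ^ 3 * ∫ ω in A, (B u ω - B r ω) ^ 4 ∂Q)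
      ≤ L * (ε * Q.real A + ε⁻¹ ^ 3 * (96 * (u - r) ^ 2)) := by gcongr
    linarith
  have h8 := hle.trans hfin
  rw [← hsum, abs_mul, abs_of_pos (by norm_num : (0 : ℝ) < 2)] at h8
  linarith

/-- The reflection principle: functions odd about the level `z` see no difference
between the whole space and the event that the path stays below `z`. -/
theorem setIntegral_odd (hB : IsBM B Q) {φ : ℝ → ℝ} {L : ℝ} (hL : 0 ≤ L)
    (hφ : ∀ x y, |φ x - φ y| ≤ L * |x - y|) {z : ℝ} (hz : 0 ≤ z)
    (hodd : ∀ y, φ (2 * z - y) = -φ y) {h : ℝ} (hh : 0 < h) :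
    ∫ ω in {ω | ∀ s ∈ Icc 0 h, B s ω ≤ z}, φ (B h ω) ∂Q = ∫ ω, φ (B h ω) ∂Q := by
  have := hB.isProbabilityMeasure
  have hφc : Continuous φ := by
    refine (LipschitzWith.of_dist_le_mul (K := L.toNNReal) fun x y => ?_).continuous
    rw [Real.dist_eq, Real.dist_eq, Real.coe_toNNReal _ hL]
    exact hφ x y
  have i1 : Integrable (fun ω => φ (B h ω)) Q := by
    have hφ0 : φ z = 0 := by
      have := hodd z
      rw [show 2 * z - z = z by ring] at this
      linarith
    refine Integrable.mono' (((hB.integrable hh.le).sub (integrable_const z)).abs.const_mul L)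
      (hφc.measurable.comp (hB.meas h)).aestronglyMeasurable (ae_of_all _ fun ω => ?_)
    simpa [hφ0] using hφ (B h ω) z
  let t : ℕ → ℕ → ℝ := fun n k => k * (h / n)
  let A : ℕ → ℕ → Set Ω := fun n k => {ω | ∀ j ≤ k, B (t n j) ω ≤ z}
  have ht0 : ∀ n k, 0 ≤ t n k := fun n k => by positivity
  have hA : ∀ n k, MeasurableSet[pastσ B (t n k)] (A n k) := by
    intro n k
    have : A n k = ⋂ j ∈ Iic k, {ω | B (t n j) ω ≤ z} := by ext ω; simp [A]
    rw [this]
    refine MeasurableSet.biInter (Set.to_countable _) fun j hj => ?_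
    refine measurableSet_le (measurable_pastσ B ⟨ht0 _ _, ?_⟩) measurable_const
    have : (j : ℝ) ≤ k := by exact_mod_cast hj
    exact mul_le_mul_of_nonneg_right this (by positivity)
  have hA' : ∀ n k, MeasurableSet (A n k) := fun n k => hB.past_le _ _ (hA n k)
  have hanti : ∀ n k, A n (k + 1) ⊆ A n k := fun n k ω hω j hj => hω j (hj.trans (Nat.le_succ k))
  have hA0 : ∀ n, A n 0 = univ := by
    intro n
    ext ω
    simp only [A, Set.mem_univ, iff_true]
    intro j hj
    obtain rfl : j = 0 := Nat.le_zero.1 hj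
    simp [t, hB.zero, hz]
  have hstep : ∀ n : ℕ, 0 < n → ∀ ε : ℝ, 0 < ε → ∀ k ≤ n,
      |∫ ω in A n k, φ (B h ω) ∂Q - ∫ ω, φ (B h ω) ∂Q|
        ≤ L * (ε * (1 - Q.real (A n k)) + k * (ε⁻¹ ^ 3 * (96 * (h / n) ^ 2))) := by
    intro n hn ε hε k
    have hn' : (0 : ℝ) < n := by exact_mod_cast hn
    induction k with
    | zero => simp [hA0]
    | succ k ih =>
      intro hk
      have hdiff := hB.abs_integral_odd_le hL hφ hodd (r := t n k) (u := t n (k + 1)) (t := h)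
        (A := A n k \ A n (k + 1)) (ht0 _ _)
        (by
          have : (0 : ℝ) < h / n := by positivity
          simp only [t]; push_cast; nlinarith)
        (by
          have : ((k + 1 : ℕ) : ℝ) ≤ n := by exact_mod_cast hk
          calc t n (k + 1) ≤ n * (h / n) := mul_le_mul_of_nonneg_right this (by positivity)
            _ = h := by field_simp)
        (by
          refine MeasurableSet.diff ?_ (hA n (k + 1))
          refine pastσ_mono B ?_ _ (hA n k)
          have : (0 : ℝ) < h / n := by positivity
          simp only [t]; push_cast; nlinarith)
        (fun ω hω => hω.1 k le_rfl)
        (fun ω hω => by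
          by_contra hcon
          refine hω.2 fun j hj => ?_
          rcases Nat.lt_or_ge j (k + 1) with h | h
          · exact hω.1 j (Nat.lt_succ_iff.1 h)
          · obtain rfl : j = k + 1 := le_antisymm hj h
            exact not_lt.1 hcon) hε
      have e1 : ∫ ω in A n k \ A n (k + 1), φ (B h ω) ∂Q
          = ∫ ω in A n k, φ (B h ω) ∂Q - ∫ ω in A n (k + 1), φ (B h ω) ∂Q :=
        setIntegral_sdiff (hA' n (k + 1)) i1.integrableOn (hanti n k)
      have e2 : Q.real (A n k \ A n (k + 1)) = Q.real (A n k) - Q.real (A n (k + 1)) :=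
        measureReal_sdiff (hanti n k) (hA' n (k + 1))
      have e3 : t n (k + 1) - t n k = h / n := by simp only [t]; push_cast; ring
      rw [e1, e2, e3] at hdiff
      have ih' := ih (Nat.le_of_succ_le hk)
      have htri : |∫ ω in A n (k + 1), φ (B h ω) ∂Q - ∫ ω, φ (B h ω) ∂Q|
          ≤ |∫ ω in A n k, φ (B h ω) ∂Q - ∫ ω, φ (B h ω) ∂Q|
            + |∫ ω in A n k, φ (B h ω) ∂Q - ∫ ω in A n (k + 1), φ (B h ω) ∂Q| := by
        have := abs_sub (∫ ω in A n k, φ (B h ω) ∂Q - ∫ ω, φ (B h ω) ∂Q)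
          (∫ ω in A n k, φ (B h ω) ∂Q - ∫ ω in A n (k + 1), φ (B h ω) ∂Q)
        calc _ = |∫ ω in A n k, φ (B h ω) ∂Q - ∫ ω, φ (B h ω) ∂Q
            - (∫ ω in A n k, φ (B h ω) ∂Q - ∫ ω in A n (k + 1), φ (B h ω) ∂Q)| := by
              congr 1; ring
          _ ≤ _ := this
      refine (htri.trans (add_le_add ih' hdiff)).trans (le_of_eq ?_)
      push_cast
      ring
  -- pass to the limit of finer and finer grids
  set S := {ω | ∀ s ∈ Icc 0 h, B s ω ≤ z} with hS
  have hlim : Tendsto (fun n : ℕ => ∫ ω in A n n, φ (B h ω) ∂Q) atTop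
      (nhds (∫ ω in S, φ (B h ω) ∂Q)) := by
    have hSm : MeasurableSet S :=
      measurableSet_forall_le hh.le (fun s _ => hB.meas s) hB.cont continuous_const
    simp_rw [← integral_indicator (hA' _ _)]
    rw [← integral_indicator hSm]
    refine tendsto_integral_of_dominated_convergence (fun ω => ‖φ (B h ω)‖)
      (fun n => (i1.aestronglyMeasurable.indicator (hA' n n))) i1.norm
      (fun n => ae_of_all _ fun ω => ?_) (ae_of_all _ fun ω => ?_)
    · by_cases hω : ω ∈ A n n <;> simp [hω]
    · by_cases hω : ω ∈ S
      · refine tendsto_const_nhds.congr' ?_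
        filter_upwards [eventually_gt_atTop 0] with n hn
        have hn' : (0 : ℝ) < n := by exact_mod_cast hn
        have : ω ∈ A n n := fun j hj => hω _ ⟨ht0 _ _, by
          have : (j : ℝ) ≤ n := by exact_mod_cast hj
          calc t n j ≤ n * (h / n) := mul_le_mul_of_nonneg_right this (by positivity)
            _ = h := by field_simp⟩
        simp [hω, this]
      · refine tendsto_const_nhds.congr' ?_
        rw [hS] at hω
        simp only [mem_ofPred_eq, not_forall, not_le] at hω
        obtain ⟨s, hs, hsz⟩ := hω
        have hopen : ∀ᶠ r in nhds s, z < B r ω := (hB.cont ω).continuousAt.eventually_const_lt hsz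
        have hconv : Tendsto (fun n : ℕ => t n ⌊s / (h / n)⌋₊) atTop (nhds s) := by
          have hhn : Tendsto (fun n : ℕ => h / (n : ℝ)) atTop (nhds 0) :=
            tendsto_const_div_atTop_nhds_zero_nat h
          have hlow : Tendsto (fun n : ℕ => s - h / (n : ℝ)) atTop (nhds s) := by
            simpa using tendsto_const_nhds.sub hhn
          refine tendsto_of_tendsto_of_tendsto_of_le_of_le' hlow tendsto_const_nhds ?_ ?_
          · filter_upwards [eventually_gt_atTop 0] with n hn
            have hn' : (0 : ℝ) < n := by exact_mod_cast hn
            have hp : 0 < h / n := by positivity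
            have := Nat.lt_floor_add_one (s / (h / n))
            rw [div_lt_iff₀ hp] at this
            simp only [t]
            linarith
          · filter_upwards [eventually_gt_atTop 0] with n hn
            have hn' : (0 : ℝ) < n := by exact_mod_cast hn
            have hp : 0 < h / n := by positivity
            have := Nat.floor_le (div_nonneg hs.1 hp.le)
            rw [le_div_iff₀ hp] at this
            exact this
        filter_upwards [hconv.eventually hopen, eventually_gt_atTop 0] with n hn hn0
        have hn' : (0 : ℝ) < n := by exact_mod_cast hn0
        have hnA : ω ∉ A n n := fun hcon => by
          refine absurd (hcon ⌊s / (h / n)⌋₊ ?_) (not_le.2 hn)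
          refine Nat.floor_le_of_le ?_
          rw [div_le_iff₀ (by positivity)]
          calc s ≤ h := hs.2
            _ = n * (h / n) := by field_simp
        have hnS : ω ∉ S := fun hcon => absurd (hcon s hs) (not_le.2 hsz)
        simp [hnA, hnS]
  have hsmall : Tendsto (fun n : ℕ => ∫ ω in A n n, φ (B h ω) ∂Q) atTop
      (nhds (∫ ω, φ (B h ω) ∂Q)) := by
    rw [Metric.tendsto_atTop]
    intro δ hδ
    obtain ⟨ε, hε, hε2⟩ : ∃ ε > 0, L * ε < δ / 2 := by
      refine ⟨δ / (2 * (L + 1)) / 2, by positivity, ?_⟩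
      rw [div_div, ← mul_div_assoc, div_lt_div_iff₀ (by positivity) (by norm_num)]
      nlinarith
    have hz : Tendsto (fun n : ℕ => L * (ε⁻¹ ^ 3 * (96 * h ^ 2)) / (n : ℝ)) atTop (nhds 0) :=
      tendsto_const_div_atTop_nhds_zero_nat _
    have hev := (hz.eventually_lt_const (show (0 : ℝ) < δ / 2 by positivity)).and
      (eventually_gt_atTop 0)
    obtain ⟨N, hN⟩ := eventually_atTop.1 hev
    refine ⟨N, fun n hn => ?_⟩
    obtain ⟨h1, h2⟩ := hN n hn
    have hn' : (0 : ℝ) < n := by exact_mod_cast h2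
    rw [Real.dist_eq]
    refine (hstep n h2 ε hε n le_rfl).trans_lt ?_
    have e : L * (ε * (1 - Q.real (A n n)) + n * (ε⁻¹ ^ 3 * (96 * (h / n) ^ 2)))
        = L * ε * (1 - Q.real (A n n)) + L * (ε⁻¹ ^ 3 * (96 * h ^ 2)) / n := by
      field_simp
    rw [e]
    have : L * ε * (1 - Q.real (A n n)) ≤ L * ε :=
      mul_le_of_le_one_right (by positivity) (by linarith [measureReal_nonneg (μ := Q) (s := A n n)])
    linarith
  exact tendsto_nhds_unique hlim hsmall

end IsBM

theorem gaussianReal_Icc_le {m : ℝ} {v : NNReal} (hv : v ≠ 0) (a b : ℝ) :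
    gaussianReal m v (Icc a b) ≤ ofReal ((b - a) / √(2 * π * v)) := by
  have h0 : (0 : ℝ) ≤ (√(2 * π * v))⁻¹ := by positivity
  rw [gaussianReal_apply _ hv]
  calc ∫⁻ x in Icc a b, gaussianPDF m v x
      ≤ ∫⁻ _ in Icc a b, ofReal (√(2 * π * v))⁻¹ := by
        refine lintegral_mono fun x => ?_
        unfold gaussianPDF gaussianPDFReal
        refine ofReal_le_ofReal ?_
        refine mul_le_of_le_one_right h0 ?_
        rw [exp_le_one_iff]
        have : 0 ≤ (x - m) ^ 2 / (2 * (v : ℝ)) := by positivity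
        rw [neg_div]; linarith
    _ = _ := by
        rw [setLIntegral_const, Real.volume_Icc, ← ofReal_mul h0, inv_mul_eq_div]

theorem le_gaussianReal_Icc {v : NNReal} (hv : v ≠ 0) (z : ℝ) :
    ofReal (2 * z * ((√(2 * π * v))⁻¹ * exp (-z ^ 2 / (2 * v))))
      ≤ gaussianReal 0 v (Icc (-z) z) := by
  have h0 : (0 : ℝ) ≤ (√(2 * π * v))⁻¹ * exp (-z ^ 2 / (2 * v)) := by positivity
  rw [gaussianReal_apply _ hv]
  calc ofReal (2 * z * ((√(2 * π * v))⁻¹ * exp (-z ^ 2 / (2 * v))))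
      = ∫⁻ _ in Icc (-z) z, ofReal ((√(2 * π * v))⁻¹ * exp (-z ^ 2 / (2 * v))) := by
        rw [setLIntegral_const, Real.volume_Icc, ← ofReal_mul h0]
        congr 1; ring
    _ ≤ _ := by
        refine setLIntegral_mono (measurable_gaussianPDF _ _) fun x hx => ?_
        unfold gaussianPDF gaussianPDFReal
        refine ofReal_le_ofReal ?_
        have h2 := sq_le_sq' hx.1 hx.2
        rw [sub_zero]
        refine mul_le_mul_of_nonneg_left (exp_le_exp.2 ?_) (by positivity)
        exact div_le_div_of_nonneg_right (neg_le_neg h2) (by positivity)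

namespace IsBM

theorem integral_abs_le (hB : IsBM B Q) {h : ℝ} (hh : 0 < h) : ∫ ω, |B h ω| ∂Q ≤ 4 * √h := by
  have := hB.isProbabilityMeasure
  set c := (√h)⁻¹ with hc
  have hs : 0 < √h := by positivity
  have hc0 : 0 < c := by positivity
  have hct : c ^ 2 * h = 1 := by
    rw [hc, inv_pow, Real.sq_sqrt hh.le]; field_simp
  have i1 := hB.integrable_exp hh.le c
  have i2 := hB.integrable_exp hh.le (-c)
  have hpt : ∀ x : ℝ, |x| ≤ √h * (exp (c * x) + exp (-c * x)) := by
    intro x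
    have h1 : |c * x| ≤ exp (c * x) + exp (-c * x) := by
      rw [neg_mul]
      rcases abs_cases (c * x) with ⟨e, _⟩ | ⟨e, _⟩ <;> rw [e]
      · linarith [add_one_le_exp (c * x), exp_pos (-(c * x))]
      · linarith [add_one_le_exp (-(c * x)), exp_pos (c * x)]
    rw [abs_mul, abs_of_pos hc0, hc, inv_mul_le_iff₀ hs] at h1
    exact h1
  calc ∫ ω, |B h ω| ∂Q ≤ ∫ ω, √h * (exp (c * B h ω) + exp (-c * B h ω)) ∂Q :=
        integral_mono (hB.integrable hh.le).abs ((i1.add i2).const_mul _) fun ω => hpt _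
    _ = √h * (2 * exp (1 / 2)) := by
        rw [integral_const_mul, integral_add i1 i2, hB.integral_exp hh.le, hB.integral_exp hh.le]
        have h2 : h * c ^ 2 / 2 = 1 / 2 := by rw [mul_comm h, hct]
        have h3 : h * (-c) ^ 2 / 2 = 1 / 2 := by rw [neg_sq, h2]
        rw [h2, h3]; ring
    _ ≤ 4 * √h := by
        have he : exp (1 / 2) ≤ 2 := by
          have h := Real.exp_one_lt_d9
          have : exp (1 / 2) ^ 2 = exp 1 := by rw [← exp_nat_mul]; norm_num
          nlinarith [exp_pos (1 / 2 : ℝ)]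
        nlinarith

/-- The integral of the time-`h` value over the event of staying below a level. -/
theorem setIntegral_sub (hB : IsBM B Q) {z : ℝ} (hz : 0 ≤ z) {h : ℝ} (hh : 0 < h) :
    ∫ ω in {ω | ∀ s ∈ Icc 0 h, B s ω ≤ z}, (z - B h ω) ∂Q = z := by
  have := hB.isProbabilityMeasure
  rw [hB.setIntegral_odd (φ := fun y => z - y) (L := 1) zero_le_one
    (fun x y => by rw [one_mul, abs_sub_comm x y]; apply le_of_eq; congr 1; ring) hz
    (fun y => by ring) hh, integral_sub (integrable_const _) (hB.integrable hh.le),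
    hB.integral_eq_zero hh.le]
  simp

/-- A Lipschitz approximation of the sign function around `z`. -/
theorem clamp_facts {z ε : ℝ} (hz : 0 ≤ z) (hε : 0 < ε) :
    (∀ x y : ℝ, |max (-1) (min 1 ((z - x) / ε)) - max (-1) (min 1 ((z - y) / ε))| ≤ ε⁻¹ * |x - y|) ∧
    (∀ y : ℝ, max (-1) (min 1 ((z - (2 * z - y)) / ε)) = -max (-1) (min 1 ((z - y) / ε))) ∧
    (∀ x : ℝ, 0 ≤ max (-1) (min 1 ((z - x) / ε)) + max (-1) (min 1 ((z - -x) / ε))) ∧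
    (∀ x : ℝ, |x| ≤ z - ε → max (-1) (min 1 ((z - x) / ε)) + max (-1) (min 1 ((z - -x) / ε)) = 2) ∧
    (∀ x : ℝ, z + ε ≤ |x| →
      max (-1) (min 1 ((z - x) / ε)) + max (-1) (min 1 ((z - -x) / ε)) = 0) := by
  refine ⟨fun x y => ?_, fun y => ?_, fun x => ?_, fun x hx => ?_, fun x hx => ?_⟩
  · have h1 := abs_max_sub_max_le_abs (min 1 ((z - x) / ε)) (min 1 ((z - y) / ε)) (-1)
    rw [max_comm _ (-1 : ℝ), max_comm _ (-1 : ℝ)] at h1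
    have h2 := abs_min_sub_min_le_max 1 ((z - x) / ε) 1 ((z - y) / ε)
    have h3 : |(z - x) / ε - (z - y) / ε| = ε⁻¹ * |x - y| := by
      rw [← sub_div, abs_div, abs_of_pos hε, abs_sub_comm x y, inv_mul_eq_div]
      congr 2; ring
    rw [h3, sub_self, abs_zero, max_eq_right (by positivity)] at h2
    exact h1.trans h2
  · have : (z - (2 * z - y)) / ε = -((z - y) / ε) := by ring
    rw [this]
    generalize (z - y) / ε = w
    simp only [max_def, min_def]
    split_ifs <;> linarith
  · have : (z - -x) / ε = 2 * z / ε - (z - x) / ε := by ring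
    have h0 : 0 ≤ 2 * z / ε := by positivity
    rw [this]
    generalize (z - x) / ε = w
    generalize 2 * z / ε = b at *
    simp only [max_def, min_def]
    split_ifs <;> linarith
  · rw [abs_le] at hx
    have h1 : 1 ≤ (z - x) / ε := by rw [le_div_iff₀ hε]; linarith
    have h2 : 1 ≤ (z - -x) / ε := by rw [le_div_iff₀ hε]; linarith
    rw [min_eq_left h1, min_eq_left h2]; norm_num
  · rcases le_abs.1 hx with h | h
    · have h1 : (z - x) / ε ≤ -1 := by rw [div_le_iff₀ hε]; linarith
      have h2 : 1 ≤ (z - -x) / ε := by rw [le_div_iff₀ hε]; linarith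
      rw [min_eq_left h2, min_eq_right (by linarith), max_eq_left h1]; norm_num
    · have h1 : (z - -x) / ε ≤ -1 := by rw [div_le_iff₀ hε]; linarith
      have h2 : 1 ≤ (z - x) / ε := by rw [le_div_iff₀ hε]; linarith
      rw [min_eq_left h2, min_eq_right (a := (1 : ℝ)) (b := (z - -x) / ε) (by linarith),
        max_eq_left h1]
      norm_num

/-- Approximate form of the law of the running maximum. -/
theorem below_approx (hB : IsBM B Q) {z : ℝ} (hz : 0 ≤ z) {h : ℝ} (hh : 0 < h)
    {ε : ℝ} (hε : 0 < ε) : Q {ω | |B h ω| ≤ z - ε} ≤ Q {ω | ∀ s ∈ Icc 0 h, B s ω ≤ z} ∧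
    Q {ω | ∀ s ∈ Icc 0 h, B s ω ≤ z} ≤ Q {ω | |B h ω| ≤ z + ε} + Q {ω | B h ω ∈ Icc (z - ε) z} := by
  have := hB.isProbabilityMeasure
  obtain ⟨c1, c2, c3, c4, c5⟩ := clamp_facts hz hε
  set φ : ℝ → ℝ := fun x => max (-1) (min 1 ((z - x) / ε)) with hφ
  have hφc : Continuous φ := by fun_prop
  have hφ1 : ∀ x, φ x ≤ 1 := fun x => max_le (by norm_num) (min_le_left _ _)
  have hφ2 : ∀ x, -1 ≤ φ x := fun x => le_max_left _ _
  have hφa : ∀ x, ‖φ x‖ ≤ 1 := fun x => by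
    rw [Real.norm_eq_abs, abs_le]; exact ⟨hφ2 x, hφ1 x⟩
  set S := {ω | ∀ s ∈ Icc 0 h, B s ω ≤ z} with hS
  have hSm : MeasurableSet S :=
    measurableSet_forall_le hh.le (fun s _ => hB.meas s) hB.cont continuous_const
  have hodd := hB.setIntegral_odd (φ := φ) (inv_pos.2 hε).le c1 hz c2 hh
  have i1 : Integrable (fun ω => φ (B h ω)) Q :=
    (integrable_const (1 : ℝ)).mono' (hφc.measurable.comp (hB.meas h)).aestronglyMeasurable
      (ae_of_all _ fun ω => hφa _)
  have i2 : Integrable (fun ω => φ (-B h ω)) Q :=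
    (integrable_const (1 : ℝ)).mono' (hφc.measurable.comp (hB.meas h).neg).aestronglyMeasurable
      (ae_of_all _ fun ω => hφa _)
  have hsym : ∫ ω, φ (-B h ω) ∂Q = ∫ ω, φ (B h ω) ∂Q := by
    rw [hB.integral_comp hh.le (φ := fun x => φ (-x)) (by fun_prop),
      hB.integral_comp hh.le hφc.measurable]
    have hn : (gaussianReal 0 h.toNNReal).map (fun x => -x) = gaussianReal 0 h.toNNReal := by
      rw [gaussianReal_map_neg, neg_zero]
    conv_rhs => rw [← hn]
    rw [integral_map (by fun_prop) (by fun_prop)]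
  have hsum : ∫ ω, (φ (B h ω) + φ (-B h ω)) ∂Q = 2 * ∫ ω, φ (B h ω) ∂Q := by
    rw [integral_add i1 i2, hsym]; ring
  have hle : ∀ (c : ℝ), MeasurableSet {ω | |B h ω| ≤ c} := fun c =>
    measurableSet_le (hB.meas h).abs measurable_const
  have hind : ∀ {s : Set Ω}, MeasurableSet s → ∫ ω, s.indicator (fun _ => (2 : ℝ)) ω ∂Q
      = 2 * Q.real s := by
    intro s hs
    rw [integral_indicator hs]; simp [mul_comm]
  have hii : ∀ {s : Set Ω}, MeasurableSet s →
      Integrable (fun ω => s.indicator (fun _ => (2 : ℝ)) ω) Q := fun hs =>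
    (integrable_const (2 : ℝ)).indicator hs
  have lower : Q.real {ω | |B h ω| ≤ z - ε} ≤ ∫ ω, φ (B h ω) ∂Q := by
    have : ∫ ω, ({ω | |B h ω| ≤ z - ε}).indicator (fun _ => (2 : ℝ)) ω ∂Q
        ≤ ∫ ω, (φ (B h ω) + φ (-B h ω)) ∂Q := by
      refine integral_mono (hii (hle _)) (i1.add i2) fun ω => ?_
      by_cases hω : |B h ω| ≤ z - ε
      · simp only [indicator, mem_ofPred_eq, hω, if_true]
        exact (c4 _ hω).ge
      · simp only [indicator, mem_ofPred_eq, hω, if_false]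
        exact c3 _
    rw [hind (hle _), hsum] at this
    linarith
  have upper : ∫ ω, φ (B h ω) ∂Q ≤ Q.real {ω | |B h ω| ≤ z + ε} := by
    have : ∫ ω, (φ (B h ω) + φ (-B h ω)) ∂Q
        ≤ ∫ ω, ({ω | |B h ω| ≤ z + ε}).indicator (fun _ => (2 : ℝ)) ω ∂Q := by
      refine integral_mono (i1.add i2) (hii (hle _)) fun ω => ?_
      by_cases hω : |B h ω| ≤ z + ε
      · simp only [indicator, mem_ofPred_eq, hω, if_true]
        linarith [hφ1 (B h ω), hφ1 (-B h ω)]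
      · simp only [indicator, mem_ofPred_eq, hω, if_false]
        exact (c5 _ (not_le.1 hω).le).le
    rw [hind (hle _), hsum] at this
    linarith
  have hT : MeasurableSet {ω | B h ω ∈ Icc (z - ε) z} := hB.meas h measurableSet_Icc
  constructor
  · rw [← toReal_le_toReal (measure_ne_top _ _) (measure_ne_top _ _)]
    refine lower.trans ?_
    rw [← hodd]
    calc ∫ ω in S, φ (B h ω) ∂Q ≤ ∫ _ in S, (1 : ℝ) ∂Q :=
          setIntegral_mono i1.integrableOn (integrable_const _).integrableOn fun ω => hφ1 _
      _ = Q.real S := by simp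
  · rw [← toReal_le_toReal (measure_ne_top _ _)
      (ENNReal.add_ne_top.2 ⟨measure_ne_top _ _, measure_ne_top _ _⟩),
      ENNReal.toReal_add (measure_ne_top _ _) (measure_ne_top _ _)]
    have h1 : Q.real S ≤ ∫ ω in S, φ (B h ω) ∂Q + Q.real {ω | B h ω ∈ Icc (z - ε) z} := by
      have e1 : Q.real S = ∫ ω in S, (1 : ℝ) ∂Q := by simp
      have e2 : Q.real {ω | B h ω ∈ Icc (z - ε) z}
          = ∫ ω, ({ω | B h ω ∈ Icc (z - ε) z}).indicator (fun _ => (1 : ℝ)) ω ∂Q := by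
        rw [integral_indicator hT]; simp
      have i3 : Integrable (({ω | B h ω ∈ Icc (z - ε) z}).indicator (fun _ => (1 : ℝ))) Q :=
        (integrable_const _).indicator hT
      calc Q.real S ≤ ∫ ω in S, (φ (B h ω)
              + ({ω | B h ω ∈ Icc (z - ε) z}).indicator (fun _ => (1 : ℝ)) ω) ∂Q := by
            rw [e1]
            refine setIntegral_mono_on (integrable_const _).integrableOn
              (i1.add i3).integrableOn hSm fun ω hω => ?_
            have hBz : B h ω ≤ z := hω h ⟨hh.le, le_rfl⟩
            by_cases hω2 : B h ω ∈ Icc (z - ε) z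
            · simp only [indicator, mem_ofPred_eq, hω2, if_true]
              have : 0 ≤ φ (B h ω) := by
                have : 0 ≤ (z - B h ω) / ε := div_nonneg (by linarith) hε.le
                exact le_max_of_le_right (le_min zero_le_one this)
              linarith
            · simp only [indicator, mem_ofPred_eq, hω2, if_false, add_zero]
              have h3 : B h ω < z - ε := by
                by_contra hcon
                exact hω2 ⟨not_lt.1 hcon, hBz⟩
              have h4 : 1 ≤ (z - B h ω) / ε := by rw [le_div_iff₀ hε]; linarith
              exact le_max_of_le_right (le_min le_rfl h4)
        _ = ∫ ω in S, φ (B h ω) ∂Q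
            + ∫ ω in S, ({ω | B h ω ∈ Icc (z - ε) z}).indicator (fun _ => (1 : ℝ)) ω ∂Q :=
            integral_add i1.integrableOn i3.integrableOn
        _ ≤ _ := by
            rw [e2]
            refine add_le_add le_rfl ?_
            exact setIntegral_le_integral i3 (ae_of_all _ fun ω =>
              Set.indicator_nonneg (fun _ _ => zero_le_one) _)
    rw [hodd] at h1
    exact h1.trans (add_le_add upper le_rfl)

theorem measure_mem (hB : IsBM B Q) {h : ℝ} (hh : 0 ≤ h) {s : Set ℝ} (hs : MeasurableSet s) :
    Q {ω | B h ω ∈ s} = gaussianReal 0 h.toNNReal s := by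
  rw [← hB.map_eq hh, Measure.map_apply (hB.meas h) hs]; rfl

/-- Upper bound for the probability of staying below a level. -/
theorem below_le (hB : IsBM B Q) {z : ℝ} (hz : 0 ≤ z) {h : ℝ} (hh : 0 < h) :
    Q {ω | ∀ s ∈ Icc 0 h, B s ω ≤ z} ≤ ofReal (√(2 / (π * h)) * z) := by
  have hh' : h.toNNReal ≠ 0 := by simpa using hh
  have hev : ∀ ε : ℝ, 0 < ε → Q {ω | ∀ s ∈ Icc 0 h, B s ω ≤ z}
      ≤ ofReal ((2 * z + 3 * ε) / √(2 * π * h)) := by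
    intro ε hε
    refine (hB.below_approx hz hh hε).2.trans ?_
    have e1 : {ω | |B h ω| ≤ z + ε} = {ω | B h ω ∈ Icc (-(z + ε)) (z + ε)} := by
      ext ω; simp [abs_le]
    rw [e1, hB.measure_mem hh.le measurableSet_Icc, hB.measure_mem hh.le measurableSet_Icc]
    refine (add_le_add (gaussianReal_Icc_le hh' _ _) (gaussianReal_Icc_le hh' _ _)).trans ?_
    rw [Real.coe_toNNReal _ hh.le, ← ofReal_add (div_nonneg (by linarith) (by positivity))
      (div_nonneg (by linarith) (by positivity)), ← add_div]
    refine ofReal_le_ofReal (le_of_eq ?_)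
    congr 1; ring
  have hlim : Tendsto (fun ε : ℝ => ofReal ((2 * z + 3 * ε) / √(2 * π * h)))
      (nhdsWithin 0 (Ioi 0)) (nhds (ofReal ((2 * z + 3 * 0) / √(2 * π * h)))) := by
    refine (continuous_ofReal.tendsto _).comp ?_
    have : Continuous fun ε : ℝ => (2 * z + 3 * ε) / √(2 * π * h) := by fun_prop
    exact (this.tendsto 0).mono_left nhdsWithin_le_nhds
  have := ge_of_tendsto hlim (eventually_nhdsWithin_of_forall fun ε hε => hev ε hε)
  refine this.trans (ofReal_le_ofReal (le_of_eq ?_))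
  have : √(2 / (π * h)) = 2 / √(2 * π * h) := by
    rw [show 2 / (π * h) = 2 ^ 2 / (2 * π * h) by field_simp, Real.sqrt_div (by positivity),
      Real.sqrt_sq (by norm_num)]
  rw [this]; ring

theorem measure_abs_lt_le_below (hB : IsBM B Q) {z : ℝ} (hz : 0 ≤ z) {h : ℝ} (hh : 0 < h) :
    Q {ω | |B h ω| < z} ≤ Q {ω | ∀ s ∈ Icc 0 h, B s ω ≤ z} := by
  have e : {ω | |B h ω| < z} = ⋃ n : ℕ, {ω | |B h ω| ≤ z - 1 / (n + 1)} := by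
    ext ω
    simp only [mem_ofPred_eq, mem_iUnion]
    constructor
    · intro hω
      obtain ⟨n, hn⟩ := exists_nat_one_div_lt (sub_pos.2 hω)
      exact ⟨n, by linarith⟩
    · rintro ⟨n, hn⟩
      have : (0 : ℝ) < 1 / (n + 1) := by positivity
      linarith
  rw [e, Monotone.measure_iUnion]
  · exact iSup_le fun n => (hB.below_approx hz hh (by positivity)).1
  · intro m n hmn ω (hω : |B h ω| ≤ z - 1 / (m + 1))
    change |B h ω| ≤ z - 1 / (n + 1)
    refine hω.trans ?_
    have := one_div_le_one_div_of_le (by positivity : (0 : ℝ) < m + 1)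
      (by gcongr : (m : ℝ) + 1 ≤ n + 1)
    linarith

/-- Lower bound for the probability of staying below a level. -/
theorem le_below (hB : IsBM B Q) {z : ℝ} (hz : 0 ≤ z) {h : ℝ} (hh : 0 < h) :
    ofReal (√(2 / (π * h)) * z * (1 - z ^ 2 / (2 * h))) ≤ Q {ω | ∀ s ∈ Icc 0 h, B s ω ≤ z} := by
  have hh' : h.toNNReal ≠ 0 := by simpa using hh
  have hev : ∀ ε ∈ Set.Ioo 0 z, ofReal (2 * (z - ε) * ((√(2 * π * h))⁻¹ *
      exp (-(z - ε) ^ 2 / (2 * h)))) ≤ Q {ω | ∀ s ∈ Icc 0 h, B s ω ≤ z} := by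
    intro ε hε
    refine le_trans ?_ (hB.below_approx hz hh hε.1).1
    have e1 : {ω | |B h ω| ≤ z - ε} = {ω | B h ω ∈ Icc (-(z - ε)) (z - ε)} := by
      ext ω; simp only [mem_ofPred_eq, abs_le, mem_Icc]
    rw [e1, hB.measure_mem hh.le measurableSet_Icc]
    have := le_gaussianReal_Icc hh' (z - ε)
    rwa [Real.coe_toNNReal _ hh.le] at this
  rcases hz.eq_or_lt with rfl | hz0
  · simp
  have hlim : Tendsto (fun ε : ℝ => ofReal (2 * (z - ε) * ((√(2 * π * h))⁻¹ *
      exp (-(z - ε) ^ 2 / (2 * h))))) (nhdsWithin 0 (Ioi 0))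
      (nhds (ofReal (2 * (z - 0) * ((√(2 * π * h))⁻¹ *
      exp (-(z - 0) ^ 2 / (2 * h)))))) := by
    refine (continuous_ofReal.tendsto _).comp ?_
    have : Continuous fun ε : ℝ => 2 * (z - ε) * ((√(2 * π * h))⁻¹ *
      exp (-(z - ε) ^ 2 / (2 * h))) := by fun_prop
    exact (this.tendsto 0).mono_left nhdsWithin_le_nhds
  have := le_of_tendsto hlim (by
    filter_upwards [Ioo_mem_nhdsGT hz0] with ε hε using hev ε hε)
  refine le_trans (ofReal_le_ofReal ?_) this
  have e : √(2 / (π * h)) = 2 / √(2 * π * h) := by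
    rw [show 2 / (π * h) = 2 ^ 2 / (2 * π * h) by field_simp, Real.sqrt_div (by positivity),
      Real.sqrt_sq (by norm_num)]
  have h1 : 1 - z ^ 2 / (2 * h) ≤ exp (-z ^ 2 / (2 * h)) := by
    have := add_one_le_exp (-z ^ 2 / (2 * h))
    rw [neg_div] at this ⊢
    linarith
  rw [e, sub_zero]
  calc 2 / √(2 * π * h) * z * (1 - z ^ 2 / (2 * h))
      ≤ 2 / √(2 * π * h) * z * exp (-z ^ 2 / (2 * h)) := by gcongr
    _ = _ := by rw [div_eq_mul_inv]; ring

/-- The mean of the running maximum. -/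
theorem lintegral_runSup_le (hB : IsBM B Q) {h : ℝ} (hh : 0 < h) :
    ∫⁻ ω, ofReal (runSup B 0 h ω) ∂Q ≤ ofReal (4 * √h) := by
  have := hB.isProbabilityMeasure
  have hm : Measurable (runSup B 0 h) := measurable_runSup hh.le (fun s _ => hB.meas s) hB.cont
  have hpos : ∀ ω, 0 ≤ runSup B 0 h ω := fun ω => by
    have := le_runSup (hB.cont ω) (⟨le_rfl, hh.le⟩ : (0 : ℝ) ∈ Icc 0 h)
    simpa [hB.zero] using this
  calc ∫⁻ ω, ofReal (runSup B 0 h ω) ∂Q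
      = ∫⁻ t in Ioi 0, Q {ω | t < runSup B 0 h ω} :=
        lintegral_eq_lintegral_meas_lt Q (ae_of_all _ hpos) hm.aemeasurable
    _ ≤ ∫⁻ t in Ioi 0, Q {ω | t ≤ |B h ω|} := by
        refine setLIntegral_mono' measurableSet_Ioi fun t (ht : 0 < t) => ?_
        have e1 : {ω | t < runSup B 0 h ω} = {ω | ∀ s ∈ Icc 0 h, B s ω ≤ t}ᶜ := by
          ext ω
          simp only [mem_compl_iff, mem_ofPred_eq]
          rw [← runSup_le_iff hh.le (hB.cont ω), not_le]
        have e2 : {ω | t ≤ |B h ω|} = {ω | |B h ω| < t}ᶜ := by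
          ext ω; simp
        rw [e1, e2, prob_compl_eq_one_sub (measurableSet_forall_le hh.le (fun s _ => hB.meas s)
          hB.cont continuous_const), prob_compl_eq_one_sub
          (measurableSet_lt (hB.meas h).abs measurable_const)]
        exact tsub_le_tsub_left (hB.measure_abs_lt_le_below ht.le hh) _
    _ = ∫⁻ ω, ofReal |B h ω| ∂Q :=
        (lintegral_eq_lintegral_meas_le Q (ae_of_all _ fun ω => abs_nonneg _)
          (hB.meas h).abs.aemeasurable).symm
    _ = ofReal (∫ ω, |B h ω| ∂Q) :=
        (ofReal_integral_eq_lintegral_ofReal (hB.integrable hh.le).abs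
          (ae_of_all _ fun ω => abs_nonneg _)).symm
    _ ≤ _ := ofReal_le_ofReal (hB.integral_abs_le hh)

end IsBM

/-- A Brownian motion with respect to a filtration. -/
structure IsBMF (F : ℝ → MeasurableSpace Ω)
    (B : ℝ → Ω → ℝ) (Q : Measure Ω) : Prop where
  bm : IsBM B Q
  le : ∀ u, F u ≤ mΩ
  mono : Monotone F
  adapted : ∀ s, 0 ≤ s → Measurable[F s] (B s)
  indep : ∀ u, 0 ≤ u → Indep (F u) (futσ B u) Q

namespace IsBMF

theorem adapted_le (hB : IsBMF F B Q) {s u : ℝ} (hs : 0 ≤ s) (hu : s ≤ u) : Measurable[F u] (B s) :=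
  (hB.adapted s hs).mono (hB.mono hu) le_rfl

theorem measurable_runSup_fut (hB : IsBMF F B Q) {u h h' : ℝ} (h0 : 0 ≤ h) (hh : h ≤ h') :
    Measurable[futσ B u] (runSup (fun s ω => B (u + s) ω - B u ω) h h') :=
  measurable_runSup hh (fun s hs => measurable_futσ B (h0.trans hs.1)) fun ω => by
    have := hB.bm.cont ω
    fun_prop

/-- Disintegration of an event over the past and the running maximum of the future. -/
theorem measure_inter_forall_le (hB : IsBMF F B Q) {u h : ℝ} (hu : 0 ≤ u) (hh : 0 < h)
    {A : Set Ω} (hA : MeasurableSet[F u] A) {θ : Ω → ℝ} (hθ : Measurable[F u] θ) :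
    Q (A ∩ {ω | ∀ s ∈ Icc u (u + h), B s ω ≤ B u ω + θ ω})
      = ∫⁻ ω in A, Q {ω' | ∀ s ∈ Icc 0 h, B (u + s) ω' - B u ω' ≤ θ ω} ∂Q := by
  have := hB.bm.isProbabilityMeasure
  set Z : ℝ → Ω → ℝ := fun s ω => B (u + s) ω - B u ω with hZ
  have hZc : ∀ ω, Continuous fun s => Z s ω := fun ω => (hB.bm.shift hu).cont ω
  have hAm : MeasurableSet A := hB.le u A hA
  have hθm : Measurable θ := hθ.mono (hB.le u) le_rfl
  have hRm : Measurable (runSup Z 0 h) :=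
    measurable_runSup hh.le (fun s _ => (hB.bm.shift hu).meas s) hZc
  have key := lintegral_indep (hB.indep u hu) (hB.le u) (hB.bm.fut_le u)
    (U := fun ω => (A.indicator (fun _ => (1 : ENNReal)) ω, θ ω)) (V := runSup Z 0 h)
    ((measurable_const.indicator hA).prodMk hθ) (hB.measurable_runSup_fut le_rfl hh.le)
    (F := fun p m => p.1 * (Iic (0 : ℝ)).indicator (fun _ => (1 : ENNReal)) (m - p.2))
    (by
      refine Measurable.mul (by fun_prop) ?_
      exact (measurable_const.indicator measurableSet_Iic).comp
        (measurable_snd.sub measurable_fst.snd))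
  have e1 : ∀ ω, ∀ c : ℝ, (∀ s ∈ Icc 0 h, Z s ω ≤ c) ↔ runSup Z 0 h ω - c ∈ Iic (0 : ℝ) := by
    intro ω c
    rw [← runSup_le_iff hh.le (hZc ω), mem_Iic, sub_nonpos]
  have e2 : ∀ ω, (∀ s ∈ Icc u (u + h), B s ω ≤ B u ω + θ ω) ↔
      ∀ s ∈ Icc 0 h, Z s ω ≤ θ ω := by
    intro ω
    constructor
    · intro H s hs
      have := H (u + s) ⟨by linarith [hs.1], by linarith [hs.2]⟩
      simp only [hZ]; linarith
    · intro H s hs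
      have := H (s - u) ⟨by linarith [hs.1], by linarith [hs.2]⟩
      simp only [hZ, add_sub_cancel] at this; linarith
  have hmeas : MeasurableSet {ω | runSup Z 0 h ω - θ ω ∈ Iic (0 : ℝ)} :=
    (hRm.sub hθm) measurableSet_Iic
  have l1 : Q (A ∩ {ω | ∀ s ∈ Icc u (u + h), B s ω ≤ B u ω + θ ω})
      = ∫⁻ ω, A.indicator (fun _ => (1 : ENNReal)) ω *
        (Iic (0 : ℝ)).indicator (fun _ => (1 : ENNReal)) (runSup Z 0 h ω - θ ω) ∂Q := by
    have : A ∩ {ω | ∀ s ∈ Icc u (u + h), B s ω ≤ B u ω + θ ω}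
        = A ∩ {ω | runSup Z 0 h ω - θ ω ∈ Iic (0 : ℝ)} := by
      ext ω; simp only [mem_inter_iff, mem_ofPred_eq, e2, e1]
    rw [this, ← lintegral_indicator_one (hAm.inter hmeas)]
    refine lintegral_congr fun ω => ?_
    by_cases h1 : ω ∈ A <;> by_cases h2 : runSup Z 0 h ω - θ ω ∈ Iic (0 : ℝ) <;>
      simp [indicator, h1, h2, mem_inter_iff, mem_ofPred_eq] <;> simp_all
  rw [l1, key, ← lintegral_indicator hAm]
  refine lintegral_congr fun ω => ?_
  have hmω : MeasurableSet {ω' | runSup Z 0 h ω' - θ ω ∈ Iic (0 : ℝ)} :=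
    (hRm.sub measurable_const) measurableSet_Iic
  by_cases h1 : ω ∈ A
  · simp only [indicator_of_mem h1, one_mul]
    have e4 : {ω' | ∀ s ∈ Icc 0 h, B (u + s) ω' - B u ω' ≤ θ ω}
        = {ω' | runSup Z 0 h ω' - θ ω ∈ Iic (0 : ℝ)} := by
      ext ω'; exact e1 ω' (θ ω)
    rw [e4, ← lintegral_indicator_one hmω]
    rfl
  · simp only [indicator_of_notMem h1, zero_mul, lintegral_zero]

theorem measure_inter_forall_le_le (hB : IsBMF F B Q) {u h : ℝ} (hu : 0 ≤ u) (hh : 0 < h)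
    {A : Set Ω} (hA : MeasurableSet[F u] A) {θ : Ω → ℝ} (hθ : Measurable[F u] θ) :
    Q (A ∩ {ω | ∀ s ∈ Icc u (u + h), B s ω ≤ B u ω + θ ω})
      ≤ ofReal √(2 / (π * h)) * ∫⁻ ω in A, ofReal (θ ω) ∂Q := by
  rw [hB.measure_inter_forall_le hu hh hA hθ,
    ← lintegral_const_mul _ (hθ.mono (hB.le u) le_rfl).ennreal_ofReal]
  refine lintegral_mono fun ω => ?_
  rw [← ofReal_mul (by positivity)]
  rcases le_or_gt 0 (θ ω) with h0 | h0
  · exact (hB.bm.shift hu).below_le h0 hh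
  · have : {ω' | ∀ s ∈ Icc 0 h, B (u + s) ω' - B u ω' ≤ θ ω} = ∅ := by
      ext ω'
      simp only [mem_ofPred_eq, mem_empty_iff_false, iff_false]
      intro H
      have := H 0 ⟨le_rfl, hh.le⟩
      simp at this; linarith
    rw [this]; simp

theorem le_measure_inter_forall_le (hB : IsBMF F B Q) {u h : ℝ} (hu : 0 ≤ u) (hh : 0 < h)
    {A : Set Ω} (hA : MeasurableSet[F u] A) {θ : Ω → ℝ} (hθ : Measurable[F u] θ)
    (hθ0 : ∀ ω ∈ A, 0 ≤ θ ω) : ∫⁻ ω in A, ofReal (√(2 / (π * h)) * θ ω * (1 - θ ω ^ 2 / (2 * h))) ∂Q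
      ≤ Q (A ∩ {ω | ∀ s ∈ Icc u (u + h), B s ω ≤ B u ω + θ ω}) := by
  rw [hB.measure_inter_forall_le hu hh hA hθ]
  exact setLIntegral_mono' (hB.le u A hA) fun ω hω => (hB.bm.shift hu).le_below (hθ0 ω hω) hh

end IsBMF

theorem IsBM.setLIntegral_sub (hB : IsBM B Q) (z : ℝ) {h : ℝ} (hh : 0 < h) :
    ∫⁻ ω in {ω | ∀ s ∈ Icc 0 h, B s ω ≤ z}, ofReal (z - B h ω) ∂Q = ofReal z := by
  have := hB.isProbabilityMeasure
  have hSm : MeasurableSet {ω | ∀ s ∈ Icc 0 h, B s ω ≤ z} :=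
    measurableSet_forall_le hh.le (fun s _ => hB.meas s) hB.cont continuous_const
  rcases le_or_gt 0 z with hz | hz
  · rw [← ofReal_integral_eq_lintegral_ofReal, hB.setIntegral_sub hz hh]
    · exact ((integrable_const _).sub (hB.integrable hh.le)).integrableOn
    · filter_upwards [self_mem_ae_restrict hSm] with ω hω
      exact sub_nonneg.2 (hω h ⟨hh.le, le_rfl⟩)
  · have : {ω | ∀ s ∈ Icc 0 h, B s ω ≤ z} = ∅ := by
      ext ω
      simp only [mem_ofPred_eq, mem_empty_iff_false, iff_false]
      intro H
      have := H 0 ⟨le_rfl, hh.le⟩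
      rw [hB.zero] at this; linarith
    rw [this, ofReal_of_nonpos hz.le]; simp

namespace IsBMF

/-- The distance to a fixed level, killed when the level is exceeded, has constant mean. -/
theorem setLIntegral_inter_forall_le (hB : IsBMF F B Q) {u h : ℝ} (hu : 0 ≤ u) (hh : 0 < h)
    {A : Set Ω} (hA : MeasurableSet[F u] A) {θ : Ω → ℝ} (hθ : Measurable[F u] θ) :
    ∫⁻ ω in A ∩ {ω | ∀ s ∈ Icc u (u + h), B s ω ≤ B u ω + θ ω},
        ofReal (B u ω + θ ω - B (u + h) ω) ∂Q = ∫⁻ ω in A, ofReal (θ ω) ∂Q := by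
  have := hB.bm.isProbabilityMeasure
  set Z : ℝ → Ω → ℝ := fun s ω => B (u + s) ω - B u ω with hZ
  have hZb : IsBM Z Q := hB.bm.shift hu
  have hAm : MeasurableSet A := hB.le u A hA
  have hθm : Measurable θ := hθ.mono (hB.le u) le_rfl
  have hRm : Measurable (runSup Z 0 h) :=
    measurable_runSup hh.le (fun s _ => hZb.meas s) hZb.cont
  have key := lintegral_indep (hB.indep u hu) (hB.le u) (hB.bm.fut_le u)
    (U := fun ω => (A.indicator (fun _ => (1 : ENNReal)) ω, θ ω))
    (V := fun ω => (runSup Z 0 h ω, Z h ω))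
    ((measurable_const.indicator hA).prodMk hθ)
    ((hB.measurable_runSup_fut le_rfl hh.le).prodMk (measurable_futσ B hh.le))
    (F := fun p m => p.1 * ((Iic (0 : ℝ)).indicator (fun _ => (1 : ENNReal)) (m.1 - p.2)
      * ofReal (p.2 - m.2)))
    (by
      refine Measurable.mul (by fun_prop) (Measurable.mul ?_ (by fun_prop))
      exact (measurable_const.indicator measurableSet_Iic).comp
        (measurable_snd.fst.sub measurable_fst.snd))
  have e1 : ∀ ω, ∀ c : ℝ, (∀ s ∈ Icc 0 h, Z s ω ≤ c) ↔ runSup Z 0 h ω - c ∈ Iic (0 : ℝ) := by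
    intro ω c
    rw [← runSup_le_iff hh.le (hZb.cont ω), mem_Iic, sub_nonpos]
  have e2 : ∀ ω, (∀ s ∈ Icc u (u + h), B s ω ≤ B u ω + θ ω) ↔
      ∀ s ∈ Icc 0 h, Z s ω ≤ θ ω := by
    intro ω
    constructor
    · intro H s hs
      have := H (u + s) ⟨by linarith [hs.1], by linarith [hs.2]⟩
      simp only [hZ]; linarith
    · intro H s hs
      have := H (s - u) ⟨by linarith [hs.1], by linarith [hs.2]⟩
      simp only [hZ, add_sub_cancel] at this; linarith
  have hmeas : MeasurableSet {ω | runSup Z 0 h ω - θ ω ∈ Iic (0 : ℝ)} :=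
    (hRm.sub hθm) measurableSet_Iic
  have e3 : A ∩ {ω | ∀ s ∈ Icc u (u + h), B s ω ≤ B u ω + θ ω}
        = A ∩ {ω | runSup Z 0 h ω - θ ω ∈ Iic (0 : ℝ)} := by
      ext ω; simp only [mem_inter_iff, mem_ofPred_eq, e2, e1]
  rw [e3, ← lintegral_indicator (hAm.inter hmeas)]
  have l1 : ∀ ω, (A ∩ {ω | runSup Z 0 h ω - θ ω ∈ Iic (0 : ℝ)}).indicator
      (fun ω => ofReal (B u ω + θ ω - B (u + h) ω)) ω
      = A.indicator (fun _ => (1 : ENNReal)) ω *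
        ((Iic (0 : ℝ)).indicator (fun _ => (1 : ENNReal)) (runSup Z 0 h ω - θ ω) *
          ofReal (θ ω - Z h ω)) := by
    intro ω
    have : θ ω - Z h ω = B u ω + θ ω - B (u + h) ω := by simp only [hZ]; ring
    rw [this]
    by_cases h1 : ω ∈ A <;> by_cases h2 : runSup Z 0 h ω - θ ω ∈ Iic (0 : ℝ) <;>
      simp [indicator, h1, h2, mem_inter_iff, mem_ofPred_eq] <;> simp_all
  rw [lintegral_congr l1, key, ← lintegral_indicator hAm]
  refine lintegral_congr fun ω => ?_
  have hmω : MeasurableSet {ω' | runSup Z 0 h ω' - θ ω ∈ Iic (0 : ℝ)} :=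
    (hRm.sub measurable_const) measurableSet_Iic
  by_cases h1 : ω ∈ A
  · simp only [indicator_of_mem h1, one_mul]
    rw [← hZb.setLIntegral_sub (θ ω) hh]
    simp only [e1]
    rw [← lintegral_indicator hmω]
    refine lintegral_congr fun ω' => ?_
    by_cases h2 : runSup Z 0 h ω' - θ ω ∈ Iic (0 : ℝ)
    · rw [indicator_of_mem h2, one_mul, indicator_of_mem (by exact h2)]
    · rw [indicator_of_notMem h2, zero_mul, indicator_of_notMem (by exact h2)]
  · simp only [indicator_of_notMem h1, zero_mul, lintegral_zero]

/-- Anti-concentration of the value at a later time, given the past. -/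
theorem measure_inter_Icc_le (hB : IsBMF F B Q) {u h : ℝ} (hu : 0 ≤ u) (hh : 0 < h)
    {A : Set Ω} (hA : MeasurableSet[F u] A) (a b : ℝ) :
    Q (A ∩ {ω | B (u + h) ω ∈ Icc a b}) ≤ ofReal ((b - a) / √(2 * π * h)) * Q A := by
  have := hB.bm.isProbabilityMeasure
  have hh' : h.toNNReal ≠ 0 := by simpa using hh
  have hAm : MeasurableSet A := hB.le u A hA
  have hS : MeasurableSet {ω | B (u + h) ω ∈ Icc a b} := hB.bm.meas _ measurableSet_Icc
  have key := lintegral_indep (hB.indep u hu) (hB.le u) (hB.bm.fut_le u)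
    (U := fun ω => (A.indicator (fun _ => (1 : ENNReal)) ω, B u ω))
    (V := fun ω => B (u + h) ω - B u ω)
    ((measurable_const.indicator hA).prodMk (hB.adapted u hu))
    (measurable_futσ B hh.le)
    (F := fun p m => p.1 * ((Icc a b).indicator (fun _ => (1 : ENNReal)) (p.2 + m)))
    (by
      refine Measurable.mul (by fun_prop) ?_
      exact (measurable_const.indicator measurableSet_Icc).comp
        (measurable_fst.snd.add measurable_snd))
  rw [← lintegral_indicator_one (hAm.inter hS)]
  have l1 : ∀ ω, (A ∩ {ω | B (u + h) ω ∈ Icc a b}).indicator (1 : Ω → ENNReal) ω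
      = A.indicator (fun _ => (1 : ENNReal)) ω *
        ((Icc a b).indicator (fun _ => (1 : ENNReal)) (B u ω + (B (u + h) ω - B u ω))) := by
    intro ω
    rw [add_sub_cancel]
    by_cases h1 : ω ∈ A <;> by_cases h2 : B (u + h) ω ∈ Icc a b <;>
      simp [indicator, h1, h2, mem_inter_iff, mem_ofPred_eq] <;> simp_all
  rw [lintegral_congr l1, key]
  have l2 : ∀ ω, ∫⁻ ω', A.indicator (fun _ => (1 : ENNReal)) ω *
        ((Icc a b).indicator (fun _ => (1 : ENNReal)) (B u ω + (B (u + h) ω' - B u ω'))) ∂Q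
      ≤ A.indicator (fun _ => ofReal ((b - a) / √(2 * π * h))) ω := by
    intro ω
    by_cases h1 : ω ∈ A
    · simp only [indicator_of_mem h1, one_mul]
      have hm : MeasurableSet {ω' | B (u + h) ω' - B u ω' ∈ Icc (a - B u ω) (b - B u ω)} :=
        ((hB.bm.meas _).sub (hB.bm.meas _)) measurableSet_Icc
      calc _ = Q {ω' | B (u + h) ω' - B u ω' ∈ Icc (a - B u ω) (b - B u ω)} := by
            rw [← lintegral_indicator_one hm]
            refine lintegral_congr fun ω' => ?_
            have e : (B u ω + (B (u + h) ω' - B u ω') ∈ Icc a b) ↔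
                B (u + h) ω' - B u ω' ∈ Icc (a - B u ω) (b - B u ω) := by
              simp only [mem_Icc]
              constructor <;> rintro ⟨h1, h2⟩ <;> constructor <;> linarith
            simp only [indicator, mem_ofPred_eq, Pi.one_apply, e]
        _ ≤ _ := by
            rw [(hB.bm.shift hu).measure_mem hh.le measurableSet_Icc]
            refine (gaussianReal_Icc_le hh' _ _).trans ?_
            rw [Real.coe_toNNReal _ hh.le]
            refine ofReal_le_ofReal (le_of_eq ?_)
            congr 1; ring
    · simp only [indicator_of_notMem h1, zero_mul, lintegral_zero, le_refl]
  refine (lintegral_mono l2).trans ?_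
  rw [lintegral_indicator_const hAm]

/-- Weighted estimate for the event that the running maximum over a late window falls in a
given interval. -/
theorem lintegral_window_le (hB : IsBMF F B Q) {u h h' : ℝ} (hu : 0 ≤ u) (hh : 0 < h)
    (hh' : 0 < h') {A : Set Ω} (hA : MeasurableSet[F u] A) (c G : ℝ)
    {φ : ℝ → ENNReal} (hφ : Measurable φ) :
    ∫⁻ ω in A ∩ {ω | runSup B (u + h) (u + h + h') ω ∈ Icc (c - G) c},
        φ (runSup B (u + h) (u + h + h') ω - B (u + h + h') ω) ∂Q
      ≤ ofReal (G / √(2 * π * h)) * Q A *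
        ∫⁻ ω, φ (runSup (fun s ω => B (u + h + s) ω - B (u + h) ω) 0 h' ω
          - (B (u + h + h') ω - B (u + h) ω)) ∂Q := by
  have := hB.bm.isProbabilityMeasure
  have huh : 0 ≤ u + h := by positivity
  set Z : ℝ → Ω → ℝ := fun s ω => B (u + h + s) ω - B (u + h) ω with hZ
  have hZb : IsBM Z Q := hB.bm.shift huh
  have hAm : MeasurableSet A := hB.le u A hA
  have hRm : Measurable (runSup Z 0 h') :=
    measurable_runSup hh'.le (fun s _ => hZb.meas s) hZb.cont
  have hle : u + h ≤ u + h + h' := by linarith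
  have hR : ∀ ω, runSup B (u + h) (u + h + h') ω = B (u + h) ω + runSup Z 0 h' ω := by
    intro ω
    apply le_antisymm
    · rw [runSup_le_iff hle (hB.bm.cont ω)]
      intro s hs
      have := le_runSup (hZb.cont ω)
        (⟨by linarith [hs.1], by linarith [hs.2]⟩ : s - (u + h) ∈ Icc 0 h')
      simp only [hZ, add_sub_cancel] at this ⊢
      linarith
    · have : runSup Z 0 h' ω ≤ runSup B (u + h) (u + h + h') ω - B (u + h) ω := by
        rw [runSup_le_iff hh'.le (hZb.cont ω)]
        intro s hs
        have := le_runSup (hB.bm.cont ω) (⟨by linarith [hs.1], by linarith [hs.2]⟩ :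
          u + h + s ∈ Icc (u + h) (u + h + h'))
        simp only [hZ]; linarith
      linarith
  have hSm : MeasurableSet {ω | runSup B (u + h) (u + h + h') ω ∈ Icc (c - G) c} := by
    simp only [hR]
    exact ((hB.bm.meas _).add hRm) measurableSet_Icc
  have hA' : MeasurableSet[F (u + h)] A := hB.mono (by linarith) A hA
  have key := lintegral_indep (hB.indep (u + h) huh) (hB.le _) (hB.bm.fut_le _)
    (U := fun ω => (A.indicator (fun _ => (1 : ENNReal)) ω, B (u + h) ω))
    (V := fun ω => (runSup Z 0 h' ω, Z h' ω))
    ((measurable_const.indicator hA').prodMk (hB.adapted _ huh))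
    ((hB.measurable_runSup_fut le_rfl hh'.le).prodMk (measurable_futσ B hh'.le))
    (F := fun p m => p.1 * ((Icc (c - G) c).indicator (fun _ => (1 : ENNReal)) (p.2 + m.1)
      * φ (m.1 - m.2)))
    (by
      refine Measurable.mul (by fun_prop) (Measurable.mul ?_ (by fun_prop))
      exact (measurable_const.indicator measurableSet_Icc).comp
        (measurable_fst.snd.add measurable_snd.fst))
  rw [← lintegral_indicator (hAm.inter hSm)]
  have l1 : ∀ ω, (A ∩ {ω | runSup B (u + h) (u + h + h') ω ∈ Icc (c - G) c}).indicator
      (fun ω => φ (runSup B (u + h) (u + h + h') ω - B (u + h + h') ω)) ω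
      = A.indicator (fun _ => (1 : ENNReal)) ω *
        ((Icc (c - G) c).indicator (fun _ => (1 : ENNReal)) (B (u + h) ω + runSup Z 0 h' ω)
          * φ (runSup Z 0 h' ω - Z h' ω)) := by
    intro ω
    have e : runSup Z 0 h' ω - Z h' ω = B (u + h) ω + runSup Z 0 h' ω - B (u + h + h') ω := by
      simp only [hZ]; ring
    rw [e]
    by_cases h1 : ω ∈ A <;>
      by_cases h2 : B (u + h) ω + runSup Z 0 h' ω ∈ Icc (c - G) c <;>
      simp only [indicator, h1, h2, mem_inter_iff, mem_ofPred_eq, hR, and_true,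
        and_false, if_true, if_false, one_mul, zero_mul, mul_zero]
  rw [lintegral_congr l1, key, lintegral_lintegral_swap]
  swap
  · refine Measurable.aemeasurable ?_
    refine Measurable.mul ((measurable_const.indicator hAm).comp measurable_fst)
      (Measurable.mul ?_ (hφ.comp ((hRm.sub (hZb.meas _)).comp measurable_snd)))
    exact (measurable_const.indicator measurableSet_Icc).comp
        (((hB.bm.meas _).comp measurable_fst).add (hRm.comp measurable_snd))
  have hφm : Measurable fun ω => φ (runSup Z 0 h' ω - Z h' ω) :=
    hφ.comp (hRm.sub (hZb.meas _))
  change _ ≤ _ * ∫⁻ ω, φ (runSup Z 0 h' ω - Z h' ω) ∂Q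
  rw [← lintegral_const_mul _ hφm]
  refine lintegral_mono fun ω' => ?_
  have l3 : ∀ ω, A.indicator (fun _ => (1 : ENNReal)) ω *
        ((Icc (c - G) c).indicator (fun _ => (1 : ENNReal)) (B (u + h) ω + runSup Z 0 h' ω')
          * φ (runSup Z 0 h' ω' - Z h' ω'))
      = (A ∩ {ω | B (u + h) ω ∈ Icc (c - G - runSup Z 0 h' ω') (c - runSup Z 0 h' ω')}).indicator
        1 ω * φ (runSup Z 0 h' ω' - Z h' ω') := by
    intro ω
    have e : (B (u + h) ω + runSup Z 0 h' ω' ∈ Icc (c - G) c) ↔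
        B (u + h) ω ∈ Icc (c - G - runSup Z 0 h' ω') (c - runSup Z 0 h' ω') := by
      simp only [mem_Icc]
      constructor <;> rintro ⟨h1, h2⟩ <;> constructor <;> linarith
    by_cases h1 : ω ∈ A <;>
      by_cases h2 : B (u + h) ω + runSup Z 0 h' ω' ∈ Icc (c - G) c <;>
      simp only [indicator, h1, h2, mem_inter_iff, mem_ofPred_eq, and_true, ← e,
        and_false, if_true, if_false, one_mul, zero_mul, mul_zero,
        Pi.one_apply]
  have hIm : MeasurableSet (A ∩ {ω | B (u + h) ω ∈
      Icc (c - G - runSup Z 0 h' ω') (c - runSup Z 0 h' ω')}) :=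
    hAm.inter (hB.bm.meas _ measurableSet_Icc)
  rw [lintegral_congr l3, lintegral_mul_const _ (measurable_one.indicator hIm),
    lintegral_indicator_one hIm]
  refine mul_le_mul_left ?_ _
  refine (hB.measure_inter_Icc_le hu hh hA _ _).trans (le_of_eq ?_)
  congr 3; ring

end IsBMF

/-- The event of staying below the curve `f` on `[u, t]`. -/
def below (B : ℝ → Ω → ℝ) (f : ℝ → ℝ) (u t : ℝ) : Set Ω :=
  {ω | ∀ s ∈ Icc u t, B s ω ≤ f s}

/-- The mean distance to the curve `f` at time `t`, on an event and on survival up to `t`. -/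
noncomputable def gap (B : ℝ → Ω → ℝ) (Q : Measure Ω) (f : ℝ → ℝ) (A : Set Ω) (t : ℝ) : ENNReal :=
  ∫⁻ ω in A ∩ below B f 0 t, ofReal (f t - B t ω) ∂Q

/-- Slowly growing upper barriers. -/
structure IsBarrier (f : ℝ → ℝ) (c : ℝ) : Prop where
  cont : Continuous f
  mono : MonotoneOn f (Ici 0)
  nonneg : ∀ s, 0 ≤ s → 0 ≤ f s
  const_nonneg : 0 ≤ c
  double : ∀ t, 0 ≤ t → f (2 * t) ≤ f t + c

theorem below_anti {f : ℝ → ℝ} {u t t' : ℝ} (h : t ≤ t') :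
    below B f u t' ⊆ below B f u t := fun _ H s hs => H s ⟨hs.1, hs.2.trans h⟩

namespace IsBMF

variable {f : ℝ → ℝ} {c : ℝ}

theorem measurableSet_below (hB : IsBMF F B Q) (hf : Continuous f) {u t : ℝ} (hu : 0 ≤ u)
    (ht : u ≤ t) : MeasurableSet[F t] (below B f u t) :=
  measurableSet_forall_le ht (fun s hs => hB.adapted_le (hu.trans hs.1) hs.2) hB.bm.cont hf

theorem step_aux (hB : IsBMF F B Q) (hf : IsBarrier f c) {t : ℝ} (ht : 0 < t) {A : Set Ω}
    (hA : MeasurableSet[F t] A) : ∫⁻ ω in A ∩ below B f 0 t, ofReal (f t + c - B t ω) ∂Q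
      ≤ gap B Q f A t + ofReal c * Q (A ∩ below B f 0 t) := by
  have hS : MeasurableSet (A ∩ below B f 0 t) :=
    hB.le t _ (hA.inter (hB.measurableSet_below hf.cont le_rfl ht.le))
  have : ofReal c * Q (A ∩ below B f 0 t)
      = ∫⁻ _ in A ∩ below B f 0 t, ofReal c ∂Q := by rw [setLIntegral_const]
  rw [this, gap, ← lintegral_add_right _ measurable_const]
  refine setLIntegral_mono' hS fun ω hω => ?_
  have h1 : B t ω ≤ f t := hω.2 t ⟨ht.le, le_rfl⟩
  rw [← ofReal_add (sub_nonneg.2 h1) hf.const_nonneg]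
  exact ofReal_le_ofReal (by linarith)

theorem below_double_subset (hf : IsBarrier f c) {t : ℝ} (ht : 0 < t) (A : Set Ω) :
    A ∩ below B f 0 (2 * t) ⊆ (A ∩ below B f 0 t) ∩
      {ω | ∀ s ∈ Icc t (t + t), B s ω ≤ B t ω + (f t + c - B t ω)} := by
  rintro ω ⟨h1, h2⟩
  refine ⟨⟨h1, below_anti (by linarith) h2⟩, fun s hs => ?_⟩
  have h3 := h2 s ⟨by linarith [hs.1], by linarith [hs.2]⟩
  have h4 := hf.mono (mem_Ici.2 (by linarith [hs.1])) (mem_Ici.2 (by linarith))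
    (by linarith [hs.2] : s ≤ 2 * t)
  linarith [hf.double t ht.le]

theorem measure_below_double_le (hB : IsBMF F B Q) (hf : IsBarrier f c) {t : ℝ} (ht : 0 < t)
    {A : Set Ω} (hA : MeasurableSet[F t] A) : Q (A ∩ below B f 0 (2 * t)) ≤ ofReal √(2 / (π * t)) *
      (gap B Q f A t + ofReal c * Q (A ∩ below B f 0 t)) := by
  have hS := hA.inter (hB.measurableSet_below hf.cont le_rfl ht.le)
  refine (measure_mono (below_double_subset hf ht A)).trans ?_
  refine (hB.measure_inter_forall_le_le ht.le ht hS
    (measurable_const.sub (hB.adapted t ht.le))).trans ?_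
  exact mul_le_mul_right (hB.step_aux hf ht hA) _

theorem gap_double_le (hB : IsBMF F B Q) (hf : IsBarrier f c) {t : ℝ} (ht : 0 < t)
    {A : Set Ω} (hA : MeasurableSet[F t] A) :
    gap B Q f A (2 * t) ≤ gap B Q f A t + ofReal c * Q (A ∩ below B f 0 t) := by
  have hS := hA.inter (hB.measurableSet_below hf.cont le_rfl ht.le)
  refine le_trans ?_ (hB.step_aux hf ht hA)
  have e := hB.setLIntegral_inter_forall_le (θ := fun ω => f t + c - B t ω) ht.le ht hS
    (measurable_const.sub (hB.adapted t ht.le))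
  rw [← e, gap]
  refine (lintegral_mono_set (below_double_subset hf ht A)).trans (lintegral_mono fun ω => ?_)
  refine ofReal_le_ofReal ?_
  rw [two_mul]
  have := hf.double t ht.le
  rw [two_mul] at this
  linarith

/-- Propagation of the survival probability and of the mean distance along doubling times. -/
theorem doubling_le (hB : IsBMF F B Q) (hf : IsBarrier f c) {s : ℝ} (hs : 1 ≤ s)
    {A : Set Ω} (hA : MeasurableSet[F s] A) (j : ℕ) :
    gap B Q f A (2 ^ j * s) ≤ ofReal (exp (2 * c * ∑ i ∈ Finset.range j, (√2)⁻¹ ^ i)) *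
      (gap B Q f A s + ofReal √s * Q (A ∩ below B f 0 s)) ∧
    ofReal √(2 ^ j * s) * Q (A ∩ below B f 0 (2 ^ j * s)) ≤
      2 * (ofReal (exp (2 * c * ∑ i ∈ Finset.range j, (√2)⁻¹ ^ i)) *
      (gap B Q f A s + ofReal √s * Q (A ∩ below B f 0 s))) := by
  have hc := hf.const_nonneg
  induction j with
  | zero =>
    simp only [pow_zero, one_mul, Finset.range_zero, Finset.sum_empty, mul_zero, exp_zero,
      ofReal_one]
    refine ⟨le_self_add, ?_⟩
    rw [two_mul]
    exact le_add_left le_add_self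
  | succ j ih =>
    set K := exp (2 * c * ∑ i ∈ Finset.range j, (√2)⁻¹ ^ i) with hK
    set m := gap B Q f A s + ofReal √s * Q (A ∩ below B f 0 s) with hm
    set t := 2 ^ j * s with htdef
    have hpow : (1 : ℝ) ≤ 2 ^ j := one_le_pow₀ (by norm_num)
    have hst : s ≤ t := by rw [htdef]; nlinarith
    have ht : 0 < t := by linarith
    have hAt : MeasurableSet[F t] A := hB.mono hst A hA
    have e1 : (2 : ℝ) ^ (j + 1) * s = 2 * t := by rw [htdef]; ring
    obtain ⟨ih1, ih2⟩ := ih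
    have hK' : K * (1 + 2 * c * (√2)⁻¹ ^ j)
        ≤ exp (2 * c * ∑ i ∈ Finset.range (j + 1), (√2)⁻¹ ^ i) := by
      rw [Finset.sum_range_succ, mul_add (2 * c), exp_add]
      refine mul_le_mul_of_nonneg_left ?_ (exp_pos _).le
      linarith [add_one_le_exp (2 * c * (√2)⁻¹ ^ j)]
    have hcp : ofReal c * Q (A ∩ below B f 0 t)
        ≤ ofReal (2 * c * (√2)⁻¹ ^ j) * (ofReal K * m) := by
      have h1 : ofReal c * Q (A ∩ below B f 0 t)
          ≤ ofReal (c * (√2)⁻¹ ^ j) *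
            (ofReal √t * Q (A ∩ below B f 0 t)) := by
        rw [← mul_assoc, ← ofReal_mul (by positivity)]
        refine mul_le_mul_left (ofReal_le_ofReal ?_) _
        have h2 : (√2) ^ j ≤ √t := by
          refine Real.le_sqrt_of_sq_le ?_
          rw [← pow_mul, mul_comm j 2, pow_mul, Real.sq_sqrt (by norm_num), htdef]
          nlinarith
        have h3 : 1 ≤ (√2)⁻¹ ^ j * √t := by
          rw [inv_pow, inv_mul_eq_div, le_div_iff₀ (by positivity)]; linarith
        nlinarith
      refine h1.trans ?_
      calc _ ≤ ofReal (c * (√2)⁻¹ ^ j) * (2 * (ofReal K * m)) :=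
            mul_le_mul_right ih2 _
        _ = _ := by
            rw [← mul_assoc, mul_assoc 2 c, ofReal_mul (p := 2) (by norm_num)]
            rw [ofReal_ofNat]; ring
    have hmain : gap B Q f A t + ofReal c * Q (A ∩ below B f 0 t)
        ≤ ofReal (exp (2 * c * ∑ i ∈ Finset.range (j + 1), (√2)⁻¹ ^ i)) * m := by
      calc _ ≤ ofReal K * m +
            ofReal (2 * c * (√2)⁻¹ ^ j) * (ofReal K * m) := add_le_add ih1 hcp
        _ = ofReal (K * (1 + 2 * c * (√2)⁻¹ ^ j)) * m := by
            rw [ofReal_mul (exp_pos _).le, ofReal_add zero_le_one (by positivity), ofReal_one]; ring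
        _ ≤ _ := mul_le_mul_left (ofReal_le_ofReal hK') _
    rw [e1]
    refine ⟨(hB.gap_double_le hf ht hAt).trans hmain, ?_⟩
    calc ofReal √(2 * t) * Q (A ∩ below B f 0 (2 * t))
        ≤ ofReal √(2 * t) * (ofReal √(2 / (π * t)) *
          (gap B Q f A t + ofReal c * Q (A ∩ below B f 0 t))) :=
          mul_le_mul_right (hB.measure_below_double_le hf ht hAt) _
      _ ≤ 2 * (gap B Q f A t + ofReal c * Q (A ∩ below B f 0 t)) := by
          rw [← mul_assoc, ← ofReal_mul (by positivity), ← Real.sqrt_mul (by positivity)]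
          refine mul_le_mul_left ?_ _
          rw [← ofReal_ofNat]
          refine ofReal_le_ofReal ?_
          rw [Real.sqrt_le_left (by norm_num)]
          have : 2 * t * (2 / (π * t)) = 4 / π := by field_simp; norm_num
          rw [this, div_le_iff₀ pi_pos]
          nlinarith [pi_gt_three]
      _ ≤ _ := mul_le_mul_right hmain _

theorem doubling (hB : IsBMF F B Q) (hf : IsBarrier f c) {s : ℝ} (hs : 1 ≤ s)
    {A : Set Ω} (hA : MeasurableSet[F s] A) (j : ℕ) :
    gap B Q f A (2 ^ j * s) + ofReal √(2 ^ j * s) * Q (A ∩ below B f 0 (2 ^ j * s)) ≤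
      ofReal (3 * exp (8 * c)) * (gap B Q f A s + ofReal √s * Q (A ∩ below B f 0 s)) := by
  obtain ⟨h1, h2⟩ := hB.doubling_le hf hs hA j
  have hr : (√2)⁻¹ ≤ 3 / 4 := by
    rw [inv_le_comm₀ (by positivity) (by norm_num)]
    exact Real.le_sqrt_of_sq_le (by norm_num)
  have hr0 : 0 ≤ (√2)⁻¹ := by positivity
  have hsum : ∑ i ∈ Finset.range j, (√2)⁻¹ ^ i ≤ 4 := by
    calc ∑ i ∈ Finset.range j, (√2)⁻¹ ^ i ≤ ∑ i ∈ Finset.range j, (3 / 4 : ℝ) ^ i :=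
          Finset.sum_le_sum fun i _ => pow_le_pow_left₀ hr0 hr i
      _ ≤ ∑' i : ℕ, (3 / 4 : ℝ) ^ i :=
          (summable_geometric_of_lt_one (by norm_num) (by norm_num)).sum_le_tsum _
            fun i _ => by positivity
      _ = 4 := by rw [tsum_geometric_of_lt_one (by norm_num) (by norm_num)]; norm_num
  have hK : ofReal (exp (2 * c * ∑ i ∈ Finset.range j, (√2)⁻¹ ^ i))
      ≤ ofReal (exp (8 * c)) := by
    refine ofReal_le_ofReal (exp_le_exp.2 ?_)
    nlinarith [hf.const_nonneg]
  refine (add_le_add h1 h2).trans ?_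
  rw [ofReal_mul (by norm_num), ofReal_ofNat]
  set m := gap B Q f A s + ofReal √s * Q (A ∩ below B f 0 s)
  calc _ = 3 * (ofReal (exp (2 * c * ∑ i ∈ Finset.range j, (√2)⁻¹ ^ i)) * m) := by ring
    _ ≤ 3 * (ofReal (exp (8 * c)) * m) := mul_le_mul_right (mul_le_mul_left hK _) _
    _ = _ := (mul_assoc _ _ _).symm

theorem lintegral_abs_le (hB : IsBMF F B Q) {h : ℝ} (hh : 0 < h) :
    ∫⁻ ω, ofReal |B h ω| ∂Q ≤ ofReal (4 * √h) := by
  rw [← ofReal_integral_eq_lintegral_ofReal (hB.bm.integrable hh.le).abs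
    (ae_of_all _ fun ω => abs_nonneg _)]
  exact ofReal_le_ofReal (hB.bm.integral_abs_le hh)

theorem exists_dyadic {t : ℝ} (ht : 1 ≤ t) : ∃ (j : ℕ) (s : ℝ), 1 ≤ s ∧ s < 2 ∧ t = 2 ^ j * s := by
  obtain ⟨j, h1, h2⟩ := exists_nat_pow_near ht (by norm_num : (1 : ℝ) < 2)
  have hp : (0 : ℝ) < 2 ^ j := by positivity
  refine ⟨j, t / 2 ^ j, ?_, ?_, ?_⟩
  · rwa [le_div_iff₀ hp, one_mul]
  · rw [div_lt_iff₀ hp]; rw [pow_succ] at h2; linarith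
  · field_simp

/-- The survival probability decays like `1 / √t` and the mean distance stays bounded. -/
theorem gap_add_le (hB : IsBMF F B Q) (hf : IsBarrier f c) {t : ℝ} (ht : 1 ≤ t) :
    gap B Q f univ t + ofReal √t * Q (below B f 0 t) ≤ ofReal (3 * exp (8 * c) * (f 2 + 8)) := by
  have := hB.bm.isProbabilityMeasure
  obtain ⟨j, s, hs1, hs2, rfl⟩ := exists_dyadic ht
  have h := hB.doubling hf hs1 (A := univ) MeasurableSet.univ j
  simp only [univ_inter] at h
  refine h.trans ?_
  rw [ofReal_mul (p := 3 * exp (8 * c)) (by positivity)]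
  refine mul_le_mul_right ?_ _
  have hf2 : 0 ≤ f 2 := hf.nonneg 2 (by norm_num)
  have hsq : √s ≤ 3 / 2 := by
    rw [Real.sqrt_le_left (by norm_num)]; linarith
  have h1 : gap B Q f univ s ≤ ofReal (f 2 + 6) := by
    calc gap B Q f univ s ≤ ∫⁻ ω, ofReal (f s - B s ω) ∂Q :=
          setLIntegral_le_lintegral _ _
      _ ≤ ∫⁻ ω, (ofReal (f 2) + ofReal |B s ω|) ∂Q := by
          refine lintegral_mono fun ω => ?_
          rw [← ofReal_add hf2 (abs_nonneg _)]
          refine ofReal_le_ofReal ?_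
          have := hf.mono (mem_Ici.2 (by linarith)) (mem_Ici.2 (by norm_num)) hs2.le
          linarith [neg_abs_le (B s ω)]
      _ ≤ ofReal (f 2) + ofReal (4 * √s) := by
          rw [lintegral_add_left measurable_const]
          refine add_le_add (by simp) (hB.lintegral_abs_le (by linarith))
      _ ≤ _ := by
          rw [← ofReal_add hf2 (by positivity)]
          exact ofReal_le_ofReal (by linarith)
  have h2 : ofReal √s * Q (below B f 0 s) ≤ ofReal 2 := by
    calc _ ≤ ofReal √s * 1 := mul_le_mul_right prob_le_one _
      _ ≤ _ := by rw [mul_one]; exact ofReal_le_ofReal (by linarith)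
  refine (add_le_add h1 h2).trans ?_
  rw [← ofReal_add (by linarith) (by norm_num)]
  exact ofReal_le_ofReal (by linarith)

end IsBMF

/-- A slowly growing upper barrier `f` together with a lower barrier `-r` whose distance to `f`
is integrable along dyadic times. -/
structure IsCorridor (f r : ℝ → ℝ) (c : ℝ) : Prop where
  upper : IsBarrier f c
  cont : Continuous r
  mono : MonotoneOn r (Ici 0)
  nonneg : ∀ s, 0 ≤ s → 0 ≤ r s
  summable : Summable fun j : ℕ => (f (2 ^ (j + 1)) + r (2 ^ (j + 1))) / √(2 ^ j)

/-- The tails of the series attached to a corridor. -/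
noncomputable def corridorTail (f r : ℝ → ℝ) (n : ℕ) : ℝ :=
  ∑' j : ℕ, (f (2 ^ (j + n + 1)) + r (2 ^ (j + n + 1))) / √(2 ^ (j + n))

theorem IsCorridor.term_nonneg {f r : ℝ → ℝ} {c : ℝ} (hf : IsCorridor f r c) (j : ℕ) :
    0 ≤ (f (2 ^ (j + 1)) + r (2 ^ (j + 1))) / √(2 ^ j) :=
  div_nonneg (add_nonneg (hf.upper.nonneg _ (by positivity)) (hf.nonneg _ (by positivity)))
    (Real.sqrt_nonneg _)

theorem tendsto_corridorTail (f r : ℝ → ℝ) : Tendsto (corridorTail f r) atTop (nhds 0) :=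
  tendsto_sum_nat_add fun j : ℕ => (f (2 ^ (j + 1)) + r (2 ^ (j + 1))) / √(2 ^ j)

theorem IsCorridor.tail_nonneg {f r : ℝ → ℝ} {c : ℝ} (hf : IsCorridor f r c) (n : ℕ) :
    0 ≤ corridorTail f r n := tsum_nonneg fun j => hf.term_nonneg (j + n)

theorem IsCorridor.div_sqrt_le {f r : ℝ → ℝ} {c : ℝ} (hf : IsCorridor f r c) {j : ℕ} {τ : ℝ}
    (h1 : 1 ≤ τ) (h2 : τ < 2) : (f (2 ^ j * τ) + r (2 ^ j * τ)) / √(2 ^ j * τ)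
      ≤ (f (2 ^ (j + 1)) + r (2 ^ (j + 1))) / √(2 ^ j) := by
  have hp : (0 : ℝ) < 2 ^ j := by positivity
  have h3 : (2 : ℝ) ^ j * τ ≤ 2 ^ (j + 1) := by rw [pow_succ]; nlinarith
  have hm : ∀ g : ℝ → ℝ, MonotoneOn g (Ici 0) → g (2 ^ j * τ) ≤ g (2 ^ (j + 1)) := fun g hg =>
    hg (mem_Ici.2 (by positivity)) (mem_Ici.2 (by positivity)) h3
  have h0 : 0 ≤ f (2 ^ (j + 1)) + r (2 ^ (j + 1)) :=
    add_nonneg (hf.upper.nonneg _ (by positivity)) (hf.nonneg _ (by positivity))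
  refine div_le_div₀ h0 (add_le_add (hm f hf.upper.mono) (hm r hf.mono)) (by positivity)
    (Real.sqrt_le_sqrt (by nlinarith))

theorem IsCorridor.le_mul_sqrt {f r : ℝ → ℝ} {c : ℝ} (hf : IsCorridor f r c) {s : ℝ}
    (hs : 1 ≤ s) : f s + r s ≤ corridorTail f r 0 * √s := by
  obtain ⟨j, τ, h1, h2, rfl⟩ := IsBMF.exists_dyadic hs
  have h := hf.div_sqrt_le h1 h2 (j := j)
  have hp : (0 : ℝ) < 2 ^ j * τ := by positivity
  rw [div_le_iff₀ (by positivity)] at h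
  refine h.trans (mul_le_mul_of_nonneg_right ?_ (Real.sqrt_nonneg _))
  exact hf.summable.le_tsum j fun i _ => hf.term_nonneg i

namespace IsBMF

variable {f r : ℝ → ℝ} {c : ℝ}

/-- Mean distance and survival on the event of coming close to the barrier late. -/
theorem gap_late_le (hB : IsBMF F B Q) (hf : IsCorridor f r c) {s : ℝ} (hs : 4 ≤ s) :
    gap B Q f (below B (fun v => -r v) (s / 2) s)ᶜ s + ofReal √s *
        Q ((below B (fun v => -r v) (s / 2) s)ᶜ ∩ below B f 0 s)
      ≤ ofReal (2 * (3 * exp (8 * c) * (f 2 + 8)) * (corridorTail f r 0 + 9) *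
          ((f s + r s) / √s)) := by
  have := hB.bm.isProbabilityMeasure
  have hs0 : 0 < s := by linarith
  set G := f s + r s with hG
  set C₁ := 3 * exp (8 * c) * (f 2 + 8) with hC₁
  set T := corridorTail f r 0 with hT
  have hf2 := hf.upper.nonneg 2 (by norm_num)
  have hC₁0 : 0 ≤ C₁ := by positivity
  have hT0 : 0 ≤ T := hf.tail_nonneg 0
  have hG0 : 0 ≤ G := add_nonneg (hf.upper.nonneg s hs0.le) (hf.nonneg s hs0.le)
  have hGT : G ≤ T * √s := hf.le_mul_sqrt (by linarith)
  have hsq : 0 < √s := Real.sqrt_pos.2 hs0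
  set R : Ω → ℝ := runSup B (s / 4 + s / 4) (s / 4 + s / 4 + s / 2) with hR
  have e1 : s / 4 + s / 4 = s / 2 := by ring
  have e2 : s / 2 + s / 2 = s := by ring
  set A := below B f 0 (s / 4) with hA
  have hAm : MeasurableSet[F (s / 4)] A := hB.measurableSet_below hf.upper.cont le_rfl (by linarith)
  set bad := (below B (fun v => -r v) (s / 2) s)ᶜ ∩ below B f 0 s with hbad
  have hbadm : MeasurableSet bad := hB.le s _
    ((hB.measurableSet_below hf.cont.neg (by linarith) (by linarith)).compl.inter
      (hB.measurableSet_below hf.upper.cont le_rfl hs0.le))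
  have hRm : Measurable R := measurable_runSup (by linarith) (fun v _ => hB.bm.meas v) hB.bm.cont
  have hsub : bad ⊆ A ∩ {ω | R ω ∈ Icc (f s - G) (f s)} := by
    rintro ω ⟨h1, h2⟩
    refine ⟨below_anti (by linarith) h2, ?_, ?_⟩
    · have h1' : ¬ ∀ v ∈ Icc (s / 2) s, B v ω ≤ -r v := h1
      push Not at h1'
      obtain ⟨v, hv, hlt⟩ := h1'
      have h3 : B v ω ≤ R ω := le_runSup (hB.bm.cont ω) (by rw [e1, e2]; exact hv)
      have h4 := hf.mono (mem_Ici.2 (by linarith [hv.1])) (mem_Ici.2 hs0.le) hv.2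
      rw [hG]; linarith
    · rw [hR, runSup_le_iff (by linarith) (hB.bm.cont ω), e1, e2]
      intro v hv
      exact (h2 v ⟨by linarith [hv.1], hv.2⟩).trans
        (hf.upper.mono (mem_Ici.2 (by linarith [hv.1])) (mem_Ici.2 hs0.le) hv.2)
  have hQA : Q A ≤ ofReal (2 * C₁ / √s) := by
    have h1 : ofReal √(s / 4) * Q A ≤ ofReal C₁ :=
      le_add_self.trans (hB.gap_add_le hf.upper (by linarith))
    have e3 : √(s / 4) = √s / 2 := by
      rw [Real.sqrt_div hs0.le, show (4 : ℝ) = 2 ^ 2 by norm_num, Real.sqrt_sq (by norm_num)]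
    rw [e3] at h1
    calc Q A = ofReal (2 / √s) * (ofReal (√s / 2) * Q A) := by
          rw [← mul_assoc, ← ofReal_mul (by positivity)]
          rw [show 2 / √s * (√s / 2) = 1 by field_simp, ofReal_one, one_mul]
      _ ≤ ofReal (2 / √s) * ofReal C₁ := mul_le_mul_right h1 _
      _ = _ := by rw [← ofReal_mul (by positivity)]; congr 1; ring
  have hpre : ofReal (G / √(2 * π * (s / 4))) * Q A
      ≤ ofReal (2 * C₁ * G / s) := by
    calc _ ≤ ofReal (G / √s) * ofReal (2 * C₁ / √s) := by
          refine mul_le_mul' (ofReal_le_ofReal ?_) hQA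
          refine div_le_div_of_nonneg_left hG0 hsq (Real.sqrt_le_sqrt ?_)
          nlinarith [pi_gt_three]
      _ = _ := by
          rw [← ofReal_mul (by positivity)]; congr 1
          rw [div_mul_div_comm, Real.mul_self_sqrt hs0.le]; ring
  have hb1 : Q bad ≤ ofReal (2 * C₁ * G / s) := by
    have h := hB.lintegral_window_le (u := s / 4) (h := s / 4) (h' := s / 2) (by linarith)
      (by linarith) (by linarith) hAm (f s) G (φ := fun _ => 1) measurable_const
    simp only [lintegral_const, measure_univ, mul_one, one_mul, Measure.restrict_apply_univ] at h
    exact (measure_mono hsub).trans (h.trans hpre)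
  have hφ : Measurable fun x : ℝ => ofReal (G + max x 0) := by fun_prop
  have hmean : ∫⁻ ω, ofReal (G + max (runSup (fun v ω => B (s / 4 + s / 4 + v) ω
      - B (s / 4 + s / 4) ω) 0 (s / 2) ω
        - (B (s / 4 + s / 4 + s / 2) ω - B (s / 4 + s / 4) ω)) 0) ∂Q
      ≤ ofReal ((T + 8) * √s) := by
    have hZ := hB.bm.shift (u := s / 4 + s / 4) (by linarith)
    set Z : ℝ → Ω → ℝ := fun v ω => B (s / 4 + s / 4 + v) ω - B (s / 4 + s / 4) ω with hZdef
    have hs2 : 4 * √(s / 2) ≤ 4 * √s := by gcongr; linarith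
    calc _ ≤ ∫⁻ ω, (ofReal G + (ofReal (runSup Z 0 (s / 2) ω)
          + ofReal |Z (s / 2) ω|)) ∂Q := by
          refine lintegral_mono fun ω => ?_
          rw [ofReal_add hG0 (le_max_right _ _)]
          refine add_le_add le_rfl ?_
          have h0 : 0 ≤ runSup Z 0 (s / 2) ω := by
            have := le_runSup (hZ.cont ω) (⟨le_rfl, by linarith⟩ : (0 : ℝ) ∈ Icc 0 (s / 2))
            rwa [show Z 0 ω = 0 by simp [hZdef]] at this
          rw [← ofReal_add h0 (abs_nonneg _)]
          refine ofReal_le_ofReal (max_le ?_ (by positivity))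
          have := neg_abs_le (Z (s / 2) ω)
          linarith
      _ ≤ ofReal G + (ofReal (4 * √(s / 2)) + ofReal (4 * √(s / 2))) := by
          rw [lintegral_add_left measurable_const, lintegral_add_right _
            (hZ.meas _).abs.ennreal_ofReal]
          refine add_le_add (by simp) (add_le_add (hZ.lintegral_runSup_le (by linarith)) ?_)
          rw [← ofReal_integral_eq_lintegral_ofReal (hZ.integrable (by linarith)).abs
            (ae_of_all _ fun ω => abs_nonneg _)]
          exact ofReal_le_ofReal (hZ.integral_abs_le (by linarith))
      _ ≤ _ := by
          rw [← ofReal_add (by positivity) (by positivity), ← ofReal_add hG0 (by positivity)]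
          refine ofReal_le_ofReal ?_
          nlinarith
  have hb2 : ∫⁻ ω in bad, ofReal (f s - B s ω) ∂Q
      ≤ ofReal (2 * C₁ * G / s) * ofReal ((T + 8) * √s) := by
    have h := hB.lintegral_window_le (u := s / 4) (h := s / 4) (h' := s / 2) (by linarith)
      (by linarith) (by linarith) hAm (f s) G hφ
    refine le_trans ?_ (h.trans (mul_le_mul' hpre hmean))
    refine le_trans (setLIntegral_mono' hbadm fun ω hω => ?_) (lintegral_mono_set hsub)
    refine ofReal_le_ofReal ?_
    rw [e1, e2]
    have h3 : f s - G ≤ R ω := (hsub hω).2.1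
    have h4 := le_max_left (R ω - B s ω) 0
    simp only [hR, e1, e2] at h3 h4
    linarith
  rw [gap]
  refine (add_le_add hb2 (mul_le_mul_right hb1 _)).trans ?_
  rw [← ofReal_mul (by positivity), ← ofReal_mul (by positivity),
    ← ofReal_add (by positivity) (by positivity)]
  refine ofReal_le_ofReal (le_of_eq ?_)
  have : s = √s * √s := (Real.mul_self_sqrt hs0.le).symm
  have e4 : G / s = G / √s / √s := by rw [div_div, ← this]
  rw [mul_div_assoc, e4]
  field_simp
  ring

/-- On survival it is unlikely to come close to the barrier at late times. -/
theorem survival_late_le (hB : IsBMF F B Q) (hf : IsCorridor f r c) {n : ℕ} (hn : 2 ≤ n)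
    {u t : ℝ} (hu : 2 ^ n ≤ u) (hut : u ≤ t) :
    ofReal √t * Q (below B f 0 t \ below B (fun v => -r v) u t)
      ≤ ofReal (3 * exp (8 * c) * (2 * (3 * exp (8 * c) * (f 2 + 8)) *
        (corridorTail f r 0 + 9)) * corridorTail f r n) := by
  have hn1 : (1 : ℝ) ≤ 2 ^ n := one_le_pow₀ (by norm_num)
  obtain ⟨M, τ, hτ1, hτ2, rfl⟩ := exists_dyadic (hn1.trans (hu.trans hut))
  have hf2 := hf.upper.nonneg 2 (by norm_num)
  have hT0 := hf.tail_nonneg 0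
  set C := 2 * (3 * exp (8 * c) * (f 2 + 8)) * (corridorTail f r 0 + 9) with hC
  have hC0 : 0 ≤ C := by positivity
  set bad : ℕ → Set Ω := fun j => (below B (fun v => -r v) (2 ^ j * τ / 2) (2 ^ j * τ))ᶜ with hbad
  set b : ℕ → ℝ := fun j => (f (2 ^ (j + 1)) + r (2 ^ (j + 1))) / √(2 ^ j) with hb
  have hsub : below B f 0 (2 ^ M * τ) \ below B (fun v => -r v) u (2 ^ M * τ)
      ⊆ ⋃ j ∈ Finset.Icc n M, bad j ∩ below B f 0 (2 ^ M * τ) := by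
    rintro ω ⟨h1, h2⟩
    have h2' : ¬ ∀ v ∈ Icc u (2 ^ M * τ), B v ω ≤ -r v := h2
    push Not at h2'
    obtain ⟨v, hv, hlt⟩ := h2'
    have hex : ∃ j : ℕ, v ≤ 2 ^ j * τ := ⟨M, hv.2⟩
    classical
    have hj := Nat.find_spec hex
    set j := Nat.find hex with hjdef
    have hjM : j ≤ M := Nat.find_min' hex hv.2
    have hnj : n ≤ j := by
      by_contra! hlt
      have h3 : (2 : ℝ) ^ (j + 1) ≤ 2 ^ n := pow_le_pow_right₀ (by norm_num) hlt
      have h4 : (2 : ℝ) ^ j * τ < 2 ^ (j + 1) := by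
        rw [pow_succ]; exact mul_lt_mul_of_pos_left hτ2 (by positivity)
      linarith [hv.1]
    have hmin : 2 ^ j * τ / 2 ≤ v := by
      have h5 := Nat.find_min hex (m := j - 1) (by omega)
      push Not at h5
      have h6 : (2 : ℝ) ^ j = 2 ^ (j - 1) * 2 := by rw [← pow_succ]; congr 1; omega
      rw [h6]; linarith
    simp only [mem_iUnion, Finset.mem_Icc]
    refine ⟨j, ⟨hnj, hjM⟩, fun H => ?_, h1⟩
    exact absurd (H v ⟨hmin, hj⟩) (not_le.2 hlt)
  have hterm : ∀ j ∈ Finset.Icc n M, ofReal √(2 ^ M * τ) *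
      Q (bad j ∩ below B f 0 (2 ^ M * τ)) ≤ ofReal (3 * exp (8 * c) * C * b j) := by
    intro j hj
    rw [Finset.mem_Icc] at hj
    have hj2 : (4 : ℝ) ≤ 2 ^ j := by
      calc (4 : ℝ) = 2 ^ 2 := by norm_num
        _ ≤ 2 ^ j := pow_le_pow_right₀ (by norm_num) (hn.trans hj.1)
    have hs : 4 ≤ 2 ^ j * τ := by nlinarith
    have hA : MeasurableSet[F (2 ^ j * τ)] (bad j) :=
      (hB.measurableSet_below hf.cont.neg (by linarith) (by linarith)).compl
    have h1 := hB.doubling hf.upper (by linarith : 1 ≤ 2 ^ j * τ) hA (M - j)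
    have e : (2 : ℝ) ^ (M - j) * (2 ^ j * τ) = 2 ^ M * τ := by
      rw [← mul_assoc, ← pow_add, Nat.sub_add_cancel hj.2]
    rw [e] at h1
    refine le_add_self.trans (h1.trans ?_)
    rw [mul_assoc _ C, ofReal_mul (p := 3 * exp (8 * c)) (by positivity)]
    refine mul_le_mul_right ((hB.gap_late_le hf hs).trans (ofReal_le_ofReal ?_)) _
    exact mul_le_mul_of_nonneg_left (hf.div_sqrt_le hτ1 hτ2) hC0
  calc _ ≤ ofReal √(2 ^ M * τ) *
        ∑ j ∈ Finset.Icc n M, Q (bad j ∩ below B f 0 (2 ^ M * τ)) :=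
        mul_le_mul_right ((measure_mono hsub).trans (measure_biUnion_finset_le _ _)) _
    _ ≤ ∑ j ∈ Finset.Icc n M, ofReal (3 * exp (8 * c) * C * b j) := by
        rw [Finset.mul_sum]; exact Finset.sum_le_sum hterm
    _ = ofReal (∑ j ∈ Finset.Icc n M, 3 * exp (8 * c) * C * b j) := by
        rw [ofReal_sum_of_nonneg]
        exact fun j _ => mul_nonneg (by positivity) (hf.term_nonneg j)
    _ ≤ _ := by
        refine ofReal_le_ofReal ?_
        rw [← Finset.mul_sum]
        refine mul_le_mul_of_nonneg_left ?_ (by positivity)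
        have hsum : Summable fun j => b (j + n) := (summable_nat_add_iff n).2 hf.summable
        calc ∑ j ∈ Finset.Icc n M, b j = ∑ i ∈ Finset.range (M + 1 - n), b (i + n) := by
              rw [← Finset.Ico_add_one_right_eq_Icc, Finset.sum_Ico_eq_sum_range]
              exact Finset.sum_congr rfl fun i _ => by rw [add_comm]
          _ ≤ ∑' i, b (i + n) := hsum.sum_le_tsum _ fun i _ => hf.term_nonneg _

theorem lintegral_pow_three_le (hB : IsBMF F B Q) (hf : IsBarrier f c) {u : ℝ} (hu : 0 < u) :
    ∫⁻ ω in below B f 0 u, ofReal ((f u - B u ω) ^ 3) ∂Q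
      ≤ ofReal (1 + 8 * f u ^ 4 + 768 * u ^ 2) := by
  have := hB.bm.isProbabilityMeasure
  obtain ⟨hi, hle⟩ := hB.bm.pow_four_le hu
  calc _ ≤ ∫⁻ ω, ofReal (1 + 8 * f u ^ 4 + 8 * B u ω ^ 4) ∂Q := by
        refine (setLIntegral_le_lintegral _ _).trans (lintegral_mono fun ω => ?_)
        refine ofReal_le_ofReal ?_
        set y := f u - B u ω
        have h1 : y ^ 3 ≤ 1 + y ^ 4 := by
          nlinarith [sq_nonneg (y ^ 2 - y), sq_nonneg (y - 1), sq_nonneg (y + 1), sq_nonneg (y ^ 2)]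
        have h2 : y ^ 4 ≤ 8 * f u ^ 4 + 8 * B u ω ^ 4 := by
          have h3 : y ^ 2 ≤ 2 * f u ^ 2 + 2 * B u ω ^ 2 := by
            nlinarith [sq_nonneg (f u + B u ω)]
          have h4 : (y ^ 2) ^ 2 ≤ (2 * f u ^ 2 + 2 * B u ω ^ 2) ^ 2 :=
            pow_le_pow_left₀ (sq_nonneg _) h3 2
          nlinarith [sq_nonneg (f u ^ 2 - B u ω ^ 2)]
        linarith
    _ = ofReal (∫ ω, (1 + 8 * f u ^ 4 + 8 * B u ω ^ 4) ∂Q) := by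
        refine (ofReal_integral_eq_lintegral_ofReal ((integrable_const _).add (hi.const_mul 8))
          ?_).symm
        exact ae_of_all _ fun ω => by
          change (0 : ℝ) ≤ 1 + 8 * f u ^ 4 + 8 * B u ω ^ 4
          positivity
    _ ≤ _ := by
        refine ofReal_le_ofReal ?_
        rw [integral_add (integrable_const _) (hi.const_mul 8), integral_const_mul]
        simp only [integral_const, probReal_univ, smul_eq_mul, one_mul]
        linarith

/-- The mean distance at time `u` is asymptotically bounded by the rescaled survival
probability. -/
theorem gap_le_survival (hB : IsBMF F B Q) (hf : IsBarrier f c) {u t : ℝ} (hu : 0 < u)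
    (hut : u < t) : gap B Q f univ u ≤ ofReal √(π * t / 2) * Q (below B f 0 t) +
      ofReal ((1 + 8 * f u ^ 4 + 768 * u ^ 2) / (2 * (t - u))) := by
  have hh : 0 < t - u := by linarith
  set h := t - u with hhdef
  set A := below B f 0 u with hA
  have hAm : MeasurableSet[F u] A := hB.measurableSet_below hf.cont le_rfl hu.le
  have hθ : Measurable[F u] fun ω => f u - B u ω := measurable_const.sub (hB.adapted u hu.le)
  have hθ0 : ∀ ω ∈ A, 0 ≤ f u - B u ω := fun ω hω => sub_nonneg.2 (hω u ⟨hu.le, le_rfl⟩)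
  have key := hB.le_measure_inter_forall_le hu.le hh hAm hθ hθ0
  have hsub : A ∩ {ω | ∀ s ∈ Icc u (u + h), B s ω ≤ B u ω + (f u - B u ω)} ⊆ below B f 0 t := by
    rintro ω ⟨h1, h2⟩ s hs
    rcases le_total s u with h3 | h3
    · exact h1 s ⟨hs.1, h3⟩
    · have h4 := h2 s ⟨h3, by rw [hhdef]; linarith [hs.2]⟩
      have h5 := hf.mono (mem_Ici.2 hu.le) (mem_Ici.2 hs.1) h3
      linarith
  have hpt : ∀ ω ∈ A, ofReal (f u - B u ω)
      ≤ ofReal √(π * h / 2) * ofReal (√(2 / (π * h)) * (f u - B u ω) *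
          (1 - (f u - B u ω) ^ 2 / (2 * h))) +
        ofReal (1 / (2 * h)) * ofReal ((f u - B u ω) ^ 3) := by
    intro ω hω
    have h0 := hθ0 ω hω
    set y := f u - B u ω
    rw [← ofReal_mul (by positivity), ← ofReal_mul (by positivity)]
    have e : √(π * h / 2) * (√(2 / (π * h)) * y * (1 - y ^ 2 / (2 * h)))
        = y * (1 - y ^ 2 / (2 * h)) := by
      rw [← mul_assoc, ← mul_assoc, ← Real.sqrt_mul (by positivity),
        show π * h / 2 * (2 / (π * h)) = 1 by field_simp, Real.sqrt_one, one_mul]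
    rw [e]
    have e2 : y = y * (1 - y ^ 2 / (2 * h)) + 1 / (2 * h) * y ^ 3 := by field_simp; ring
    conv_lhs => rw [e2]
    exact ofReal_add_le
  have hBm := hB.bm.meas u
  rw [gap, univ_inter]
  calc _ ≤ ∫⁻ ω in A, (ofReal √(π * h / 2) * ofReal (√(2 / (π * h)) *
          (f u - B u ω) * (1 - (f u - B u ω) ^ 2 / (2 * h))) +
        ofReal (1 / (2 * h)) * ofReal ((f u - B u ω) ^ 3)) ∂Q :=
        setLIntegral_mono' (hB.le u _ hAm) hpt
    _ = ofReal √(π * h / 2) * ∫⁻ ω in A, ofReal (√(2 / (π * h)) *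
          (f u - B u ω) * (1 - (f u - B u ω) ^ 2 / (2 * h))) ∂Q +
        ofReal (1 / (2 * h)) * ∫⁻ ω in A, ofReal ((f u - B u ω) ^ 3) ∂Q := by
        rw [lintegral_add_left (by fun_prop), lintegral_const_mul _ (by fun_prop),
          lintegral_const_mul _ (by fun_prop)]
    _ ≤ ofReal √(π * t / 2) * Q (below B f 0 t) +
        ofReal (1 / (2 * h)) * ofReal (1 + 8 * f u ^ 4 + 768 * u ^ 2) := by
        refine add_le_add (mul_le_mul' (ofReal_le_ofReal (Real.sqrt_le_sqrt ?_))
          (key.trans (measure_mono hsub))) (mul_le_mul_right (hB.lintegral_pow_three_le hf hu) _)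
        have := pi_pos
        rw [hhdef]; nlinarith
    _ = _ := by rw [← ofReal_mul (by positivity)]; congr 2; ring

end IsBMF

/-- A process whose values are linear combinations of the values of a Gaussian process is
Gaussian. -/
theorem IsGaussianProcess.of_mem_span {Ω S T : Type*} {mΩ : MeasurableSpace Ω} {P : Measure Ω}
    {Z : T → Ω → ℝ} {Y : S → Ω → ℝ} (hZ : IsGaussianProcess Z P)
    (h : ∀ s, Y s ∈ Submodule.span ℝ (Set.range Z)) : IsGaussianProcess Y P := by
  classical
  refine hZ.of_isGaussianProcess fun s => ?_
  obtain ⟨c, hc⟩ := Finsupp.mem_span_range_iff_exists_finsupp.1 (h s)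
  refine ⟨c.support, ∑ i : c.support, c i • ContinuousLinearMap.proj i, fun ω => ?_⟩
  rw [← hc, Finsupp.sum, Finset.sum_apply, _root_.sum_apply]
  rw [← Finset.sum_coe_sort]
  simp [Finset.restrict_def]

/-- Orthogonal families in a Gaussian space generate independent σ-algebras. -/
theorem IsGaussianProcess.indep_of_mem_span {Ω S S' T : Type*} {mΩ : MeasurableSpace Ω}
    {P : Measure Ω} {Z : T → Ω → ℝ} {Y : S → Ω → ℝ} {Y' : S' → Ω → ℝ}
    (hZ : IsGaussianProcess Z P) (hY : ∀ s, Y s ∈ Submodule.span ℝ (Set.range Z))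
    (hY' : ∀ s, Y' s ∈ Submodule.span ℝ (Set.range Z)) (h : ∀ s s', cov[Y s, Y' s'; P] = 0) :
    Indep (MeasurableSpace.comap (fun ω s => Y s ω) MeasurableSpace.pi)
      (MeasurableSpace.comap (fun ω s => Y' s ω) MeasurableSpace.pi) P := by
  have h1 : IsGaussianProcess (Sum.elim Y Y') P := IsGaussianProcess.of_mem_span hZ fun s => by
    cases s with
    | inl s => exact hY s
    | inr s => exact hY' s
  exact (IndepFun_iff_Indep _ _ _).1 (h1.indepFun_of_covariance_eq_zero
    (fun s => h1.aemeasurable (Sum.inl s)) (fun s => h1.aemeasurable (Sum.inr s)) h)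

/-- Independence is preserved by a change of measure with a product density. -/
theorem Indep.withDensity_mul {Ω : Type*} {m₁ m₂ mΩ : MeasurableSpace Ω} {P : Measure Ω}
    (h : Indep m₁ m₂ P) (h₁ : m₁ ≤ mΩ) (h₂ : m₂ ≤ mΩ) {D₁ D₂ : Ω → ENNReal}
    (hD₁ : Measurable[m₁] D₁) (hD₂ : Measurable[m₂] D₂)
    [IsProbabilityMeasure (P.withDensity fun ω => D₁ ω * D₂ ω)] :
    Indep m₁ m₂ (P.withDensity fun ω => D₁ ω * D₂ ω) := by
  have key : ∀ A B : Set Ω, MeasurableSet[m₁] A → MeasurableSet[m₂] B →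
      P.withDensity (fun ω => D₁ ω * D₂ ω) (A ∩ B) = (∫⁻ ω in A, D₁ ω ∂P) * ∫⁻ ω in B, D₂ ω ∂P := by
    intro A B hA hB
    rw [withDensity_apply _ ((h₁ A hA).inter (h₂ B hB)), ← lintegral_indicator ((h₁ A hA).inter (h₂ B hB)),
      ← lintegral_indicator (h₁ A hA), ← lintegral_indicator (h₂ B hB),
      ← lintegral_mul_eq_lintegral_mul_lintegral_of_independent_measurableSpace h₁ h₂ h
        (hD₁.indicator hA) (hD₂.indicator hB)]
    congr 1 with ω
    by_cases hA' : ω ∈ A <;> by_cases hB' : ω ∈ B <;> simp [hA', hB']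
  rw [Indep_iff]
  intro A B hA hB
  have h1 : (∫⁻ ω, D₁ ω ∂P) * ∫⁻ ω, D₂ ω ∂P = 1 := by
    have := key univ univ MeasurableSet.univ MeasurableSet.univ
    simpa using this.symm
  have hAu := key A univ hA MeasurableSet.univ
  have hBu := key univ B MeasurableSet.univ hB
  simp only [Set.inter_univ, univ_inter, Measure.restrict_univ] at hAu hBu
  rw [key A B hA hB, hAu, hBu]
  calc _ = (∫⁻ ω in A, D₁ ω ∂P) * (∫⁻ ω in B, D₂ ω ∂P) * ((∫⁻ ω, D₁ ω ∂P) * ∫⁻ ω, D₂ ω ∂P) := by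
        rw [h1, mul_one]
    _ = _ := by ring

/-- A Gaussian field indexed by time and space, with independent increments in time, which is a
Brownian motion at each point up to its initial value, and whose increments after time `s` are
independent at points which are at distance at least `exp (-s)`. -/
structure IsStarField {Ω V : Type*} {mΩ : MeasurableSpace Ω} [NormedAddCommGroup V]
    (X : ℝ → V → Ω → ℝ) (k : ℝ → V → V → ℝ) (P : Measure Ω) : Prop where
  gauss : IsGaussianProcess (fun p : NNReal × V => X p.1 p.2) P
  mean : ∀ s x, 0 ≤ s → P[X s x] = 0
  cov : ∀ s t x y, 0 ≤ s → 0 ≤ t → cov[X s x, X t y; P] = k (min s t) x y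
  meas : ∀ s x, Measurable (X s x)
  cont : ∀ ω, Continuous fun p : ℝ × V => X p.1 p.2 ω
  diag : ∀ t x, 0 ≤ t → k t x x = k 0 x x + t
  range : ∀ s t x y, 0 ≤ s → s ≤ t → exp (-s) ≤ ‖x - y‖ → k t x y = k s x y

/-- The σ-algebra generated by the field up to time `s`. -/
def fieldσ {Ω V : Type*} (X : ℝ → V → Ω → ℝ) (s : ℝ) : MeasurableSpace Ω :=
  MeasurableSpace.comap (fun ω (p : Icc (0 : ℝ) s × V) => X p.1 p.2 ω) MeasurableSpace.pi

/-- The field at a point, started at zero and with drift `-γ` up to time `t`. -/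
def drifted {Ω V : Type*} (γ : ℝ) (X : ℝ → V → Ω → ℝ) (x : V) (t s : ℝ) (ω : Ω) : ℝ :=
  X s x ω - X 0 x ω - γ * min s t

/-- The exponential martingale of the field. -/
noncomputable def wt {Ω V : Type*} (γ : ℝ) (X : ℝ → V → Ω → ℝ) (k : ℝ → V → V → ℝ) (t : ℝ) (x : V)
    (ω : Ω) : ENNReal := ofReal (exp (γ * X t x ω - γ ^ 2 / 2 * k t x x))

theorem measurable_fieldσ {Ω V : Type*} (X : ℝ → V → Ω → ℝ) {r s : ℝ} (h : r ∈ Icc 0 s) (x : V) :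
    Measurable[fieldσ X s] (X r x) :=
  (measurable_pi_apply ((⟨r, h⟩, x) : Icc (0 : ℝ) s × V)).comp
    (comap_measurable fun ω (p : Icc (0 : ℝ) s × V) => X p.1 p.2 ω)

theorem fieldσ_mono {Ω V : Type*} (X : ℝ → V → Ω → ℝ) : Monotone (fieldσ X) := by
  intro r s h
  rw [fieldσ, ← measurable_iff_comap_le]
  exact @measurable_pi_lambda _ _ _ (fieldσ X s) _ _ fun p =>
    measurable_fieldσ X ⟨p.1.2.1, p.1.2.2.trans h⟩ p.2

variable {V : Type*} [NormedAddCommGroup V] {X : ℝ → V → Ω → ℝ} {k : ℝ → V → V → ℝ} {γ : ℝ}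

namespace IsStarField

theorem isProbabilityMeasure (hX : IsStarField X k P) : IsProbabilityMeasure P :=
  hX.gauss.isProbabilityMeasure

theorem fieldσ_le (hX : IsStarField X k P) (s : ℝ) : fieldσ X s ≤ mΩ := by
  rw [fieldσ, ← measurable_iff_comap_le]
  exact measurable_pi_lambda _ fun p => hX.meas _ _

theorem mem_span (_hX : IsStarField X k P) {s : ℝ} (hs : 0 ≤ s) (x : V) :
    X s x ∈ Submodule.span ℝ (Set.range fun p : NNReal × V => X p.1 p.2) :=
  Submodule.subset_span ⟨(⟨s, hs⟩, x), rfl⟩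

theorem memLp (hX : IsStarField X k P) {s : ℝ} (hs : 0 ≤ s) (x : V) : MemLp (X s x) 2 P :=
  (hX.gauss.hasGaussianLaw_eval (⟨s, hs⟩, x)).memLp_two

theorem kernel_comm (hX : IsStarField X k P) {s : ℝ} (hs : 0 ≤ s) (x y : V) : k s x y = k s y x := by
  rw [← min_self s, ← hX.cov s s x y hs hs, ← hX.cov s s y x hs hs, covariance_comm]

theorem cov_sub_right (hX : IsStarField X k P) {r s t : ℝ} (hr : 0 ≤ r) (hs : 0 ≤ s) (ht : 0 ≤ t)
    (x y : V) : cov[X r y, X t x - X s x; P] = k (min r t) y x - k (min r s) y x := by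
  have := hX.isProbabilityMeasure
  rw [covariance_sub_right (hX.memLp hr y) (hX.memLp ht x) (hX.memLp hs x), hX.cov _ _ _ _ hr ht,
    hX.cov _ _ _ _ hr hs]

/-- The increments at a point after time `u` are independent of the field before time `u`. -/
theorem indep_fut (hX : IsStarField X k P) {u : ℝ} (hu : 0 ≤ u) (x : V) :
    Indep (fieldσ X u) (futσ (fun s => X s x) u) P := by
  refine IsGaussianProcess.indep_of_mem_span (Y := fun p : Icc (0 : ℝ) u × V => X p.1 p.2)
    (Y' := fun (s : NNReal) ω => X (u + s) x ω - X u x ω) hX.gauss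
    (fun p => hX.mem_span p.1.2.1 _) (fun s => Submodule.sub_mem _
      (hX.mem_span (add_nonneg hu s.coe_nonneg) x) (hX.mem_span hu x)) fun p s => ?_
  refine (hX.cov_sub_right p.1.2.1 hu (add_nonneg hu s.coe_nonneg) x p.2).trans ?_
  have h1 : p.1.1 ≤ u := p.1.2.2
  have h2 : p.1.1 ≤ u + s := h1.trans (le_add_of_nonneg_right s.coe_nonneg)
  rw [min_eq_left h1, min_eq_left h2, sub_self]

/-- The increments at a point after time `u` are independent of the field before time `u` and of
the increments at a distant point. -/
theorem indep_sup_fut (hX : IsStarField X k P) {u : ℝ} (hu : 0 ≤ u) {x y : V}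
    (hxy : exp (-u) ≤ ‖y - x‖) :
    Indep (fieldσ X u ⊔ futσ (fun s => X s y) u) (futσ (fun s => X s x) u) P := by
  have h := IsGaussianProcess.indep_of_mem_span
    (Y := Sum.elim (fun p : Icc (0 : ℝ) u × V => X p.1 p.2)
      (fun (s : NNReal) ω => X (u + s) y ω - X u y ω))
    (Y' := fun (s : NNReal) ω => X (u + s) x ω - X u x ω) hX.gauss
    (fun p => by
      cases p with
      | inl p => exact hX.mem_span p.1.2.1 _
      | inr s => exact Submodule.sub_mem _ (hX.mem_span (add_nonneg hu s.coe_nonneg) y) (hX.mem_span hu y))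
    (fun s => Submodule.sub_mem _
      (hX.mem_span (add_nonneg hu s.coe_nonneg) x) (hX.mem_span hu x)) fun p s => by
      have hs : (0 : ℝ) ≤ s := s.2
      have := hX.isProbabilityMeasure
      cases p with
      | inl p =>
        have h1 : p.1.1 ≤ u := p.1.2.2
        have h2 : p.1.1 ≤ u + s := h1.trans (le_add_of_nonneg_right s.coe_nonneg)
        refine (hX.cov_sub_right p.1.2.1 hu (add_nonneg hu s.coe_nonneg) x p.2).trans ?_
        rw [min_eq_left h1, min_eq_left h2, sub_self]
      | inr s' =>
        have hs' : (0 : ℝ) ≤ s' := s'.2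
        have e : ∀ r, u ≤ r → k r y x = k u y x := fun r hr => hX.range u r y x hu hr hxy
        refine (covariance_sub_left (hX.memLp (add_nonneg hu hs') y) (hX.memLp hu y)
          ((hX.memLp (add_nonneg hu hs) x).sub (hX.memLp hu x))).trans ?_
        rw [hX.cov_sub_right (by positivity) (by positivity) (by positivity),
          hX.cov_sub_right (by positivity) (by positivity) (by positivity)]
        rw [e _ (le_min (by linarith) (by linarith)), e _ (le_min (by linarith) (by linarith)),
          e _ (le_min (by linarith) (by linarith)), e _ (le_min (by linarith) (by linarith))]
        ring
  refine indep_of_indep_of_le_left h (sup_le ?_ ?_)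
  · rw [fieldσ, ← measurable_iff_comap_le]
    refine @measurable_pi_lambda _ _ _ (_) _ _ fun p => ?_
    exact (measurable_pi_apply (Sum.inl p)).comp (comap_measurable fun ω s => Sum.elim
      (fun p : Icc (0 : ℝ) u × V => X p.1 p.2)
      (fun (s : NNReal) ω => X (u + s) y ω - X u y ω) s ω)
  · rw [futσ, ← measurable_iff_comap_le]
    refine @measurable_pi_lambda _ _ _ (_) _ _ fun p => ?_
    exact (measurable_pi_apply (Sum.inr p)).comp (comap_measurable fun ω s => Sum.elim
      (fun p : Icc (0 : ℝ) u × V => X p.1 p.2)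
      (fun (s : NNReal) ω => X (u + s) y ω - X u y ω) s ω)

end IsStarField

/-- The field at a point, relative to its initial value and with drift `-γ`. -/
def rel {Ω V : Type*} (γ : ℝ) (X : ℝ → V → Ω → ℝ) (x : V) (s : ℝ) (ω : Ω) : ℝ :=
  X s x ω - X 0 x ω - γ * s

theorem drifted_eq_rel {Ω V : Type*} (γ : ℝ) (X : ℝ → V → Ω → ℝ) (x : V) {s t : ℝ} (h : s ≤ t)
    (ω : Ω) : drifted γ X x t s ω = rel γ X x s ω := by
  rw [drifted, rel, min_eq_left h]

/-- The increment of the exponential martingale of the field between two times. -/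
noncomputable def wtIncr {Ω V : Type*} (γ : ℝ) (X : ℝ → V → Ω → ℝ) (u t : ℝ) (x : V)
    (ω : Ω) : ENNReal := ofReal (exp (γ * (X t x ω - X u x ω) - γ ^ 2 / 2 * (t - u)))

theorem measurable_fieldσ_wt {Ω V : Type*} (γ : ℝ) (X : ℝ → V → Ω → ℝ) (k : ℝ → V → V → ℝ) {s t : ℝ} (hs : 0 ≤ s)
    (hst : s ≤ t) (x : V) : Measurable[fieldσ X t] (wt γ X k s x) :=
  (show Measurable fun r : ℝ => ofReal (exp (γ * r - γ ^ 2 / 2 * k s x x)) by fun_prop).comp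
    (measurable_fieldσ X ⟨hs, hst⟩ x)

theorem measurable_fieldσ_rel {Ω V : Type*} (γ : ℝ) (X : ℝ → V → Ω → ℝ) {s t : ℝ} (hs : 0 ≤ s)
    (hst : s ≤ t) (x : V) : Measurable[fieldσ X t] (rel γ X x s) :=
  ((measurable_fieldσ X ⟨hs, hst⟩ x).sub (measurable_fieldσ X ⟨le_rfl, hs.trans hst⟩ x)).sub
    measurable_const

theorem measurable_futσ_wtIncr {Ω V : Type*} (γ : ℝ) (X : ℝ → V → Ω → ℝ) {u t : ℝ} (hut : u ≤ t) (x : V) :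
    Measurable[futσ (fun s => X s x) u] (wtIncr γ X u t x) := by
  have h := measurable_futσ (fun s => X s x) (u := u) (sub_nonneg.2 hut)
  rw [add_sub_cancel] at h
  exact (show Measurable fun r : ℝ => ofReal (exp (γ * r - γ ^ 2 / 2 * (t - u))) by
    fun_prop).comp h

theorem wtIncr_self {Ω V : Type*} (γ : ℝ) (X : ℝ → V → Ω → ℝ) (t : ℝ) (x : V) (ω : Ω) : wtIncr γ X t t x ω = 1 := by
  simp [wtIncr]

namespace IsStarField

/-- The Cameron–Martin formula in the Gaussian space of the field. -/
theorem lintegral_exp_mul (hX : IsStarField X k P) {T : Type*} {G : T → Ω → ℝ} {H : Ω → ℝ}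
    (hH : H ∈ Submodule.span ℝ (Set.range fun p : NNReal × V => X p.1 p.2))
    (hG : ∀ t, G t ∈ Submodule.span ℝ (Set.range fun p : NNReal × V => X p.1 p.2))
    (hGm : ∀ t, Measurable (G t)) (hHm : Measurable H) (hH0 : P[H] = 0)
    {F : (T → ℝ) → ENNReal} (hF : Measurable F) :
    ∫⁻ ω, ofReal (exp (H ω - Var[H; P] / 2)) * F (fun t => G t ω) ∂P
      = ∫⁻ ω, F (fun t => G t ω + cov[G t, H; P]) ∂P := by
  refine lintegral_exp_gaussian (IsGaussianProcess.of_mem_span hX.gauss fun s => ?_) hGm hHm hH0 hF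
  cases s with
  | none => exact hH
  | some s => exact hG s

theorem mean_smul (hX : IsStarField X k P) {t : ℝ} (ht : 0 ≤ t) (x : V) (γ : ℝ) :
    P[fun ω => γ * X t x ω] = 0 := by
  rw [integral_const_mul, hX.mean t x ht, mul_zero]

theorem variance_smul (hX : IsStarField X k P) {t : ℝ} (ht : 0 ≤ t) (x : V) (γ : ℝ) :
    Var[fun ω => γ * X t x ω; P] = γ ^ 2 * k t x x := by
  have := hX.isProbabilityMeasure
  rw [variance_const_mul, ← covariance_self (hX.meas t x).aemeasurable, hX.cov t t x x ht ht,
    min_self]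

theorem measurable_wt (hX : IsStarField X k P) (t : ℝ) (x : V) : Measurable (wt γ X k t x) := by
  have := hX.meas t x
  unfold wt
  fun_prop

theorem wt_eq_mul (hX : IsStarField X k P) {u t : ℝ} (hu : 0 ≤ u) (ht : 0 ≤ t) (x : V) (ω : Ω) :
    wt γ X k t x ω = wt γ X k u x ω * wtIncr γ X u t x ω := by
  rw [wt, wt, wtIncr, ← ofReal_mul (exp_pos _).le, ← exp_add, hX.diag t x ht, hX.diag u x hu]
  congr 2
  ring

theorem lintegral_wt (hX : IsStarField X k P) {t : ℝ} (ht : 0 ≤ t) (x : V) :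
    ∫⁻ ω, wt γ X k t x ω ∂P = 1 := by
  have := hX.isProbabilityMeasure
  have h := hX.lintegral_exp_mul (H := fun ω => γ * X t x ω) (G := fun (_ : Unit) => X t x)
    (F := fun _ => 1) (Submodule.smul_mem _ γ (hX.mem_span ht x)) (fun _ => hX.mem_span ht x)
    (fun _ => hX.meas t x) ((hX.meas t x).const_mul γ) (hX.mean_smul ht x γ) measurable_const
  rw [hX.variance_smul ht] at h
  simp only [mul_one, lintegral_const, measure_univ] at h
  rw [← h]
  refine lintegral_congr fun ω => ?_
  rw [wt]
  congr 3
  ring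

theorem isProbabilityMeasure_tilt (hX : IsStarField X k P) {t : ℝ} (ht : 0 ≤ t) (x : V) :
    IsProbabilityMeasure (P.withDensity (wt γ X k t x)) :=
  ⟨by rw [withDensity_apply _ MeasurableSet.univ, Measure.restrict_univ, hX.lintegral_wt ht x]⟩

theorem isBM (hX : IsStarField X k P) (x : V) : IsBM (fun s ω => X s x ω - X 0 x ω) P where
  pre := by
    have := hX.isProbabilityMeasure
    refine IsGaussianProcess.isPreBrownianReal_of_covariance
      (IsGaussianProcess.of_mem_span hX.gauss fun s =>
        Submodule.sub_mem _ (hX.mem_span s.coe_nonneg x) (hX.mem_span le_rfl x))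
      (fun t => ?_) fun s t hst => ?_
    · rw [integral_sub ((hX.memLp t.coe_nonneg x).integrable (by norm_num))
        ((hX.memLp le_rfl x).integrable (by norm_num)), hX.mean _ _ t.coe_nonneg,
        hX.mean _ _ le_rfl, sub_zero]
    · refine (covariance_sub_left (hX.memLp s.coe_nonneg x) (hX.memLp le_rfl x)
        ((hX.memLp t.coe_nonneg x).sub (hX.memLp le_rfl x))).trans ?_
      rw [hX.cov_sub_right s.coe_nonneg le_rfl t.coe_nonneg,
        hX.cov_sub_right le_rfl le_rfl t.coe_nonneg, min_eq_left (NNReal.coe_le_coe.2 hst),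
        min_eq_right s.coe_nonneg, min_eq_left t.coe_nonneg, min_self, hX.diag _ _ s.coe_nonneg]
      ring
  meas s := (hX.meas s x).sub (hX.meas 0 x)
  cont ω := ((hX.cont ω).comp (continuous_id.prodMk continuous_const)).sub continuous_const
  zero ω := sub_self _

theorem lintegral_wt_mul_drifted (hX : IsStarField X k P) {t : ℝ} (ht : 0 ≤ t) (x : V)
    {F : (NNReal → ℝ) → ENNReal} (hF : Measurable F) :
    ∫⁻ ω, wt γ X k t x ω * F (fun s => drifted γ X x t s ω) ∂P
      = ∫⁻ ω, F (fun s => X s x ω - X 0 x ω) ∂P := by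
  have := hX.isProbabilityMeasure
  have h := hX.lintegral_exp_mul (H := fun ω => γ * X t x ω)
    (G := fun (s : NNReal) ω => X s x ω - X 0 x ω)
    (F := fun g => F fun s => g s - γ * min (s : ℝ) t) (Submodule.smul_mem _ γ (hX.mem_span ht x))
    (fun s => Submodule.sub_mem _ (hX.mem_span s.coe_nonneg x) (hX.mem_span le_rfl x))
    (fun _ => (hX.meas _ x).sub (hX.meas 0 x)) ((hX.meas t x).const_mul γ) (hX.mean_smul ht x γ)
    (hF.comp (measurable_pi_lambda _ fun s => (measurable_pi_apply s).sub_const _))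
  rw [hX.variance_smul ht] at h
  have e : ∀ s : NNReal, cov[fun ω => X s x ω - X 0 x ω, fun ω => γ * X t x ω; P]
      = γ * min (s : ℝ) t := by
    intro s
    rw [covariance_const_mul_right, covariance_comm]
    have := hX.cov_sub_right (r := t) (s := 0) (t := s) ht le_rfl s.coe_nonneg x x
    refine congrArg (γ * ·) (this.trans ?_)
    rw [min_eq_right ht, hX.diag _ _ (le_min ht s.coe_nonneg), min_comm]
    ring
  simp only [e, add_sub_cancel_right] at h
  rw [← h]
  refine lintegral_congr fun ω => ?_
  rw [wt]
  congr 4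
  ring

theorem futσ_le (hX : IsStarField X k P) (u : ℝ) (x : V) : futσ (fun s => X s x) u ≤ mΩ := by
  rw [futσ, ← measurable_iff_comap_le]
  exact measurable_pi_lambda _ fun s => (hX.meas _ _).sub (hX.meas _ _)

/-- The weight between two times is independent of the field before the first time and has
expectation one. -/
theorem lintegral_mul_wt (hX : IsStarField X k P) {u t : ℝ} (hu : 0 ≤ u) (hut : u ≤ t) (x : V)
    {U : Ω → ENNReal} (hU : Measurable[fieldσ X u] U) :
    ∫⁻ ω, U ω * wt γ X k t x ω ∂P = ∫⁻ ω, U ω * wt γ X k u x ω ∂P := by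
  have ht := hu.trans hut
  have key : ∀ U : Ω → ENNReal, Measurable[fieldσ X u] U →
      ∫⁻ ω, U ω * wt γ X k t x ω ∂P
        = (∫⁻ ω, U ω * wt γ X k u x ω ∂P) * ∫⁻ ω, wtIncr γ X u t x ω ∂P := by
    intro U hU
    have := lintegral_mul_eq_lintegral_mul_lintegral_of_independent_measurableSpace (hX.fieldσ_le u)
      (hX.futσ_le u x) (hX.indep_fut hu x) (f := fun ω => U ω * wt γ X k u x ω)
      (hU.mul (measurable_fieldσ_wt γ X k hu le_rfl x)) (measurable_futσ_wtIncr γ X hut x)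
    rw [← this]
    refine lintegral_congr fun ω => ?_
    rw [hX.wt_eq_mul hu ht, mul_assoc]
  have h1 := key (fun _ => 1) measurable_const
  simp only [one_mul, hX.lintegral_wt ht, hX.lintegral_wt hu] at h1
  rw [key U hU, ← h1, mul_one]

/-- Girsanov's theorem: under the tilted measure, the drifted field is a Brownian motion. -/
theorem isBMF_tilt (hX : IsStarField X k P) {t : ℝ} (ht : 0 ≤ t) (x : V) :
    IsBMF (fieldσ X) (drifted γ X x t) (P.withDensity (wt γ X k t x)) where
  bm :=
    { pre := by
        have := hX.isProbabilityMeasure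
        have hm : ∀ s, Measurable (drifted γ X x t s) := fun s =>
          ((hX.meas s x).sub (hX.meas 0 x)).sub_const _
        have hB := (hX.isBM x).pre
        have hBm := fun s => (hX.isBM x).meas s
        refine ⟨fun I => ⟨?_, ?_⟩⟩
        · exact (measurable_pi_lambda _ fun s => hm _).aemeasurable
        · rw [← (hB.hasLaw I).map_eq]
          ext A hA
          have h1 : Measurable fun ω => I.restrict (fun s : NNReal => drifted γ X x t s ω) :=
            measurable_pi_lambda _ fun s => hm _
          have h2 : Measurable fun ω => I.restrict (fun s : NNReal => X s x ω - X 0 x ω) :=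
            measurable_pi_lambda _ fun s => hBm _
          have h3 := hX.lintegral_wt_mul_drifted (γ := γ) ht x
            (F := fun g => A.indicator 1 (I.restrict g))
            ((measurable_one.indicator hA).comp (Finset.measurable_restrict I))
          rw [Measure.map_apply h1 hA, Measure.map_apply h2 hA, withDensity_apply _ (h1 hA),
            ← lintegral_indicator_one (h2 hA), ← lintegral_indicator (h1 hA)]
          refine Eq.trans ?_ h3
          refine lintegral_congr fun ω => ?_
          by_cases hω : I.restrict (fun s : NNReal => drifted γ X x t s ω) ∈ A
          · rw [indicator_of_mem (by exact hω), indicator_of_mem hω, Pi.one_apply, mul_one]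
          · rw [indicator_of_notMem (by exact hω), indicator_of_notMem hω, mul_zero]
      meas := fun s => ((hX.meas s x).sub (hX.meas 0 x)).sub_const _
      cont := fun ω => (((hX.cont ω).comp (continuous_id.prodMk continuous_const)).sub
        continuous_const).sub (by fun_prop)
      zero := fun ω => by simp [drifted, ht] }
  le := hX.fieldσ_le
  mono := fieldσ_mono X
  adapted s hs := ((measurable_fieldσ X ⟨hs, le_rfl⟩ x).sub
    (measurable_fieldσ X ⟨le_rfl, hs⟩ x)).sub measurable_const
  indep u hu := by
    have hp := hX.isProbabilityMeasure_tilt (γ := γ) ht x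
    have hm : 0 ≤ min u t := le_min hu ht
    have e : wt γ X k t x = fun ω => wt γ X k (min u t) x ω * wtIncr γ X (min u t) t x ω :=
      funext fun ω => hX.wt_eq_mul hm ht x ω
    have hle : futσ (drifted γ X x t) u ≤ futσ (fun s => X s x) u := by
      conv_lhs => rw [futσ]
      rw [← measurable_iff_comap_le]
      refine @measurable_pi_lambda _ _ _ (_) _ _ fun s => ?_
      have := (measurable_futσ (fun s => X s x) (u := u) s.coe_nonneg).sub_const
        (γ * (min (u + s) t - min u t))
      convert this using 2 with ω
      simp only [drifted]
      ring
    refine indep_of_indep_of_le_right ?_ hle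
    rw [e] at hp ⊢
    refine Indep.withDensity_mul (hX.indep_fut hu x) (hX.fieldσ_le u) (hX.futσ_le u x)
      (measurable_fieldσ_wt γ X k hm (min_le_left u t) x) ?_
    rcases le_total u t with h | h
    · rw [min_eq_left h]
      exact measurable_futσ_wtIncr γ X h x
    · rw [min_eq_right h]
      rw [show wtIncr γ X t t x = fun _ => 1 from funext fun ω => wtIncr_self γ X t x ω]
      exact measurable_const

end IsStarField

/-- The event that the field at a point, restarted from `z` at time `u`, stays below `g`. -/
def stay {Ω V : Type*} (γ : ℝ) (X : ℝ → V → Ω → ℝ) (g : ℝ → ℝ) (u t : ℝ) (x : V) (z : ℝ) : Set Ω :=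
  {ω | ∀ s ∈ Icc u t, z + (X s x ω - X u x ω) - γ * (s - u) ≤ g s}

/-- The weighted probability that the field at a point, restarted from `z` at time `u`,
stays below `g`. -/
noncomputable def stayProb {Ω V : Type*} {mΩ : MeasurableSpace Ω} (γ : ℝ) (X : ℝ → V → Ω → ℝ)
    (P : Measure Ω) (g : ℝ → ℝ) (u t : ℝ) (x : V) (z : ℝ) : ENNReal :=
  ∫⁻ ω, wtIncr γ X u t x ω * (stay γ X g u t x z).indicator 1 ω ∂P

theorem mem_stay_rel {Ω V : Type*} {γ : ℝ} {X : ℝ → V → Ω → ℝ} {g : ℝ → ℝ} {u t : ℝ} {x : V}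
    {ω : Ω} : ω ∈ stay γ X g u t x (rel γ X x u ω) ↔ ω ∈ below (rel γ X x) g u t := by
  refine forall₂_congr fun s _ => ?_
  rw [rel, rel, show X u x ω - X 0 x ω - γ * u + (X s x ω - X u x ω) - γ * (s - u)
    = X s x ω - X 0 x ω - γ * s by ring]

theorem below_drifted {Ω V : Type*} (γ : ℝ) (X : ℝ → V → Ω → ℝ) (g : ℝ → ℝ) (u : ℝ) {s t : ℝ} (x : V)
    (hst : s ≤ t) : below (drifted γ X x t) g u s = below (rel γ X x) g u s := by
  ext ω
  refine forall₂_congr fun r hr => ?_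
  rw [drifted_eq_rel _ _ _ (hr.2.trans hst)]

/-- Measurability of a pair of functions with respect to an explicit σ-algebra. -/
theorem measurable_pair {Ω α β : Type*} [MeasurableSpace α] [MeasurableSpace β]
    (m : MeasurableSpace Ω) {f : Ω → α} {g : Ω → β} (hf : Measurable[m] f) (hg : Measurable[m] g) :
    Measurable[m] fun ω => (f ω, g ω) :=
  hf.prodMk hg

namespace IsStarField

variable {g : ℝ → ℝ} {u t : ℝ}

theorem continuous_time (hX : IsStarField X k P) (x : V) (ω : Ω) : Continuous fun s => X s x ω :=
  (hX.cont ω).comp (continuous_id.prodMk continuous_const)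

theorem measurable_rel (hX : IsStarField X k P) (s : ℝ) (x : V) : Measurable (rel γ X x s) :=
  ((hX.meas s x).sub (hX.meas 0 x)).sub_const _

theorem measurable_wtIncr (hX : IsStarField X k P) (u t : ℝ) (x : V) :
    Measurable (wtIncr γ X u t x) := by
  have := hX.meas t x
  have := hX.meas u x
  unfold wtIncr
  fun_prop

theorem continuous_rel (hX : IsStarField X k P) (x : V) (ω : Ω) :
    Continuous fun s => rel γ X x s ω := by
  have := hX.continuous_time x ω
  unfold rel
  fun_prop

theorem measurableSet_below_rel (hX : IsStarField X k P) (hg : Continuous g) {s : ℝ} (hu : 0 ≤ u)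
    (hus : u ≤ s) (hst : s ≤ t) (x : V) : MeasurableSet[fieldσ X t] (below (rel γ X x) g u s) :=
  measurableSet_forall_le hus (fun _ hr => measurable_fieldσ_rel γ X (hu.trans hr.1)
    (hr.2.trans hst) x) (hX.continuous_rel x) hg

theorem measurableSet_below_rel' (hX : IsStarField X k P) (hg : Continuous g) (hut : u ≤ t) (x : V) :
    MeasurableSet (below (rel γ X x) g u t) :=
  measurableSet_forall_le hut (fun _ _ => hX.measurable_rel _ x) (hX.continuous_rel x) hg

theorem measurableSet_stay (hX : IsStarField X k P) (hg : Continuous g) (hut : u ≤ t) (x : V)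
    (z : ℝ) : MeasurableSet (stay γ X g u t x z) := by
  refine measurableSet_forall_le hut (fun s _ => ?_) (fun ω => ?_) hg
  · have := hX.meas s x
    have := hX.meas u x
    fun_prop
  · have := hX.continuous_time x ω
    fun_prop

theorem measurable_wtIncr_mul_stay (hX : IsStarField X k P) (hg : Continuous g) (hut : u ≤ t) (x : V)
    (z : ℝ) : Measurable fun ω => wtIncr γ X u t x ω *
      (stay γ X g u t x z).indicator (1 : Ω → ENNReal) ω :=
  (hX.measurable_wtIncr u t x).mul (measurable_one.indicator (hX.measurableSet_stay hg hut x _))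

theorem lintegral_mul_below_aux (hX : IsStarField X k P) (hg : Continuous g) (hut : u ≤ t) (x : V)
    {G : MeasurableSpace Ω} (hG : G ≤ mΩ) (hi : Indep G (futσ (fun s => X s x) u) P)
    {α : Type*} [MeasurableSpace α] {U : Ω → α} (hU : Measurable[G] U) {φ : α → ENNReal}
    (hφ : Measurable φ) {ψ : α → ℝ} (hψ : Measurable ψ) :
    ∫⁻ ω, φ (U ω) * (wtIncr γ X u t x ω * (stay γ X g u t x (ψ (U ω))).indicator 1 ω) ∂P
      = ∫⁻ ω, φ (U ω) * stayProb γ X P g u t x (ψ (U ω)) ∂P := by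
  have := hX.isProbabilityMeasure
  set Z : ℝ → Ω → ℝ := fun s ω => X s x ω - X u x ω - γ * (s - u) - g s with hZ
  have hZc : ∀ ω, Continuous fun s => Z s ω := fun ω => by
    have := hX.continuous_time x ω
    fun_prop
  have hfut : ∀ s, u ≤ s → Measurable[futσ (fun s => X s x) u] fun ω => X s x ω - X u x ω := by
    intro s hs
    have h := measurable_futσ (fun s => X s x) (u := u) (sub_nonneg.2 hs)
    rwa [add_sub_cancel] at h
  have hR : Measurable[futσ (fun s => X s x) u] (runSup Z u t) :=
    measurable_runSup hut (fun s hs => ((hfut s hs.1).sub measurable_const).sub measurable_const) hZc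
  have hstay : ∀ z ω, ω ∈ stay γ X g u t x z ↔ z + runSup Z u t ω ≤ 0 := by
    intro z ω
    have := runSup_le_iff hut (hZc ω) (c := -z)
    rw [show z + runSup Z u t ω ≤ 0 ↔ runSup Z u t ω ≤ -z by constructor <;> intro h <;> linarith,
      this]
    refine forall₂_congr fun s _ => ?_
    simp only [hZ]
    constructor <;> intro h <;> linarith
  set N : Set (α × ℝ × ℝ) := {p | ψ p.1 + p.2.2 ≤ 0}
  have hN : MeasurableSet N :=
    measurableSet_le ((hψ.comp measurable_fst).add measurable_snd.snd) measurable_const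
  set F : α → ℝ × ℝ → ENNReal := fun a p => φ a *
    (ofReal (exp (γ * p.1 - γ ^ 2 / 2 * (t - u))) * N.indicator 1 (a, p))
  have hF : Measurable (Function.uncurry F) := by
    refine (hφ.comp measurable_fst).mul (Measurable.mul ?_ (measurable_one.indicator hN))
    fun_prop
  have hind : ∀ a ω, N.indicator (1 : α × ℝ × ℝ → ENNReal) (a, X t x ω - X u x ω, runSup Z u t ω)
      = (stay γ X g u t x (ψ a)).indicator 1 ω := by
    intro a ω
    by_cases h : ω ∈ stay γ X g u t x (ψ a)
    · rw [indicator_of_mem h, indicator_of_mem (by exact (hstay _ _).1 h)]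
      rfl
    · rw [indicator_of_notMem h, indicator_of_notMem (by exact fun h' => h ((hstay _ _).2 h'))]
  have := lintegral_indep hi hG (hX.futσ_le u x) hU
    (measurable_pair _ (hfut t hut) hR) hF
  simp only [F, hind] at this
  refine this.trans (lintegral_congr fun ω => ?_)
  exact lintegral_const_mul _ (hX.measurable_wtIncr_mul_stay hg hut x _)

/-- Conditioning on the past at time `u` of the event of staying below `g` after time `u`. -/
theorem lintegral_mul_below (hX : IsStarField X k P) (hg : Continuous g) (hut : u ≤ t) (x : V)
    {G : MeasurableSpace Ω} (hG : G ≤ mΩ) (hi : Indep G (futσ (fun s => X s x) u) P)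
    {U : Ω → ENNReal} (hU : Measurable[G] U) (hr : Measurable[G] (rel γ X x u)) :
    ∫⁻ ω, U ω * (wtIncr γ X u t x ω * (below (rel γ X x) g u t).indicator 1 ω) ∂P
      = ∫⁻ ω, U ω * stayProb γ X P g u t x (rel γ X x u ω) ∂P := by
  have := hX.lintegral_mul_below_aux (γ := γ) hg hut x hG hi
    (measurable_pair G hU hr) measurable_fst measurable_snd
  rw [← this]
  refine lintegral_congr fun ω => ?_
  congr 2
  by_cases h : ω ∈ below (rel γ X x) g u t
  · rw [indicator_of_mem h, indicator_of_mem (mem_stay_rel.2 h)]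
  · rw [indicator_of_notMem h, indicator_of_notMem fun h' => h (mem_stay_rel.1 h')]

theorem stayProb_le (hX : IsStarField X k P) (hg : Continuous g) (hu : 0 ≤ u) (hut : u < t) (x : V)
    (h0 : ∀ s ∈ Icc u t, g s ≤ 0) (z : ℝ) :
    stayProb γ X P g u t x z ≤ ofReal √(2 / (π * (t - u))) * ofReal (-z) := by
  have ht := hu.trans hut.le
  have hp := hX.isProbabilityMeasure
  have hQ := hX.isProbabilityMeasure_tilt (γ := γ) ht x
  have hB := hX.isBMF_tilt (γ := γ) ht x
  have h1 := hX.lintegral_mul_below_aux (γ := γ) hg hut.le x (hX.fieldσ_le u) (hX.indep_fut hu x)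
    (U := wt γ X k u x) (measurable_fieldσ_wt γ X k hu le_rfl x) measurable_id
    (measurable_const (a := z))
  simp only [id, lintegral_mul_const _ (hX.measurable_wt u x), hX.lintegral_wt hu, one_mul] at h1
  rw [← h1]
  have h2 := hB.measure_inter_forall_le_le hu (sub_pos.2 hut) (A := univ) MeasurableSet.univ
    (θ := fun _ => -z) measurable_const
  rw [Measure.restrict_univ, lintegral_const, measure_univ, mul_one] at h2
  refine le_trans ?_ h2
  have hm := hX.measurableSet_stay (γ := γ) hg hut.le x z
  have h3 : stay γ X g u t x z ⊆ univ ∩ {ω | ∀ s ∈ Icc u (u + (t - u)),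
      drifted γ X x t s ω ≤ drifted γ X x t u ω + -z} := by
    refine fun ω hω => ⟨trivial, fun s hs => ?_⟩
    rw [add_sub_cancel] at hs
    rw [drifted_eq_rel _ _ _ hs.2, drifted_eq_rel _ _ _ hut.le, rel, rel]
    have := hω s hs
    have := h0 s hs
    linarith
  refine le_trans (le_of_eq ?_) (measure_mono h3)
  rw [withDensity_apply _ hm, ← lintegral_indicator hm]
  refine lintegral_congr fun ω => ?_
  rw [← mul_assoc, ← hX.wt_eq_mul hu ht]
  by_cases h : ω ∈ stay γ X g u t x z
  · simp [h]
  · simp [h]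

theorem stayProb_le_one (hX : IsStarField X k P) (hu : 0 ≤ u) (hut : u ≤ t) (x : V) (z : ℝ) :
    stayProb γ X P g u t x z ≤ 1 := by
  have h1 : ∫⁻ ω, wtIncr γ X u t x ω ∂P = 1 := by
    have := lintegral_mul_eq_lintegral_mul_lintegral_of_independent_measurableSpace (hX.fieldσ_le u)
      (hX.futσ_le u x) (hX.indep_fut hu x) (measurable_fieldσ_wt γ X k hu le_rfl x)
      (measurable_futσ_wtIncr γ X hut x)
    rw [hX.lintegral_wt hu, one_mul] at this
    rw [← this, ← hX.lintegral_wt (γ := γ) (hu.trans hut) x]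
    exact lintegral_congr fun ω => (hX.wt_eq_mul hu (hu.trans hut) x ω).symm
  rw [← h1]
  refine lintegral_mono fun ω => ?_
  refine mul_le_of_le_one_right' ?_
  by_cases h : ω ∈ stay γ X g u t x z
  · simp [h]
  · simp [h]

end IsStarField

/-- The weight restricted to the event of staying below `f` up to time `u` and below `g`
between times `u` and `t`. -/
noncomputable def keptWt {Ω V : Type*} (γ : ℝ) (X : ℝ → V → Ω → ℝ) (k : ℝ → V → V → ℝ) (f g : ℝ → ℝ)
    (u t : ℝ) (x : V) (ω : Ω) : ENNReal :=
  wt γ X k t x ω * (below (rel γ X x) f 0 u ∩ below (rel γ X x) g u t).indicator 1 ω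

/-- The conditional expectation of `keptWt` given the field up to time `u`. -/
noncomputable def condWt {Ω V : Type*} {mΩ : MeasurableSpace Ω} (γ : ℝ) (X : ℝ → V → Ω → ℝ)
    (k : ℝ → V → V → ℝ) (P : Measure Ω) (f g : ℝ → ℝ) (u t : ℝ) (x : V) (ω : Ω) : ENNReal :=
  wt γ X k u x ω * (below (rel γ X x) f 0 u).indicator 1 ω * stayProb γ X P g u t x (rel γ X x u ω)

theorem measurable_of_continuous_left {Ω V : Type*} {m : MeasurableSpace Ω} [NormedAddCommGroup V]
    [MeasurableSpace V] [BorelSpace V] [SecondCountableTopology V] {F : V → Ω → ℝ}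
    (hc : ∀ ω, Continuous fun x => F x ω) (hm : ∀ x, Measurable (F x)) :
    Measurable fun p : V × Ω => F p.1 p.2 :=
  measurable_uncurry_of_continuous_of_measurable hc hm

variable [MeasurableSpace V] [BorelSpace V] [SecondCountableTopology V] {Kc : Set V}

namespace IsStarField

variable {f g : ℝ → ℝ} {u t : ℝ}

theorem measurable_field (hX : IsStarField X k P) {s t : ℝ} (hs : 0 ≤ s) (hst : s ≤ t) :
    Measurable[(inferInstance : MeasurableSpace V).prod (fieldσ X t)]
      fun p : V × Ω => X s p.1 p.2 :=
  measurable_of_continuous_left (fun ω => (hX.cont ω).comp (continuous_const.prodMk continuous_id))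
    (fun x => measurable_fieldσ X ⟨hs, hst⟩ x)

theorem measurable_field' (hX : IsStarField X k P) (s : ℝ) :
    Measurable fun p : V × Ω => X s p.1 p.2 :=
  measurable_uncurry_of_continuous_of_measurable (u := fun x ω => X s x ω)
    (fun ω => (hX.cont ω).comp (continuous_const.prodMk continuous_id)) (hX.meas s)

theorem measurable_stayProb (hX : IsStarField X k P) (hg : Continuous g) (hut : u ≤ t) :
    Measurable fun p : V × ℝ => stayProb γ X P g u t p.1 p.2 := by
  have := hX.isProbabilityMeasure
  have hm : ∀ s, Measurable fun p : (V × ℝ) × Ω => X s p.1.1 p.2 := fun s =>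
    (hX.measurable_field' s).comp (measurable_fst.fst.prodMk measurable_snd)
  have hS : MeasurableSet {p : (V × ℝ) × Ω | p.2 ∈ stay γ X g u t p.1.1 p.1.2} := by
    refine measurableSet_forall_le (Z := fun s (p : (V × ℝ) × Ω) => p.1.2 +
      (X s p.1.1 p.2 - X u p.1.1 p.2) - γ * (s - u)) hut (fun s _ => ?_) (fun ω => ?_) hg
    · exact ((measurable_fst.snd).add ((hm s).sub (hm u))).sub_const _
    · have := hX.continuous_time ω.1.1 ω.2
      fun_prop
  have h : Measurable fun p : (V × ℝ) × Ω => wtIncr γ X u t p.1.1 p.2 *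
      {p : (V × ℝ) × Ω | p.2 ∈ stay γ X g u t p.1.1 p.1.2}.indicator 1 p := by
    refine Measurable.mul ?_ ((measurable_one (α := ENNReal)).indicator hS)
    exact (measurable_exp.comp ((((hm t).sub (hm u)).const_mul γ).sub_const _)).ennreal_ofReal
  exact h.lintegral_prod_right'

theorem measurable_stayProb_rel (hX : IsStarField X k P) (hg : Continuous g) (hu : 0 ≤ u)
    (hut : u ≤ t) (x : V) :
    Measurable[fieldσ X u] fun ω => stayProb γ X P g u t x (rel γ X x u ω) :=
  ((hX.measurable_stayProb hg hut).comp measurable_prodMk_left).comp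
    (measurable_fieldσ_rel γ X hu le_rfl x)

theorem measurable_fieldσ_wt_below (hX : IsStarField X k P) (hf : Continuous f) (hu : 0 ≤ u)
    (x : V) : Measurable[fieldσ X u] fun ω => wt γ X k u x ω *
      (below (rel γ X x) f 0 u).indicator (1 : Ω → ENNReal) ω :=
  (measurable_fieldσ_wt γ X k hu le_rfl x).mul (measurable_const.indicator
    (hX.measurableSet_below_rel hf le_rfl hu le_rfl x))

theorem measurable_condWt (hX : IsStarField X k P) (hf : Continuous f) (hg : Continuous g)
    (hu : 0 ≤ u) (hut : u ≤ t) (x : V) : Measurable[fieldσ X u] (condWt γ X k P f g u t x) :=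
  (hX.measurable_fieldσ_wt_below hf hu x).mul
    (hX.measurable_stayProb_rel hg hu hut x)

theorem keptWt_eq (hX : IsStarField X k P) (hu : 0 ≤ u) (hut : u ≤ t) (x : V) (ω : Ω) :
    keptWt γ X k f g u t x ω = wt γ X k u x ω * (below (rel γ X x) f 0 u).indicator 1 ω *
      (wtIncr γ X u t x ω * (below (rel γ X x) g u t).indicator 1 ω) := by
  rw [keptWt, hX.wt_eq_mul hu (hu.trans hut), inter_indicator_one, Pi.mul_apply]
  ring

theorem lintegral_mul_keptWt (hX : IsStarField X k P) (hf : Continuous f) (hg : Continuous g)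
    (hu : 0 ≤ u) (hut : u ≤ t) (x : V) {U : Ω → ENNReal} (hU : Measurable[fieldσ X u] U) :
    ∫⁻ ω, U ω * keptWt γ X k f g u t x ω ∂P = ∫⁻ ω, U ω * condWt γ X k P f g u t x ω ∂P := by
  have h := hX.lintegral_mul_below (γ := γ) hg hut x (hX.fieldσ_le u) (hX.indep_fut hu x)
    (hU.mul (hX.measurable_fieldσ_wt_below (γ := γ) hf hu x))
    (measurable_fieldσ_rel γ X hu le_rfl x)
  simp only [hX.keptWt_eq hu hut, condWt]
  simp only [Pi.mul_apply, mul_assoc] at h ⊢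
  exact h

/-- At distant points, the events after time `u` are conditionally independent. -/
theorem lintegral_mul_below_mul_below (hX : IsStarField X k P) (hg : Continuous g)
    (hu : 0 ≤ u) (hut : u ≤ t) {x y : V} (hxy : exp (-u) ≤ ‖y - x‖) {U : Ω → ENNReal}
    (hU : Measurable[fieldσ X u] U) :
    ∫⁻ ω, U ω * (wtIncr γ X u t y ω * (below (rel γ X y) g u t).indicator 1 ω) *
        (wtIncr γ X u t x ω * (below (rel γ X x) g u t).indicator 1 ω) ∂P
      = ∫⁻ ω, U ω * stayProb γ X P g u t y (rel γ X y u ω) *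
        stayProb γ X P g u t x (rel γ X x u ω) ∂P := by
  set G := fieldσ X u ⊔ futσ (fun s => X s y) u with hGdef
  have hG : G ≤ mΩ := sup_le (hX.fieldσ_le u) (hX.futσ_le u y)
  have hl : fieldσ X u ≤ G := le_sup_left
  have hr : futσ (fun s => X s y) u ≤ G := le_sup_right
  have hry : ∀ s, u ≤ s → Measurable[G] (rel γ X y s) := by
    intro s hs
    have h1 := (measurable_futσ (fun s => X s y) (u := u) (sub_nonneg.2 hs)).mono hr le_rfl
    have h2 := (measurable_fieldσ_rel γ X hu le_rfl y).mono hl le_rfl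
    have h3 := (h1.add h2).sub_const (γ * (s - u))
    convert h3 using 2 with ω
    simp only [rel, Pi.add_apply, add_sub_cancel]
    ring
  have hby : MeasurableSet[G] (below (rel γ X y) g u t) :=
    measurableSet_forall_le hut (fun s hs => hry s hs.1) (hX.continuous_rel y) hg
  have hVy : Measurable[G] fun ω => wtIncr γ X u t y ω *
      (below (rel γ X y) g u t).indicator (1 : Ω → ENNReal) ω :=
    ((measurable_futσ_wtIncr γ X hut y).mono hr le_rfl).mul (measurable_one.indicator hby)
  have h₁ := hX.lintegral_mul_below hg hut x hG (hX.indep_sup_fut hu hxy)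
    ((hU.mono hl le_rfl).mul hVy) ((measurable_fieldσ_rel γ X hu le_rfl x).mono hl le_rfl)
  simp only [Pi.mul_apply] at h₁
  refine h₁.trans ?_
  have h := hX.lintegral_mul_below (γ := γ) hg hut y (hX.fieldσ_le u) (hX.indep_fut hu y)
    (hU.mul (hX.measurable_stayProb_rel (γ := γ) hg hu hut x)) (measurable_fieldσ_rel γ X hu le_rfl y)
  simp only [Pi.mul_apply] at h ⊢
  refine Eq.trans (lintegral_congr fun ω => by ring) (h.trans (lintegral_congr fun ω => by ring))

theorem lintegral_keptWt_mul_keptWt (hX : IsStarField X k P) (hf : Continuous f) (hg : Continuous g)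
    (hu : 0 ≤ u) (hut : u ≤ t) {x y : V} (hxy : exp (-u) ≤ ‖y - x‖) :
    ∫⁻ ω, keptWt γ X k f g u t x ω * keptWt γ X k f g u t y ω ∂P
      = ∫⁻ ω, condWt γ X k P f g u t x ω * condWt γ X k P f g u t y ω ∂P := by
  have h := hX.lintegral_mul_below_mul_below (γ := γ) hg hu hut hxy
    ((hX.measurable_fieldσ_wt_below (γ := γ) hf hu x).mul
      (hX.measurable_fieldσ_wt_below (γ := γ) hf hu y))
  simp only [hX.keptWt_eq hu hut, condWt]
  simp only [Pi.mul_apply] at h ⊢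
  refine Eq.trans (lintegral_congr fun ω => by ring) (h.trans (lintegral_congr fun ω => by ring))

/-- A two-point exponential moment. -/
theorem lintegral_wt_mul_wt_mul_exp (hX : IsStarField X k P) {m t : ℝ} (hm : 0 ≤ m) (hmt : m ≤ t)
    {x y : V} (hk : k t x y = k m x y) :
    ∫⁻ ω, wt γ X k t x ω * wt γ X k t y ω * ofReal (exp (-(γ * rel γ X x m ω))) ∂P
      = ofReal (exp (γ ^ 2 * k 0 x y + γ ^ 2 / 2 * m)) := by
  have hp := hX.isProbabilityMeasure
  have ht := hm.trans hmt
  set H : Ω → ℝ := fun ω => γ * (X t x ω + X t y ω - (X m x ω - X 0 x ω)) with hH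
  have l2 : ∀ s, 0 ≤ s → ∀ z, MemLp (X s z) 2 P := fun s hs z => hX.memLp hs z
  have hmem : H ∈ Submodule.span ℝ (Set.range fun p : NNReal × V => X p.1 p.2) :=
    Submodule.smul_mem _ γ (Submodule.sub_mem _ (Submodule.add_mem _ (hX.mem_span ht x)
      (hX.mem_span ht y)) (Submodule.sub_mem _ (hX.mem_span hm x) (hX.mem_span le_rfl x)))
  have hint : ∀ s, 0 ≤ s → ∀ z, Integrable (X s z) P := fun s hs z =>
    (l2 s hs z).integrable (by norm_num)
  have hH0 : P[H] = 0 := by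
    have e := integral_sub ((hint t ht x).add (hint t ht y)) ((hint m hm x).sub (hint 0 le_rfl x))
    have e1 := integral_add (hint t ht x) (hint t ht y)
    have e2 := integral_sub (hint m hm x) (hint 0 le_rfl x)
    simp only [hX.mean _ _ ht, hX.mean _ _ hm, hX.mean _ _ le_rfl] at e1 e2
    rw [hH, integral_const_mul]
    refine mul_eq_zero_of_right _ (e.trans ?_)
    simp only [Pi.add_apply, Pi.sub_apply]
    rw [e1, e2]
    ring
  have hvar : Var[H; P] = γ ^ 2 * (k 0 x x + t + (k 0 y y + t) + 2 * k t x y + m - 2 * m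
      - 2 * (k m x y - k 0 x y)) := by
    have hS : MemLp (X t x + X t y) 2 P := (l2 t ht x).add (l2 t ht y)
    have hD : MemLp (X m x - X 0 x) 2 P := (l2 m hm x).sub (l2 0 le_rfl x)
    have e0 : Var[H; P] = γ ^ 2 * Var[(X t x + X t y) - (X m x - X 0 x); P] :=
      variance_const_mul γ _ P
    rw [e0, variance_sub hS hD, variance_add (l2 t ht x) (l2 t ht y),
      variance_sub (l2 m hm x) (l2 0 le_rfl x), covariance_add_left (l2 t ht x) (l2 t ht y) hD,
      hX.cov_sub_right ht le_rfl hm, hX.cov_sub_right ht le_rfl hm, hX.cov _ _ _ _ ht ht,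
      hX.cov _ _ _ _ hm le_rfl, ← covariance_self (hX.meas t x).aemeasurable,
      ← covariance_self (hX.meas t y).aemeasurable, ← covariance_self (hX.meas m x).aemeasurable,
      ← covariance_self (hX.meas 0 x).aemeasurable, hX.cov _ _ _ _ ht ht, hX.cov _ _ _ _ ht ht,
      hX.cov _ _ _ _ hm hm, hX.cov _ _ _ _ le_rfl le_rfl, min_eq_right hmt, min_eq_right hm,
      min_eq_right ht, min_self, min_self, min_self, hX.diag t x ht, hX.diag t y ht, hX.diag m x hm,
      hX.kernel_comm hm y x, hX.kernel_comm le_rfl y x]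
    ring
  have hHm : Measurable H :=
    (((hX.meas t x).add (hX.meas t y)).sub ((hX.meas m x).sub (hX.meas 0 x))).const_mul γ
  have h := hX.lintegral_exp_mul (G := fun (_ : Unit) => X t x) (F := fun _ => 1) hmem
    (fun _ => hX.mem_span ht x) (fun _ => hX.meas t x) hHm hH0 measurable_const
  simp only [mul_one, lintegral_const, measure_univ] at h
  calc _ = ∫⁻ ω, ofReal (exp (γ ^ 2 * k 0 x y + γ ^ 2 / 2 * m)) *
        ofReal (exp (H ω - Var[H; P] / 2)) ∂P := by
        refine lintegral_congr fun ω => ?_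
        rw [wt, wt, ← ofReal_mul (exp_pos _).le, ← ofReal_mul (by positivity),
          ← ofReal_mul (exp_pos _).le, ← exp_add, ← exp_add, ← exp_add, hvar, hX.diag t x ht,
          hX.diag t y ht, hk, hH, rel]
        congr 2
        ring
    _ = _ := by
        rw [lintegral_const_mul _ (by fun_prop), h, mul_one]

end IsStarField

theorem sq_mul_exp_le {z a γ : ℝ} (hγ : 7 / 5 ≤ γ) (ha : 0 ≤ a) (haz : a ≤ z) :
    z ^ 2 ≤ 25 * exp (γ * z) * exp (-a) := by
  have hz := ha.trans haz
  have h := add_one_le_exp (z / 5)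
  have h1 : z / 5 ≤ exp (z / 5) := by linarith
  have h2 : (z / 5) ^ 2 ≤ exp (z / 5) ^ 2 := by gcongr
  rw [← exp_nat_mul] at h2
  have h3 : exp ((2 : ℕ) * (z / 5)) ≤ exp (γ * z) * exp (-a) := by
    rw [← exp_add]
    apply exp_le_exp.2
    push_cast
    nlinarith
  nlinarith

namespace IsStarField

variable {f r : ℝ → ℝ} {u t : ℝ}

theorem keptWt_mul_keptWt_le (hγ : 0 ≤ γ) {m : ℝ} (hum : u ≤ m) (hmt : m ≤ t) (x y : V) (ω : Ω) :
    keptWt γ X k f (fun s => -r s) u t x ω * keptWt γ X k f (fun s => -r s) u t y ω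
      ≤ ofReal (exp (-(γ * r m))) * (wt γ X k t x ω * wt γ X k t y ω *
        ofReal (exp (-(γ * rel γ X x m ω)))) := by
  by_cases h : ω ∈ below (rel γ X x) f 0 u ∩ below (rel γ X x) (fun s => -r s) u t
  · have h1 : keptWt γ X k f (fun s => -r s) u t y ω ≤ wt γ X k t y ω :=
      mul_le_of_le_one_right' (indicator_le_self' (by simp) _)
    have h2 : (1 : ENNReal) ≤ ofReal (exp (-(γ * r m))) *
        ofReal (exp (-(γ * rel γ X x m ω))) := by
      rw [← ofReal_mul (exp_pos _).le, ← exp_add, ← ofReal_one]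
      refine ofReal_le_ofReal (one_le_exp ?_)
      have := h.2 m ⟨hum, hmt⟩
      simp only at this
      nlinarith
    rw [keptWt, indicator_of_mem h, Pi.one_apply, mul_one]
    calc _ ≤ wt γ X k t x ω * wt γ X k t y ω * 1 := by
          rw [mul_one]; exact mul_le_mul_right h1 _
      _ ≤ wt γ X k t x ω * wt γ X k t y ω * _ := mul_le_mul_right h2 _
      _ = _ := by ring
  · rw [keptWt, indicator_of_notMem h]
    simp

/-- Two-point estimate through a single time. -/
theorem lintegral_keptWt_mul_le_exp (hX : IsStarField X k P) (hγ : 0 ≤ γ) {m : ℝ} (hm : 0 ≤ m)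
    (hum : u ≤ m) (hmt : m ≤ t) {x y : V} (hk : k t x y = k m x y) :
    ∫⁻ ω, keptWt γ X k f (fun s => -r s) u t x ω * keptWt γ X k f (fun s => -r s) u t y ω ∂P
      ≤ ofReal (exp (γ ^ 2 * k 0 x y + γ ^ 2 / 2 * m - γ * r m)) := by
  refine (lintegral_mono fun ω => keptWt_mul_keptWt_le hγ hum hmt x y ω).trans ?_
  rw [lintegral_const_mul', hX.lintegral_wt_mul_wt_mul_exp hm hmt hk,
    ← ofReal_mul (exp_pos _).le, ← exp_add]
  · refine le_of_eq ?_
    congr 2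
    ring
  · exact ofReal_ne_top

/-- Two-point estimate through the separation time of the two points. -/
theorem lintegral_keptWt_mul_le_sep (hX : IsStarField X k P) (hγ : 7 / 5 ≤ γ)
    (hf : Continuous f) (hr : Continuous r) (hr0 : ∀ s, 0 ≤ s → 0 ≤ r s)
    (hu : 0 ≤ u) {v : ℝ} (huv : u ≤ v) (hvt : v < t) {x y : V} (hxy : exp (-v) ≤ ‖y - x‖) :
    ∫⁻ ω, keptWt γ X k f (fun s => -r s) u t x ω * keptWt γ X k f (fun s => -r s) u t y ω ∂P
      ≤ ofReal (2 / (π * (t - v)) * (25 * exp (γ ^ 2 * k 0 x y + γ ^ 2 / 2 * v - r v))) := by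
  have hv := hu.trans huv
  set g : ℝ → ℝ := fun s => -r s with hgdef
  have hg : Continuous g := hr.neg
  set S : V → Set Ω := fun z => below (rel γ X z) f 0 u ∩ below (rel γ X z) g u v with hS
  set w : V → Ω → ENNReal := fun z ω => wt γ X k v z ω * (S z).indicator 1 ω with hw
  have hwm : ∀ z, Measurable[fieldσ X v] (w z) := fun z =>
    (measurable_fieldσ_wt γ X k hv le_rfl z).mul (measurable_const.indicator
      ((hX.measurableSet_below_rel hf le_rfl hu huv z).inter
        (hX.measurableSet_below_rel hg hu huv le_rfl z)))
  have hsplit : ∀ z ω, keptWt γ X k f g u t z ω = w z ω *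
      (wtIncr γ X v t z ω * (below (rel γ X z) g v t).indicator 1 ω) := by
    intro z ω
    have : below (rel γ X z) f 0 u ∩ below (rel γ X z) g u t
        = S z ∩ below (rel γ X z) g v t := by
      have h : below (rel γ X z) g u t = below (rel γ X z) g u v ∩ below (rel γ X z) g v t := by
        ext ω
        constructor
        · exact fun h => ⟨fun s hs => h s ⟨hs.1, hs.2.trans hvt.le⟩,
            fun s hs => h s ⟨huv.trans hs.1, hs.2⟩⟩
        · rintro ⟨h1, h2⟩ s hs
          rcases le_total s v with h | h
          · exact h1 s ⟨hs.1, h⟩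
          · exact h2 s ⟨h, hs.2⟩
      rw [h, hS, Set.inter_assoc]
    rw [keptWt, this, hX.wt_eq_mul hv (hv.trans hvt.le), inter_indicator_one, Pi.mul_apply, hw]
    ring
  have e1 := hX.lintegral_mul_below_mul_below (γ := γ) hg hv hvt.le hxy ((hwm x).mul (hwm y))
  have e2 : ∫⁻ ω, keptWt γ X k f g u t x ω * keptWt γ X k f g u t y ω ∂P
      = ∫⁻ ω, w x ω * w y ω * stayProb γ X P g v t y (rel γ X y v ω) *
        stayProb γ X P g v t x (rel γ X x v ω) ∂P := by
    refine Eq.trans (lintegral_congr fun ω => ?_) e1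
    rw [hsplit, hsplit, Pi.mul_apply]
    ring
  rw [e2]
  have hβ : 0 ≤ 2 / (π * (t - v)) := div_nonneg (by norm_num)
    (mul_nonneg pi_pos.le (sub_pos.2 hvt).le)
  have hsp : ∀ z ω, stayProb γ X P g v t z (rel γ X z v ω) ≤
      ofReal √(2 / (π * (t - v))) * ofReal (-rel γ X z v ω) := fun z ω =>
    hX.stayProb_le hg hv hvt z (fun s hs => neg_nonpos.2 (hr0 s (hv.trans hs.1))) _
  have hpt : ∀ ω, w x ω * w y ω * stayProb γ X P g v t y (rel γ X y v ω) *
        stayProb γ X P g v t x (rel γ X x v ω) ≤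
      ofReal (2 / (π * (t - v)) * (25 / 2 * exp (-r v))) *
        (wt γ X k v x ω * wt γ X k v y ω * ofReal (exp (-(γ * rel γ X x v ω))) +
          wt γ X k v y ω * wt γ X k v x ω * ofReal (exp (-(γ * rel γ X y v ω)))) := by
    intro ω
    by_cases hx : ω ∈ S x
    swap
    · simp [hw, indicator_of_notMem hx]
    by_cases hy : ω ∈ S y
    swap
    · simp [hw, indicator_of_notMem hy]
    have hx' : r v ≤ -rel γ X x v ω := by
      have := hx.2 v ⟨huv, le_rfl⟩
      simp only [hgdef] at this
      linarith
    have hy' : r v ≤ -rel γ X y v ω := by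
      have := hy.2 v ⟨huv, le_rfl⟩
      simp only [hgdef] at this
      linarith
    have hrv := hr0 v hv
    have ax := sq_mul_exp_le hγ hrv hx'
    have ay := sq_mul_exp_le hγ hrv hy'
    have hkey : ofReal (-rel γ X y v ω) * ofReal (-rel γ X x v ω) ≤
        ofReal (25 / 2 * exp (-r v)) * (ofReal (exp (-(γ * rel γ X x v ω))) +
          ofReal (exp (-(γ * rel γ X y v ω)))) := by
      rw [← ofReal_add (exp_pos _).le (exp_pos _).le, ← ofReal_mul (by linarith),
        ← ofReal_mul (by positivity)]
      refine ofReal_le_ofReal ?_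
      rw [mul_neg] at ax ay
      nlinarith [sq_nonneg (-rel γ X x v ω - -rel γ X y v ω)]
    have hwx : w x ω = wt γ X k v x ω := by simp [hw, hx]
    have hwy : w y ω = wt γ X k v y ω := by simp [hw, hy]
    rw [hwx, hwy, ofReal_mul hβ]
    have hs2 : ofReal (2 / (π * (t - v))) =
        ofReal √(2 / (π * (t - v))) * ofReal √(2 / (π * (t - v))) := by
      rw [← ofReal_mul (sqrt_nonneg _), mul_self_sqrt hβ]
    rw [hs2]
    set A := ofReal √(2 / (π * (t - v)))
    calc _ ≤ wt γ X k v x ω * wt γ X k v y ω * (A * ofReal (-rel γ X y v ω)) *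
          (A * ofReal (-rel γ X x v ω)) := by
          gcongr
          · exact hsp y ω
          · exact hsp x ω
      _ = wt γ X k v x ω * wt γ X k v y ω * (A * A) *
          (ofReal (-rel γ X y v ω) * ofReal (-rel γ X x v ω)) := by ring
      _ ≤ _ := mul_le_mul_right hkey _
      _ = _ := by ring
  refine (lintegral_mono hpt).trans ?_
  have hmeas : Measurable fun ω => wt γ X k v x ω * wt γ X k v y ω *
      ofReal (exp (-(γ * rel γ X x v ω))) :=
    ((hX.measurable_wt v x).mul (hX.measurable_wt v y)).mul
      (((hX.measurable_rel v x).const_mul γ).neg.exp.ennreal_ofReal)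
  rw [lintegral_const_mul' _ _ ofReal_ne_top, lintegral_add_left hmeas,
    hX.lintegral_wt_mul_wt_mul_exp hv le_rfl rfl, hX.lintegral_wt_mul_wt_mul_exp hv le_rfl rfl,
    hX.kernel_comm le_rfl y x, ← ofReal_add (exp_pos _).le (exp_pos _).le,
    ← ofReal_mul (by positivity), sub_eq_add_neg _ (r v), exp_add _ (-r v)]
  refine le_of_eq ?_
  congr 1
  ring

/-- The two-point bound for the normalised truncated weights. -/
theorem lintegral_keptWt_mul_le (hX : IsStarField X k P) (hγ : 7 / 5 ≤ γ)
    (hf : Continuous f) (hr : Continuous r) (hr0 : ∀ s, 0 ≤ s → 0 ≤ r s) {ρ : ℝ → ℝ} {C₁ C₂ : ℝ}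
    (hρ0 : ∀ s, 0 ≤ s → 0 ≤ ρ s)
    (hrρ : ∀ s, 1 ≤ s → r s = 2 * ρ s) (hC₁ : ∀ s, 1 ≤ s → s ≤ C₁ * exp (ρ s)) (hC₂ : 0 ≤ C₂)
    (hρ : ∀ s v, 1 ≤ s → s ≤ v → ρ v ≤ ρ s + γ ^ 2 / 2 * (v - s) + C₂)
    (hu : 1 ≤ u) (hut : u ≤ t) {x y : V} {v : ℝ} (huv : u ≤ v) (hxy : exp (-v) ≤ ‖x - y‖) :
    ofReal (π * t / 2) * ∫⁻ ω, keptWt γ X k f (fun s => -r s) u t x ω *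
        keptWt γ X k f (fun s => -r s) u t y ω ∂P ≤ ofReal ((50 + π * C₁ * exp C₂) *
        exp (γ ^ 2 * k 0 x y + γ ^ 2 / 2 * v - ρ v)) := by
  have hv : 1 ≤ v := hu.trans huv
  have ht : 1 ≤ t := hu.trans hut
  have hC₁0 : 0 ≤ C₁ := by
    by_contra h
    have := hC₁ 1 le_rfl
    have := mul_neg_of_neg_of_pos (not_le.1 h) (exp_pos (ρ 1))
    linarith
  have hpi := pi_pos
  have hpt : 0 ≤ π * t / 2 := by positivity
  have hec : 1 ≤ exp C₂ := one_le_exp hC₂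
  have hρv := hρ0 v (by linarith)
  have hρt := hρ0 t (by linarith)
  rcases lt_or_ge t (2 * v) with h2 | h2
  · rcases le_total v t with h3 | h3
    · refine (mul_le_mul_right (hX.lintegral_keptWt_mul_le_exp (m := v) (by linarith)
        (by linarith) huv h3 (hX.range v t x y (by linarith) h3 hxy)) _).trans ?_
      rw [← ofReal_mul hpt, hrρ v hv]
      refine ofReal_le_ofReal ?_
      have e : exp (γ ^ 2 * k 0 x y + γ ^ 2 / 2 * v - γ * (2 * ρ v)) ≤
          exp (γ ^ 2 * k 0 x y + γ ^ 2 / 2 * v - ρ v) * exp (-ρ v) := by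
        rw [← exp_add]
        exact exp_le_exp.2 (by nlinarith)
      have hc : v * exp (-ρ v) ≤ C₁ := by
        have := mul_le_mul_of_nonneg_right (hC₁ v hv) (exp_pos (-ρ v)).le
        rwa [mul_assoc, ← exp_add, add_neg_cancel, exp_zero, mul_one] at this
      set a := exp (γ ^ 2 * k 0 x y + γ ^ 2 / 2 * v - ρ v)
      have ha : 0 < a := exp_pos _
      calc _ ≤ π * t / 2 * (a * exp (-ρ v)) := mul_le_mul_of_nonneg_left e hpt
        _ ≤ π * v * (a * exp (-ρ v)) := by gcongr; nlinarith
        _ = π * (v * exp (-ρ v)) * a := by ring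
        _ ≤ π * C₁ * a := by gcongr
        _ ≤ π * C₁ * exp C₂ * a := by
            refine mul_le_mul_of_nonneg_right ?_ ha.le
            exact le_mul_of_one_le_right (by positivity) hec
        _ ≤ _ := by gcongr; linarith
    · refine (mul_le_mul_right (hX.lintegral_keptWt_mul_le_exp (m := t) (by linarith)
        (by linarith) hut le_rfl rfl) _).trans ?_
      rw [← ofReal_mul hpt, hrρ t ht]
      refine ofReal_le_ofReal ?_
      have e : exp (γ ^ 2 * k 0 x y + γ ^ 2 / 2 * t - γ * (2 * ρ t)) ≤
          exp (γ ^ 2 * k 0 x y + γ ^ 2 / 2 * v - ρ v) * (exp (-ρ t) * exp C₂) := by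
        rw [← exp_add, ← exp_add]
        have := hρ t v ht h3
        exact exp_le_exp.2 (by nlinarith)
      have hc : t * exp (-ρ t) ≤ C₁ := by
        have := mul_le_mul_of_nonneg_right (hC₁ t ht) (exp_pos (-ρ t)).le
        rwa [mul_assoc, ← exp_add, add_neg_cancel, exp_zero, mul_one] at this
      set a := exp (γ ^ 2 * k 0 x y + γ ^ 2 / 2 * v - ρ v)
      have ha : 0 < a := exp_pos _
      calc _ ≤ π * t / 2 * (a * (exp (-ρ t) * exp C₂)) := mul_le_mul_of_nonneg_left e hpt
        _ = π / 2 * (t * exp (-ρ t)) * exp C₂ * a := by ring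
        _ ≤ π * C₁ * exp C₂ * a := by gcongr; linarith
        _ ≤ _ := by gcongr; linarith
  · have h3 : v < t := by linarith
    refine (mul_le_mul_right (hX.lintegral_keptWt_mul_le_sep hγ hf hr hr0 (by linarith) huv h3
      (by rwa [norm_sub_rev])) _).trans ?_
    rw [← ofReal_mul hpt, hrρ v hv]
    refine ofReal_le_ofReal ?_
    have e : exp (γ ^ 2 * k 0 x y + γ ^ 2 / 2 * v - 2 * ρ v) ≤
        exp (γ ^ 2 * k 0 x y + γ ^ 2 / 2 * v - ρ v) := exp_le_exp.2 (by linarith)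
    set a := exp (γ ^ 2 * k 0 x y + γ ^ 2 / 2 * v - ρ v)
    have ha : 0 < a := exp_pos _
    have h4 : π * t / 2 * (2 / (π * (t - v))) ≤ 2 := by
      rw [div_mul_div_comm, div_le_iff₀ (by nlinarith)]
      nlinarith
    calc _ = π * t / 2 * (2 / (π * (t - v))) *
          (25 * exp (γ ^ 2 * k 0 x y + γ ^ 2 / 2 * v - 2 * ρ v)) := by ring
      _ ≤ 2 * (25 * a) := by gcongr
      _ = 50 * a := by ring
      _ ≤ _ := by gcongr; exact le_add_of_nonneg_right (by positivity)

end IsStarField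

/-- The integrals of `U` and `V` over any event differ by at most `δ`. -/
def Close (P : Measure Ω) (δ : ENNReal) (U V : Ω → ENNReal) : Prop :=
  ∀ A, MeasurableSet A → ∫⁻ ω in A, U ω ∂P ≤ ∫⁻ ω in A, V ω ∂P + δ ∧
    ∫⁻ ω in A, V ω ∂P ≤ ∫⁻ ω in A, U ω ∂P + δ

namespace Close

variable {δ δ' : ENNReal} {U V W : Ω → ENNReal}

theorem symm (h : Close P δ U V) : Close P δ V U := fun A hA => (h A hA).symm

theorem mono (h : Close P δ U V) (hδ : δ ≤ δ') : Close P δ' U V := fun A hA =>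
  ⟨(h A hA).1.trans (by gcongr), (h A hA).2.trans (by gcongr)⟩

theorem trans (h : Close P δ U V) (h' : Close P δ' V W) : Close P (δ + δ') U W := fun A hA =>
  ⟨((h A hA).1.trans (add_le_add_left (h' A hA).1 _)).trans_eq (by ring),
    ((h' A hA).2.trans (add_le_add_left (h A hA).2 _)).trans_eq (by ring)⟩

theorem of_le {a : ENNReal} (hUV : ∀ ω, U ω ≤ V ω) (hf : ∫⁻ ω, U ω ∂P ≠ ⊤)
    (h : ∫⁻ ω, V ω ∂P ≤ ∫⁻ ω, U ω ∂P + a) : Close P a U V := by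
  intro A hA
  refine ⟨(lintegral_mono hUV).trans le_self_add, ?_⟩
  have hfc : ∫⁻ ω in Aᶜ, U ω ∂P ≠ ⊤ := ne_top_of_le_ne_top hf (setLIntegral_le_lintegral _ _)
  rw [← lintegral_add_compl V hA, ← lintegral_add_compl U hA] at h
  have h2 : ∫⁻ ω in A, V ω ∂P + ∫⁻ ω in Aᶜ, U ω ∂P ≤
      (∫⁻ ω in A, U ω ∂P + a) + ∫⁻ ω in Aᶜ, U ω ∂P :=
    (add_le_add_right (lintegral_mono hUV) _).trans (h.trans_eq (by ring))
  exact (ENNReal.add_le_add_iff_right hfc).1 h2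

/-- If `U ≤ (1 + b) V` and the integral of `V` hardly exceeds that of `U`, then `U`, `V` are
close. -/
theorem of_le_mul {a b : ENNReal} (hUV : ∀ ω, U ω ≤ (1 + b) * V ω) (hVm : Measurable V)
    (hf : ∫⁻ ω, U ω ∂P ≠ ⊤)
    (h : ∫⁻ ω, V ω ∂P ≤ ∫⁻ ω, U ω ∂P + a) : Close P (a + b * ∫⁻ ω, V ω ∂P) U V := by
  intro A hA
  have hA' : ∀ s : Set Ω, ∫⁻ ω in s, U ω ∂P ≤ ∫⁻ ω in s, V ω ∂P + b * ∫⁻ ω in s, V ω ∂P := by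
    intro s
    rw [← lintegral_const_mul _ hVm, ← lintegral_add_left hVm]
    exact lintegral_mono fun ω => (hUV ω).trans_eq (by ring)
  have hb : b * ∫⁻ ω in A, V ω ∂P + b * ∫⁻ ω in Aᶜ, V ω ∂P = b * ∫⁻ ω, V ω ∂P := by
    rw [← mul_add, lintegral_add_compl V hA]
  constructor
  · refine (hA' A).trans (add_le_add_right ?_ _)
    rw [← hb]
    exact le_self_add.trans le_add_self
  · have hfc : ∫⁻ ω in Aᶜ, U ω ∂P ≠ ⊤ := ne_top_of_le_ne_top hf (setLIntegral_le_lintegral _ _)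
    have h2 : ∫⁻ ω in A, V ω ∂P + ∫⁻ ω in Aᶜ, U ω ∂P ≤
        (∫⁻ ω in A, U ω ∂P + (a + b * ∫⁻ ω, V ω ∂P)) + ∫⁻ ω in Aᶜ, U ω ∂P := by
      calc _ ≤ ∫⁻ ω in A, V ω ∂P + (∫⁻ ω in Aᶜ, V ω ∂P + b * ∫⁻ ω in Aᶜ, V ω ∂P) :=
            add_le_add_right (hA' _) _
        _ = ∫⁻ ω, V ω ∂P + b * ∫⁻ ω in Aᶜ, V ω ∂P := by rw [← add_assoc, lintegral_add_compl V hA]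
        _ ≤ (∫⁻ ω, U ω ∂P + a) + b * ∫⁻ ω, V ω ∂P :=
            add_le_add h (mul_le_mul_right (setLIntegral_le_lintegral _ _) _)
        _ = _ := by rw [← lintegral_add_compl U hA]; ring
    exact (ENNReal.add_le_add_iff_right hfc).1 h2

theorem two_mul_le_sq (a b : ENNReal) : 2 * (a * b) ≤ a ^ 2 + b ^ 2 := by
  by_cases ha : a = ⊤
  · simp [ha]
  by_cases hb : b = ⊤
  · simp [hb]
  lift a to NNReal using ha
  lift b to NNReal using hb
  norm_cast
  rw [← NNReal.coe_le_coe]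
  push_cast
  nlinarith [sq_nonneg ((a : ℝ) - b)]

theorem two_mul_add_le (a b : ENNReal) (s : NNReal) :
    2 * s * a + 2 * (a * b) ≤ 2 * s * b + (a ^ 2 + b ^ 2 + s ^ 2) := by
  by_cases ha : a = ⊤
  · simp [ha]
  by_cases hb : b = ⊤
  · simp [hb]
  lift a to NNReal using ha
  lift b to NNReal using hb
  norm_cast
  rw [← NNReal.coe_le_coe]
  push_cast
  nlinarith [sq_nonneg ((a : ℝ) - b - s)]

theorem setLIntegral_le_of_sq [IsProbabilityMeasure P] {η : ENNReal} {s : NNReal} (hs : 0 < s)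
    (hη : η ≤ s ^ 2) (hU : Measurable U) (hV : Measurable V) (hf : ∫⁻ ω, U ω * V ω ∂P ≠ ⊤)
    (h : ∫⁻ ω, U ω ^ 2 ∂P + ∫⁻ ω, V ω ^ 2 ∂P ≤ 2 * ∫⁻ ω, U ω * V ω ∂P + η)
    {A : Set Ω} (hA : MeasurableSet A) : ∫⁻ ω in A, U ω ∂P ≤ ∫⁻ ω in A, V ω ∂P + s := by
  have h1 : ∫⁻ ω in A, (2 * s * U ω + 2 * (U ω * V ω)) ∂P ≤
      ∫⁻ ω in A, (2 * s * V ω + (U ω ^ 2 + V ω ^ 2 + s ^ 2)) ∂P :=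
    lintegral_mono fun ω => two_mul_add_le _ _ _
  have h2 : ∫⁻ ω in Aᶜ, 2 * (U ω * V ω) ∂P ≤ ∫⁻ ω in Aᶜ, (U ω ^ 2 + V ω ^ 2) ∂P :=
    lintegral_mono fun ω => two_mul_le_sq _ _
  rw [lintegral_add_left (by fun_prop), lintegral_add_left (by fun_prop),
    lintegral_add_left (by fun_prop), lintegral_const_mul _ hU, lintegral_const_mul _ hV] at h1
  have h3 := add_le_add h1 h2
  have hUVm : Measurable fun ω => U ω * V ω := hU.mul hV
  have e1 := (lintegral_add_compl (μ := P) (fun ω => 2 * (U ω * V ω)) hA).trans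
    (lintegral_const_mul _ hUVm)
  have e2 := (lintegral_add_compl (μ := P) (fun ω => U ω ^ 2 + V ω ^ 2) hA).trans
    (lintegral_add_left (hU.pow_const 2) _)
  have e3 : ∫⁻ _ in A, (s : ENNReal) ^ 2 ∂P ≤ s ^ 2 := by
    rw [setLIntegral_const]
    exact mul_le_of_le_one_right' prob_le_one
  have h4 : 2 * s * ∫⁻ ω in A, U ω ∂P + 2 * ∫⁻ ω, U ω * V ω ∂P ≤
      2 * s * (∫⁻ ω in A, V ω ∂P + s) + 2 * ∫⁻ ω, U ω * V ω ∂P := by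
    calc _ = 2 * s * ∫⁻ ω in A, U ω ∂P + ∫⁻ ω in A, 2 * (U ω * V ω) ∂P +
          ∫⁻ ω in Aᶜ, 2 * (U ω * V ω) ∂P := by rw [← e1, add_assoc]
      _ ≤ _ := h3
      _ = 2 * s * ∫⁻ ω in A, V ω ∂P + (∫⁻ ω in A, (U ω ^ 2 + V ω ^ 2) ∂P +
          ∫⁻ ω in Aᶜ, (U ω ^ 2 + V ω ^ 2) ∂P) + ∫⁻ _ in A, (s : ENNReal) ^ 2 ∂P := by ring
      _ ≤ 2 * s * ∫⁻ ω in A, V ω ∂P + (2 * ∫⁻ ω, U ω * V ω ∂P + s ^ 2) + s ^ 2 := by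
          rw [e2]
          exact add_le_add (add_le_add_right (h.trans (add_le_add_right hη _)) _) e3
      _ = _ := by ring
  have h5 := (ENNReal.add_le_add_iff_right (ENNReal.mul_ne_top (by simp) hf)).1 h4
  exact (ENNReal.mul_le_mul_iff_right (by simpa using hs.ne')
    (ENNReal.mul_ne_top (by simp) (by simp))).1 h5

theorem of_sq [IsProbabilityMeasure P] {η : ENNReal} {s : NNReal} (hs : 0 < s)
    (hη : η ≤ s ^ 2) (hU : Measurable U) (hV : Measurable V)
    (hf : ∫⁻ ω, V ω ^ 2 ∂P ≠ ⊤) (hUV : ∫⁻ ω, U ω * V ω ∂P = ∫⁻ ω, V ω ^ 2 ∂P)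
    (h : ∫⁻ ω, U ω ^ 2 ∂P ≤ ∫⁻ ω, V ω ^ 2 ∂P + η) : Close P s U V := by
  intro A hA
  refine ⟨setLIntegral_le_of_sq hs hη hU hV (hUV ▸ hf) ?_ hA,
    setLIntegral_le_of_sq hs hη hV hU ?_ ?_ hA⟩
  · rw [hUV]
    exact (add_le_add_left h _).trans_eq (by ring)
  · simpa only [mul_comm, hUV] using hf
  · simp only [mul_comm (V _), hUV]
    exact (add_le_add_right h _).trans_eq (by ring)

end Close

/-- The total truncated weight at time `t`. -/
noncomputable def truncMass {Ω V : Type*} [MeasurableSpace V] (γ : ℝ) (X : ℝ → V → Ω → ℝ)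
    (k : ℝ → V → V → ℝ) (ν : Measure V) (f : ℝ → ℝ) (t : ℝ) (ω : Ω) : ENNReal :=
  ∫⁻ x, wt γ X k t x ω * (below (rel γ X x) f 0 t).indicator 1 ω ∂ν

/-- The truncated derivative mass at time `t`. -/
noncomputable def derivMass {Ω V : Type*} [MeasurableSpace V] (γ : ℝ) (X : ℝ → V → Ω → ℝ)
    (k : ℝ → V → V → ℝ) (ν : Measure V) (f : ℝ → ℝ) (t : ℝ) (ω : Ω) : ENNReal :=
  ∫⁻ x, ofReal (f t - rel γ X x t ω) *
    (wt γ X k t x ω * (below (rel γ X x) f 0 t).indicator 1 ω) ∂ν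

noncomputable def keptMass {Ω V : Type*} [MeasurableSpace V] (γ : ℝ) (X : ℝ → V → Ω → ℝ)
    (k : ℝ → V → V → ℝ) (ν : Measure V) (f g : ℝ → ℝ) (u t : ℝ) (ω : Ω) : ENNReal :=
  ∫⁻ x, keptWt γ X k f g u t x ω ∂ν

noncomputable def condMass {Ω V : Type*} {mΩ : MeasurableSpace Ω} [MeasurableSpace V] (γ : ℝ)
    (X : ℝ → V → Ω → ℝ) (k : ℝ → V → V → ℝ) (P : Measure Ω) (ν : Measure V) (f g : ℝ → ℝ)
    (u t : ℝ) (ω : Ω) : ENNReal :=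
  ∫⁻ x, condWt γ X k P f g u t x ω ∂ν

theorem measurable_lintegral_left {Ω V : Type*} {m : MeasurableSpace Ω} [MeasurableSpace V]
    {ν : Measure V} [SFinite ν] {F : V → Ω → ENNReal} (hF : Measurable fun p : V × Ω => F p.1 p.2) :
    Measurable fun ω => ∫⁻ x, F x ω ∂ν :=
  hF.lintegral_prod_left'

theorem measurable_wt_aux {Ω V : Type*} {m : MeasurableSpace Ω} [MeasurableSpace V]
    {X : V → Ω → ℝ} {κ : V → ℝ} {γ c : ℝ} (hX : Measurable fun p : V × Ω => X p.1 p.2)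
    (hκ : Measurable κ) : Measurable fun p : V × Ω => ofReal (exp (γ * X p.1 p.2 - c * κ p.1)) := by
  have h2 : Measurable fun p : V × Ω => γ * X p.1 p.2 - c * κ p.1 :=
    (hX.const_mul γ).sub ((hκ.comp measurable_fst).const_mul c)
  exact h2.exp.ennreal_ofReal

theorem measurableSet_below_aux {Ω V : Type*} {m : MeasurableSpace Ω} [MeasurableSpace V]
    {X : ℝ → V → Ω → ℝ} {γ a b : ℝ} {f : ℝ → ℝ} (hf : Continuous f) (hab : a ≤ b)
    (hm : ∀ s ∈ Icc a b, Measurable fun p : V × Ω => rel γ X p.1 s p.2)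
    (hc : ∀ x ω, Continuous fun s => rel γ X x s ω) :
    MeasurableSet {p : V × Ω | p.2 ∈ below (rel γ X p.1) f a b} :=
  measurableSet_forall_le (Z := fun s (p : V × Ω) => rel γ X p.1 s p.2) hab hm
    (fun p => hc p.1 p.2) hf

theorem measurable_rel_aux {Ω V : Type*} {m : MeasurableSpace Ω} [MeasurableSpace V]
    {X : ℝ → V → Ω → ℝ} {γ s : ℝ} (h0 : Measurable fun p : V × Ω => X 0 p.1 p.2)
    (hs : Measurable fun p : V × Ω => X s p.1 p.2) :
    Measurable fun p : V × Ω => rel γ X p.1 s p.2 :=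
  (hs.sub h0).sub_const _

theorem measurable_mul_indicator_aux {Ω V : Type*} {m : MeasurableSpace Ω} [MeasurableSpace V]
    {F : V → Ω → ENNReal} {S : V → Set Ω} (hF : Measurable fun p : V × Ω => F p.1 p.2)
    (hS : MeasurableSet {p : V × Ω | p.2 ∈ S p.1}) :
    Measurable fun p : V × Ω => F p.1 p.2 * (S p.1).indicator 1 p.2 :=
  hF.mul ((measurable_one (α := ENNReal)).indicator hS)

theorem measurable_ofReal_sub_mul_aux {Ω V : Type*} {m : MeasurableSpace Ω} [MeasurableSpace V]
    {F : V → Ω → ENNReal} {Y : V → Ω → ℝ} {c : ℝ} (hF : Measurable fun p : V × Ω => F p.1 p.2)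
    (hY : Measurable fun p : V × Ω => Y p.1 p.2) :
    Measurable fun p : V × Ω => ofReal (c - Y p.1 p.2) * F p.1 p.2 :=
  (hY.const_sub c).ennreal_ofReal.mul hF

namespace IsStarField

variable {f g r : ℝ → ℝ} {u t c : ℝ} {ν : Measure V} [SFinite ν]

theorem measurable_diag (hX : IsStarField X k P) (ht : 0 ≤ t) : Measurable fun x => k t x x := by
  have := hX.isProbabilityMeasure
  have h : ∀ x, k t x x = ∫ ω, X t x ω ^ 2 ∂P := by
    intro x
    have h1 := hX.cov t t x x ht ht
    rw [min_self, covariance_self (hX.meas t x).aemeasurable,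
      variance_of_integral_eq_zero (hX.meas t x).aemeasurable (hX.mean t x ht)] at h1
    exact h1.symm
  simp only [h]
  exact (StronglyMeasurable.integral_prod_right
    ((hX.measurable_field' t).pow_const 2).stronglyMeasurable).measurable

theorem measurable_fieldσ_wt_joint (hX : IsStarField X k P) (ht : 0 ≤ t) :
    Measurable[(inferInstance : MeasurableSpace V).prod (fieldσ X t)]
      fun p : V × Ω => wt γ X k t p.1 p.2 :=
  measurable_wt_aux (hX.measurable_field ht le_rfl) (hX.measurable_diag ht)

theorem measurable_wt_joint (hX : IsStarField X k P) (ht : 0 ≤ t) :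
    Measurable fun p : V × Ω => wt γ X k t p.1 p.2 :=
  measurable_wt_aux (hX.measurable_field' t) (hX.measurable_diag ht)

theorem measurable_fieldσ_rel_joint (hX : IsStarField X k P) {s : ℝ} (hs : 0 ≤ s) (hst : s ≤ t) :
    Measurable[(inferInstance : MeasurableSpace V).prod (fieldσ X t)]
      fun p : V × Ω => rel γ X p.1 s p.2 :=
  measurable_rel_aux (hX.measurable_field le_rfl (hs.trans hst)) (hX.measurable_field hs hst)

theorem measurable_rel_joint (hX : IsStarField X k P) (s : ℝ) :
    Measurable fun p : V × Ω => rel γ X p.1 s p.2 :=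
  measurable_rel_aux (hX.measurable_field' 0) (hX.measurable_field' s)

theorem measurableSet_fieldσ_below_joint (hX : IsStarField X k P) (hf : Continuous f) (ht : 0 ≤ t) :
    MeasurableSet[(inferInstance : MeasurableSpace V).prod (fieldσ X t)]
      {p : V × Ω | p.2 ∈ below (rel γ X p.1) f 0 t} :=
  measurableSet_below_aux hf ht (fun _ hs => hX.measurable_fieldσ_rel_joint hs.1 hs.2)
    hX.continuous_rel

theorem measurableSet_below_joint (hX : IsStarField X k P) (hf : Continuous f) (hut : u ≤ t) :
    MeasurableSet {p : V × Ω | p.2 ∈ below (rel γ X p.1) f u t} :=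
  measurableSet_below_aux hf hut (fun s _ => hX.measurable_rel_joint s) hX.continuous_rel

theorem measurable_fieldσ_derivMass (hX : IsStarField X k P) (hf : Continuous f) (ht : 0 ≤ t) :
    Measurable[fieldσ X t] (derivMass γ X k ν f t) :=
  measurable_lintegral_left (measurable_ofReal_sub_mul_aux (Y := fun x ω => rel γ X x t ω)
    (F := fun x ω => wt γ X k t x ω * (below (rel γ X x) f 0 t).indicator 1 ω)
    (measurable_mul_indicator_aux (F := wt γ X k t) (S := fun x => below (rel γ X x) f 0 t)
    (hX.measurable_fieldσ_wt_joint ht) (hX.measurableSet_fieldσ_below_joint hf ht))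
    (hX.measurable_fieldσ_rel_joint ht le_rfl))

theorem measurable_truncWt_joint (hX : IsStarField X k P) (hf : Continuous f) (ht : 0 ≤ t) :
    Measurable fun p : V × Ω => wt γ X k t p.1 p.2 * (below (rel γ X p.1) f 0 t).indicator 1 p.2 :=
  measurable_mul_indicator_aux (F := wt γ X k t) (S := fun x => below (rel γ X x) f 0 t)
    (hX.measurable_wt_joint ht) (hX.measurableSet_below_joint hf ht)

theorem measurable_derivWt_joint (hX : IsStarField X k P) (hf : Continuous f) (ht : 0 ≤ t) :
    Measurable fun p : V × Ω => ofReal (f t - rel γ X p.1 t p.2) *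
      (wt γ X k t p.1 p.2 * (below (rel γ X p.1) f 0 t).indicator 1 p.2) :=
  measurable_ofReal_sub_mul_aux (Y := fun x ω => rel γ X x t ω)
    (F := fun x ω => wt γ X k t x ω * (below (rel γ X x) f 0 t).indicator 1 ω)
    (hX.measurable_truncWt_joint hf ht) (hX.measurable_rel_joint t)

theorem measurable_derivMass (hX : IsStarField X k P) (hf : Continuous f) (ht : 0 ≤ t) :
    Measurable (derivMass γ X k ν f t) :=
  measurable_lintegral_left (hX.measurable_derivWt_joint hf ht)

theorem measurable_truncMass (hX : IsStarField X k P) (hf : Continuous f) (ht : 0 ≤ t) :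
    Measurable (truncMass γ X k ν f t) :=
  measurable_lintegral_left (hX.measurable_truncWt_joint hf ht)

theorem measurable_keptWt_joint (hX : IsStarField X k P) (hf : Continuous f) (hg : Continuous g)
    (hu : 0 ≤ u) (hut : u ≤ t) : Measurable fun p : V × Ω => keptWt γ X k f g u t p.1 p.2 :=
  measurable_mul_indicator_aux (F := wt γ X k t)
    (S := fun x => below (rel γ X x) f 0 u ∩ below (rel γ X x) g u t)
    (hX.measurable_wt_joint (hu.trans hut))
    ((hX.measurableSet_below_joint hf hu).inter (hX.measurableSet_below_joint hg hut))

theorem measurable_keptMass (hX : IsStarField X k P) (hf : Continuous f) (hg : Continuous g)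
    (hu : 0 ≤ u) (hut : u ≤ t) : Measurable (keptMass γ X k ν f g u t) :=
  measurable_lintegral_left (hX.measurable_keptWt_joint hf hg hu hut)

theorem measurable_condWt_joint (hX : IsStarField X k P) (hf : Continuous f) (hg : Continuous g)
    (hu : 0 ≤ u) (hut : u ≤ t) : Measurable fun p : V × Ω => condWt γ X k P f g u t p.1 p.2 := by
  have h := (hX.measurable_stayProb (γ := γ) hg hut).comp
    (measurable_fst.prodMk (hX.measurable_rel_joint (γ := γ) u))
  exact (hX.measurable_truncWt_joint hf hu).mul h

theorem measurable_condMass (hX : IsStarField X k P) (hf : Continuous f) (hg : Continuous g)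
    (hu : 0 ≤ u) (hut : u ≤ t) : Measurable (condMass γ X k P ν f g u t) :=
  measurable_lintegral_left (hX.measurable_condWt_joint hf hg hu hut)

end IsStarField

/-- The constant in the first-moment bounds at a barrier. -/
noncomputable def barrierConst (f : ℝ → ℝ) (c : ℝ) : ℝ := 3 * exp (8 * c) * (f 2 + 8)

/-- The constant in the bound for surviving while leaving the corridor late. -/
noncomputable def lateConst (f r : ℝ → ℝ) (c : ℝ) : ℝ :=
  3 * exp (8 * c) * (2 * barrierConst f c * (corridorTail f r 0 + 9))

namespace IsStarField

variable {f g r : ℝ → ℝ} {u t c : ℝ}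

theorem lintegral_wt_mul_indicator {S : Set Ω} (hS : MeasurableSet S)
    (x : V) : ∫⁻ ω, wt γ X k t x ω * S.indicator 1 ω ∂P = P.withDensity (wt γ X k t x) S := by
  rw [withDensity_apply _ hS, ← lintegral_indicator hS]
  refine lintegral_congr fun ω => ?_
  by_cases h : ω ∈ S <;> simp [h]

theorem measurable_fieldσ_derivWt (hX : IsStarField X k P) (hf : Continuous f) (hu : 0 ≤ u)
    (x : V) : Measurable[fieldσ X u] fun ω => ofReal (f u - rel γ X x u ω) *
      (below (rel γ X x) f 0 u).indicator (1 : Ω → ENNReal) ω :=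
  (((measurable_fieldσ_rel γ X hu le_rfl x).const_sub (f u)).ennreal_ofReal).mul
    (measurable_const.indicator (hX.measurableSet_below_rel hf le_rfl hu le_rfl x))

theorem lintegral_derivWt_eq_gap (hX : IsStarField X k P) (hf : Continuous f) (hu : 0 ≤ u)
    (hut : u ≤ t) (x : V) : ∫⁻ ω, ofReal (f u - rel γ X x u ω) *
        (wt γ X k u x ω * (below (rel γ X x) f 0 u).indicator 1 ω) ∂P
      = gap (drifted γ X x t) (P.withDensity (wt γ X k t x)) f univ u := by
  have hS := hX.measurableSet_below_rel' (γ := γ) hf hu x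
  have hm := hX.measurable_fieldσ_derivWt (γ := γ) hf hu x
  have h := hX.lintegral_mul_wt (γ := γ) hu hut x hm
  have hm' : Measurable fun ω => ofReal (f u - rel γ X x u ω) *
      (below (rel γ X x) f 0 u).indicator (1 : Ω → ENNReal) ω := hm.mono (hX.fieldσ_le u) le_rfl
  calc _ = ∫⁻ ω, ofReal (f u - rel γ X x u ω) *
        (below (rel γ X x) f 0 u).indicator 1 ω * wt γ X k u x ω ∂P :=
        lintegral_congr fun ω => by ring
    _ = _ := h.symm
    _ = _ := by
        rw [gap, univ_inter, below_drifted γ X f 0 x hut, ← lintegral_indicator hS]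
        simp only [drifted_eq_rel γ X x hut]
        have e : (below (rel γ X x) f 0 u).indicator
              (fun ω => ofReal (f u - rel γ X x u ω)) = fun ω =>
            ofReal (f u - rel γ X x u ω) *
              (below (rel γ X x) f 0 u).indicator (1 : Ω → ENNReal) ω := by
          ext ω
          by_cases h : ω ∈ below (rel γ X x) f 0 u <;> simp [h]
        rw [e, lintegral_withDensity_eq_lintegral_mul _ (hX.measurable_wt t x) hm']
        exact lintegral_congr fun ω => by rw [Pi.mul_apply, mul_comm]

theorem keptWt_le_truncWt (hf : IsCorridor f r c) (x : V) (ω : Ω) :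
    keptWt γ X k f (fun s => -r s) u t x ω ≤
      wt γ X k t x ω * (below (rel γ X x) f 0 t).indicator 1 ω := by
  refine mul_le_mul_right (Set.indicator_le_indicator_of_subset ?_ (fun _ => zero_le) ω) _
  rintro ω ⟨h1, h2⟩ s hs
  rcases le_total s u with h | h
  · exact h1 s ⟨hs.1, h⟩
  · refine (h2 s ⟨h, hs.2⟩).trans ?_
    have := hf.nonneg s hs.1
    have := hf.upper.nonneg s hs.1
    simp only
    linarith

theorem truncWt_le_keptWt_add (hut : u ≤ t) (x : V) (ω : Ω) :
    wt γ X k t x ω * (below (rel γ X x) f 0 t).indicator 1 ω ≤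
      keptWt γ X k f g u t x ω + wt γ X k t x ω *
        (below (rel γ X x) f 0 t \ below (rel γ X x) g u t).indicator 1 ω := by
  rw [keptWt, ← mul_add]
  refine mul_le_mul_right ?_ _
  by_cases h : ω ∈ below (rel γ X x) f 0 t
  · by_cases h2 : ω ∈ below (rel γ X x) g u t
    · have h3 : ω ∈ below (rel γ X x) f 0 u ∩ below (rel γ X x) g u t :=
        ⟨fun s hs => h s ⟨hs.1, hs.2.trans hut⟩, h2⟩
      rw [indicator_of_mem h, indicator_of_mem h3]
      exact le_self_add
    · have h3 : ω ∈ below (rel γ X x) f 0 t \ below (rel γ X x) g u t := ⟨h, h2⟩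
      rw [indicator_of_mem h, indicator_of_mem h3]
      exact le_add_self
  · rw [indicator_of_notMem h]
    exact zero_le

theorem sqrt_pi_mul (t : ℝ) : √(π * t / 2) = √(π / 2) * √t := by
  rw [← sqrt_mul (by positivity)]
  congr 1
  ring

theorem lintegral_truncWt_le_keptWt (hX : IsStarField X k P) (hf : IsCorridor f r c) {n : ℕ}
    (hn : 2 ≤ n) (hu : 2 ^ n ≤ u) (hut : u ≤ t) (x : V) : ofReal √(π * t / 2) *
        ∫⁻ ω, wt γ X k t x ω * (below (rel γ X x) f 0 t).indicator 1 ω ∂P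
      ≤ ofReal √(π * t / 2) * ∫⁻ ω, keptWt γ X k f (fun s => -r s) u t x ω ∂P +
        ofReal (√(π / 2) * (lateConst f r c * corridorTail f r n)) := by
  have hu0 : 0 ≤ u := le_trans (by positivity) hu
  have ht := hu0.trans hut
  have hS : MeasurableSet (below (rel γ X x) f 0 t \ below (rel γ X x) (fun s => -r s) u t) :=
    (hX.measurableSet_below_rel' hf.upper.cont ht x).diff
      (hX.measurableSet_below_rel' hf.cont.neg hut x)
  have hm : Measurable fun ω => wt γ X k t x ω * (below (rel γ X x) f 0 t \
      below (rel γ X x) (fun s => -r s) u t).indicator (1 : Ω → ENNReal) ω :=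
    (hX.measurable_wt t x).mul (measurable_one.indicator hS)
  have h1 := lintegral_mono (μ := P) fun ω =>
    truncWt_le_keptWt_add (X := X) (γ := γ) (k := k) (f := f) (g := fun s => -r s) hut x ω
  rw [lintegral_add_right _ hm, lintegral_wt_mul_indicator hS] at h1
  have hQ := hX.isProbabilityMeasure_tilt (γ := γ) ht x
  have h2 := (hX.isBMF_tilt (γ := γ) ht x).survival_late_le hf hn hu hut
  rw [below_drifted γ X f 0 x le_rfl, below_drifted γ X _ u x le_rfl] at h2
  calc _ ≤ _ := mul_le_mul_right h1 _
    _ = _ := mul_add _ _ _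
    _ ≤ _ := by
      refine add_le_add_right ?_ _
      rw [sqrt_pi_mul t, ofReal_mul (sqrt_nonneg _), mul_assoc, ofReal_mul (sqrt_nonneg _)]
      exact mul_le_mul_right h2 _

theorem lintegral_derivWt_le_truncWt (hX : IsStarField X k P) (hf : IsBarrier f c) (hu : 0 < u)
    (hut : u < t) (x : V) : ∫⁻ ω, ofReal (f u - rel γ X x u ω) *
        (wt γ X k u x ω * (below (rel γ X x) f 0 u).indicator 1 ω) ∂P ≤ ofReal √(π * t / 2) *
        ∫⁻ ω, wt γ X k t x ω * (below (rel γ X x) f 0 t).indicator 1 ω ∂P +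
        ofReal ((1 + 8 * f u ^ 4 + 768 * u ^ 2) / (2 * (t - u))) := by
  have ht := hu.le.trans hut.le
  rw [hX.lintegral_derivWt_eq_gap hf.cont hu.le hut.le, lintegral_wt_mul_indicator
    (hX.measurableSet_below_rel' hf.cont ht x), ← below_drifted γ X f 0 x le_rfl]
  have hQ := hX.isProbabilityMeasure_tilt (γ := γ) ht x
  exact (hX.isBMF_tilt (γ := γ) ht x).gap_le_survival hf hu hut

theorem lintegral_derivWt_le (hX : IsStarField X k P) (hf : IsBarrier f c) (ht : 1 ≤ t) (x : V) :
    ∫⁻ ω, ofReal (f t - rel γ X x t ω) *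
        (wt γ X k t x ω * (below (rel γ X x) f 0 t).indicator 1 ω) ∂P
      ≤ ofReal (barrierConst f c) := by
  have ht0 : 0 ≤ t := by linarith
  have hQ := hX.isProbabilityMeasure_tilt (γ := γ) ht0 x
  rw [hX.lintegral_derivWt_eq_gap hf.cont ht0 le_rfl]
  exact le_self_add.trans ((hX.isBMF_tilt (γ := γ) ht0 x).gap_add_le hf ht)

theorem condWt_le_derivWt (hX : IsStarField X k P) (hf : IsCorridor f r c) (hu : 0 ≤ u)
    (hut : u < t) (x : V) (ω : Ω) : ofReal √(π * t / 2) * condWt γ X k P f (fun s => -r s) u t x ω ≤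
      ofReal √(t / (t - u)) * (ofReal (f u - rel γ X x u ω) *
        (wt γ X k u x ω * (below (rel γ X x) f 0 u).indicator 1 ω)) := by
  have htu := sub_pos.2 hut
  have h := hX.stayProb_le (γ := γ) hf.cont.neg hu hut x
    (fun s hs => neg_nonpos.2 (hf.nonneg s (hu.trans hs.1))) (rel γ X x u ω)
  have h2 : ofReal (-rel γ X x u ω) ≤ ofReal (f u - rel γ X x u ω) :=
    ofReal_le_ofReal (by linarith [hf.upper.nonneg u hu])
  have h3 : ofReal √(π * t / 2) * ofReal √(2 / (π * (t - u))) =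
      ofReal √(t / (t - u)) := by
    rw [← ofReal_mul (sqrt_nonneg _), ← sqrt_mul (by have := hu.trans hut.le; positivity)]
    congr 2
    field_simp
  rw [condWt, ← h3]
  calc _ ≤ ofReal √(π * t / 2) * (wt γ X k u x ω *
        (below (rel γ X x) f 0 u).indicator 1 ω * (ofReal √(2 / (π * (t - u))) *
          ofReal (f u - rel γ X x u ω))) := by
        gcongr
        exact h.trans (mul_le_mul_right h2 _)
    _ = _ := by ring

theorem condWt_mul_condWt_le (hX : IsStarField X k P) (hγ : 0 ≤ γ) (hu : 0 ≤ u)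
    (hut : u ≤ t) (x y : V) (ω : Ω) : condWt γ X k P f g u t x ω * condWt γ X k P f g u t y ω ≤
      ofReal (exp (γ * f u)) * (wt γ X k u x ω * wt γ X k u y ω *
        ofReal (exp (-(γ * rel γ X x u ω)))) := by
  have h1 := hX.stayProb_le_one (γ := γ) (g := g) hu hut
  by_cases h : ω ∈ below (rel γ X x) f 0 u
  · have h2 : (1 : ENNReal) ≤ ofReal (exp (γ * f u)) *
        ofReal (exp (-(γ * rel γ X x u ω))) := by
      rw [← ofReal_mul (exp_pos _).le, ← exp_add, ← ofReal_one]
      refine ofReal_le_ofReal (one_le_exp ?_)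
      have := h u ⟨hu, le_rfl⟩
      nlinarith
    have h3 : ∀ z, condWt γ X k P f g u t z ω ≤ wt γ X k u z ω := fun z =>
      (mul_le_of_le_one_right' (h1 z _)).trans
        (mul_le_of_le_one_right' (indicator_le_self' (by simp) _))
    calc _ ≤ wt γ X k u x ω * wt γ X k u y ω * 1 := by
          rw [mul_one]; exact mul_le_mul' (h3 x) (h3 y)
      _ ≤ wt γ X k u x ω * wt γ X k u y ω * _ := mul_le_mul_right h2 _
      _ = _ := by ring
  · simp [condWt, indicator_of_notMem h]

end IsStarField

theorem lintegral_mul_lintegral_swap {Ω V : Type*} {mΩ : MeasurableSpace Ω} [MeasurableSpace V]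
    {P : Measure Ω} {ν : Measure V} [SFinite ν] [SFinite P] {F G : V → Ω → ENNReal}
    (hF : Measurable fun p : V × Ω => F p.1 p.2) (hG : Measurable fun p : V × Ω => G p.1 p.2) :
    ∫⁻ ω, (∫⁻ x, F x ω ∂ν) * (∫⁻ x, G x ω ∂ν) ∂P
      = ∫⁻ p, ∫⁻ ω, F p.1 ω * G p.2 ω ∂P ∂(ν.prod ν) := by
  have hF' : Measurable fun q : (V × V) × Ω => F q.1.1 q.2 :=
    hF.comp ((measurable_fst.comp measurable_fst).prodMk measurable_snd)
  have hG' : Measurable fun q : (V × V) × Ω => G q.1.2 q.2 :=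
    hG.comp ((measurable_snd.comp measurable_fst).prodMk measurable_snd)
  rw [lintegral_lintegral_swap (hF'.mul hG').aemeasurable]
  refine lintegral_congr fun ω => ?_
  exact (lintegral_prod_mul (hF.comp measurable_prodMk_right).aemeasurable
    (hG.comp measurable_prodMk_right).aemeasurable).symm

/-- The near-diagonal part of an integrable interaction vanishes in the limit. -/
theorem tendsto_lintegral_near_diagonal {V : Type*} [NormedAddCommGroup V] [MeasurableSpace V]
    [BorelSpace V] [SecondCountableTopology V] {ν : Measure V} [IsFiniteMeasure ν] [NullSingletonClass ν]
    {h : V × V → ENNReal} (hh : ∫⁻ p, h p ∂(ν.prod ν) ≠ ⊤) :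
    Tendsto (fun u : ℝ => ∫⁻ p in {p : V × V | ‖p.1 - p.2‖ ≤ exp (-u)}, h p ∂(ν.prod ν))
      atTop (nhds 0) := by
  refine tendsto_setLIntegral_zero hh ?_
  have hdiag : (ν.prod ν) {p : V × V | ‖p.1 - p.2‖ ≤ 0} = 0 := by
    rw [Measure.prod_apply (measurableSet_le (by fun_prop) measurable_const),
      lintegral_eq_zero_iff' (by
        exact (measurable_measure_prodMk_left
          (measurableSet_le (by fun_prop) measurable_const)).aemeasurable)]
    refine Eventually.of_forall fun x => ?_
    have : (Prod.mk x ⁻¹' {p : V × V | ‖p.1 - p.2‖ ≤ 0}) = {x} := by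
      ext y
      simp [sub_eq_zero, eq_comm]
    show ν (Prod.mk x ⁻¹' {p : V × V | ‖p.1 - p.2‖ ≤ 0}) = 0
    rw [this, measure_singleton]
  have hmeas : ∀ a : ℝ, MeasurableSet {p : V × V | ‖p.1 - p.2‖ ≤ a} := fun a =>
    measurableSet_le (by fun_prop) measurable_const
  have key := tendsto_measure_biInter_gt (μ := ν.prod ν) (s := fun a : ℝ =>
    {p : V × V | ‖p.1 - p.2‖ ≤ a}) (a := 0) (fun a _ => (hmeas a).nullMeasurableSet)
    (fun i j _ hij p hp => le_trans hp hij) ⟨1, one_pos, measure_ne_top _ _⟩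
  have hI : (⋂ a > (0 : ℝ), {p : V × V | ‖p.1 - p.2‖ ≤ a}) = {p : V × V | ‖p.1 - p.2‖ ≤ 0} := by
    ext p
    simp only [mem_iInter, mem_ofPred_eq]
    exact ⟨fun h => le_of_forall_pos_le_add fun ε hε => by simpa using h ε hε,
      fun h a ha => h.trans ha.le⟩
  rw [hI, hdiag] at key
  refine key.comp (tendsto_nhdsWithin_iff.2 ⟨?_, Eventually.of_forall fun u => exp_pos _⟩)
  exact tendsto_exp_neg_atTop_nhds_zero

namespace IsStarField

variable {f g r : ℝ → ℝ} {u t c : ℝ} {ν : Measure V} [IsFiniteMeasure ν]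

theorem lintegral_truncMass (hX : IsStarField X k P) (hf : Continuous f) (ht : 0 ≤ t) :
    ∫⁻ ω, truncMass γ X k ν f t ω ∂P =
      ∫⁻ x, ∫⁻ ω, wt γ X k t x ω * (below (rel γ X x) f 0 t).indicator 1 ω ∂P ∂ν := by
  have := hX.isProbabilityMeasure
  exact (lintegral_lintegral_swap (hX.measurable_truncWt_joint hf ht).aemeasurable).symm

theorem lintegral_derivMass (hX : IsStarField X k P) (hf : Continuous f) (ht : 0 ≤ t) :
    ∫⁻ ω, derivMass γ X k ν f t ω ∂P = ∫⁻ x, ∫⁻ ω, ofReal (f t - rel γ X x t ω) *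
        (wt γ X k t x ω * (below (rel γ X x) f 0 t).indicator 1 ω) ∂P ∂ν := by
  have := hX.isProbabilityMeasure
  exact (lintegral_lintegral_swap (hX.measurable_derivWt_joint hf ht).aemeasurable).symm

theorem lintegral_keptMass (hX : IsStarField X k P) (hf : Continuous f) (hg : Continuous g)
    (hu : 0 ≤ u) (hut : u ≤ t) :
    ∫⁻ ω, keptMass γ X k ν f g u t ω ∂P = ∫⁻ x, ∫⁻ ω, keptWt γ X k f g u t x ω ∂P ∂ν := by
  have := hX.isProbabilityMeasure
  exact (lintegral_lintegral_swap (hX.measurable_keptWt_joint hf hg hu hut).aemeasurable).symm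

theorem lintegral_keptMass_eq_condMass (hX : IsStarField X k P) (hf : Continuous f)
    (hg : Continuous g) (hu : 0 ≤ u) (hut : u ≤ t) :
    ∫⁻ ω, keptMass γ X k ν f g u t ω ∂P = ∫⁻ ω, condMass γ X k P ν f g u t ω ∂P := by
  have := hX.isProbabilityMeasure
  rw [hX.lintegral_keptMass hf hg hu hut]
  refine Eq.trans (lintegral_congr fun x => ?_)
    (lintegral_lintegral_swap (hX.measurable_condWt_joint hf hg hu hut).aemeasurable)
  simpa using hX.lintegral_mul_keptWt (γ := γ) hf hg hu hut x (U := fun _ => 1) measurable_const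

theorem lintegral_keptMass_le (hX : IsStarField X k P) (hf : Continuous f)
    (hg : Continuous g) (hu : 0 ≤ u) (hut : u ≤ t) :
    ∫⁻ ω, keptMass γ X k ν f g u t ω ∂P ≤ ν univ := by
  rw [hX.lintegral_keptMass hf hg hu hut, ← lintegral_one]
  refine lintegral_mono fun x => ?_
  rw [← hX.lintegral_wt (γ := γ) (hu.trans hut) x]
  exact lintegral_mono fun ω => mul_le_of_le_one_right' (indicator_le_self' (by simp) _)

theorem lintegral_derivMass_le (hX : IsStarField X k P) (hf : IsBarrier f c) (ht : 1 ≤ t) :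
    ∫⁻ ω, derivMass γ X k ν f t ω ∂P ≤ ofReal (barrierConst f c) * ν univ := by
  rw [hX.lintegral_derivMass hf.cont (by linarith), ← lintegral_const]
  exact lintegral_mono fun x => hX.lintegral_derivWt_le hf ht x

theorem lintegral_truncMass_le_keptMass (hX : IsStarField X k P) (hf : IsCorridor f r c) {n : ℕ}
    (hn : 2 ≤ n) (hu : 2 ^ n ≤ u) (hut : u ≤ t) :
    ofReal √(π * t / 2) * ∫⁻ ω, truncMass γ X k ν f t ω ∂P
      ≤ ofReal √(π * t / 2) * ∫⁻ ω, keptMass γ X k ν f (fun s => -r s) u t ω ∂P +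
        ofReal (√(π / 2) * (lateConst f r c * corridorTail f r n)) * ν univ := by
  have hu0 : 0 ≤ u := le_trans (by positivity) hu
  rw [hX.lintegral_truncMass hf.upper.cont (hu0.trans hut),
    hX.lintegral_keptMass (g := fun s => -r s) hf.upper.cont hf.cont.neg hu0 hut, ← lintegral_const,
    ← lintegral_const_mul' _ _ ofReal_ne_top, ← lintegral_const_mul' _ _ ofReal_ne_top,
    ← lintegral_add_right _ measurable_const]
  exact lintegral_mono fun x => hX.lintegral_truncWt_le_keptWt hf hn hu hut x

theorem lintegral_derivMass_le_truncMass (hX : IsStarField X k P) (hf : IsBarrier f c) (hu : 0 < u)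
    (hut : u < t) : ∫⁻ ω, derivMass γ X k ν f u ω ∂P
      ≤ ofReal √(π * t / 2) * ∫⁻ ω, truncMass γ X k ν f t ω ∂P +
        ofReal ((1 + 8 * f u ^ 4 + 768 * u ^ 2) / (2 * (t - u))) * ν univ := by
  rw [hX.lintegral_truncMass hf.cont (hu.le.trans hut.le), hX.lintegral_derivMass hf.cont hu.le,
    ← lintegral_const, ← lintegral_const_mul' _ _ ofReal_ne_top,
    ← lintegral_add_right _ measurable_const]
  exact lintegral_mono fun x => hX.lintegral_derivWt_le_truncWt hf hu hut x

theorem keptMass_le_truncMass (hf : IsCorridor f r c) (ω : Ω) :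
    keptMass γ X k ν f (fun s => -r s) u t ω ≤ truncMass γ X k ν f t ω :=
  lintegral_mono fun x => keptWt_le_truncWt hf x ω

theorem close_truncMass_keptMass (hX : IsStarField X k P) (hf : IsCorridor f r c) {n : ℕ}
    (hn : 2 ≤ n) (hu : 2 ^ n ≤ u) (hut : u ≤ t) :
    Close P (ofReal (√(π / 2) * (lateConst f r c * corridorTail f r n)) * ν univ)
      (fun ω => ofReal √(π * t / 2) * truncMass γ X k ν f t ω)
      (fun ω => ofReal √(π * t / 2) * keptMass γ X k ν f (fun s => -r s) u t ω) := by
  have hu0 : 0 ≤ u := le_trans (by positivity) hu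
  refine Close.symm (Close.of_le (fun ω => mul_le_mul_right (keptMass_le_truncMass hf ω) _) ?_ ?_)
  · rw [lintegral_const_mul' _ _ ofReal_ne_top]
    exact ENNReal.mul_ne_top ofReal_ne_top (ne_top_of_le_ne_top (measure_ne_top ν _)
      (hX.lintegral_keptMass_le hf.upper.cont hf.cont.neg hu0 hut))
  · rw [lintegral_const_mul' _ _ ofReal_ne_top, lintegral_const_mul' _ _ ofReal_ne_top]
    exact hX.lintegral_truncMass_le_keptMass hf hn hu hut

theorem close_keptMass_condMass (hX : IsStarField X k P) (hγ : 0 ≤ γ) (hf : Continuous f)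
    (hg : Continuous g) {κ₀ : ℝ} (hκ : ∀ᵐ p ∂(ν.prod ν), k 0 p.1 p.2 ≤ κ₀) {h : V × V → ENNReal}
    (hu : 0 ≤ u) (hut : u ≤ t)
    (hnear : ∀ᵐ p ∂(ν.prod ν), ‖p.1 - p.2‖ ≤ exp (-u) → ofReal (π * t / 2) *
      ∫⁻ ω, keptWt γ X k f g u t p.1 ω * keptWt γ X k f g u t p.2 ω ∂P ≤ h p)
    {s : NNReal} (hs : 0 < s)
    (hη : ∫⁻ p in {p : V × V | ‖p.1 - p.2‖ ≤ exp (-u)}, h p ∂(ν.prod ν) ≤ s ^ 2) :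
    Close P s (fun ω => ofReal √(π * t / 2) * keptMass γ X k ν f g u t ω)
      (fun ω => ofReal √(π * t / 2) * condMass γ X k P ν f g u t ω) := by
  have := hX.isProbabilityMeasure
  have ht := hu.trans hut
  have mK := hX.measurable_keptMass (γ := γ) (ν := ν) hf hg hu hut
  have mC := hX.measurable_condMass (γ := γ) (ν := ν) hf hg hu hut
  have jK := hX.measurable_keptWt_joint (γ := γ) hf hg hu hut
  have jC := hX.measurable_condWt_joint (γ := γ) hf hg hu hut
  set a : ENNReal := ofReal √(π * t / 2) with ha
  have ha2 : a ^ 2 = ofReal (π * t / 2) := by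
    rw [ha, ← ofReal_pow (sqrt_nonneg _), sq_sqrt (by positivity)]
  have hatop : a ^ 2 ≠ ⊤ := by rw [ha2]; exact ofReal_ne_top
  have e : ∀ F G : Ω → ENNReal, ∫⁻ ω, a * F ω * (a * G ω) ∂P = a ^ 2 * ∫⁻ ω, F ω * G ω ∂P := by
    intro F G
    rw [← lintegral_const_mul' _ _ hatop]
    exact lintegral_congr fun ω => by ring
  have hCC : ∫⁻ ω, condMass γ X k P ν f g u t ω * condMass γ X k P ν f g u t ω ∂P =
      ∫⁻ p, ∫⁻ ω, condWt γ X k P f g u t p.1 ω * condWt γ X k P f g u t p.2 ω ∂P ∂(ν.prod ν) :=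
    lintegral_mul_lintegral_swap jC jC
  have hKK : ∫⁻ ω, keptMass γ X k ν f g u t ω * keptMass γ X k ν f g u t ω ∂P =
      ∫⁻ p, ∫⁻ ω, keptWt γ X k f g u t p.1 ω * keptWt γ X k f g u t p.2 ω ∂P ∂(ν.prod ν) :=
    lintegral_mul_lintegral_swap jK jK
  refine Close.of_sq hs hη (mK.const_mul a) (mC.const_mul a) ?_ ?_ ?_
  · simp only [pow_two (a * _), e]
    refine ENNReal.mul_ne_top hatop ?_
    rw [hCC]
    have hb : ∀ᵐ p ∂(ν.prod ν), ∫⁻ ω, condWt γ X k P f g u t p.1 ω *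
        condWt γ X k P f g u t p.2 ω ∂P ≤ ofReal (exp (γ * f u)) *
          ofReal (exp (γ ^ 2 * κ₀ + γ ^ 2 / 2 * u)) := by
      filter_upwards [hκ] with p hp
      refine (lintegral_mono fun ω => hX.condWt_mul_condWt_le hγ hu hut _ _ ω).trans ?_
      rw [lintegral_const_mul' _ _ ofReal_ne_top, hX.lintegral_wt_mul_wt_mul_exp hu le_rfl rfl]
      gcongr
    refine ne_top_of_le_ne_top ?_ (lintegral_mono_ae hb)
    rw [lintegral_const]
    exact ENNReal.mul_ne_top (ENNReal.mul_ne_top ofReal_ne_top ofReal_ne_top)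
      (measure_ne_top _ _)
  · simp only [pow_two (a * _), e]
    congr 1
    rw [hCC]
    have h1 : ∫⁻ ω, keptMass γ X k ν f g u t ω * condMass γ X k P ν f g u t ω ∂P =
        ∫⁻ p, ∫⁻ ω, keptWt γ X k f g u t p.1 ω * condWt γ X k P f g u t p.2 ω ∂P ∂(ν.prod ν) :=
      lintegral_mul_lintegral_swap jK jC
    rw [h1]
    refine lintegral_congr fun p => ?_
    have h2 := hX.lintegral_mul_keptWt (γ := γ) hf hg hu hut p.1
      (hX.measurable_condWt (γ := γ) hf hg hu hut p.2)
    simpa only [mul_comm] using h2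
  · simp only [pow_two (a * _), e]
    rw [hCC, hKK]
    set S : Set (V × V) := {p : V × V | ‖p.1 - p.2‖ ≤ exp (-u)} with hS
    have hSm : MeasurableSet S := measurableSet_le (by fun_prop) measurable_const
    rw [← lintegral_add_compl _ hSm, mul_add, add_comm]
    refine add_le_add ?_ ?_
    · refine mul_le_mul_right (le_trans (setLIntegral_mono' hSm.compl fun p hp => ?_)
        (setLIntegral_le_lintegral _ _)) _
      refine (hX.lintegral_keptWt_mul_keptWt hf hg hu hut ?_).le
      rw [norm_sub_rev]
      exact (not_le.1 (show ¬ ‖p.1 - p.2‖ ≤ exp (-u) from hp)).le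
    · rw [← lintegral_const_mul' _ _ hatop, ha2]
      refine lintegral_mono_ae ?_
      rw [ae_restrict_iff' hSm]
      exact hnear

theorem close_condMass_derivMass (hX : IsStarField X k P) (hf : IsCorridor f r c) {n : ℕ}
    (hn : 2 ≤ n) (hu : 2 ^ n ≤ u) (hut : u < t) :
    Close P (ofReal (√(π / 2) * (lateConst f r c * corridorTail f r n)) * ν univ +
        ofReal ((1 + 8 * f u ^ 4 + 768 * u ^ 2) / (2 * (t - u))) * ν univ +
        ofReal (√(t / (t - u)) - 1) * (ofReal (barrierConst f c) * ν univ))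
      (fun ω => ofReal √(π * t / 2) * condMass γ X k P ν f (fun s => -r s) u t ω)
      (derivMass γ X k ν f u) := by
  have hu0 : 1 ≤ u := le_trans (one_le_pow₀ (by norm_num)) hu
  have hu1 : 0 ≤ u := by linarith
  have htu := sub_pos.2 hut
  refine Close.mono (Close.of_le_mul (b := ofReal (√(t / (t - u)) - 1)) (fun ω => ?_)
    (hX.measurable_derivMass hf.upper.cont hu1) ?_ ?_)
    (add_le_add_right (mul_le_mul_right (hX.lintegral_derivMass_le hf.upper hu0) _) _)
  · have h1 : (1 : ENNReal) + ofReal (√(t / (t - u)) - 1) =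
        ofReal √(t / (t - u)) := by
      have : 1 ≤ √(t / (t - u)) := by
        rw [one_le_sqrt, one_le_div htu]
        linarith
      rw [← ofReal_one, ← ofReal_add zero_le_one (by linarith), add_sub_cancel]
    rw [h1, condMass, derivMass, ← lintegral_const_mul' _ _ ofReal_ne_top,
      ← lintegral_const_mul' _ _ ofReal_ne_top]
    exact lintegral_mono fun x => hX.condWt_le_derivWt hf hu1 hut x ω
  · rw [lintegral_const_mul' _ _ ofReal_ne_top, ← hX.lintegral_keptMass_eq_condMass
      (g := fun s => -r s) hf.upper.cont hf.cont.neg hu1 hut.le]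
    exact ENNReal.mul_ne_top ofReal_ne_top (ne_top_of_le_ne_top (measure_ne_top ν _)
      (hX.lintegral_keptMass_le hf.upper.cont hf.cont.neg hu1 hut.le))
  · rw [lintegral_const_mul' _ _ ofReal_ne_top, ← hX.lintegral_keptMass_eq_condMass
      (g := fun s => -r s) hf.upper.cont hf.cont.neg hu1 hut.le, ← add_assoc]
    exact (hX.lintegral_derivMass_le_truncMass hf.upper (by linarith) hut).trans
      (add_le_add_left (hX.lintegral_truncMass_le_keptMass hf hn hu hut.le) _)

variable {f r : ℝ → ℝ} {c : ℝ} {ν : Measure V} [IsFiniteMeasure ν]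

/-- The rescaled critical mass is close to the derivative mass at an earlier, still large, time. -/
theorem eventually_close [NullSingletonClass ν] (hX : IsStarField X k P) (hγ : 0 ≤ γ)
    (hf : IsCorridor f r c) {κ₀ : ℝ} (hκ : ∀ᵐ p ∂(ν.prod ν), k 0 p.1 p.2 ≤ κ₀)
    {h : V × V → ENNReal} (hh : ∫⁻ p, h p ∂(ν.prod ν) ≠ ⊤)
    (hnear : ∀ u t, 1 ≤ u → u ≤ t → ∀ᵐ p ∂(ν.prod ν), ‖p.1 - p.2‖ ≤ exp (-u) →
      ofReal (π * t / 2) * ∫⁻ ω, keptWt γ X k f (fun s => -r s) u t p.1 ω *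
        keptWt γ X k f (fun s => -r s) u t p.2 ω ∂P ≤ h p) {ε : ENNReal} (hε : ε ≠ 0) :
    ∀ᶠ u in atTop, ∀ᶠ t in atTop, Close P ε (fun ω => ofReal √(π * t / 2) * truncMass γ X k ν f t ω)
      (derivMass γ X k ν f u) := by
  have h5 : ε / 5 ≠ 0 := by simp [hε]
  have hofReal : Tendsto ofReal (nhds 0) (nhds 0) := by
    simpa using continuous_ofReal.tendsto (0 : ℝ)
  have small : ∀ {g : ℝ → ℝ} {b : ENNReal}, b ≠ ⊤ → Tendsto g atTop (nhds 0) →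
      ∀ᶠ t in atTop, ofReal (g t) * b ≤ ε / 5 := by
    intro g b hb hg
    have : Tendsto (fun t => ofReal (g t) * b) atTop (nhds 0) := by
      simpa using ENNReal.Tendsto.mul_const (hofReal.comp hg) (Or.inr hb)
    exact this.eventually (ge_mem_nhds (pos_iff_ne_zero.2 h5))
  obtain ⟨s, hs0, hs⟩ := ENNReal.lt_iff_exists_nnreal_btwn.1 (pos_iff_ne_zero.2 h5)
  have hs0' : 0 < s := by exact_mod_cast hs0
  obtain ⟨n, hn2, hn⟩ : ∃ n : ℕ, 2 ≤ n ∧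
      ofReal (√(π / 2) * (lateConst f r c * corridorTail f r n)) * ν univ ≤ ε / 5 := by
    have h1 : Tendsto (fun n => √(π / 2) * (lateConst f r c * corridorTail f r n)) atTop (nhds 0) := by
      simpa using ((tendsto_corridorTail f r).const_mul (lateConst f r c)).const_mul √(π / 2)
    have h2 : Tendsto (fun n => ofReal (√(π / 2) * (lateConst f r c * corridorTail f r n)) *
        ν univ) atTop (nhds 0) := by
      simpa using ENNReal.Tendsto.mul_const (hofReal.comp h1) (Or.inr (measure_ne_top ν univ))
    exact ((eventually_ge_atTop 2).and (h2.eventually (ge_mem_nhds (pos_iff_ne_zero.2 h5)))).exists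
  have hη := (tendsto_lintegral_near_diagonal hh).eventually
    (ge_mem_nhds (show (0 : ENNReal) < (s : ENNReal) ^ 2 by positivity))
  filter_upwards [hη, eventually_ge_atTop ((2 : ℝ) ^ n)] with u hu hun
  have hu1 : 1 ≤ u := le_trans (one_le_pow₀ (by norm_num)) hun
  have t1 : Tendsto (fun t : ℝ => (1 + 8 * f u ^ 4 + 768 * u ^ 2) / (2 * (t - u))) atTop (nhds 0) :=
    Tendsto.div_atTop tendsto_const_nhds
      ((tendsto_atTop_add_const_right _ (-u) tendsto_id).const_mul_atTop (by norm_num : (0 : ℝ) < 2))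
  have t2 : Tendsto (fun t : ℝ => √(t / (t - u)) - 1) atTop (nhds 0) := by
    have h1 : Tendsto (fun t : ℝ => 1 + u / (t - u)) atTop (nhds (1 + 0)) :=
      (Tendsto.div_atTop tendsto_const_nhds
        (tendsto_atTop_add_const_right _ (-u) tendsto_id)).const_add 1
    have h2 : Tendsto (fun t : ℝ => √(t / (t - u)) - 1) atTop (nhds (√(1 + 0) - 1)) := by
      refine ((continuous_sqrt.tendsto _).comp h1 |>.congr' ?_).sub_const 1
      filter_upwards [eventually_gt_atTop u] with t ht
      have := sub_pos.2 ht
      simp only [Function.comp]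
      congr 1
      field_simp
      ring
    simpa using h2
  filter_upwards [eventually_gt_atTop u, small (measure_ne_top ν univ) t1,
    small (b := ofReal (barrierConst f c) * ν univ)
      (ENNReal.mul_ne_top ofReal_ne_top (measure_ne_top ν _)) t2] with t htu e1 e2
  refine (((hX.close_truncMass_keptMass hf hn2 hun htu.le).trans
    (hX.close_keptMass_condMass (g := fun s => -r s) hγ hf.upper.cont hf.cont.neg hκ (by linarith)
      htu.le (hnear u t hu1 htu.le) hs0' hu)).trans
    (hX.close_condMass_derivMass hf hn2 hun htu)).mono ?_
  calc _ ≤ ε / 5 + ε / 5 + (ε / 5 + ε / 5 + ε / 5) := by gcongr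
    _ = 5 * (ε / 5) := by ring
    _ = ε := ENNReal.mul_div_cancel (by norm_num) (by norm_num)

end IsStarField

/-- Nonnegative extended real submartingales on a half line. -/
structure IsPosSubmartingale (F : ℝ → MeasurableSpace Ω)
    (S : ℝ → Ω → ENNReal) (P : Measure Ω) : Prop where
  le : ∀ t, F t ≤ mΩ
  mono : Monotone F
  meas : ∀ t, 0 ≤ t → Measurable[F t] (S t)
  sub : ∀ s t, 0 ≤ s → s ≤ t → ∀ A, MeasurableSet[F s] A → ∫⁻ ω in A, S s ω ∂P ≤ ∫⁻ ω in A, S t ω ∂P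

section Discrete

variable {m : ℕ → MeasurableSpace Ω} {S : ℕ → Ω → ENNReal} {U : Ω → ENNReal} {c δ : ENNReal}

/-- Measurability of `{U ≤ V}` for an explicit σ-algebra. -/
theorem measurableSet_le_ennreal (m : MeasurableSpace Ω) {U V : Ω → ENNReal} (hU : Measurable[m] U)
    (hV : Measurable[m] V) : MeasurableSet[m] {ω | U ω ≤ V ω} := measurableSet_le hU hV

theorem measurable_add_const_ennreal (m : MeasurableSpace Ω) {U : Ω → ENNReal}
    (hU : Measurable[m] U) : Measurable[m] fun ω => U ω + c := hU.add_const c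

theorem setOf_exists_lt_succ (A : ℕ → Set Ω) (n : ℕ) :
    {ω | ∃ j < n + 1, ω ∈ A j} = {ω | ∃ j < n, ω ∈ A j} ∪ (A n \ {ω | ∃ j < n, ω ∈ A j}) := by
  rw [Set.union_sdiff_self]
  ext ω
  simp only [mem_ofPred_eq, mem_union, Nat.lt_succ_iff_lt_or_eq]
  constructor
  · rintro ⟨j, hj | rfl, h⟩
    · exact Or.inl ⟨j, hj, h⟩
    · exact Or.inr h
  · rintro (⟨j, hj, h⟩ | h)
    · exact ⟨j, Or.inl hj, h⟩
    · exact ⟨n, Or.inr rfl, h⟩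

theorem measurableSet_exists_lt (m : MeasurableSpace Ω) {A : ℕ → Set Ω} {n : ℕ}
    (hA : ∀ j < n, MeasurableSet[m] (A j)) : MeasurableSet[m] {ω | ∃ j < n, ω ∈ A j} := by
  have : {ω | ∃ j < n, ω ∈ A j} = ⋃ j : ℕ, ⋃ _ : j < n, A j := by
    ext ω; simp
  rw [this]
  exact MeasurableSet.iUnion fun j => MeasurableSet.iUnion fun hj => hA j hj

/-- A nonnegative submartingale in discrete time. -/
structure IsDiscreteSub (m : ℕ → MeasurableSpace Ω) (S : ℕ → Ω → ENNReal) (P : Measure Ω) :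
    Prop where
  le n : m n ≤ mΩ
  mono : Monotone m
  meas n : Measurable[m n] (S n)
  sub n A : MeasurableSet[m n] A → ∫⁻ ω in A, S n ω ∂P ≤ ∫⁻ ω in A, S (n + 1) ω ∂P

namespace IsDiscreteSub

theorem measurableSet_up (h : IsDiscreteSub m S P) (hU : Measurable[m 0] U) (n : ℕ) :
    MeasurableSet[m n] {ω | U ω + c ≤ S n ω} :=
  measurableSet_le_ennreal _ (measurable_add_const_ennreal _ (hU.mono (h.mono n.zero_le) le_rfl))
    (h.meas n)

theorem measurableSet_exists_up (h : IsDiscreteSub m S P) (hU : Measurable[m 0] U) (n : ℕ) :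
    MeasurableSet[m n] {ω | ∃ j < n, U ω + c ≤ S j ω} :=
  measurableSet_exists_lt (m n) (A := fun j => {ω | U ω + c ≤ S j ω}) fun j hj =>
    h.mono hj.le _ (h.measurableSet_up hU j)

theorem measurableSet_down (h : IsDiscreteSub m S P) (n : ℕ) :
    MeasurableSet[m (n + 1)] {ω | S (n + 1) ω + c ≤ S 0 ω} :=
  measurableSet_le_ennreal _ (measurable_add_const_ennreal _ (h.meas (n + 1)))
    ((h.meas 0).mono (h.mono (n + 1).zero_le) le_rfl)

theorem measurableSet_exists_down (h : IsDiscreteSub m S P) (n : ℕ) :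
    MeasurableSet[m n] {ω | ∃ j < n, S (j + 1) ω + c ≤ S 0 ω} :=
  measurableSet_exists_lt (m n) (A := fun j => {ω | S (j + 1) ω + c ≤ S 0 ω}) fun j hj =>
    h.mono hj _ (h.measurableSet_down j)

theorem setLIntegral_first_up (h : IsDiscreteSub m S P) (hU : Measurable[m 0] U) (n : ℕ) :
    ∫⁻ ω in {ω | ∃ j < n, U ω + c ≤ S j ω}, (U ω + c) ∂P
      ≤ ∫⁻ ω in {ω | ∃ j < n, U ω + c ≤ S j ω}, S n ω ∂P := by
  induction n with
  | zero => simp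
  | succ n ih =>
    have e := setOf_exists_lt_succ (fun j => {ω | U ω + c ≤ S j ω}) n
    simp only [mem_ofPred_eq] at e
    have hB := h.measurableSet_exists_up (c := c) hU n
    set B : Set Ω := {ω | ∃ j < n, U ω + c ≤ S j ω}
    have hAB : MeasurableSet[m n] ({ω | U ω + c ≤ S n ω} \ B) := (h.measurableSet_up hU n).diff hB
    have hd : Disjoint B ({ω | U ω + c ≤ S n ω} \ B) := disjoint_sdiff_right
    rw [e]
    refine le_trans ?_ (h.sub n _ (hB.union hAB))
    rw [lintegral_union (h.le n _ hAB) hd, lintegral_union (h.le n _ hAB) hd]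
    exact add_le_add ih (setLIntegral_mono' (h.le n _ hAB) fun ω hω => hω.1)

theorem setLIntegral_first_down (h : IsDiscreteSub m S P) (n : ℕ) :
    ∫⁻ ω, S 0 ω ∂P + c * P {ω | ∃ j < n, S (j + 1) ω + c ≤ S 0 ω}
      ≤ ∫⁻ ω in {ω | ∃ j < n, S (j + 1) ω + c ≤ S 0 ω}, S 0 ω ∂P +
        ∫⁻ ω in {ω | ∃ j < n, S (j + 1) ω + c ≤ S 0 ω}ᶜ, S n ω ∂P := by
  induction n with
  | zero => simp
  | succ n ih =>
    have e := setOf_exists_lt_succ (fun j => {ω | S (j + 1) ω + c ≤ S 0 ω}) n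
    simp only [mem_ofPred_eq] at e
    have hB := h.measurableSet_exists_down (c := c) n
    have hB' := h.le _ _ hB
    set B : Set Ω := {ω | ∃ j < n, S (j + 1) ω + c ≤ S 0 ω}
    set A : Set Ω := {ω | S (n + 1) ω + c ≤ S 0 ω} \ B
    have hAB : MeasurableSet A := (h.le _ _ (h.measurableSet_down n)).diff hB'
    have hd : Disjoint B A := disjoint_sdiff_right
    rw [e, measure_union hd hAB, lintegral_union hAB hd]
    have h1 : ∫⁻ ω in Bᶜ, S n ω ∂P ≤ ∫⁻ ω in A, S (n + 1) ω ∂P + ∫⁻ ω in (B ∪ A)ᶜ, S (n + 1) ω ∂P := by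
      refine (h.sub n _ hB.compl).trans_eq ?_
      have hsplit : Bᶜ = A ∪ (B ∪ A)ᶜ := by
        ext ω
        by_cases hb : ω ∈ B <;> by_cases ha : ω ∈ A
        · exact absurd ha (Set.disjoint_left.1 hd hb)
        all_goals simp [ha, hb]
      conv_lhs => rw [hsplit]
      exact lintegral_union (hB'.union hAB).compl (Set.disjoint_left.2 fun ω ha hn => hn (Or.inr ha))
    have h2 : ∫⁻ ω in A, S (n + 1) ω ∂P + c * P A ≤ ∫⁻ ω in A, S 0 ω ∂P := by
      rw [← setLIntegral_const, ← lintegral_add_right _ measurable_const]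
      exact setLIntegral_mono' hAB fun ω hω => hω.1
    calc _ = (∫⁻ ω, S 0 ω ∂P + c * P B) + c * P A := by ring
      _ ≤ (∫⁻ ω in B, S 0 ω ∂P + (∫⁻ ω in A, S (n + 1) ω ∂P + ∫⁻ ω in (B ∪ A)ᶜ, S (n + 1) ω ∂P)) +
          c * P A := add_le_add_left (ih.trans (add_le_add_right h1 _)) _
      _ = ∫⁻ ω in B, S 0 ω ∂P + (∫⁻ ω in A, S (n + 1) ω ∂P + c * P A) +
          ∫⁻ ω in (B ∪ A)ᶜ, S (n + 1) ω ∂P := by ring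
      _ ≤ _ := by gcongr

theorem mul_measure_exists_le {A : ℕ → Set Ω} {c K : ENNReal}
    (h : ∀ n, c * P {ω | ∃ j < n, ω ∈ A j} ≤ K) : c * P {ω | ∃ j, ω ∈ A j} ≤ K := by
  have e : {ω | ∃ j, ω ∈ A j} = ⋃ n, {ω | ∃ j < n, ω ∈ A j} := by
    ext ω
    simp only [mem_ofPred_eq, mem_iUnion]
    exact ⟨fun ⟨j, hj⟩ => ⟨j + 1, j, j.lt_succ_self, hj⟩, fun ⟨_, j, _, hj⟩ => ⟨j, hj⟩⟩
  have hmon : Monotone fun n => {ω | ∃ j < n, ω ∈ A j} :=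
    fun a b hab ω ⟨j, hj, h⟩ => ⟨j, hj.trans_le hab, h⟩
  rw [e, hmon.measure_iUnion, ENNReal.mul_iSup]
  exact iSup_le h

/-- Doob's maximal inequality, relative to a reference variable. -/
theorem mul_measure_exists_up_le (h : IsDiscreteSub m S P) (hU : Measurable[m 0] U)
    (hUfin : ∫⁻ ω, U ω ∂P ≠ ⊤)
    (hδ : ∀ n A, MeasurableSet A → ∫⁻ ω in A, S n ω ∂P ≤ ∫⁻ ω in A, U ω ∂P + δ) :
    c * P {ω | ∃ j, U ω + c ≤ S j ω} ≤ δ := by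
  refine mul_measure_exists_le (A := fun j => {ω | U ω + c ≤ S j ω}) fun n => ?_
  have h' := (h.setLIntegral_first_up (c := c) hU n).trans
    (hδ n _ (h.le n _ (h.measurableSet_exists_up hU n)))
  rw [lintegral_add_right _ measurable_const, setLIntegral_const] at h'
  exact (ENNReal.add_le_add_iff_left
    (ne_top_of_le_ne_top hUfin (setLIntegral_le_lintegral _ _))).1 h'

theorem mul_measure_exists_down_le (h : IsDiscreteSub m S P) (hfin : ∫⁻ ω, S 0 ω ∂P ≠ ⊤)
    (hδ : ∀ n A, MeasurableSet A → ∫⁻ ω in A, S n ω ∂P ≤ ∫⁻ ω in A, S 0 ω ∂P + δ) :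
    c * P {ω | ∃ j, S (j + 1) ω + c ≤ S 0 ω} ≤ δ := by
  refine mul_measure_exists_le (A := fun j => {ω | S (j + 1) ω + c ≤ S 0 ω}) fun n => ?_
  have hB := h.le n _ (h.measurableSet_exists_down (c := c) n)
  have h' := (h.setLIntegral_first_down (c := c) n).trans (add_le_add_right (hδ n _ hB.compl) _)
  rw [← add_assoc, lintegral_add_compl _ hB] at h'
  exact (ENNReal.add_le_add_iff_left hfin).1 h'

end IsDiscreteSub

end Discrete

/-- An event which is open to the right in time is detected by fine grids. -/
theorem measure_exists_ge_le {G : Set Ω} {u : ℝ}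
    {p : ℝ → Ω → Prop} (hp : ∀ ω ∈ G, ∀ s, u ≤ s → p s ω → ∀ᶠ s' in nhdsWithin s (Ici s), p s' ω)
    {K : ENNReal} (h : ∀ δ : ℝ, 0 < δ → P {ω | ∃ j : ℕ, p (u + j * δ) ω} ≤ K) :
    P {ω | ω ∈ G ∧ ∃ s, u ≤ s ∧ p s ω} ≤ K := by
  set B : ℕ → Set Ω := fun n => {ω | ∃ j : ℕ, p (u + j * (1 / ((n : ℝ) + 1))) ω} with hB
  have hsub : {ω | ω ∈ G ∧ ∃ s, u ≤ s ∧ p s ω} ⊆ ⋃ N, ⋂ n ≥ N, B n := by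
    rintro ω ⟨hω, s, hs, hps⟩
    obtain ⟨ε, hε, hball⟩ := Metric.mem_nhdsWithin_iff.1 (hp ω hω s hs hps)
    obtain ⟨N, hN⟩ := exists_nat_one_div_lt hε
    refine mem_iUnion.2 ⟨N, Set.mem_iInter₂.2 fun n hn => ?_⟩
    have hδ : (0 : ℝ) < 1 / ((n : ℝ) + 1) := by positivity
    have hδN : 1 / ((n : ℝ) + 1) ≤ 1 / ((N : ℝ) + 1) := by
      have : (N : ℝ) ≤ n := by exact_mod_cast hn
      gcongr
    refine ⟨⌈(s - u) / (1 / ((n : ℝ) + 1))⌉₊, ?_⟩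
    have h1 := Nat.le_ceil ((s - u) / (1 / ((n : ℝ) + 1)))
    have h2 := Nat.ceil_lt_add_one (a := (s - u) / (1 / ((n : ℝ) + 1))) (by
      have : 0 ≤ s - u := by linarith
      positivity)
    rw [div_le_iff₀ hδ] at h1
    have h3 : (⌈(s - u) / (1 / ((n : ℝ) + 1))⌉₊ : ℝ) * (1 / ((n : ℝ) + 1)) <
        s - u + 1 / ((n : ℝ) + 1) := by
      have := mul_lt_mul_of_pos_right h2 hδ
      rwa [add_mul, one_mul, div_mul_cancel₀ _ hδ.ne'] at this
    refine hball ⟨?_, ?_⟩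
    · rw [Metric.mem_ball, dist_eq, abs_lt]
      constructor <;> linarith
    · show s ≤ _
      linarith
  refine (measure_mono hsub).trans ?_
  have hmon : Monotone fun N => ⋂ n ≥ N, B n := fun a b hab ω hω =>
    Set.mem_iInter₂.2 fun n hn => Set.mem_iInter₂.1 hω n (le_trans hab hn)
  rw [hmon.measure_iUnion]
  refine iSup_le fun N => (measure_mono (Set.iInter₂_subset N le_rfl)).trans (h _ (by positivity))

namespace IsPosSubmartingale

variable {S : ℝ → Ω → ENNReal} {Z : ℝ → Ω → ℝ} {G : Set Ω} {u : ℝ}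

theorem grid (hS : IsPosSubmartingale F S P) (hu : 0 ≤ u) {δ : ℝ} (hδ : 0 < δ) :
    IsDiscreteSub (fun n : ℕ => F (u + n * δ)) (fun n => S (u + n * δ)) P := by
  refine ⟨fun n => hS.le _, fun a b hab => hS.mono ?_, fun n => hS.meas _ (by positivity),
    fun n A hA => hS.sub _ _ (by positivity) ?_ A hA⟩
  · have : (a : ℝ) ≤ b := by exact_mod_cast hab
    gcongr
  · gcongr
    exact n.le_succ

/-- Maximal inequality in continuous time. -/
theorem measure_exists_lt_le (hS : IsPosSubmartingale F S P) (hu : 0 ≤ u) {K : ENNReal}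
    (hK : ∀ t, u ≤ t → ∫⁻ ω, S t ω ∂P ≤ K) (hcont : ∀ ω ∈ G, Continuous fun s => Z s ω)
    (hZ : ∀ ω ∈ G, ∀ s, u ≤ s → S s ω = ofReal (Z s ω)) {c : ℝ} (hc : 0 < c) :
    P {ω | ω ∈ G ∧ ∃ s, u ≤ s ∧ c < Z s ω} ≤ K / ofReal c := by
  have hc' : ofReal c ≠ 0 := by simpa using hc
  refine (measure_mono (t := {ω | ω ∈ G ∧ ∃ s, u ≤ s ∧ ofReal c < S s ω}) ?_).trans ?_
  · rintro ω ⟨hω, s, hs, h⟩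
    refine ⟨hω, s, hs, ?_⟩
    rw [hZ ω hω s hs]
    exact (ofReal_lt_ofReal_iff (hc.trans h)).2 h
  refine measure_exists_ge_le (p := fun s ω => ofReal c < S s ω) ?_ fun δ hδ => ?_
  · intro ω hω s hs h
    rw [hZ ω hω s hs] at h
    have h1 : ∀ᶠ s' in nhds s, ofReal c < ofReal (Z s' ω) :=
      (continuous_ofReal.comp (hcont ω hω)).continuousAt.eventually (lt_mem_nhds h)
    filter_upwards [nhdsWithin_le_nhds h1, self_mem_nhdsWithin] with s' h2 h3
    rwa [hZ ω hω s' (hs.trans h3)]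
  · have h := (hS.grid hu hδ).mul_measure_exists_up_le (U := fun _ => 0) (c := ofReal c) (δ := K)
      measurable_const (by simp) (fun n A _ => (setLIntegral_le_lintegral _ _).trans
        ((hK _ (by nlinarith [show (0 : ℝ) ≤ n * δ by positivity])).trans le_add_self))
    rw [le_div_iff_mul_le (Or.inl hc') (Or.inl ofReal_ne_top), mul_comm]
    refine le_trans (mul_le_mul_right (measure_mono ?_) _) h
    rintro ω ⟨j, hj⟩
    exact ⟨j, by simpa using hj.le⟩

/-- Oscillations after time `u` are controlled by closeness to the value at time `u`. -/
theorem measure_exists_abs_lt_le (hS : IsPosSubmartingale F S P) (hu : 0 ≤ u) {δ : ENNReal}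
    (hfin : ∫⁻ ω, S u ω ∂P ≠ ⊤) (hδ : ∀ t, u ≤ t → Close P δ (S u) (S t))
    (hcont : ∀ ω ∈ G, Continuous fun s => Z s ω)
    (hZ : ∀ ω ∈ G, ∀ s, u ≤ s → 0 ≤ Z s ω ∧ S s ω = ofReal (Z s ω)) {c : ℝ} (hc : 0 < c) :
    P {ω | ω ∈ G ∧ ∃ s, u ≤ s ∧ c < |Z s ω - Z u ω|} ≤ 2 * δ / ofReal c := by
  have hc' : ofReal c ≠ 0 := by simpa using hc
  have hgu : ∀ {h : ℝ} (_ : 0 < h) (n : ℕ), u ≤ u + n * h := fun {h} hh n => by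
    nlinarith [show (0 : ℝ) ≤ n * h by positivity]
  have hup : P {ω | ω ∈ G ∧ ∃ s, u ≤ s ∧ (c < Z s ω - Z u ω ∧ S s ω = ofReal (Z s ω) ∧
      S u ω = ofReal (Z u ω) ∧ 0 ≤ Z u ω)} ≤ δ / ofReal c := by
    refine measure_exists_ge_le ?_ fun h hh => ?_
    · rintro ω hω s hs ⟨h1, -, h2⟩
      have h3 : ∀ᶠ s' in nhds s, c < Z s' ω - Z u ω :=
        ((hcont ω hω).sub continuous_const).continuousAt.eventually (lt_mem_nhds h1)
      filter_upwards [nhdsWithin_le_nhds h3, self_mem_nhdsWithin] with s' h4 h5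
      exact ⟨h4, (hZ ω hω s' (hs.trans h5)).2, h2⟩
    · have g := hS.grid hu hh
      have hm : Measurable[F (u + (0 : ℕ) * h)] (S u) := by
        simpa using g.meas 0
      have key := g.mul_measure_exists_up_le (c := ofReal c) hm hfin
        (fun n A hA => ((hδ _ (hgu hh n)) A hA).2)
      rw [le_div_iff_mul_le (Or.inl hc') (Or.inl ofReal_ne_top), mul_comm]
      refine le_trans (mul_le_mul_right (measure_mono ?_) _) key
      rintro ω ⟨j, hj, e1, e2, h0⟩
      refine ⟨j, ?_⟩
      rw [e1, e2, ← ofReal_add h0 hc.le]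
      exact ofReal_le_ofReal (by linarith)
  have hdown : P {ω | ω ∈ G ∧ ∃ s, u ≤ s ∧ (c < Z u ω - Z s ω ∧ S s ω = ofReal (Z s ω) ∧
      0 ≤ Z s ω ∧ S u ω = ofReal (Z u ω))} ≤ δ / ofReal c := by
    refine measure_exists_ge_le ?_ fun h hh => ?_
    · rintro ω hω s hs ⟨h1, -, -, h2⟩
      have h3 : ∀ᶠ s' in nhds s, c < Z u ω - Z s' ω :=
        (continuous_const.sub (hcont ω hω)).continuousAt.eventually (lt_mem_nhds h1)
      filter_upwards [nhdsWithin_le_nhds h3, self_mem_nhdsWithin] with s' h4 h5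
      exact ⟨h4, (hZ ω hω s' (hs.trans h5)).2, (hZ ω hω s' (hs.trans h5)).1, h2⟩
    · have e0 : S (u + (0 : ℕ) * h) = S u := by simp
      have key := (hS.grid hu hh).mul_measure_exists_down_le (c := ofReal c) (δ := δ) (by rwa [e0]) (fun n A hA => by
          rw [e0]
          exact ((hδ _ (hgu hh n)) A hA).2)
      rw [le_div_iff_mul_le (Or.inl hc') (Or.inl ofReal_ne_top), mul_comm]
      refine le_trans (mul_le_mul_right (measure_mono ?_) _) key
      rintro ω ⟨j, hj, e1, h0, e2⟩
      have hle : S (u + j * h) ω + ofReal c ≤ S u ω := by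
        rw [e1, e2, ← ofReal_add h0 hc.le]
        exact ofReal_le_ofReal (by linarith)
      cases j with
      | zero =>
        exfalso
        simp only [Nat.cast_zero, zero_mul, add_zero, sub_self] at hj
        linarith
      | succ j =>
        refine ⟨j, ?_⟩
        simp only [e0]
        exact hle
  calc _ ≤ _ := measure_mono (t := _ ∪ _) ?_
    _ ≤ _ := (measure_union_le _ _).trans (add_le_add hup hdown)
    _ = _ := by rw [← two_mul, mul_div_assoc]
  rintro ω ⟨hω, s, hs, h⟩
  have hs' := hZ ω hω s hs
  have hu' := hZ ω hω u le_rfl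
  rcases lt_abs.1 h with h | h
  · exact Or.inl ⟨hω, s, hs, h, hs'.2, hu'.2, hu'.1⟩
  · exact Or.inr ⟨hω, s, hs, by linarith, hs'.2, hs'.1, hu'.2⟩

/-- Almost sure convergence, along a continuous realization on an event. -/
theorem ae_tendsto (hS : IsPosSubmartingale F S P) (hfin : ∀ᶠ u in atTop, ∫⁻ ω, S u ω ∂P ≠ ⊤)
    (hδ : ∀ δ : ENNReal, δ ≠ 0 → ∀ᶠ u in atTop, ∀ t, u ≤ t → Close P δ (S u) (S t))
    (hcont : ∀ ω ∈ G, Continuous fun s => Z s ω)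
    (hZ : ∀ ω ∈ G, ∀ s, 0 ≤ s → 0 ≤ Z s ω ∧ S s ω = ofReal (Z s ω)) :
    ∀ᵐ ω ∂P, ω ∈ G → ∃ l, Tendsto (fun t => Z t ω) atTop (nhds l) := by
  have key : ∀ n : ℕ, ∀ᵐ ω ∂P, ω ∈ G → ∃ u, ∀ s, u ≤ s → |Z s ω - Z u ω| ≤ 1 / ((n : ℝ) + 1) := by
    intro n
    have hc : (0 : ℝ) < 1 / ((n : ℝ) + 1) := by positivity
    have hc' : ofReal (1 / ((n : ℝ) + 1)) ≠ 0 := by simpa using hc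
    rw [ae_iff]
    refine le_antisymm (le_of_forall_pos_le_add fun ε hε => ?_) (zero_le)
    rw [zero_add]
    by_cases hεt : ε = ⊤
    · rw [hεt]; exact le_top
    set δ : ENNReal := ε * ofReal (1 / ((n : ℝ) + 1)) / 2 with hδdef
    have hδ0 : δ ≠ 0 := by
      simp only [hδdef, ne_eq, ENNReal.div_eq_zero_iff, mul_eq_zero, hc', hε.ne', false_or]
      simp
    obtain ⟨u, ⟨hu1, hu2⟩, hu0⟩ := ((hfin.and (hδ δ hδ0)).and (eventually_ge_atTop 0)).exists
    refine le_trans (measure_mono ?_) ((hS.measure_exists_abs_lt_le (G := G) (Z := Z) hu0 hu1 hu2 hcont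
      (fun ω hω s hs => hZ ω hω s (hu0.trans hs)) hc).trans_eq ?_)
    · intro ω hω
      simp only [mem_ofPred_eq, not_forall, not_exists] at hω
      obtain ⟨h1, h2⟩ := hω
      obtain ⟨s, hs, h3⟩ := h2 u
      exact ⟨h1, s, hs, not_le.1 h3⟩
    · rw [hδdef, ENNReal.mul_div_cancel (by norm_num) (by norm_num),
        ENNReal.mul_div_cancel_right hc' ofReal_ne_top]
  filter_upwards [ae_all_iff.2 key] with ω hω hG
  refine cauchy_map_iff_exists_tendsto.1 ?_
  rw [Metric.cauchy_iff]
  refine ⟨inferInstance, fun ε hε => ?_⟩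
  obtain ⟨n, hn⟩ := exists_nat_one_div_lt (half_pos hε)
  obtain ⟨u, hu⟩ := hω n hG
  refine ⟨(fun t => Z t ω) '' Ici u, image_mem_map (Ici_mem_atTop u), ?_⟩
  rintro _ ⟨s, hs, rfl⟩ _ ⟨s', hs', rfl⟩
  have h1 := hu s hs
  have h2 := hu s' hs'
  rw [dist_eq]
  calc |Z s ω - Z s' ω| = |(Z s ω - Z u ω) - (Z s' ω - Z u ω)| := by ring_nf
    _ ≤ |Z s ω - Z u ω| + |Z s' ω - Z u ω| := abs_sub _ _
    _ < ε := by linarith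

end IsPosSubmartingale

namespace IsBMF

variable {f : ℝ → ℝ} {s t c : ℝ} {A : Set Ω}

theorem gap_mono (hB : IsBMF F B Q) (hf : IsBarrier f c) (hs : 0 ≤ s) (hst : s ≤ t)
    (hA : MeasurableSet[F s] A) : gap B Q f A s ≤ gap B Q f A t := by
  rcases hst.eq_or_lt with rfl | hlt
  · exact le_rfl
  have hA' : MeasurableSet[F s] (A ∩ below B f 0 s) :=
    hA.inter (hB.measurableSet_below hf.cont le_rfl hs)
  have hθ : Measurable[F s] fun ω => f s - B s ω := (hB.adapted s hs).const_sub _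
  have h := hB.setLIntegral_inter_forall_le hs (sub_pos.2 hlt) hA' hθ
  rw [gap, ← h, gap]
  have e : ∀ ω, B s ω + (f s - B s ω) = f s := fun ω => by ring
  have e2 : s + (t - s) = t := by ring
  simp only [e, e2]
  refine (lintegral_mono fun ω => ofReal_le_ofReal
    (sub_le_sub_right (hf.mono hs (hs.trans hst) hst) _)).trans (lintegral_mono_set ?_)
  rintro ω ⟨⟨h1, h2⟩, h3⟩
  refine ⟨h1, fun v hv => ?_⟩
  rcases le_total v s with h | h
  · exact h2 v ⟨hv.1, h⟩
  · exact (h3 v ⟨h, hv.2⟩).trans (hf.mono hs (hs.trans h) h)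

end IsBMF

namespace IsStarField

variable {f r : ℝ → ℝ} {u t c : ℝ} {A : Set Ω}

theorem setLIntegral_derivWt_eq_gap (hX : IsStarField X k P) (hf : Continuous f) (hu : 0 ≤ u)
    (hut : u ≤ t) (hA : MeasurableSet[fieldσ X u] A) (x : V) :
    ∫⁻ ω in A, ofReal (f u - rel γ X x u ω) *
        (wt γ X k u x ω * (below (rel γ X x) f 0 u).indicator 1 ω) ∂P
      = gap (drifted γ X x t) (P.withDensity (wt γ X k t x)) f A u := by
  have hA0 := hX.fieldσ_le u _ hA
  have hS := hX.measurableSet_below_rel' (γ := γ) hf hu x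
  have hm : Measurable[fieldσ X u] (A.indicator fun ω => ofReal (f u - rel γ X x u ω) *
      (below (rel γ X x) f 0 u).indicator (1 : Ω → ENNReal) ω) :=
    (hX.measurable_fieldσ_derivWt (γ := γ) hf hu x).indicator hA
  have h := hX.lintegral_mul_wt (γ := γ) hu hut x hm
  have hm' := hm.mono (hX.fieldσ_le u) le_rfl
  rw [← lintegral_indicator hA0]
  calc _ = ∫⁻ ω, (A.indicator fun ω => ofReal (f u - rel γ X x u ω) *
        (below (rel γ X x) f 0 u).indicator 1 ω) ω * wt γ X k u x ω ∂P := by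
        refine lintegral_congr fun ω => ?_
        by_cases hω : ω ∈ A
        · simp only [indicator_of_mem hω]; ring
        · simp only [indicator_of_notMem hω, zero_mul]
    _ = _ := h.symm
    _ = _ := by
        rw [gap, below_drifted γ X f 0 x hut, ← lintegral_indicator (hA0.inter hS)]
        simp only [drifted_eq_rel γ X x hut]
        have e : (A ∩ below (rel γ X x) f 0 u).indicator
              (fun ω => ofReal (f u - rel γ X x u ω)) = A.indicator fun ω =>
            ofReal (f u - rel γ X x u ω) *
              (below (rel γ X x) f 0 u).indicator (1 : Ω → ENNReal) ω := by
          ext ω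
          by_cases h : ω ∈ below (rel γ X x) f 0 u <;> by_cases h2 : ω ∈ A <;> simp [h, h2]
        rw [e, lintegral_withDensity_eq_lintegral_mul _ (hX.measurable_wt t x) hm']
        exact lintegral_congr fun ω => by rw [Pi.mul_apply, mul_comm]

variable {ν : Measure V}

/-- The truncated derivative masses form a submartingale. -/
theorem isPosSubmartingale_derivMass [SFinite ν] (hX : IsStarField X k P) (hf : IsBarrier f c) :
    IsPosSubmartingale (fieldσ X) (derivMass γ X k ν f) P where
  le := hX.fieldσ_le
  mono := fieldσ_mono X
  meas t ht := hX.measurable_fieldσ_derivMass hf.cont ht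
  sub s t hs hst A hA := by
    have := hX.isProbabilityMeasure
    have ht := hs.trans hst
    have hA' := fieldσ_mono X hst _ hA
    have e : ∀ v, 0 ≤ v → ∫⁻ ω in A, derivMass γ X k ν f v ω ∂P = ∫⁻ x, ∫⁻ ω in A,
        ofReal (f v - rel γ X x v ω) *
          (wt γ X k v x ω * (below (rel γ X x) f 0 v).indicator 1 ω) ∂P ∂ν := fun v hv =>
      lintegral_lintegral_swap
        ((hX.measurable_derivWt_joint (γ := γ) hf.cont hv).comp measurable_swap).aemeasurable
    rw [e s hs, e t ht]
    refine lintegral_mono fun x => ?_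
    have hQ := hX.isProbabilityMeasure_tilt (γ := γ) ht x
    rw [hX.setLIntegral_derivWt_eq_gap hf.cont hs hst hA x,
      hX.setLIntegral_derivWt_eq_gap hf.cont ht le_rfl hA' x]
    exact (hX.isBMF_tilt (γ := γ) ht x).gap_mono hf hs hst hA

/-- The truncated derivative masses form a Cauchy family in the weak-closeness sense. -/
theorem eventually_close_derivMass [IsFiniteMeasure ν] [NullSingletonClass ν]
    (hX : IsStarField X k P) {κ₀ : ℝ} {h : V × V → ENNReal} (hγ : 0 ≤ γ) (hf : IsCorridor f r c)
    (hκ : ∀ᵐ p ∂ν.prod ν, k 0 p.1 p.2 ≤ κ₀) (hh : ∫⁻ p, h p ∂ν.prod ν ≠ ⊤)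
    (hnear : ∀ u t, 1 ≤ u → u ≤ t → ∀ᵐ p ∂ν.prod ν, ‖p.1 - p.2‖ ≤ exp (-u) →
      ofReal (π * t / 2) * ∫⁻ ω, keptWt γ X k f (fun s => -r s) u t p.1 ω *
        keptWt γ X k f (fun s => -r s) u t p.2 ω ∂P ≤ h p) {ε : ENNReal} (hε : ε ≠ 0) :
    ∀ᶠ u in atTop, ∀ t ≥ u, Close P ε (derivMass γ X k ν f u) (derivMass γ X k ν f t) := by
  have h2 : ε / 2 ≠ 0 := by simp [hε]
  have h1 := hX.eventually_close hγ hf hκ hh hnear h2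
  obtain ⟨u₀, hu₀⟩ := eventually_atTop.1 h1
  filter_upwards [eventually_ge_atTop u₀] with u hu t ht
  obtain ⟨T, hT1, hT2⟩ := ((hu₀ u hu).and (hu₀ t (hu.trans ht))).exists
  have := hT1.symm.trans hT2
  rwa [ENNReal.add_halves] at this

end IsStarField

/-- The increment since time zero of a combination of the field at two points. -/
def incr {Ω V : Type*} (X : ℝ → V → Ω → ℝ) (b : ℝ) (x y : V) (s : ℝ) (ω : Ω) : ℝ :=
  (X s x ω - X 0 x ω) - b * (X s y ω - X 0 y ω)

namespace IsStarField

variable {b l s t T : ℝ}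

theorem lintegral_exp_of_mem_span (hX : IsStarField X k P) {H : Ω → ℝ}
    (hH : H ∈ Submodule.span ℝ (Set.range fun p : NNReal × V => X p.1 p.2))
    (hHm : Measurable H) (hH0 : P[H] = 0) :
    ∫⁻ ω, ofReal (exp (H ω)) ∂P = ofReal (exp (Var[H; P] / 2)) := by
  have := hX.isProbabilityMeasure
  have h := hX.lintegral_exp_mul (H := H) (G := fun (_ : Unit) => H)
    (F := fun _ => 1) hH (fun _ => hH) (fun _ => hHm) hHm hH0 measurable_const
  simp only [mul_one, lintegral_const, measure_univ] at h
  rw [← mul_one (ofReal (exp (Var[H; P] / 2))), ← h, ← lintegral_const_mul _ (by fun_prop)]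
  refine lintegral_congr fun ω => ?_
  rw [← ofReal_mul (exp_pos _).le, ← exp_add]
  congr 2
  ring

theorem incr_mem_span (hX : IsStarField X k P) (hs : 0 ≤ s) (x y : V) :
    incr X b x y s ∈ Submodule.span ℝ (Set.range fun p : NNReal × V => X p.1 p.2) := by
  have h := fun z => Submodule.sub_mem _ (hX.mem_span hs z) (hX.mem_span le_rfl z)
  exact Submodule.sub_mem _ (h x) (Submodule.smul_mem _ b (h y))

theorem measurable_incr (hX : IsStarField X k P) (x y : V) : Measurable (incr X b x y s) :=
  ((hX.meas _ _).sub (hX.meas _ _)).sub (((hX.meas _ _).sub (hX.meas _ _)).const_mul _)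

theorem measurable_fieldσ_incr (hs : 0 ≤ s) (x y : V) : Measurable[fieldσ X s] (incr X b x y s) :=
  ((measurable_fieldσ X ⟨hs, le_rfl⟩ _).sub (measurable_fieldσ X ⟨le_rfl, hs⟩ _)).sub
    (((measurable_fieldσ X ⟨hs, le_rfl⟩ _).sub
      (measurable_fieldσ X ⟨le_rfl, hs⟩ _)).const_mul _)

theorem continuous_incr (hX : IsStarField X k P) (x y : V) (ω : Ω) :
    Continuous fun s => incr X b x y s ω := by
  have h := fun z => hX.continuous_time z ω
  exact ((h x).sub continuous_const).sub (((h y).sub continuous_const).const_mul b)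

theorem integral_incr (hX : IsStarField X k P) (hs : 0 ≤ s) (x y : V) : P[incr X b x y s] = 0 := by
  have := hX.isProbabilityMeasure
  have hi : ∀ z r, 0 ≤ r → Integrable (X r z) P := fun z r hr =>
    (hX.memLp hr z).integrable one_le_two
  have h1 : ∀ z, Integrable (fun ω => X s z ω - X 0 z ω) P := fun z =>
    (hi z s hs).sub (hi z 0 le_rfl)
  have h2 : ∀ z, ∫ ω, (X s z ω - X 0 z ω) ∂P = 0 := fun z => by
    rw [integral_sub (hi z s hs) (hi z 0 le_rfl), hX.mean s z hs, hX.mean 0 z le_rfl, sub_zero]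
  calc _ = ∫ ω, ((X s x ω - X 0 x ω) - b * (X s y ω - X 0 y ω)) ∂P := rfl
    _ = 0 := by
      rw [integral_sub (h1 x) ((h1 y).const_mul b), integral_const_mul, h2, h2]
      simp

theorem indep_incr (hX : IsStarField X k P) (hs : 0 ≤ s) (hst : s ≤ t) (x y : V) :
    Indep (fieldσ X s)
      (MeasurableSpace.comap (fun ω (_ : Unit) => incr X b x y t ω - incr X b x y s ω)
        MeasurableSpace.pi) P := by
  have := hX.isProbabilityMeasure
  have ht := hs.trans hst
  refine IsGaussianProcess.indep_of_mem_span (Y := fun p : Icc (0 : ℝ) s × V => X p.1 p.2)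
    (Y' := fun (_ : Unit) ω => incr X b x y t ω - incr X b x y s ω) hX.gauss
    (fun p => hX.mem_span p.1.2.1 _) (fun _ => Submodule.sub_mem _
      (hX.incr_mem_span ht x y) (hX.incr_mem_span hs x y)) fun p _ => ?_
  have h1 : p.1.1 ≤ s := p.1.2.2
  have h2 : p.1.1 ≤ t := h1.trans hst
  have e : (fun ω => incr X b x y t ω - incr X b x y s ω) =
      (X t x - X s x) - (fun ω => b * (X t y - X s y) ω) := by
    ext ω
    simp only [incr, Pi.sub_apply]
    ring
  have hm : ∀ z, MemLp (X t z - X s z) 2 P := fun z => (hX.memLp ht z).sub (hX.memLp hs z)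
  have hz : ∀ z, cov[X p.1 p.2, X t z - X s z; P] = 0 := fun z => by
    rw [hX.cov_sub_right p.1.2.1 hs ht z p.2, min_eq_left h1, min_eq_left h2, sub_self]
  rw [e, covariance_sub_right (hX.memLp p.1.2.1 _) (hm x) ((hm y).const_mul b),
    covariance_const_mul_right, hz, hz]
  simp

theorem isPosSubmartingale_exp_incr (hX : IsStarField X k P) (hT : 0 ≤ T) (x y : V) :
    IsPosSubmartingale (fieldσ X) (fun s ω => ofReal (exp (l * incr X b x y (min s T) ω))) P where
  le := hX.fieldσ_le
  mono := fieldσ_mono X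
  meas s hs := by
    have h := (measurable_fieldσ_incr (X := X) (b := b) (le_min hs hT) x y).mono
      (fieldσ_mono X (min_le_left s T)) le_rfl
    exact (h.const_mul l).exp.ennreal_ofReal
  sub s t hs hst A hA := by
    have := hX.isProbabilityMeasure
    rcases le_total T s with h | h
    · rw [min_eq_right h, min_eq_right (h.trans hst)]
    rw [min_eq_left h]
    have hst' : s ≤ min t T := le_min hst h
    set v := min t T
    have hv : 0 ≤ v := hs.trans hst'
    have hind := hX.indep_incr (b := b) hs hst' x y
    have hU : Measurable[fieldσ X s]
        (A.indicator fun ω => ofReal (exp (l * incr X b x y s ω))) :=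
      (((measurable_fieldσ_incr hs x y).const_mul l).exp.ennreal_ofReal).indicator hA
    have hVm : Measurable fun ω => incr X b x y v ω - incr X b x y s ω :=
      (hX.measurable_incr x y).sub (hX.measurable_incr x y)
    have hV : Measurable[MeasurableSpace.comap (fun ω (_ : Unit) => incr X b x y v ω -
        incr X b x y s ω) MeasurableSpace.pi] fun ω => incr X b x y v ω - incr X b x y s ω :=
      (measurable_pi_apply ()).comp (comap_measurable fun ω (_ : Unit) => incr X b x y v ω -
        incr X b x y s ω)
    have hle : MeasurableSpace.comap (fun ω (_ : Unit) => incr X b x y v ω -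
        incr X b x y s ω) MeasurableSpace.pi ≤ mΩ := by
      rw [← measurable_iff_comap_le]
      exact measurable_pi_lambda _ fun _ => hVm
    have h := lintegral_indep hind (hX.fieldσ_le s) hle hU hV
      (F := fun a c => a * ofReal (exp (l * c))) (by fun_prop)
    have hA0 := hX.fieldσ_le s _ hA
    have hH : (fun ω => l * (incr X b x y v ω - incr X b x y s ω)) ∈
        Submodule.span ℝ (Set.range fun p : NNReal × V => X p.1 p.2) :=
      Submodule.smul_mem _ l (Submodule.sub_mem _ (hX.incr_mem_span hv x y)
        (hX.incr_mem_span hs x y))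
    have hint : ∀ r, 0 ≤ r → Integrable (incr X b x y r) P := fun r hr =>
      have hi : ∀ z, Integrable (fun ω => X r z ω - X 0 z ω) P := fun z =>
        ((hX.memLp hr z).integrable one_le_two).sub ((hX.memLp le_rfl z).integrable one_le_two)
      (hi x).sub ((hi y).const_mul b)
    have hH0 : ∫ ω, l * (incr X b x y v ω - incr X b x y s ω) ∂P = 0 := by
      rw [integral_const_mul, integral_sub (hint v hv) (hint s hs), hX.integral_incr hv,
        hX.integral_incr hs]
      simp
    have h1 : 1 ≤ ∫⁻ ω, ofReal (exp (l * (incr X b x y v ω - incr X b x y s ω))) ∂P := by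
      rw [hX.lintegral_exp_of_mem_span hH (hVm.const_mul l) hH0, ← ofReal_one]
      exact ofReal_le_ofReal (one_le_exp
        (div_nonneg (variance_nonneg _ _) zero_le_two))
    rw [← lintegral_indicator hA0, ← lintegral_indicator hA0]
    calc _ ≤ ∫⁻ ω, ∫⁻ ω', (A.indicator (fun ω => ofReal (exp (l * incr X b x y s ω))) ω) *
          ofReal (exp (l * (incr X b x y v ω' - incr X b x y s ω'))) ∂P ∂P := by
          refine lintegral_mono fun ω => ?_
          dsimp only
          rw [lintegral_const_mul _ (hVm.const_mul l).exp.ennreal_ofReal]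
          exact le_mul_of_one_le_right' h1
      _ = _ := h.symm
      _ = _ := by
          refine lintegral_congr fun ω => ?_
          by_cases hω : ω ∈ A
          · simp only [indicator_of_mem hω]
            rw [← ofReal_mul (exp_pos _).le, ← exp_add]
            congr 2
            ring
          · simp only [indicator_of_notMem hω, zero_mul]

/-- Exponential tail bound for the running maximum of an increment. -/
theorem measure_exists_incr_lt_le (hX : IsStarField X k P) (hl : 0 ≤ l) (hT : 0 ≤ T) (x y : V)
    (c : ℝ) : P {ω | ∃ s ∈ Icc 0 T, c < incr X b x y s ω} ≤
      ofReal (exp (l ^ 2 * Var[incr X b x y T; P] / 2 - l * c)) := by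
  have hP := hX.isProbabilityMeasure
  rcases hl.eq_or_lt with rfl | hl'
  · simpa using prob_le_one
  have hS := hX.isPosSubmartingale_exp_incr (b := b) (l := l) hT x y
  have hK : ∀ t, 0 ≤ t → ∫⁻ ω, ofReal (exp (l * incr X b x y (min t T) ω)) ∂P ≤
      ofReal (exp (l ^ 2 * Var[incr X b x y T; P] / 2)) := by
    intro t ht
    have h1 : ∫⁻ ω, ofReal (exp (l * incr X b x y (min t T) ω)) ∂P ≤
        ∫⁻ ω, ofReal (exp (l * incr X b x y T ω)) ∂P := by
      have := hS.sub t (max t T) ht (le_max_left _ _) univ MeasurableSet.univ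
      simpa using this
    refine h1.trans_eq ?_
    rw [hX.lintegral_exp_of_mem_span (H := fun ω => l * incr X b x y T ω)
      (Submodule.smul_mem _ l (hX.incr_mem_span hT x y)) ((hX.measurable_incr x y).const_mul l)
      (by rw [integral_const_mul, hX.integral_incr hT, mul_zero]), variance_const_mul]
  have h := hS.measure_exists_lt_le (G := univ)
    (Z := fun s ω => exp (l * incr X b x y (min s T) ω)) le_rfl hK
    (fun ω _ => (((hX.continuous_incr x y ω).comp (continuous_id.min continuous_const)).const_mul
      l).rexp) (fun ω _ s _ => rfl) (exp_pos (l * c))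
  refine (measure_mono ?_).trans (h.trans_eq ?_)
  · rintro ω ⟨s, hs, h⟩
    refine ⟨trivial, s, hs.1, ?_⟩
    rw [min_eq_left hs.2]
    exact exp_lt_exp.2 (mul_lt_mul_of_pos_left h hl')
  · rw [← ofReal_div_of_pos (exp_pos _), ← exp_sub]

theorem variance_incr (hX : IsStarField X k P) (hT : 0 ≤ T) (x y : V) :
    Var[incr X b x y T; P] = T - 2 * b * (k T x y - k 0 x y) + b ^ 2 * T := by
  have hP := hX.isProbabilityMeasure
  have hm : ∀ z, MemLp (X T z - X 0 z) 2 P := fun z => (hX.memLp hT z).sub (hX.memLp le_rfl z)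
  have hc : ∀ z w, cov[X T z - X 0 z, X T w - X 0 w; P] = k T z w - k 0 z w := fun z w => by
    rw [covariance_sub_left (hX.memLp hT z) (hX.memLp le_rfl z) (hm w),
      hX.cov_sub_right hT le_rfl hT, hX.cov_sub_right le_rfl le_rfl hT, min_self, min_self,
      min_eq_right hT, min_eq_left hT]
    ring
  have hv : ∀ z, Var[X T z - X 0 z; P] = T := fun z => by
    rw [← covariance_self (hm z).aemeasurable, hc, hX.diag T z hT]
    ring
  have e : incr X b x y T = (X T x - X 0 x) - fun ω => b * (X T y - X 0 y) ω := rfl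
  rw [e, variance_sub (hm x) ((hm y).const_mul b), variance_const_mul, covariance_const_mul_right,
    hv, hv, hc]
  ring

end IsStarField

/-- Balls of a Euclidean space have finite nets of polynomial cardinality. -/
theorem exists_euclidean_net (d : ℕ) {R : ℝ} (hR : 0 ≤ R) : ∃ A : ℝ, 1 ≤ A ∧ ∀ h : ℝ, 0 < h → h ≤ 1 →
    ∃ G : Finset (EuclideanSpace ℝ (Fin d)), (G.card : ℝ) ≤ (A / h) ^ d ∧
      ∀ x : EuclideanSpace ℝ (Fin d), ‖x‖ ≤ R → ∃ p ∈ G, ‖x - p‖ ≤ h := by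
  refine ⟨2 * R * (d + 1) + 3, by have : 0 ≤ 2 * R * (d + 1) := by positivity
                                  linarith, fun h hh hh1 => ?_⟩
  set e := h / (d + 1) with he
  have he0 : 0 < e := by positivity
  set L : ℤ := ⌈R / e⌉ with hL
  have hL1 : R / e ≤ L := Int.le_ceil _
  have hL2 : (L : ℝ) < R / e + 1 := Int.ceil_lt_add_one _
  have hL0 : 0 ≤ L := Int.ceil_nonneg (by positivity)
  classical
  refine ⟨(Fintype.piFinset fun _ : Fin d => Finset.Icc (-L) L).image
    fun m => WithLp.toLp 2 fun i => e * (m i : ℝ), ?_, fun x hx => ?_⟩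
  · have h1 : ((Fintype.piFinset fun _ : Fin d => Finset.Icc (-L) L).card : ℝ) =
        (2 * L + 1 : ℝ) ^ d := by
      have h3 : ((L + 1 - -L).toNat : ℤ) = 2 * L + 1 := by omega
      have h4 : ((L + 1 - -L).toNat : ℝ) = 2 * L + 1 := by exact_mod_cast h3
      rw [Fintype.card_piFinset_const, Int.card_Icc, Nat.cast_pow, h4]
    refine (Nat.cast_le.2 Finset.card_image_le).trans (h1.trans_le ?_)
    have hL0' : (0 : ℝ) ≤ L := by exact_mod_cast hL0
    refine pow_le_pow_left₀ (by positivity) ?_ d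
    have h2 : R / e = R * (d + 1) / h := by rw [he]; field_simp
    rw [h2] at hL2
    have h3 : 3 ≤ 3 / h := by rw [le_div_iff₀ hh]; linarith
    calc (2 * L + 1 : ℝ) ≤ 2 * (R * (d + 1) / h) + 3 / h := by linarith
      _ = _ := by ring
  · refine ⟨WithLp.toLp 2 fun i => e * (⌊x i / e⌋ : ℝ), ?_, ?_⟩
    · refine Finset.mem_image.2 ⟨fun i => ⌊x i / e⌋, ?_, rfl⟩
      rw [Fintype.mem_piFinset]
      intro i
      have hxi : |x i| ≤ R := by
        have := PiLp.norm_apply_le x i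
        rw [Real.norm_eq_abs] at this
        exact this.trans hx
      rw [abs_le] at hxi
      have h1 : x i / e ≤ R / e := by gcongr; exact hxi.2
      have h2 : -(R / e) ≤ x i / e := by rw [← neg_div]; gcongr; exact hxi.1
      rw [Finset.mem_Icc]
      constructor
      · rw [Int.le_floor]; push_cast; linarith
      · have h3 := Int.floor_le (x i / e)
        have : (⌊x i / e⌋ : ℝ) ≤ L := by linarith
        exact_mod_cast this
    · have hi : ∀ i, ‖(x - WithLp.toLp 2 fun i => e * (⌊x i / e⌋ : ℝ)) i‖ ^ 2 ≤ e ^ 2 := by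
        intro i
        have h1 := Int.floor_le (x i / e)
        have h2 := Int.lt_floor_add_one (x i / e)
        rw [le_div_iff₀ he0] at h1
        rw [div_lt_iff₀ he0] at h2
        refine pow_le_pow_left₀ (norm_nonneg _) ?_ 2
        simp only [PiLp.sub_apply, Real.norm_eq_abs]
        rw [abs_le]
        constructor <;> nlinarith
      refine abs_le_of_sq_le_sq' ?_ hh.le |>.2
      rw [EuclideanSpace.norm_sq_eq]
      refine (Finset.sum_le_sum fun i _ => hi i).trans ?_
      rw [Finset.sum_const, Finset.card_univ, Fintype.card_fin, nsmul_eq_mul]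
      have : h = e * (d + 1) := by rw [he]; field_simp
      rw [this]
      have : (d : ℝ) ≤ (d + 1) ^ 2 := by nlinarith [(Nat.cast_nonneg d : (0 : ℝ) ≤ d)]
      nlinarith [sq_nonneg e]

/-- `Kc` has `h`-nets of at most `(A / h) ^ d` points. -/
def HasNets (Kc : Set V) (A : ℝ) (d : ℕ) : Prop :=
  ∀ h : ℝ, 0 < h → h ≤ 1 → ∃ G : Finset V, (G.card : ℝ) ≤ (A / h) ^ d ∧
    ∀ x ∈ Kc, ∃ p ∈ G, ‖x - p‖ ≤ h

namespace IsStarField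

variable {γ a A C q T y : ℝ} {d n : ℕ}

/-- Chaining: control on all nets gives control everywhere. -/
theorem incr_le_of_chain (hX : IsStarField X k P) {h : ℕ → ℝ} (hh : Tendsto h atTop (nhds 0))
    (hanti : Antitone h) {G : ℕ → Finset V} {ω : Ω} {s : ℝ} (hq : 0 ≤ q)
    (h0 : ∀ p ∈ G 0, incr X 0 p p s ω ≤ y)
    (h1 : ∀ i, ∀ p ∈ G (i + 1), ∀ p' ∈ G i, ‖p - p'‖ ≤ 2 * h i →
      incr X 1 p p' s ω ≤ q / 2 ^ (i + 2)) {x : V} (hx : ∀ i, ∃ p ∈ G i, ‖x - p‖ ≤ h i) :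
    X s x ω - X 0 x ω ≤ y + q / 2 := by
  choose p hp hpx using hx
  have hpl : Tendsto p atTop (nhds x) := by
    rw [tendsto_iff_norm_sub_tendsto_zero]
    refine squeeze_zero (fun _ => norm_nonneg _) (fun i => ?_) hh
    rw [norm_sub_rev]
    exact hpx i
  have hstep : ∀ i, X s (p i) ω - X 0 (p i) ω ≤ y + q / 2 * (1 - 1 / 2 ^ i) := by
    intro i
    induction i with
    | zero =>
      have := h0 _ (hp 0)
      simp only [incr] at this
      simp only [pow_zero]
      linarith
    | succ i ih =>
      have h2 : ‖p (i + 1) - p i‖ ≤ 2 * h i := by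
        have e : p (i + 1) - p i = (x - p i) - (x - p (i + 1)) := by abel
        rw [e]
        have := norm_sub_le (x - p i) (x - p (i + 1))
        linarith [hpx i, hpx (i + 1), hanti (Nat.le_succ i)]
      have h3 := h1 i _ (hp (i + 1)) _ (hp i) h2
      simp only [incr] at h3
      have e : q / 2 ^ (i + 2) = q / 2 * (1 / 2 ^ i) / 2 := by
        rw [pow_add]; field_simp
      have e2 : q / 2 * (1 / 2 ^ (i + 1)) = q / 2 * (1 / 2 ^ i) / 2 := by
        rw [pow_succ]; field_simp
      linarith
  have hc : ∀ r, Continuous fun z => X r z ω := fun r =>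
    (hX.cont ω).comp (Continuous.prodMk_right r)
  have hlim : Tendsto (fun i => X s (p i) ω - X 0 (p i) ω) atTop (nhds (X s x ω - X 0 x ω)) :=
    (((hc s).tendsto x).comp hpl).sub (((hc 0).tendsto x).comp hpl)
  refine le_of_tendsto' hlim fun i => (hstep i).trans ?_
  have : (0 : ℝ) ≤ 1 / 2 ^ i := by positivity
  nlinarith

theorem measure_incr_pair_le (hX : IsStarField X k P) (hT : 0 < T) (hC : 0 < C)
    (hmod : ∀ t x y, 0 ≤ t → t - (k t x y - k 0 x y) ≤ C * (exp t * ‖x - y‖))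
    (hq : 0 ≤ q) (i : ℕ) {p p' : V} (hp : ‖p - p'‖ ≤ 2 * (exp (-T) / (T * 8 ^ i))) :
    P {ω | ∃ s ∈ Icc 0 T, q / 2 ^ (i + 2) < incr X 1 p p' s ω} ≤
      ofReal (exp (-(q ^ 2 / (128 * C) * (T * (1 + i))))) := by
  set v := 4 * C / (T * 8 ^ i) with hv
  have hv0 : 0 < v := by positivity
  have hvar : Var[incr X 1 p p' T; P] ≤ v := by
    rw [hX.variance_incr hT.le]
    have h1 := hmod T p p' hT.le
    have h2 : C * (exp T * ‖p - p'‖) ≤ C * (exp T * (2 * (exp (-T) / (T * 8 ^ i)))) := by gcongr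
    have h3 : C * (exp T * (2 * (exp (-T) / (T * 8 ^ i)))) = v / 2 := by
      rw [hv, exp_neg]; field_simp; norm_num
    linarith
  refine (hX.measure_exists_incr_lt_le (l := q / 2 ^ (i + 2) / v) (by positivity) hT.le p p' _).trans
    (ofReal_le_ofReal (exp_le_exp.2 ?_))
  have h1 : (q / 2 ^ (i + 2) / v) ^ 2 * Var[incr X 1 p p' T; P] / 2 ≤
      (q / 2 ^ (i + 2) / v) ^ 2 * v / 2 := by gcongr
  have h2 : (q / 2 ^ (i + 2) / v) ^ 2 * v / 2 - q / 2 ^ (i + 2) / v * (q / 2 ^ (i + 2)) =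
      -(q ^ 2 / (128 * C) * (T * 2 ^ i)) := by
    have e8 : (8 : ℝ) ^ i = 2 ^ i * 2 ^ i * 2 ^ i := by
      rw [← mul_pow, ← mul_pow]; norm_num
    rw [hv, e8, pow_add]
    field_simp
    ring
  have h3 : (1 + i : ℝ) ≤ 2 ^ i := by
    have := one_add_mul_le_pow (a := (1 : ℝ)) (by norm_num) i
    norm_num at this
    linarith
  have h4 : q ^ 2 / (128 * C) * (T * (1 + i)) ≤ q ^ 2 / (128 * C) * (T * 2 ^ i) := by gcongr
  linarith

theorem card_pair_le (hA : 1 ≤ A) (hT : 1 ≤ T) (i : ℕ) :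
    (A / (exp (-T) / (T * 8 ^ (i + 1)))) ^ d * (A / (exp (-T) / (T * 8 ^ i))) ^ d ≤
      exp (2 * d * (log A + 5) * (T * (1 + i))) := by
  have hT0 : 0 < T := by linarith
  have hA0 : 0 < A := by linarith
  have hi : (0 : ℝ) ≤ i := i.cast_nonneg
  have key : ∀ j : ℕ, (j : ℝ) ≤ i + 1 → A / (exp (-T) / (T * 8 ^ j)) ≤
      exp ((log A + 5) * (T * (1 + i))) := by
    intro j hj
    have h1 : A / (exp (-T) / (T * 8 ^ j)) = exp (log A) * T * exp T * 8 ^ j := by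
      rw [exp_log hA0, exp_neg]; field_simp
    have h2 : T ≤ exp T := by linarith [add_one_le_exp T]
    have h3 : (8 : ℝ) ^ j ≤ exp (3 * (1 + i)) := by
      have h5 : (8 : ℝ) ≤ exp 3 := by
        have h6 := exp_one_gt_d9
        have h7 : exp 3 = exp 1 ^ 3 := by rw [← exp_nat_mul]; norm_num
        rw [h7]
        have h8 : (2 : ℝ) ^ 3 ≤ exp 1 ^ 3 := pow_le_pow_left₀ (by norm_num) (by linarith) 3
        linarith
      calc (8 : ℝ) ^ j ≤ exp 3 ^ j := pow_le_pow_left₀ (by norm_num) h5 j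
        _ = exp (j * 3) := (exp_nat_mul 3 j).symm
        _ ≤ _ := exp_le_exp.2 (by linarith)
    rw [h1]
    calc exp (log A) * T * exp T * 8 ^ j ≤ exp (log A) * exp T * exp T * exp (3 * (1 + i)) := by
          gcongr
      _ = exp (log A + 2 * T + 3 * (1 + i)) := by rw [← exp_add, ← exp_add, ← exp_add]; ring_nf
      _ ≤ _ := by
        refine exp_le_exp.2 ?_
        have hl := log_nonneg hA
        have h4 : 1 ≤ T * (1 + i) := by nlinarith
        have h5 : T ≤ T * (1 + i) := by nlinarith
        have h6 : (1 + i : ℝ) ≤ T * (1 + i) := by nlinarith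
        nlinarith
  have h1 := key (i + 1) (by push_cast; linarith)
  have h2 := key i (by linarith)
  calc _ ≤ exp ((log A + 5) * (T * (1 + i))) ^ d * exp ((log A + 5) * (T * (1 + i))) ^ d := by
        gcongr
    _ = _ := by
      rw [← exp_nat_mul, ← exp_add]
      congr 1
      ring

theorem measure_exceed_level_le (hX : IsStarField X k P) (hC : 0 < C)
    (hmod : ∀ t x y, 0 ≤ t → t - (k t x y - k 0 x y) ≤ C * (exp t * ‖x - y‖))
    (hA : 1 ≤ A) (hnet : HasNets Kc A d) (hT : 1 ≤ T) (hq : 0 ≤ q) {l : ℝ} (hl : 0 ≤ l) (y : ℝ) :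
    P {ω | ∃ x ∈ Kc, ∃ s ∈ Icc 0 T, y + q / 2 < X s x ω - X 0 x ω} ≤
      ofReal ((A * T * exp T) ^ d * exp (l ^ 2 * T / 2 - l * y)) +
      ∑' i : ℕ, ofReal (exp (-((q ^ 2 / (128 * C) - 2 * d * (log A + 5)) * (T * (1 + i))))) := by
  have hT0 : 0 < T := by linarith
  set h : ℕ → ℝ := fun i => exp (-T) / (T * 8 ^ i) with hh
  have hpos : ∀ i, 0 < h i := fun i => by simp only [hh]; positivity
  have hanti : Antitone h := by
    refine antitone_nat_of_succ_le fun i => ?_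
    simp only [hh]
    gcongr <;> norm_num
  have hle1 : ∀ i, h i ≤ 1 := fun i => (hanti i.zero_le).trans (by
    simp only [hh, pow_zero, mul_one]
    rw [div_le_one hT0]
    exact (exp_le_one_iff.2 (by linarith)).trans hT)
  have hlim : Tendsto h atTop (nhds 0) := by
    have e : h = fun i => exp (-T) / T * (1 / 8 : ℝ) ^ i := by
      ext i; simp only [hh]; rw [one_div, inv_pow]; field_simp
    rw [e]
    simpa using (tendsto_pow_atTop_nhds_zero_of_lt_one (by norm_num)
      (by norm_num : (1 / 8 : ℝ) < 1)).const_mul (exp (-T) / T)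
  choose G hcard hG using fun i => hnet (h i) (hpos i) (hle1 i)
  classical
  set S : ℕ → Finset (V × V) := fun i => (G (i + 1) ×ˢ G i).filter fun p => ‖p.1 - p.2‖ ≤ 2 * h i
  have hsub : {ω | ∃ x ∈ Kc, ∃ s ∈ Icc 0 T, y + q / 2 < X s x ω - X 0 x ω} ⊆
      (⋃ p ∈ G 0, {ω | ∃ s ∈ Icc 0 T, y < incr X 0 p p s ω}) ∪
      ⋃ i, ⋃ p ∈ S i, {ω | ∃ s ∈ Icc 0 T, q / 2 ^ (i + 2) < incr X 1 p.1 p.2 s ω} := by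
    rintro ω ⟨x, hx, s, hs, hω⟩
    by_contra hcon
    simp only [mem_union, mem_iUnion, mem_ofPred_eq, not_or, not_exists, not_and, not_lt] at hcon
    refine absurd hω (not_lt.2 (hX.incr_le_of_chain hlim hanti hq (fun p hp => hcon.1 p hp s hs)
      (fun i p hp p' hp' hpp => hcon.2 i (p, p') ?_ s hs) fun i => hG i x hx))
    exact Finset.mem_filter.2 ⟨Finset.mem_product.2 ⟨hp, hp'⟩, hpp⟩
  refine (measure_mono hsub).trans ((measure_union_le _ _).trans (add_le_add ?_ ?_))
  · refine (measure_biUnion_finset_le _ _).trans ?_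
    refine (Finset.sum_le_sum fun p _ => hX.measure_exists_incr_lt_le hl hT0.le p p y).trans ?_
    have hv : ∀ p : V, Var[incr X 0 p p T; P] = T := fun p => by
      rw [hX.variance_incr hT0.le]; ring
    simp only [hv, Finset.sum_const, nsmul_eq_mul]
    rw [← ofReal_natCast, ← ofReal_mul (Nat.cast_nonneg _)]
    refine ofReal_le_ofReal ?_
    gcongr
    refine (hcard 0).trans_eq ?_
    congr 1
    simp only [hh, exp_neg]
    field_simp
  · refine (measure_iUnion_le _).trans (ENNReal.tsum_le_tsum fun i => ?_)
    refine (measure_biUnion_finset_le _ _).trans ?_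
    refine (Finset.sum_le_sum fun p hp => hX.measure_incr_pair_le hT0 hC hmod hq i
      (Finset.mem_filter.1 hp).2).trans ?_
    simp only [Finset.sum_const, nsmul_eq_mul]
    rw [← ofReal_natCast, ← ofReal_mul (Nat.cast_nonneg _)]
    refine ofReal_le_ofReal ?_
    have h1 : ((S i).card : ℝ) ≤ exp (2 * d * (log A + 5) * (T * (1 + i))) := by
      refine le_trans ?_ (card_pair_le (d := d) hA hT i)
      calc ((S i).card : ℝ) ≤ ((G (i + 1) ×ˢ G i).card : ℝ) :=
            Nat.cast_le.2 (Finset.card_filter_le _ _)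
        _ = (G (i + 1)).card * (G i).card := by rw [Finset.card_product]; push_cast; rfl
        _ ≤ _ := by
          have := hpos (i + 1)
          exact mul_le_mul (hcard _) (hcard _) (Nat.cast_nonneg _) (by positivity)
    calc _ ≤ exp (2 * d * (log A + 5) * (T * (1 + i))) *
          exp (-(q ^ 2 / (128 * C) * (T * (1 + i)))) := by gcongr
      _ = _ := by
        rw [← exp_add]
        congr 1
        ring

end IsStarField

theorem tendsto_ofReal_mul_const_zero {α : Type*} {l : Filter α} {g : α → ℝ} {b : ENNReal}
    (hb : b ≠ ⊤) (hg : Tendsto g l (nhds 0)) : Tendsto (fun t => ofReal (g t) * b) l (nhds 0) := by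
  have h := (continuous_ofReal.tendsto (0 : ℝ)).comp hg
  rw [ofReal_zero] at h
  simpa using ENNReal.Tendsto.mul_const h (Or.inr hb)

namespace IsStarField

variable {γ a A C q T y : ℝ} {d n : ℕ}

theorem measure_exceed_block_le (hX : IsStarField X k P) (hC : 0 < C) (hγ : 0 ≤ γ)
    (hγd : γ ^ 2 = 2 * d) (ha : d + 2 ≤ γ * a)
    (hmod : ∀ t x y, 0 ≤ t → t - (k t x y - k 0 x y) ≤ C * (exp t * ‖x - y‖))
    (hA : 1 ≤ A) (hnet : HasNets Kc A d) (hq : 0 ≤ q)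
    (hqm : 1 ≤ q ^ 2 / (128 * C) - 2 * d * (log A + 5)) (n : ℕ) :
    P {ω | ∃ x ∈ Kc, ∃ s ∈ Icc (0 : ℝ) (n + 1), γ * n + q + a * log (1 + n) < X s x ω - X 0 x ω} ≤
      ofReal (A ^ d * exp (2 * d) * exp (-(γ * q / 2))) * ofReal (1 / (n + 1 : ℝ) ^ 2) +
      ofReal (exp (-(q ^ 2 / (128 * C) - 2 * d * (log A + 5)))) *
        ∑' i : ℕ, ofReal (exp (-n) * exp (-i)) := by
  set m := q ^ 2 / (128 * C) - 2 * d * (log A + 5) with hm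
  have hn0 : (0 : ℝ) ≤ n := n.cast_nonneg
  have hT : (1 : ℝ) ≤ n + 1 := by linarith
  have hT0 : (0 : ℝ) < n + 1 := by linarith
  have h := hX.measure_exceed_level_le hC hmod hA hnet hT hq hγ (γ * n + q / 2 + a * log (1 + n))
  have e : γ * n + q / 2 + a * log (1 + n) + q / 2 = γ * n + q + a * log (1 + n) := by ring
  rw [e] at h
  refine h.trans (add_le_add ?_ ?_)
  · rw [← ofReal_mul (by positivity)]
    refine ofReal_le_ofReal ?_
    have hL := log_nonneg hT
    have hTe : (n + 1 : ℝ) ^ d = exp (d * log (n + 1)) := by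
      rw [exp_nat_mul, exp_log hT0]
    have hT2 : 1 / (n + 1 : ℝ) ^ 2 = exp (-(2 * log (n + 1))) := by
      have := exp_nat_mul (log (n + 1 : ℝ)) 2
      rw [exp_log hT0] at this
      rw [exp_neg, ← this]
      simp
    rw [mul_pow, mul_pow, hTe, hT2, ← exp_nat_mul, add_comm (1 : ℝ) n]
    rw [mul_assoc, mul_assoc, mul_assoc, mul_assoc]
    refine mul_le_mul_of_nonneg_left ?_ (by positivity)
    rw [← exp_add, ← exp_add, ← exp_add, ← exp_add]
    refine exp_le_exp.2 ?_
    have h2 : (d + 2) * log (n + 1 : ℝ) ≤ γ * a * log (n + 1) := by gcongr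
    have h3 : γ * (γ * n + q / 2 + a * log (n + 1)) =
        γ ^ 2 * n + γ * q / 2 + γ * a * log (n + 1) := by ring
    rw [h3, hγd]
    have hd0 : (0 : ℝ) ≤ d := d.cast_nonneg
    nlinarith
  · rw [← ENNReal.tsum_mul_left]
    refine ENNReal.tsum_le_tsum fun i => ?_
    rw [← ofReal_mul (exp_pos _).le, ← exp_add, ← exp_add]
    refine ofReal_le_ofReal (exp_le_exp.2 ?_)
    have hi : (0 : ℝ) ≤ i := i.cast_nonneg
    have h1 : (1 + n + i : ℝ) ≤ (n + 1) * (1 + i) := by nlinarith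
    nlinarith [mul_nonneg hn0 hi]

/-- The field stays below a logarithmic curve on top of the critical drift. -/
theorem tendsto_measure_exceed (hX : IsStarField X k P) (hC : 0 < C) (hγ : 0 < γ)
    (hγd : γ ^ 2 = 2 * d) (ha : d + 2 ≤ γ * a)
    (hmod : ∀ t x y, 0 ≤ t → t - (k t x y - k 0 x y) ≤ C * (exp t * ‖x - y‖))
    (hA : 1 ≤ A) (hnet : HasNets Kc A d) :
    Tendsto (fun q : ℝ => P {ω | ∃ x ∈ Kc, ∃ t, 0 ≤ t ∧ q + a * log (1 + t) < rel γ X x t ω})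
      atTop (nhds 0) := by
  have ha0 : 0 ≤ a := by
    by_contra hcon
    push Not at hcon
    have := mul_neg_of_pos_of_neg hγ hcon
    have hd0 : (0 : ℝ) ≤ d := d.cast_nonneg
    linarith
  set S₁ : ENNReal := ∑' n : ℕ, ofReal (1 / (n + 1 : ℝ) ^ 2)
  set S₂ : ENNReal := ∑' n : ℕ, ∑' i : ℕ, ofReal (exp (-n) * exp (-i))
  have hS₁ : S₁ ≠ ⊤ := by
    have : Summable fun n : ℕ => 1 / (n + 1 : ℝ) ^ 2 := by
      have h := (summable_nat_add_iff 1).2 (Real.summable_one_div_nat_pow.2 one_lt_two)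
      simpa using h
    exact this.tsum_ofReal_ne_top
  have hS₂ : S₂ ≠ ⊤ := by
    have h1 : ∑' n : ℕ, ofReal (exp (-n)) ≠ ⊤ :=
      Real.summable_exp_neg_nat.tsum_ofReal_ne_top
    have : S₂ = (∑' n : ℕ, ofReal (exp (-n))) * ∑' i : ℕ, ofReal (exp (-i)) := by
      rw [← ENNReal.tsum_mul_right]
      refine tsum_congr fun n => ?_
      rw [← ENNReal.tsum_mul_left]
      exact tsum_congr fun i => ofReal_mul (exp_pos _).le
    rw [this]
    exact ENNReal.mul_ne_top h1 h1
  have hm : Tendsto (fun q : ℝ => q ^ 2 / (128 * C) - 2 * d * (log A + 5)) atTop atTop :=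
    tendsto_atTop_add_const_right _ _
      ((tendsto_pow_atTop two_ne_zero).atTop_div_const (by positivity))
  have hlim : Tendsto (fun q : ℝ => ofReal (A ^ d * exp (2 * d) * exp (-(γ * q / 2))) * S₁ +
      ofReal (exp (-(q ^ 2 / (128 * C) - 2 * d * (log A + 5)))) * S₂) atTop (nhds 0) := by
    rw [← add_zero (0 : ENNReal)]
    refine (tendsto_ofReal_mul_const_zero hS₁ ?_).add (tendsto_ofReal_mul_const_zero hS₂ ?_)
    · have h1 : Tendsto (fun q : ℝ => γ * q / 2) atTop atTop :=
        (tendsto_id.const_mul_atTop hγ).atTop_div_const two_pos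
      simpa using (tendsto_exp_neg_atTop_nhds_zero.comp h1).const_mul (A ^ d * exp (2 * d))
    · exact tendsto_exp_neg_atTop_nhds_zero.comp hm
  refine tendsto_of_tendsto_of_tendsto_of_le_of_le' tendsto_const_nhds hlim
    (Eventually.of_forall fun _ => zero_le) ?_
  filter_upwards [hm.eventually_ge_atTop 1, eventually_ge_atTop 0] with q hqm hq
  have hsub : {ω | ∃ x ∈ Kc, ∃ t, 0 ≤ t ∧ q + a * log (1 + t) < rel γ X x t ω} ⊆
      ⋃ n : ℕ, {ω | ∃ x ∈ Kc, ∃ s ∈ Icc (0 : ℝ) (n + 1),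
        γ * n + q + a * log (1 + n) < X s x ω - X 0 x ω} := by
    rintro ω ⟨x, hx, t, ht, h⟩
    have h1 := Nat.floor_le ht
    have h2 := (Nat.lt_floor_add_one t).le
    refine mem_iUnion.2 ⟨⌊t⌋₊, x, hx, t, ⟨ht, h2⟩, ?_⟩
    rw [rel] at h
    have h3 : log (1 + (⌊t⌋₊ : ℝ)) ≤ log (1 + t) :=
      log_le_log (by positivity) (by linarith)
    nlinarith [mul_le_mul_of_nonneg_left h3 ha0, mul_le_mul_of_nonneg_left h1 hγ.le]
  refine (measure_mono hsub).trans ((measure_iUnion_le _).trans ?_)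
  refine (ENNReal.tsum_le_tsum fun n => hX.measure_exceed_block_le hC hγ.le hγd ha hmod hA hnet hq
    hqm n).trans_eq ?_
  rw [ENNReal.tsum_add, ENNReal.tsum_mul_left, ENNReal.tsum_mul_left]

end IsStarField

/-- The logarithmic barrier. -/
noncomputable def logBar (q a s : ℝ) : ℝ := q + a * log (1 + |s|)

theorem continuous_logBar (q a : ℝ) : Continuous (logBar q a) := by
  unfold logBar
  refine continuous_const.add (continuous_const.mul (Continuous.log (by fun_prop) fun s => ?_))
  positivity

theorem le_logBar {q a : ℝ} (ha : 0 ≤ a) (s : ℝ) : q ≤ logBar q a s := by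
  unfold logBar
  have := log_nonneg (x := 1 + |s|) (by linarith [abs_nonneg s])
  nlinarith

theorem logBar_double {q a : ℝ} (s : ℝ) : logBar (2 * q) (2 * a) s = 2 * logBar q a s := by
  unfold logBar; ring

theorem isBarrier_logBar {q a : ℝ} (hq : 0 ≤ q) (ha : 0 ≤ a) :
    IsBarrier (logBar q a) (a * log 2) where
  cont := continuous_logBar q a
  mono s hs t ht hst := by
    have hs' : (0 : ℝ) ≤ s := hs
    have ht' : (0 : ℝ) ≤ t := ht
    unfold logBar
    rw [abs_of_nonneg hs', abs_of_nonneg ht']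
    gcongr
  nonneg s _ := hq.trans (le_logBar ha s)
  const_nonneg := mul_nonneg ha (log_nonneg one_le_two)
  double t ht := by
    unfold logBar
    rw [abs_of_nonneg ht, abs_of_nonneg (by linarith : (0 : ℝ) ≤ 2 * t), add_assoc, ← mul_add,
      ← log_mul (by linarith) two_ne_zero]
    gcongr
    linarith

theorem summable_logBar_div {q a : ℝ} :
    Summable fun j : ℕ => logBar q a (2 ^ (j + 1)) / √(2 ^ j) := by
  have hr : |1 / √2| < 1 := by
    rw [abs_of_nonneg (by positivity), div_lt_one (by positivity)]
    exact (lt_sqrt zero_le_one).2 (by norm_num)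
  have h0 : Summable fun j : ℕ => (1 / √2) ^ j := summable_geometric_of_norm_lt_one hr
  have h1 : Summable fun j : ℕ => (j : ℝ) ^ 1 * (1 / √2) ^ j :=
    summable_pow_mul_geometric_of_norm_lt_one 1 hr
  have hs : Summable fun j : ℕ => |q| * (1 / √2) ^ j + |a| * log 2 *
      ((j : ℝ) ^ 1 * (1 / √2) ^ j + 2 * (1 / √2) ^ j) :=
    (h0.mul_left _).add ((h1.add (h0.mul_left 2)).mul_left _)
  refine Summable.of_norm_bounded hs fun j => ?_
  have e : √((2 : ℝ) ^ j) = √2 ^ j := by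
    rw [sqrt_eq_iff_eq_sq (by positivity) (by positivity), ← pow_mul, mul_comm, pow_mul,
      sq_sqrt zero_le_two]
  have hl : log (1 + |(2 : ℝ) ^ (j + 1)|) ≤ (j + 2) * log 2 := by
    rw [abs_of_nonneg (by positivity)]
    have : ((j : ℝ) + 2) * log 2 = log (2 ^ (j + 2)) := by rw [log_pow]; push_cast; ring
    rw [this]
    refine log_le_log (by positivity) ?_
    have h1 : (1 : ℝ) ≤ 2 ^ (j + 1) := one_le_pow₀ one_le_two
    rw [pow_succ _ (j + 1)]
    linarith
  have hl0 : 0 ≤ log (1 + |(2 : ℝ) ^ (j + 1)|) :=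
    log_nonneg (by linarith [abs_nonneg ((2 : ℝ) ^ (j + 1))])
  rw [norm_div, norm_of_nonneg (sqrt_nonneg _), e, div_eq_mul_one_div, ← one_div_pow]
  have : ‖logBar q a (2 ^ (j + 1))‖ ≤ |q| + |a| * ((j + 2) * log 2) := by
    unfold logBar
    refine (norm_add_le _ _).trans ?_
    rw [norm_mul, norm_eq_abs, norm_eq_abs, norm_of_nonneg hl0]
    gcongr
  calc ‖logBar q a (2 ^ (j + 1))‖ * (1 / √2) ^ j
      ≤ (|q| + |a| * ((j + 2) * log 2)) * (1 / √2) ^ j := by gcongr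
    _ = _ := by ring

section Compact

variable {ν : Measure V} [IsFiniteMeasure ν]

theorem integrable_of_ae_mem_isCompact (hK : IsCompact Kc) (hν : ∀ᵐ x ∂ν, x ∈ Kc) {f : V → ℝ}
    (hf : Continuous f) : Integrable f ν := by
  have := hf.continuousOn.integrableOn_compact (μ := ν) hK
  rwa [IntegrableOn, Measure.restrict_eq_self_of_ae_mem hν] at this

theorem continuous_integral_of_ae_mem_isCompact (hK : IsCompact Kc) (hν : ∀ᵐ x ∂ν, x ∈ Kc)
    {F : ℝ → V → ℝ} (hF : Continuous F.uncurry) : Continuous fun t => ∫ x, F t x ∂ν := by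
  have := continuous_parametric_integral_of_continuous (μ := ν) hF hK
  rwa [Measure.restrict_eq_self_of_ae_mem hν] at this

end Compact

/-- The exponential weight, as a real number. -/
noncomputable def expWt {Ω V : Type*} (γ : ℝ) (X : ℝ → V → Ω → ℝ) (k : ℝ → V → V → ℝ) (t : ℝ)
    (x : V) (ω : Ω) : ℝ := exp (γ * X t x ω - γ ^ 2 / 2 * (k 0 x x + t))

/-- The total weight. -/
noncomputable def totMass {Ω V : Type*} [MeasurableSpace V] (γ : ℝ) (X : ℝ → V → Ω → ℝ)
    (k : ℝ → V → V → ℝ) (ν : Measure V) (t : ℝ) (ω : Ω) : ℝ := ∫ x, expWt γ X k t x ω ∂ν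

/-- The total weight times the distance to the barrier. -/
noncomputable def potMass {Ω V : Type*} [MeasurableSpace V] (γ : ℝ) (X : ℝ → V → Ω → ℝ)
    (k : ℝ → V → V → ℝ) (ν : Measure V) (f : ℝ → ℝ) (t : ℝ) (ω : Ω) : ℝ :=
  ∫ x, (f t - rel γ X x t ω) * expWt γ X k t x ω ∂ν

theorem expWt_pos {Ω V : Type*} (γ : ℝ) (X : ℝ → V → Ω → ℝ) (k : ℝ → V → V → ℝ) (t : ℝ)
    (x : V) (ω : Ω) : 0 < expWt γ X k t x ω := exp_pos _

theorem totMass_nonneg {Ω V : Type*} [MeasurableSpace V] (γ : ℝ) (X : ℝ → V → Ω → ℝ)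
    (k : ℝ → V → V → ℝ) (ν : Measure V) (t : ℝ) (ω : Ω) : 0 ≤ totMass γ X k ν t ω :=
  integral_nonneg fun _ => (expWt_pos _ _ _ _ _ _).le

namespace IsStarField

variable {γ t : ℝ} {f g : ℝ → ℝ} {ω : Ω}

theorem wt_eq_ofReal_expWt (hX : IsStarField X k P) (ht : 0 ≤ t) (x : V) (ω : Ω) :
    wt γ X k t x ω = ofReal (expWt γ X k t x ω) := by
  rw [wt, expWt, hX.diag t x ht]

theorem continuous_expWt (hX : IsStarField X k P) (hk : Continuous fun x => k 0 x x) (ω : Ω) :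
    Continuous (Function.uncurry fun t x => expWt γ X k t x ω) := by
  have h1 := hX.cont ω
  have h2 : Continuous fun p : ℝ × V => k 0 p.2 p.2 := hk.comp continuous_snd
  have h3 : Continuous fun p : ℝ × V =>
      exp (γ * X p.1 p.2 ω - γ ^ 2 / 2 * (k 0 p.2 p.2 + p.1)) :=
    ((h1.const_mul γ).sub ((h2.add continuous_fst).const_mul _)).rexp
  exact h3

theorem continuous_rel_joint (hX : IsStarField X k P) (ω : Ω) :
    Continuous (Function.uncurry fun t x => rel γ X x t ω) := by
  have h1 := hX.cont ω
  have h2 : Continuous fun p : ℝ × V => X 0 p.2 ω :=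
    h1.comp (continuous_const.prodMk continuous_snd)
  have h3 : Continuous fun p : ℝ × V => X p.1 p.2 ω - X 0 p.2 ω - γ * p.1 :=
    (h1.sub h2).sub (continuous_fst.const_mul γ)
  exact h3

theorem continuous_potWt (hX : IsStarField X k P) (hk : Continuous fun x => k 0 x x)
    (hf : Continuous f) (ω : Ω) :
    Continuous (Function.uncurry fun t x => (f t - rel γ X x t ω) * expWt γ X k t x ω) :=
  ((hf.comp continuous_fst).sub (hX.continuous_rel_joint ω)).mul (hX.continuous_expWt hk ω)

variable {ν : Measure V} [IsFiniteMeasure ν]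

theorem integrable_expWt (hX : IsStarField X k P) (hk : Continuous fun x => k 0 x x)
    (hK : IsCompact Kc) (hν : ∀ᵐ x ∂ν, x ∈ Kc) (t : ℝ) (ω : Ω) :
    Integrable (fun x => expWt γ X k t x ω) ν :=
  integrable_of_ae_mem_isCompact hK hν
    ((hX.continuous_expWt hk ω).comp (continuous_const.prodMk continuous_id))

theorem integrable_mul_expWt (hX : IsStarField X k P) (hk : Continuous fun x => k 0 x x)
    (hK : IsCompact Kc) (hν : ∀ᵐ x ∂ν, x ∈ Kc) (t : ℝ) (ω : Ω) {h : V → ℝ} (hh : Continuous h) :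
    Integrable (fun x => h x * expWt γ X k t x ω) ν :=
  integrable_of_ae_mem_isCompact hK hν
    (hh.mul ((hX.continuous_expWt hk ω).comp (continuous_const.prodMk continuous_id)))

theorem integrable_potWt (hX : IsStarField X k P) (hk : Continuous fun x => k 0 x x)
    (hK : IsCompact Kc) (hν : ∀ᵐ x ∂ν, x ∈ Kc) (f : ℝ → ℝ) (t : ℝ) (ω : Ω) :
    Integrable (fun x => (f t - rel γ X x t ω) * expWt γ X k t x ω) ν :=
  hX.integrable_mul_expWt hk hK hν t ω (continuous_const.sub
    ((hX.continuous_rel_joint ω).comp (continuous_const.prodMk continuous_id)))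

theorem continuous_potMass (hX : IsStarField X k P) (hk : Continuous fun x => k 0 x x)
    (hK : IsCompact Kc) (hν : ∀ᵐ x ∂ν, x ∈ Kc) (hf : Continuous f) (ω : Ω) :
    Continuous fun t => potMass γ X k ν f t ω :=
  continuous_integral_of_ae_mem_isCompact hK hν (hX.continuous_potWt hk hf ω)

theorem truncMass_eq (hX : IsStarField X k P) (hk : Continuous fun x => k 0 x x)
    (hK : IsCompact Kc) (hν : ∀ᵐ x ∂ν, x ∈ Kc) (ht : 0 ≤ t)
    (hG : ∀ x ∈ Kc, ∀ s, 0 ≤ s → rel γ X x s ω ≤ f s) :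
    truncMass γ X k ν f t ω = ofReal (totMass γ X k ν t ω) := by
  rw [totMass, ofReal_integral_eq_lintegral_ofReal (hX.integrable_expWt hk hK hν t ω)
    (ae_of_all _ fun x => (expWt_pos _ _ _ _ _ _).le), truncMass]
  refine lintegral_congr_ae ?_
  filter_upwards [hν] with x hx
  rw [indicator_of_mem (show ω ∈ below (rel γ X x) f 0 t from fun s hs => hG x hx s hs.1),
    Pi.one_apply, mul_one, hX.wt_eq_ofReal_expWt ht]

theorem derivMass_eq (hX : IsStarField X k P) (hk : Continuous fun x => k 0 x x)
    (hK : IsCompact Kc) (hν : ∀ᵐ x ∂ν, x ∈ Kc) (ht : 0 ≤ t)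
    (hG : ∀ x ∈ Kc, ∀ s, 0 ≤ s → rel γ X x s ω ≤ f s) : 0 ≤ potMass γ X k ν f t ω ∧
      derivMass γ X k ν f t ω = ofReal (potMass γ X k ν f t ω) := by
  have h0 : ∀ᵐ x ∂ν, 0 ≤ (f t - rel γ X x t ω) * expWt γ X k t x ω := by
    filter_upwards [hν] with x hx
    exact mul_nonneg (sub_nonneg.2 (hG x hx t ht)) (expWt_pos _ _ _ _ _ _).le
  refine ⟨integral_nonneg_of_ae h0, ?_⟩
  rw [potMass, ofReal_integral_eq_lintegral_ofReal (hX.integrable_potWt hk hK hν f t ω) h0,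
    derivMass]
  refine lintegral_congr_ae ?_
  filter_upwards [hν] with x hx
  rw [indicator_of_mem (show ω ∈ below (rel γ X x) f 0 t from fun s hs => hG x hx s hs.1),
    Pi.one_apply, mul_one, hX.wt_eq_ofReal_expWt ht, ofReal_mul
      (sub_nonneg.2 (hG x hx t ht))]

theorem potMass_eq_add (hX : IsStarField X k P) (hk : Continuous fun x => k 0 x x)
    (hK : IsCompact Kc) (hν : ∀ᵐ x ∂ν, x ∈ Kc) (f g : ℝ → ℝ) (t : ℝ) (ω : Ω) :
    potMass γ X k ν g t ω = potMass γ X k ν f t ω + (g t - f t) * totMass γ X k ν t ω := by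
  rw [potMass, potMass, totMass, ← integral_const_mul, ← integral_add
    (hX.integrable_potWt hk hK hν f t ω) ((hX.integrable_expWt hk hK hν t ω).const_mul _)]
  exact integral_congr_ae (ae_of_all _ fun x => by ring)

/-- Expected truncated mass. -/
theorem lintegral_truncMass_le {c : ℝ} (hX : IsStarField X k P) (hf : IsBarrier f c) (ht : 1 ≤ t) :
    ofReal √t * ∫⁻ ω, truncMass γ X k ν f t ω ∂P ≤ ofReal (barrierConst f c) * ν univ := by
  have ht0 : 0 ≤ t := by linarith
  rw [hX.lintegral_truncMass hf.cont ht0, ← lintegral_const,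
    ← lintegral_const_mul' _ _ ofReal_ne_top]
  refine lintegral_mono fun x => ?_
  have hQ := hX.isProbabilityMeasure_tilt (γ := γ) ht0 x
  have hB := hX.isBMF_tilt (γ := γ) ht0 x
  have h := hB.gap_add_le hf ht
  rw [below_drifted γ X f 0 x le_rfl] at h
  rw [IsStarField.lintegral_wt_mul_indicator (hX.measurableSet_below_rel' hf.cont ht0 x)]
  exact le_add_self.trans h

end IsStarField

theorem tendsto_logBar_div_sqrt (q a : ℝ) :
    Tendsto (fun t => logBar q a t / √t) atTop (nhds 0) := by
  have h1 : Tendsto (fun t : ℝ => 1 / √t) atTop (nhds 0) :=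
    tendsto_const_nhds.div_atTop tendsto_sqrt_atTop
  have h2 : Tendsto (fun t : ℝ => log t / √t) atTop (nhds 0) := by
    have := (isLittleO_log_rpow_atTop (by norm_num : (0 : ℝ) < 1 / 2)).tendsto_div_nhds_zero
    simpa only [sqrt_eq_rpow] using this
  have h3 : Tendsto (fun t : ℝ => |q| * (1 / √t) + |a| * (log 2 * (1 / √t) + log t / √t)) atTop
      (nhds 0) := by
    have := (h1.const_mul |q|).add (((h1.const_mul (log 2)).add h2).const_mul |a|)
    simpa using this
  refine squeeze_zero_norm' ?_ h3
  filter_upwards [eventually_ge_atTop 1] with t ht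
  have ht0 : 0 < t := by linarith
  have hl0 : 0 ≤ log (1 + |t|) := log_nonneg (by linarith [abs_nonneg t])
  have hl : log (1 + |t|) ≤ log 2 + log t := by
    rw [← log_mul two_ne_zero ht0.ne', abs_of_pos ht0]
    exact log_le_log (by linarith) (by linarith)
  rw [norm_div, norm_of_nonneg (sqrt_nonneg _)]
  have : ‖logBar q a t‖ ≤ |q| + |a| * (log 2 + log t) := by
    unfold logBar
    refine (norm_add_le _ _).trans ?_
    rw [norm_mul, norm_eq_abs, norm_eq_abs, norm_of_nonneg hl0]
    gcongr
  calc ‖logBar q a t‖ / √t ≤ (|q| + |a| * (log 2 + log t)) / √t := by gcongr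
    _ = _ := by ring

/-- On `G` every path indexed by `Kc` stays below the logarithmic barrier. -/
def IsBarrierOn (γ : ℝ) (X : ℝ → V → Ω → ℝ) (Kc : Set V) (q a : ℝ) (G : Set Ω) : Prop :=
  ∀ ω ∈ G, ∀ x ∈ Kc, ∀ t, 0 ≤ t → rel γ X x t ω ≤ logBar q a t

namespace IsStarField

variable {γ q a : ℝ} {f g : ℝ → ℝ} {G : Set Ω} {ν : Measure V} [IsFiniteMeasure ν]

theorem liminf_logBar_mul_truncMass (hX : IsStarField X k P) (hq : 0 ≤ q) (ha : 0 ≤ a) :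
    ∀ᵐ ω ∂P, liminf (fun n : ℕ => ofReal (logBar q a n) *
      truncMass γ X k ν (logBar q a) n ω) atTop = 0 := by
  have hm : ∀ n : ℕ, Measurable fun ω => ofReal (logBar q a n) *
      truncMass γ X k ν (logBar q a) n ω := fun n =>
    (hX.measurable_truncMass (continuous_logBar q a) n.cast_nonneg).const_mul _
  have hB := isBarrier_logBar hq ha
  set b := ofReal (barrierConst (logBar q a) (a * log 2)) * ν univ with hb
  have hbt : b ≠ ⊤ := ENNReal.mul_ne_top ofReal_ne_top (measure_ne_top _ _)
  have hlim : Tendsto (fun n : ℕ => ofReal (logBar q a n / √(n : ℝ)) * b) atTop (nhds 0) :=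
    tendsto_ofReal_mul_const_zero hbt
      ((tendsto_logBar_div_sqrt q a).comp tendsto_natCast_atTop_atTop)
  have hle : ∀ᶠ n : ℕ in atTop, ∫⁻ ω, ofReal (logBar q a n) *
      truncMass γ X k ν (logBar q a) n ω ∂P ≤ ofReal (logBar q a n / √(n : ℝ)) * b := by
    filter_upwards [eventually_ge_atTop 1] with n hn
    have hn' : (1 : ℝ) ≤ n := by exact_mod_cast hn
    rw [lintegral_const_mul' _ _ ofReal_ne_top]
    have h := hX.lintegral_truncMass_le (γ := γ) (ν := ν) hB hn'
    have hs : 0 < √(n : ℝ) := sqrt_pos.2 (by linarith)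
    calc ofReal (logBar q a n) * ∫⁻ ω, truncMass γ X k ν (logBar q a) n ω ∂P
        = ofReal (logBar q a n / √(n : ℝ)) *
          (ofReal √n * ∫⁻ ω, truncMass γ X k ν (logBar q a) n ω ∂P) := by
          rw [← mul_assoc, ← ofReal_mul (div_nonneg (hq.trans (le_logBar ha _)) hs.le),
            div_mul_cancel₀ _ hs.ne']
      _ ≤ _ := mul_le_mul_right h _
  have h0 : ∫⁻ ω, liminf (fun n : ℕ => ofReal (logBar q a n) *
      truncMass γ X k ν (logBar q a) n ω) atTop ∂P = 0 := by
    refine le_antisymm ((lintegral_liminf_le hm).trans ?_) zero_le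
    have := liminf_le_liminf hle
    rwa [hlim.liminf_eq] at this
  exact (lintegral_eq_zero_iff (.liminf hm)).1 h0

/-- Almost sure convergence on a good event, when the derivative masses are asymptotically close. -/
theorem ae_tendsto_potMass (hX : IsStarField X k P) (hk : Continuous fun x => k 0 x x)
    (hK : IsCompact Kc) (hν : ∀ᵐ x ∂ν, x ∈ Kc) (hq : 0 ≤ q) (ha : 0 ≤ a)
    (hG : IsBarrierOn γ X Kc q a G)
    (hcl : ∀ ε : ENNReal, ε ≠ 0 → ∀ᶠ u in atTop, ∀ t ≥ u,
      Close P ε (derivMass γ X k ν (logBar q a) u) (derivMass γ X k ν (logBar q a) t)) :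
    ∀ᵐ ω ∂P, ω ∈ G → ∃ l, Tendsto (fun t => potMass γ X k ν (logBar q a) t ω) atTop (nhds l) := by
  have hB := isBarrier_logBar hq ha
  refine (hX.isPosSubmartingale_derivMass (γ := γ) (ν := ν) hB).ae_tendsto ?_ hcl
    (fun ω _ => hX.continuous_potMass hk hK hν hB.cont ω)
    (fun ω hω s hs => hX.derivMass_eq hk hK hν hs (hG ω hω))
  filter_upwards [eventually_ge_atTop 1] with u hu
  exact ne_top_of_le_ne_top (ENNReal.mul_ne_top ofReal_ne_top (measure_ne_top _ _))
    (hX.lintegral_derivMass_le hB hu)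

theorem ae_tendsto_potMass_logBar (hX : IsStarField X k P) (hk : Continuous fun x => k 0 x x)
    (hK : IsCompact Kc) (hν : ∀ᵐ x ∂ν, x ∈ Kc) (hq : 0 ≤ q) (ha : 0 ≤ a)
    (hG : IsBarrierOn γ X Kc q a G)
    (hcl : ∀ q a : ℝ, 0 ≤ q → 0 ≤ a → ∀ ε : ENNReal, ε ≠ 0 → ∀ᶠ u in atTop, ∀ t ≥ u,
      Close P ε (derivMass γ X k ν (logBar q a) u) (derivMass γ X k ν (logBar q a) t)) :
    ∀ᵐ ω ∂P, ω ∈ G → (∃ l, Tendsto (fun t => potMass γ X k ν (logBar q a) t ω) atTop (nhds l)) ∧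
      Tendsto (fun t => logBar q a t * totMass γ X k ν t ω) atTop (nhds 0) := by
  have hG2 : IsBarrierOn γ X Kc (2 * q) (2 * a) G := by
    intro ω hω x hx t ht
    rw [logBar_double]
    have := hq.trans (le_logBar (q := q) ha t)
    linarith [hG ω hω x hx t ht]
  have h2q : 0 ≤ 2 * q := by positivity
  have h2a : 0 ≤ 2 * a := by positivity
  filter_upwards [hX.ae_tendsto_potMass hk hK hν hq ha hG (hcl q a hq ha),
    hX.ae_tendsto_potMass hk hK hν h2q h2a hG2 (hcl _ _ h2q h2a),
    hX.liminf_logBar_mul_truncMass (γ := γ) (ν := ν) hq ha] with ω h1 h2 h3 hω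
  obtain ⟨l₁, h1⟩ := h1 hω
  obtain ⟨l₂, h2⟩ := h2 hω
  have h4 : Tendsto (fun t => logBar q a t * totMass γ X k ν t ω) atTop (nhds (l₂ - l₁)) := by
    refine (h2.sub h1).congr fun t => ?_
    rw [hX.potMass_eq_add hk hK hν (logBar q a) (logBar (2 * q) (2 * a)), logBar_double]
    ring
  refine ⟨⟨l₁, h1⟩, ?_⟩
  have h5 : Tendsto (fun n : ℕ => ofReal (logBar q a n) *
      truncMass γ X k ν (logBar q a) n ω) atTop (nhds (ofReal (l₂ - l₁))) := by
    refine (ENNReal.tendsto_ofReal (h4.comp tendsto_natCast_atTop_atTop)).congr fun n => ?_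
    rw [hX.truncMass_eq hk hK hν n.cast_nonneg (hG ω hω), ← ofReal_mul (hq.trans (le_logBar ha _))]
    rfl
  rw [h5.liminf_eq, ofReal_eq_zero] at h3
  have h6 : 0 ≤ l₂ - l₁ := ge_of_tendsto' h4 fun t =>
    mul_nonneg (hq.trans (le_logBar ha _)) (totMass_nonneg _ _ _ _ _ _)
  rwa [le_antisymm h3 h6] at h4

end IsStarField

/-- Brownian motion grows sublinearly. -/
theorem IsBM.ae_eventually_le (hB : IsBM B Q) {c : ℝ} (hc : 0 < c) : ∀ᵐ ω ∂Q, ∀ᶠ t in atTop, B t ω ≤ c * t := by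
  have hm : ∀ j : ℕ, Measurable (runSup B 0 (2 ^ (j + 1))) := fun j =>
    measurable_runSup (by positivity) (fun s _ => hB.meas s) hB.cont
  have hP : ∀ j : ℕ, Q {ω | c * 2 ^ j ≤ runSup B 0 (2 ^ (j + 1)) ω} ≤
      ofReal (4 * √2 / c * (1 / √2) ^ j) := by
    intro j
    have hpos : 0 < c * 2 ^ j := by positivity
    have h1 := mul_meas_ge_le_lintegral (μ := Q) (hm j).ennreal_ofReal
      (ofReal (c * 2 ^ j))
    have h2 := h1.trans (hB.lintegral_runSup_le (h := 2 ^ (j + 1)) (by positivity))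
    rw [mul_comm, ← le_div_iff_mul_le (Or.inl (by simpa using hpos))
      (Or.inl ofReal_ne_top), ← ofReal_div_of_pos hpos] at h2
    refine (measure_mono fun ω hω => ofReal_le_ofReal hω).trans (h2.trans_eq ?_)
    congr 1
    have e : √((2 : ℝ) ^ (j + 1)) = √2 ^ (j + 1) := by
      rw [sqrt_eq_iff_eq_sq (by positivity) (by positivity), ← pow_mul, mul_comm, pow_mul,
        sq_sqrt zero_le_two]
    have e2 : (2 : ℝ) ^ j = √2 ^ j * √2 ^ j := by
      rw [← mul_pow, mul_self_sqrt zero_le_two]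
    rw [e, e2, one_div_pow, pow_succ]
    field_simp
  have hsum : Summable fun j : ℕ => 4 * √2 / c * (1 / √2) ^ j := by
    have hr : |1 / √2| < 1 := by
      rw [abs_of_nonneg (by positivity), div_lt_one (by positivity)]
      exact (lt_sqrt zero_le_one).2 (by norm_num)
    have hg : Summable fun j : ℕ => (1 / √2) ^ j := summable_geometric_of_abs_lt_one hr
    exact hg.mul_left (4 * √2 / c)
  have hfin : ∑' j : ℕ, Q {ω | c * 2 ^ j ≤ runSup B 0 (2 ^ (j + 1)) ω} ≠ ⊤ := by
    have h1 := ENNReal.tsum_le_tsum hP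
    have h2 := hsum.tsum_ofReal_ne_top
    exact ne_top_of_le_ne_top h2 h1
  have hBC := ae_eventually_notMem (μ := Q)
    (s := fun j : ℕ => {ω | c * 2 ^ j ≤ runSup B 0 (2 ^ (j + 1)) ω})
    hfin
  filter_upwards [hBC] with ω hω
  obtain ⟨J, hJ⟩ := eventually_atTop.1 hω
  filter_upwards [eventually_ge_atTop (2 ^ J : ℝ)] with t ht
  have ht1 : (1 : ℝ) ≤ t := (one_le_pow₀ one_le_two).trans ht
  obtain ⟨j, hj1, hj2⟩ := exists_nat_pow_near ht1 one_lt_two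
  have hJj : J ≤ j := by
    by_contra h
    have : (2 : ℝ) ^ (j + 1) ≤ 2 ^ J := pow_le_pow_right₀ one_le_two (by lia)
    linarith
  have h := hJ j hJj
  simp only [not_le] at h
  have h3 := le_runSup (hB.cont ω) (⟨by linarith, hj2.le⟩ : t ∈ Icc (0 : ℝ) (2 ^ (j + 1)))
  calc B t ω ≤ c * 2 ^ j := h3.trans h.le
    _ ≤ c * t := by gcongr

theorem exists_finset_measure_sdiff_le {V : Type*} [MeasurableSpace V] [MeasurableSingletonClass V]
    {ν : Measure V} [IsFiniteMeasure ν] {S : Set V} (hS : S.Countable) {η : ENNReal} (hη : η ≠ 0) :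
    ∃ F : Finset V, (F : Set V) ⊆ S ∧ ν (S \ F) ≤ η := by
  classical
  rcases S.eq_empty_or_nonempty with rfl | hne
  · exact ⟨∅, by simp, by simp⟩
  obtain ⟨f, rfl⟩ := hS.exists_eq_range hne
  set A : ℕ → Set V := fun n => Set.range f \ ((Finset.range n).image f : Finset V) with hA
  have hanti : Antitone A := fun m n hmn => Set.sdiff_subset_sdiff_right
    (by exact_mod_cast Finset.image_subset_image (Finset.range_subset_range.2 hmn))
  have hinter : ⋂ n, A n = ∅ := by
    ext x
    simp only [mem_iInter, mem_empty_iff_false, iff_false, not_forall]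
    by_cases hx : x ∈ Set.range f
    · obtain ⟨n, rfl⟩ := hx
      refine ⟨n + 1, fun h => h.2 ?_⟩
      exact_mod_cast Finset.mem_image_of_mem f (Finset.mem_range.2 n.lt_succ_self)
    · exact ⟨0, fun h => hx h.1⟩
  have hlim := tendsto_measure_iInter_atTop (μ := ν) (s := A)
    (fun n => (hS.measurableSet.diff (Finset.measurableSet _)).nullMeasurableSet) hanti
    ⟨0, measure_ne_top _ _⟩
  rw [hinter, measure_empty] at hlim
  obtain ⟨n, hn⟩ := (hlim.eventually (gt_mem_nhds (pos_iff_ne_zero.2 hη))).exists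
  refine ⟨(Finset.range n).image f, ?_, hn.le⟩
  intro x hx
  obtain ⟨m, -, rfl⟩ := Finset.mem_image.1 (Finset.mem_coe.1 hx)
  exact ⟨m, rfl⟩

namespace IsStarField

variable {γ q a : ℝ} {f g : ℝ → ℝ} {G : Set Ω}

theorem expWt_eq_mul (γ : ℝ) (X : ℝ → V → Ω → ℝ) (k : ℝ → V → V → ℝ) (t : ℝ) (x : V) (ω : Ω) :
    expWt γ X k t x ω = exp (γ * X 0 x ω - γ ^ 2 / 2 * k 0 x x) *
      exp (γ * rel γ X x t ω + γ ^ 2 / 2 * t) := by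
  rw [expWt, ← exp_add, rel]
  congr 1
  ring

/-- The weight of a single point decays exponentially. -/
theorem ae_tendsto_point (hX : IsStarField X k P) (hγ : 0 < γ) (q a : ℝ) (x : V) :
    ∀ᵐ ω ∂P, Tendsto (fun t => (logBar q a t - rel γ X x t ω) * expWt γ X k t x ω) atTop (nhds 0) ∧
      Tendsto (fun t => √(π * t / 2) * expWt γ X k t x ω) atTop (nhds 0) := by
  have hc : 0 < γ / 10 := by positivity
  filter_upwards [(hX.isBM x).ae_eventually_le hc] with ω hω
  set c := γ ^ 2 / 5 with hcdef
  have hc0 : 0 < c := by positivity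
  set w := exp (γ * X 0 x ω - γ ^ 2 / 2 * k 0 x x) with hw
  have hw0 : 0 < w := exp_pos _
  have key : ∀ᶠ t in atTop, rel γ X x t ω ≤ 0 ∧ expWt γ X k t x ω ≤ w * exp (-c * t) ∧
      -rel γ X x t ω * expWt γ X k t x ω ≤ w * (9 / (2 * γ)) * exp (-c * t) := by
    filter_upwards [hω, eventually_ge_atTop 0] with t h1 ht
    have h2 : rel γ X x t ω ≤ -(9 / 10 * γ * t) := by
      rw [rel]; linarith
    set z := -rel γ X x t ω with hz
    have hz1 : 9 / 10 * γ * t ≤ z := by linarith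
    have hz0 : 0 ≤ z := le_trans (by positivity) hz1
    have e : expWt γ X k t x ω ≤ w * (exp (-(2 / 9 * γ * z)) * exp (-c * t)) := by
      rw [expWt_eq_mul, ← hw, ← exp_add (-(2 / 9 * γ * z))]
      refine mul_le_mul_of_nonneg_left (exp_le_exp.2 ?_) hw0.le
      have : rel γ X x t ω = -z := by rw [hz]; ring
      rw [this, hcdef]
      nlinarith [mul_le_mul_of_nonneg_left hz1 hγ.le]
    refine ⟨by linarith, e.trans ?_, ?_⟩
    · refine mul_le_mul_of_nonneg_left ?_ hw0.le
      refine mul_le_of_le_one_left (exp_pos _).le (exp_le_one_iff.2 ?_)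
      have : 0 ≤ 2 / 9 * γ * z := by positivity
      linarith
    · have h3 : 2 / 9 * γ * z * exp (-(2 / 9 * γ * z)) ≤ 1 := by
        rw [exp_neg, ← div_eq_mul_inv, div_le_one (exp_pos _)]
        linarith [add_one_le_exp (2 / 9 * γ * z)]
      have h4 : z * exp (-(2 / 9 * γ * z)) ≤ 9 / (2 * γ) := by
        rw [le_div_iff₀ (by positivity)]
        nlinarith
      calc z * expWt γ X k t x ω ≤ z * (w * (exp (-(2 / 9 * γ * z)) * exp (-c * t))) := by gcongr
        _ = w * (z * exp (-(2 / 9 * γ * z))) * exp (-c * t) := by ring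
        _ ≤ _ := by gcongr
  have hE0 : Tendsto (fun t => exp (-c * t)) atTop (nhds 0) := by
    simpa using tendsto_rpow_mul_exp_neg_mul_atTop_nhds_zero 0 c hc0
  have hE2 : Tendsto (fun t : ℝ => √t * exp (-c * t)) atTop (nhds 0) := by
    simpa only [sqrt_eq_rpow] using tendsto_rpow_mul_exp_neg_mul_atTop_nhds_zero (1 / 2) c hc0
  have hEl : Tendsto (fun t : ℝ => |logBar q a t| * exp (-c * t)) atTop (nhds 0) := by
    have h1 := (tendsto_logBar_div_sqrt q a).abs.mul hE2
    rw [abs_zero, zero_mul] at h1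
    refine h1.congr' ?_
    filter_upwards [eventually_gt_atTop 0] with t ht
    have : 0 < √t := sqrt_pos.2 ht
    rw [abs_div, abs_of_pos this]
    field_simp
  constructor
  · have hlim := (hEl.const_mul w).add (hE0.const_mul (w * (9 / (2 * γ))))
    rw [mul_zero, mul_zero, add_zero] at hlim
    refine squeeze_zero_norm' ?_ hlim
    filter_upwards [key] with t ⟨h1, h2, h3⟩
    have h0 := (expWt_pos γ X k t x ω).le
    have e : (logBar q a t - rel γ X x t ω) * expWt γ X k t x ω =
        logBar q a t * expWt γ X k t x ω + -rel γ X x t ω * expWt γ X k t x ω := by ring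
    rw [e]
    refine (norm_add_le _ _).trans (add_le_add ?_ ?_)
    · rw [norm_mul, norm_eq_abs, norm_of_nonneg h0]
      calc _ ≤ |logBar q a t| * (w * exp (-c * t)) := by gcongr
        _ = _ := by ring
    · rwa [norm_of_nonneg (mul_nonneg (by linarith) h0)]
  · have hlim := hE2.const_mul (√(π / 2) * w)
    rw [mul_zero] at hlim
    refine squeeze_zero_norm' ?_ hlim
    filter_upwards [key] with t ⟨h1, h2, h3⟩
    rw [sqrt_pi_mul, norm_of_nonneg (mul_nonneg (by positivity) (expWt_pos _ _ _ _ _ _).le)]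
    calc _ ≤ √(π / 2) * √t * (w * exp (-c * t)) := by gcongr
      _ = _ := by ring

variable {ν : Measure V} [IsFiniteMeasure ν]

theorem ae_tendsto_finset (hX : IsStarField X k P) (hk : Continuous fun x => k 0 x x) (hγ : 0 < γ)
    (hK : IsCompact Kc) (hν : ∀ᵐ x ∂ν, x ∈ Kc) (q a : ℝ) (F : Finset V) :
    ∀ᵐ ω ∂P, Tendsto (fun t => potMass γ X k (ν.restrict F) (logBar q a) t ω) atTop (nhds 0) ∧
      Tendsto (fun t => √(π * t / 2) * totMass γ X k (ν.restrict F) t ω) atTop (nhds 0) := by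
  have h := (ae_ball_iff F.countable_toSet (p := fun ω x _ =>
    Tendsto (fun t => (logBar q a t - rel γ X x t ω) * expWt γ X k t x ω) atTop (nhds 0) ∧
      Tendsto (fun t => √(π * t / 2) * expWt γ X k t x ω) atTop (nhds 0))).2
    fun x _ => hX.ae_tendsto_point hγ q a x
  filter_upwards [h] with ω hω
  constructor
  · have e : (fun t => potMass γ X k (ν.restrict F) (logBar q a) t ω) = fun t =>
        ∑ x ∈ F, ν.real {x} • ((logBar q a t - rel γ X x t ω) * expWt γ X k t x ω) := by
      ext t
      exact setIntegral_finset F (hX.integrable_potWt hk hK hν _ t ω).integrableOn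
    rw [e]
    have h0 : (0 : ℝ) = ∑ x ∈ F, (0 : ℝ) := by simp
    rw [h0]
    refine tendsto_finsetSum _ fun x hx => ?_
    simpa using ((hω x hx).1.const_smul (ν.real {x}))
  · have e : (fun t => √(π * t / 2) * totMass γ X k (ν.restrict F) t ω) = fun t =>
        ∑ x ∈ F, ν.real {x} • (√(π * t / 2) * expWt γ X k t x ω) := by
      ext t
      rw [totMass, setIntegral_finset F (hX.integrable_expWt hk hK hν t ω).integrableOn,
        Finset.mul_sum]
      refine Finset.sum_congr rfl fun x _ => ?_
      simp only [smul_eq_mul]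
      ring
    rw [e]
    have h0 : (0 : ℝ) = ∑ x ∈ F, (0 : ℝ) := by simp
    rw [h0]
    refine tendsto_finsetSum _ fun x hx => ?_
    simpa using ((hω x hx).2.const_smul (ν.real {x}))

end IsStarField

theorem exists_mul_div_le {b c ε : ENNReal} (hb : b ≠ ⊤) (hc : c ≠ 0) (hε : ε ≠ 0) :
    ∃ η : ENNReal, η ≠ 0 ∧ b * η / c ≤ ε := by
  obtain ⟨n, hn, h⟩ := ENNReal.exists_nnreal_pos_mul_lt (ENNReal.div_ne_top hb hc) hε
  refine ⟨n, by simpa using hn.ne', ?_⟩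
  rw [mul_comm, mul_div_assoc]
  exact h.le

theorem tendsto_measure_of_ae_tendsto [IsFiniteMeasure P] {Y : ℝ → Ω → ℝ} (hm : ∀ᶠ t in atTop, Measurable (Y t))
    (h : ∀ᵐ ω ∂P, Tendsto (fun t => Y t ω) atTop (nhds 0)) {ε : ℝ} (hε : 0 < ε) :
    Tendsto (fun t => P {ω | ε ≤ |Y t ω|}) atTop (nhds 0) := by
  obtain ⟨T, hT⟩ := eventually_atTop.1 hm
  have hM : TendstoInMeasure P (fun t ω => Y (max t T) ω) atTop (fun _ => 0) := by
    intro e he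
    refine tendsto_of_seq_tendsto fun s hs => ?_
    refine tendstoInMeasure_of_tendsto_ae (f := fun n ω => Y (max (s n) T) ω)
      (fun n => (hT _ (le_max_right _ _)).aestronglyMeasurable) ?_ e he
    filter_upwards [h] with ω hω
    exact hω.comp (tendsto_atTop_mono (fun n => le_max_left _ _) hs)
  rw [tendstoInMeasure_iff_norm] at hM
  refine (hM ε hε).congr' ?_
  filter_upwards [eventually_ge_atTop T] with t ht
  simp [max_eq_left ht]

namespace IsStarField

variable {γ q a : ℝ} {f g : ℝ → ℝ} {G : Set Ω} {ν ν₁ ν₂ : Measure V} [IsFiniteMeasure ν]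
  [IsFiniteMeasure ν₁] [IsFiniteMeasure ν₂]

theorem measurable_totMass (hX : IsStarField X k P) (hk : Continuous fun x => k 0 x x) (t : ℝ) :
    Measurable (totMass γ X k ν t) := by
  have h1 : Measurable fun p : Ω × V => X t p.2 p.1 :=
    (hX.measurable_field' t).comp measurable_swap
  have h2 : Measurable fun p : Ω × V => k 0 p.2 p.2 := hk.measurable.comp measurable_snd
  have h3 : Measurable fun p : Ω × V => γ * X t p.2 p.1 - γ ^ 2 / 2 * (k 0 p.2 p.2 + t) :=
    (h1.const_mul γ).sub ((h2.add_const t).const_mul _)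
  exact (h3.exp.stronglyMeasurable.integral_prod_right).measurable

theorem totMass_add_measure (hX : IsStarField X k P) (hk : Continuous fun x => k 0 x x)
    (hK : IsCompact Kc) (h₁ : ∀ᵐ x ∂ν₁, x ∈ Kc) (h₂ : ∀ᵐ x ∂ν₂, x ∈ Kc) (t : ℝ) (ω : Ω) :
    totMass γ X k (ν₁ + ν₂) t ω = totMass γ X k ν₁ t ω + totMass γ X k ν₂ t ω :=
  integral_add_measure (hX.integrable_expWt hk hK h₁ t ω) (hX.integrable_expWt hk hK h₂ t ω)

theorem potMass_add_measure (hX : IsStarField X k P) (hk : Continuous fun x => k 0 x x)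
    (hK : IsCompact Kc) (h₁ : ∀ᵐ x ∂ν₁, x ∈ Kc) (h₂ : ∀ᵐ x ∂ν₂, x ∈ Kc) (f : ℝ → ℝ) (t : ℝ)
    (ω : Ω) : potMass γ X k (ν₁ + ν₂) f t ω = potMass γ X k ν₁ f t ω + potMass γ X k ν₂ f t ω :=
  integral_add_measure (hX.integrable_potWt hk hK h₁ f t ω) (hX.integrable_potWt hk hK h₂ f t ω)

theorem restrict_eq_add_sdiff {S F : Set V} (hFS : F ⊆ S) (hF : MeasurableSet F) :
    ν.restrict S = ν.restrict F + ν.restrict (S \ F) := by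
  rw [add_comm, ← Measure.restrict_inter_add_sdiff S hF, Set.inter_eq_right.2 hFS, add_comm]

theorem ae_tendsto_potMass_countable (hX : IsStarField X k P) (hk : Continuous fun x => k 0 x x)
    (hγ : 0 < γ) (hK : IsCompact Kc) (hν : ∀ᵐ x ∂ν, x ∈ Kc) (hq : 0 ≤ q) (ha : 0 ≤ a)
    (hG : IsBarrierOn γ X Kc q a G) {S : Set V}
    (hS : S.Countable) : ∀ᵐ ω ∂P, ω ∈ G →
      Tendsto (fun t => potMass γ X k (ν.restrict S) (logBar q a) t ω) atTop (nhds 0) := by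
  have hB := isBarrier_logBar hq ha
  have hr : ∀ A : Set V, ∀ᵐ x ∂(ν.restrict A), x ∈ Kc := fun A => ae_restrict_of_ae hν
  have key : ∀ n : ℕ, ∀ᵐ ω ∂P, ω ∈ G →
      ∀ᶠ t in atTop, potMass γ X k (ν.restrict S) (logBar q a) t ω ≤ 1 / ((n : ℝ) + 1) := by
    intro n
    set c : ℝ := 1 / ((n : ℝ) + 1) with hcdef
    have hc : 0 < c / 2 := by positivity
    rw [ae_iff]
    refine le_antisymm (le_of_forall_pos_le_add fun ε hε => ?_) zero_le
    rw [zero_add]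
    obtain ⟨η, hη, hle⟩ := exists_mul_div_le (b := ofReal
      (barrierConst (logBar q a) (a * log 2))) (c := ofReal (c / 2))
      ofReal_ne_top (by simpa using hc) hε.ne'
    obtain ⟨F, hFS, hF⟩ := exists_finset_measure_sdiff_le (ν := ν) hS hη
    have htail := (hX.isPosSubmartingale_derivMass (γ := γ) (ν := ν.restrict (S \ F))
      hB).measure_exists_lt_le (G := G)
      (Z := fun t ω => potMass γ X k (ν.restrict (S \ F)) (logBar q a) t ω) zero_le_one
      (fun t ht => hX.lintegral_derivMass_le hB ht)
      (fun ω _ => hX.continuous_potMass hk hK (hr _) hB.cont ω)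
      (fun ω hω s hs => (hX.derivMass_eq hk hK (hr _) (zero_le_one.trans hs) (hG ω hω)).2) hc
    have hfin := hX.ae_tendsto_finset hk hγ hK hν q a F
    have hnull : P {ω | ¬ Tendsto (fun t => potMass γ X k (ν.restrict F) (logBar q a) t ω)
        atTop (nhds 0)} = 0 := by
      have := hfin.mono fun ω h => h.1
      rwa [ae_iff] at this
    refine (measure_mono (t := {ω | ω ∈ G ∧ ∃ s, 1 ≤ s ∧
        c / 2 < potMass γ X k (ν.restrict (S \ F)) (logBar q a) s ω} ∪
      {ω | ¬ Tendsto (fun t => potMass γ X k (ν.restrict F) (logBar q a) t ω)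
        atTop (nhds 0)}) ?_).trans ((measure_union_le _ _).trans ?_)
    · intro ω hω
      by_contra hcon
      simp only [mem_union, mem_ofPred_eq, not_or, not_and, not_exists, not_lt, not_not]
        at hcon
      refine hω fun hωG => ?_
      filter_upwards [hcon.2.eventually (ge_mem_nhds hc), eventually_ge_atTop 1] with t h1 h2
      rw [restrict_eq_add_sdiff hFS (Finset.measurableSet F), hX.potMass_add_measure hk hK (hr _)
        (hr _)]
      linarith [hcon.1 hωG t h2]
    · rw [hnull, add_zero]
      refine htail.trans (le_trans ?_ hle)
      rw [Measure.restrict_apply_univ]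
      gcongr
  filter_upwards [ae_all_iff.2 key] with ω hω hωG
  rw [Metric.tendsto_atTop]
  intro e he
  obtain ⟨n, hn⟩ := exists_nat_one_div_lt he
  obtain ⟨T, hT⟩ := eventually_atTop.1 (hω n hωG)
  refine ⟨max T 0, fun t ht => ?_⟩
  have h0 := (hX.derivMass_eq hk hK (hr S) (le_of_max_le_right ht) (hG ω hωG)).1
  rw [dist_zero_right, norm_of_nonneg h0]
  exact (hT t (le_of_max_le_left ht)).trans_lt hn

theorem measure_totMass_le (hX : IsStarField X k P) (hk : Continuous fun x => k 0 x x)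
    (hK : IsCompact Kc) (hν : ∀ᵐ x ∂ν, x ∈ Kc) (hq : 0 ≤ q) (ha : 0 ≤ a)
    (hG : IsBarrierOn γ X Kc q a G) {t ε : ℝ} (ht : 1 ≤ t)
    (hε : 0 < ε) : P {ω | ω ∈ G ∧ ε ≤ √(π * t / 2) * totMass γ X k ν t ω} ≤ ofReal √(π / 2) *
      ofReal (barrierConst (logBar q a) (a * log 2)) * ν univ / ofReal ε := by
  have hB := isBarrier_logBar hq ha
  have ht0 : 0 ≤ t := by linarith
  have hm := (hX.measurable_truncMass (γ := γ) (ν := ν) hB.cont ht0).const_mul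
    (ofReal √(π * t / 2))
  have h1 := meas_ge_le_lintegral_div (μ := P) hm.aemeasurable (ε := ofReal ε)
    (by simpa using hε) ofReal_ne_top
  refine (measure_mono fun ω hω => ?_).trans (h1.trans (ENNReal.div_le_div_right ?_ _))
  · show ofReal ε ≤ ofReal √(π * t / 2) * truncMass γ X k ν (logBar q a) t ω
    rw [hX.truncMass_eq hk hK hν ht0 (hG ω hω.1), ← ofReal_mul (sqrt_nonneg _)]
    exact ofReal_le_ofReal hω.2
  · rw [lintegral_const_mul' _ _ ofReal_ne_top, sqrt_pi_mul,
      ofReal_mul (sqrt_nonneg _), mul_assoc, mul_assoc]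
    exact mul_le_mul_right (hX.lintegral_truncMass_le hB ht) _

theorem tendsto_measure_totMass_countable (hX : IsStarField X k P)
    (hk : Continuous fun x => k 0 x x)
    (hγ : 0 < γ) (hK : IsCompact Kc) (hν : ∀ᵐ x ∂ν, x ∈ Kc) (hq : 0 ≤ q) (ha : 0 ≤ a)
    (hG : IsBarrierOn γ X Kc q a G) {S : Set V}
    (hS : S.Countable) {ε : ℝ} (hε : 0 < ε) :
    Tendsto (fun t => P {ω | ω ∈ G ∧ ε ≤ √(π * t / 2) * totMass γ X k (ν.restrict S) t ω})
      atTop (nhds 0) := by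
  have := hX.isProbabilityMeasure
  have hr : ∀ A : Set V, ∀ᵐ x ∂(ν.restrict A), x ∈ Kc := fun A => ae_restrict_of_ae hν
  have hε2 : 0 < ε / 2 := by positivity
  rw [tendsto_nhds_zero]
  intro δ hδ
  obtain ⟨η, hη, hle⟩ := exists_mul_div_le (b := ofReal √(π / 2) * ofReal
    (barrierConst (logBar q a) (a * log 2))) (c := ofReal (ε / 2)) (ε := δ / 2)
    (ENNReal.mul_ne_top ofReal_ne_top ofReal_ne_top) (by simpa using hε2)
    (ENNReal.half_pos hδ.ne').ne'
  obtain ⟨F, hFS, hF⟩ := exists_finset_measure_sdiff_le (ν := ν) hS hη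
  have hfin := tendsto_measure_of_ae_tendsto (P := P)
    (Y := fun t ω => √(π * t / 2) * totMass γ X k (ν.restrict F) t ω)
    (Eventually.of_forall fun t => (hX.measurable_totMass hk t).const_mul _)
    ((hX.ae_tendsto_finset hk hγ hK hν q a F).mono fun ω h => h.2) hε2
  filter_upwards [tendsto_nhds_zero.1 hfin (δ / 2) (ENNReal.half_pos hδ.ne'),
    eventually_ge_atTop 1] with t h1 ht
  have htail := hX.measure_totMass_le hk hK (hr (S \ F)) hq ha hG ht hε2
  rw [← ENNReal.add_halves δ]
  refine (measure_mono ?_).trans ((measure_union_le _ _).trans (add_le_add h1 (htail.trans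
    (le_trans ?_ hle))))
  · rintro ω ⟨hωG, hω⟩
    rw [restrict_eq_add_sdiff hFS (Finset.measurableSet F), hX.totMass_add_measure hk hK (hr _)
      (hr _), mul_add] at hω
    by_contra hcon
    simp only [mem_union, mem_ofPred_eq, not_or, not_and, not_le] at hcon
    have h2 := hcon.2 hωG
    have h3 := (le_abs_self _).trans_lt hcon.1
    linarith
  · rw [Measure.restrict_apply_univ]
    gcongr

end IsStarField

theorem Close.measure_add_le {U V : Ω → ENNReal} {δ e : ENNReal} (h : Close P δ U V) (hU : Measurable U)
    (hV : Measurable V) (hfin : ∫⁻ ω, V ω ∂P ≠ ⊤) (he : e ≠ 0) (he' : e ≠ ⊤) :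
    P {ω | V ω + e ≤ U ω} ≤ δ / e := by
  have hA : MeasurableSet {ω | V ω + e ≤ U ω} := measurableSet_le (hV.add_const e) hU
  have h1 := (h _ hA).1
  have h2 : ∫⁻ ω in {ω | V ω + e ≤ U ω}, (V ω + e) ∂P ≤ ∫⁻ ω in {ω | V ω + e ≤ U ω}, U ω ∂P :=
    setLIntegral_mono hU fun ω hω => hω
  rw [lintegral_add_right _ measurable_const, setLIntegral_const] at h2
  have h3 := h2.trans h1
  have h4 : ∫⁻ ω in {ω | V ω + e ≤ U ω}, V ω ∂P ≠ ⊤ :=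
    ne_top_of_le_ne_top hfin (setLIntegral_le_lintegral _ _)
  rw [ENNReal.add_le_add_iff_left h4] at h3
  rw [le_div_iff_mul_le (Or.inl he) (Or.inl he'), mul_comm]
  exact h3

theorem tendstoInMeasure_of_forall_exists {Y : ℝ → Ω → ℝ} {L : Ω → ℝ}
    (h : ∀ δ : ENNReal, δ ≠ 0 → ∃ G : Set Ω, P Gᶜ ≤ δ ∧ ∀ ε : ℝ, 0 < ε →
      Tendsto (fun t => P {ω | ω ∈ G ∧ ε ≤ |Y t ω - L ω|}) atTop (nhds 0)) :
    TendstoInMeasure P Y atTop L := by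
  rw [tendstoInMeasure_iff_norm]
  intro ε hε
  rw [tendsto_nhds_zero]
  intro δ hδ
  have hδ2 := ENNReal.half_pos hδ.ne'
  obtain ⟨G, hG, hT⟩ := h (δ / 2) hδ2.ne'
  filter_upwards [tendsto_nhds_zero.1 (hT ε hε) (δ / 2) hδ2] with t ht
  rw [← ENNReal.add_halves δ]
  refine (measure_mono fun ω hω => ?_).trans ((measure_union_le _ _).trans (add_le_add hG ht))
  by_cases hωG : ω ∈ G
  · exact Or.inr ⟨hωG, hω⟩
  · exact Or.inl hωG

theorem countable_setOf_measure_singleton_ne_zero {V : Type*} [MeasurableSpace V]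
    [MeasurableSingletonClass V] (ν : Measure V) [IsFiniteMeasure ν] :
    {x | ν {x} ≠ 0}.Countable := by
  have := Measure.countable_meas_pos_of_disjoint_iUnion (μ := ν) (As := fun x : V => {x})
    (fun x => measurableSet_singleton x) (fun x y hxy => by simpa using hxy)
  simpa [pos_iff_ne_zero] using this

theorem nullSingletonClass_restrict_compl {V : Type*} [MeasurableSpace V]
    [MeasurableSingletonClass V] (ν : Measure V) :
    NullSingletonClass (ν.restrict {x | ν {x} ≠ 0}ᶜ) := by
  refine ⟨fun x => ?_⟩
  rw [Measure.restrict_apply (measurableSet_singleton x)]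
  by_cases hx : ν {x} = 0
  · exact measure_mono_null Set.inter_subset_left hx
  · have : {x} ∩ {x | ν {x} ≠ 0}ᶜ = ∅ := by
      ext y
      simp only [mem_inter_iff, Set.mem_singleton_iff, mem_compl_iff, mem_ofPred_eq,
        mem_empty_iff_false, iff_false, not_and, not_not]
      rintro rfl
      exact hx
    rw [this, measure_empty]

namespace IsStarField

variable {γ q a : ℝ} {f g : ℝ → ℝ} {G : Set Ω} {ν : Measure V} [IsFiniteMeasure ν]

theorem measurable_potMass (hX : IsStarField X k P) (hk : Continuous fun x => k 0 x x)
    (f : ℝ → ℝ) (t : ℝ) : Measurable (potMass γ X k ν f t) := by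
  have h0 : ∀ s, Measurable fun p : Ω × V => X s p.2 p.1 := fun s =>
    (hX.measurable_field' s).comp measurable_swap
  have h2 : Measurable fun p : Ω × V => k 0 p.2 p.2 := hk.measurable.comp measurable_snd
  have h3 : Measurable fun p : Ω × V => γ * X t p.2 p.1 - γ ^ 2 / 2 * (k 0 p.2 p.2 + t) :=
    ((h0 t).const_mul γ).sub ((h2.add_const t).const_mul _)
  have h4 : Measurable fun p : Ω × V => f t - (X t p.2 p.1 - X 0 p.2 p.1 - γ * t) :=
    (((h0 t).sub (h0 0)).sub_const _).const_sub _
  exact ((h4.mul h3.exp).stronglyMeasurable.integral_prod_right).measurable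

theorem tendsto_measure_totMass_sub (hX : IsStarField X k P) (hk : Continuous fun x => k 0 x x)
    (hK : IsCompact Kc) (hν : ∀ᵐ x ∂ν, x ∈ Kc) (hq : 0 ≤ q) (ha : 0 ≤ a) (hGm : MeasurableSet G)
    (hG : IsBarrierOn γ X Kc q a G)
    (hcl : ∀ ε : ENNReal, ε ≠ 0 → ∀ᶠ u in atTop, ∀ᶠ t in atTop,
      Close P ε (fun ω => ofReal √(π * t / 2) * truncMass γ X k ν (logBar q a) t ω)
        (derivMass γ X k ν (logBar q a) u)) {L : Ω → ℝ} (hL : ∀ᵐ ω ∂P, ω ∈ G →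
      Tendsto (fun t => potMass γ X k ν (logBar q a) t ω) atTop (nhds (L ω))) {ε : ℝ} (hε : 0 < ε) :
    Tendsto (fun t => P {ω | ω ∈ G ∧ ε ≤ |√(π * t / 2) * totMass γ X k ν t ω - L ω|})
      atTop (nhds 0) := by
  have := hX.isProbabilityMeasure
  have hB := isBarrier_logBar hq ha
  have hε2 : 0 < ε / 2 := by positivity
  have hM : TendstoInMeasure P (fun (n : ℕ) => G.indicator (potMass γ X k ν (logBar q a) n)) atTop
      (G.indicator L) := by
    refine tendstoInMeasure_of_tendsto_ae (fun n =>
      ((hX.measurable_potMass hk _ _).indicator hGm).aestronglyMeasurable) ?_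
    filter_upwards [hL] with ω hω
    by_cases hωG : ω ∈ G
    · simp only [indicator_of_mem hωG]
      exact (hω hωG).comp tendsto_natCast_atTop_atTop
    · simp only [indicator_of_notMem hωG]
      exact tendsto_const_nhds
  rw [tendstoInMeasure_iff_norm] at hM
  rw [tendsto_nhds_zero]
  intro δ hδ
  have hδ2 := ENNReal.half_pos hδ.ne'
  have hδ4 := ENNReal.half_pos hδ2.ne'
  have he : ofReal (ε / 2) ≠ 0 := by simpa using hε2
  obtain ⟨η, hη, hle⟩ := exists_mul_div_le (b := 1) (c := ofReal (ε / 2))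
    (ε := δ / 2 / 2) ENNReal.one_ne_top he hδ4.ne'
  rw [one_mul] at hle
  obtain ⟨n, h1, h2, hn⟩ := ((tendsto_nhds_zero.1 (hM (ε / 2) hε2) _ hδ2).and
    ((tendsto_natCast_atTop_atTop.eventually (hcl η hη)).and (eventually_ge_atTop 1))).exists
  have hn1 : (1 : ℝ) ≤ n := by exact_mod_cast hn
  have hn0 : (0 : ℝ) ≤ n := by linarith
  filter_upwards [h2, eventually_ge_atTop 1] with t hc ht
  have ht0 : 0 ≤ t := by linarith
  have hUm := (hX.measurable_truncMass (γ := γ) (ν := ν) hB.cont ht0).const_mul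
    (ofReal √(π * t / 2))
  have hVm := hX.measurable_derivMass (γ := γ) (ν := ν) hB.cont hn0
  have hVf : ∫⁻ ω, derivMass γ X k ν (logBar q a) n ω ∂P ≠ ⊤ :=
    ne_top_of_le_ne_top (ENNReal.mul_ne_top ofReal_ne_top (measure_ne_top ν _))
      (hX.lintegral_derivMass_le hB hn1)
  have hUf : ∫⁻ ω, ofReal √(π * t / 2) * truncMass γ X k ν (logBar q a) t ω ∂P ≠ ⊤ := by
    rw [lintegral_const_mul' _ _ ofReal_ne_top, sqrt_pi_mul, ofReal_mul (sqrt_nonneg _), mul_assoc]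
    exact ENNReal.mul_ne_top ofReal_ne_top (ne_top_of_le_ne_top
      (ENNReal.mul_ne_top ofReal_ne_top (measure_ne_top ν _))
      (hX.lintegral_truncMass_le hB ht))
  have h3 := (hc.measure_add_le hUm hVm hVf he ofReal_ne_top).trans hle
  have h4 := (hc.symm.measure_add_le hVm hUm hUf he ofReal_ne_top).trans hle
  rw [← ENNReal.add_halves δ]
  refine (measure_mono ?_).trans ((measure_union_le _ _).trans (add_le_add h1
    ((measure_union_le _ _).trans ((add_le_add h3 h4).trans_eq (ENNReal.add_halves _)))))
  rintro ω ⟨hωG, hω⟩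
  by_contra hcon
  simp only [mem_union, mem_ofPred_eq, not_or, not_le, indicator_of_mem hωG] at hcon
  obtain ⟨a1, a2, a3⟩ := hcon
  rw [hX.truncMass_eq hk hK hν ht0 (hG ω hωG), ← ofReal_mul (sqrt_nonneg _),
    (hX.derivMass_eq hk hK hν hn0 (hG ω hωG)).2] at a2 a3
  have p0 := (hX.derivMass_eq hk hK hν hn0 (hG ω hωG)).1
  have m0 : 0 ≤ √(π * t / 2) * totMass γ X k ν t ω :=
    mul_nonneg (sqrt_nonneg _) (totMass_nonneg _ _ _ _ _ _)
  rw [← ofReal_add p0 hε2.le, ofReal_lt_ofReal_iff (by linarith)] at a2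
  rw [← ofReal_add m0 hε2.le, ofReal_lt_ofReal_iff (by linarith)] at a3
  rw [norm_eq_abs, abs_lt] at a1
  have : |√(π * t / 2) * totMass γ X k ν t ω - L ω| < ε := by
    rw [abs_lt]
    constructor <;> linarith
  linarith

theorem tendsto_measure_totMass_sub_limsup (hX : IsStarField X k P)
    (hk : Continuous fun x => k 0 x x) (hγ : 0 < γ)
    (hK : IsCompact Kc) (hν : ∀ᵐ x ∂ν, x ∈ Kc) (hq : 1 ≤ q) (ha : 0 ≤ a) (hGm : MeasurableSet G)
    (hG : IsBarrierOn γ X Kc q a G)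
    (hclT : ∀ q a : ℝ, 0 ≤ q → 0 ≤ a → ∀ ε : ENNReal, ε ≠ 0 → ∀ᶠ u in atTop, ∀ᶠ t in atTop,
      Close P ε (fun ω => ofReal √(π * t / 2) *
          truncMass γ X k (ν.restrict {x | ν {x} ≠ 0}ᶜ) (logBar q a) t ω)
        (derivMass γ X k (ν.restrict {x | ν {x} ≠ 0}ᶜ) (logBar q a) u))
    (hcl : ∀ q a : ℝ, 0 ≤ q → 0 ≤ a → ∀ ε : ENNReal, ε ≠ 0 → ∀ᶠ u in atTop, ∀ t ≥ u,
      Close P ε (derivMass γ X k (ν.restrict {x | ν {x} ≠ 0}ᶜ) (logBar q a) u)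
        (derivMass γ X k (ν.restrict {x | ν {x} ≠ 0}ᶜ) (logBar q a) t))
    {D : ℝ → Ω → ℝ} (hD : ∀ᶠ t in atTop, ∀ ω, D t ω =
      ∫ x, (γ * (k 0 x x + t) - X t x ω) * expWt γ X k t x ω ∂ν) {ε : ℝ} (hε : 0 < ε) :
    Tendsto (fun t => P {ω | ω ∈ G ∧
      ε ≤ |√(π * t / 2) * totMass γ X k ν t ω - limsup (fun t => D t ω) atTop|})
      atTop (nhds 0) := by
  have hq0 : 0 ≤ q := zero_le_one.trans hq
  set S : Set V := {x | ν {x} ≠ 0} with hSdef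
  have hSc : S.Countable := countable_setOf_measure_singleton_ne_zero ν
  have hdec : ν = ν.restrict Sᶜ + ν.restrict S := by
    rw [add_comm]
    exact (Measure.restrict_add_restrict_compl hSc.measurableSet).symm
  have hr : ∀ A : Set V, ∀ᵐ x ∂(ν.restrict A), x ∈ Kc := fun A => ae_restrict_of_ae hν
  have h2q : 0 ≤ 2 * q := by positivity
  have h2a : 0 ≤ 2 * a := by positivity
  have hG2 : IsBarrierOn γ X Kc (2 * q) (2 * a) G := by
    intro ω hω x hx t ht
    rw [logBar_double]
    have := hq0.trans (le_logBar (q := q) ha t)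
    linarith [hG ω hω x hx t ht]
  have hlim : ∀ᵐ ω ∂P, ω ∈ G →
      Tendsto (fun t => potMass γ X k (ν.restrict Sᶜ) (logBar q a) t ω) atTop
        (nhds (limsup (fun t => D t ω) atTop)) := by
    filter_upwards [hX.ae_tendsto_potMass_logBar hk hK (hr Sᶜ) hq0 ha hG hcl,
      hX.ae_tendsto_potMass_countable hk hγ hK hν hq0 ha hG hSc,
      hX.ae_tendsto_potMass_countable hk hγ hK hν h2q h2a hG2 hSc] with ω h1 h2 h3 hω
    obtain ⟨⟨l, hl⟩, hlm⟩ := h1 hω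
    have h4 : Tendsto (fun t => logBar q a t * totMass γ X k (ν.restrict S) t ω) atTop
        (nhds 0) := by
      have := (h3 hω).sub (h2 hω)
      rw [sub_zero] at this
      refine this.congr fun t => ?_
      rw [hX.potMass_eq_add hk hK (hr S) (logBar q a) (logBar (2 * q) (2 * a)), logBar_double]
      ring
    have hpot : Tendsto (fun t => potMass γ X k ν (logBar q a) t ω) atTop (nhds l) := by
      have := hl.add (h2 hω)
      rw [add_zero] at this
      refine this.congr fun t => ?_
      rw [← hX.potMass_add_measure hk hK (hr _) (hr _), ← hdec]
    have hbar : Tendsto (fun t => logBar q a t * totMass γ X k ν t ω) atTop (nhds 0) := by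
      have := hlm.add h4
      rw [add_zero] at this
      refine this.congr fun t => ?_
      rw [← mul_add, ← hX.totMass_add_measure hk hK (hr _) (hr _), ← hdec]
    have hX0 : Continuous fun x => X 0 x ω := (hX.cont ω).comp (by fun_prop : Continuous
      fun x : V => ((0 : ℝ), x))
    have hc : Continuous fun x => γ * k 0 x x - X 0 x ω := (hk.const_mul γ).sub hX0
    obtain ⟨C, hC⟩ := hK.exists_bound_of_continuousOn hc.continuousOn
    have hrest : Tendsto (fun t => ∫ x, (γ * k 0 x x - X 0 x ω) * expWt γ X k t x ω ∂ν) atTop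
        (nhds 0) := by
      have hz : Tendsto (fun t => |C| * (logBar q a t * totMass γ X k ν t ω)) atTop (nhds 0) := by
        simpa using hbar.const_mul |C|
      refine squeeze_zero_norm (fun t => ?_) hz
      refine (norm_integral_le_of_norm_le
        ((hX.integrable_expWt (γ := γ) hk hK hν t ω).const_mul |C|) ?_).trans ?_
      · filter_upwards [hν] with x hx
        rw [norm_mul, norm_of_nonneg (expWt_pos _ _ _ _ _ _).le]
        exact mul_le_mul_of_nonneg_right ((hC x hx).trans (le_abs_self C))
          (expWt_pos _ _ _ _ _ _).le
      · rw [integral_const_mul]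
        refine mul_le_mul_of_nonneg_left ?_ (abs_nonneg C)
        exact le_mul_of_one_le_left (totMass_nonneg _ _ _ _ _ _) (hq.trans (le_logBar ha t))
    have hDl : Tendsto (fun t => D t ω) atTop (nhds l) := by
      have := (hpot.sub hbar).add hrest
      rw [sub_zero, add_zero] at this
      refine this.congr' ?_
      filter_upwards [hD] with t ht
      have i1 := hX.integrable_potWt (γ := γ) hk hK hν (logBar q a) t ω
      have i2 := (hX.integrable_expWt (γ := γ) hk hK hν t ω).const_mul (logBar q a t)
      have i3 := hX.integrable_mul_expWt (γ := γ) hk hK hν t ω hc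
      have e : ∀ x, (γ * (k 0 x x + t) - X t x ω) * expWt γ X k t x ω =
          (logBar q a t - rel γ X x t ω) * expWt γ X k t x ω -
            logBar q a t * expWt γ X k t x ω + (γ * k 0 x x - X 0 x ω) * expWt γ X k t x ω := by
        intro x
        simp only [rel]
        ring
      have i12 : Integrable (fun x => (logBar q a t - rel γ X x t ω) * expWt γ X k t x ω -
          logBar q a t * expWt γ X k t x ω) ν := i1.sub i2
      rw [ht, potMass, totMass]
      simp_rw [e]
      rw [integral_add i12 i3, integral_sub i1 i2, integral_const_mul]
    rw [hDl.limsup_eq]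
    exact hl
  have hε2 : 0 < ε / 2 := by positivity
  have t1 := hX.tendsto_measure_totMass_sub hk hK (hr Sᶜ) hq0 ha hGm hG (hclT q a hq0 ha) hlim hε2
  have t2 := hX.tendsto_measure_totMass_countable hk hγ hK hν hq0 ha hG hSc hε2
  have t3 := t1.add t2
  rw [add_zero] at t3
  refine tendsto_of_tendsto_of_tendsto_of_le_of_le tendsto_const_nhds t3 (fun _ => zero_le)
    fun t => (measure_mono ?_).trans (measure_union_le _ _)
  rintro ω ⟨hωG, hω⟩
  by_contra hcon
  simp only [mem_union, mem_ofPred_eq, not_or, not_and, not_le] at hcon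
  have c1 := hcon.1 hωG
  have c2 := hcon.2 hωG
  have e : totMass γ X k ν t ω = totMass γ X k (ν.restrict Sᶜ) t ω +
      totMass γ X k (ν.restrict S) t ω := by
    rw [← hX.totMass_add_measure hk hK (hr _) (hr _), ← hdec]
  have m0 : 0 ≤ √(π * t / 2) * totMass γ X k (ν.restrict S) t ω :=
    mul_nonneg (sqrt_nonneg _) (totMass_nonneg _ _ _ _ _ _)
  rw [e, mul_add] at hω
  rw [abs_lt] at c1
  have : |√(π * t / 2) * totMass γ X k (ν.restrict Sᶜ) t ω +
      √(π * t / 2) * totMass γ X k (ν.restrict S) t ω - limsup (fun t => D t ω) atTop| < ε := by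
    rw [abs_lt]
    constructor <;> linarith
  linarith

end IsStarField

end

section GaussianCriterion

variable {Ω T : Type*} {mΩ : MeasurableSpace Ω} {P : Measure Ω} {Y : T → Ω → ℝ}

theorem isGaussianProcess_of_map_sum (hm : ∀ t, Measurable (Y t))
    (h : ∀ (n : ℕ) (c : Fin n → ℝ) (ts : Fin n → T), ∃ v : NNReal,
      P.map (fun ω => ∑ i, c i * Y (ts i) ω) = gaussianReal 0 v) : IsGaussianProcess Y P := by
  classical
  refine ⟨fun I => ⟨isGaussian_of_map_eq_gaussianReal fun L => ?_⟩⟩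
  have hYm : Measurable fun ω => I.restrict (Y · ω) := measurable_pi_lambda _ fun i => hm i
  let e := I.equivFin
  obtain ⟨v, hv⟩ := h I.card (fun j => L (Pi.single (e.symm j) 1)) (fun j => (e.symm j : T))
  refine ⟨0, v, ?_⟩
  rw [Measure.map_map L.continuous.measurable hYm, ← hv]
  congr 1
  ext ω
  rw [Function.comp_apply, e.symm.sum_comp (fun i : I => L (Pi.single i 1) * Y i ω)]
  have h1 : I.restrict (Y · ω) = ∑ i : I, Y i ω • (Pi.single i 1 : I → ℝ) := by
    ext j
    simp [Finset.sum_apply, Pi.single_apply]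
  rw [h1, map_sum]
  refine Finset.sum_congr rfl fun i _ => ?_
  rw [map_smul, smul_eq_mul, mul_comm]

theorem memLp_two_of_map_eq_gaussianReal {Z : Ω → ℝ} (hZ : Measurable Z) {v : NNReal}
    (h : P.map Z = gaussianReal 0 v) : MemLp Z 2 P := by
  have := memLp_id_gaussianReal (μ := 0) (v := v) 2
  rw [← h] at this
  exact (memLp_map_measure_iff aestronglyMeasurable_id hZ.aemeasurable).1 this

theorem integral_of_map_eq_gaussianReal {Z : Ω → ℝ} (hZ : Measurable Z) {v : NNReal}
    (h : P.map Z = gaussianReal 0 v) : P[Z] = 0 := by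
  have := integral_id_gaussianReal (μ := 0) (v := v)
  rw [← h, integral_map hZ.aemeasurable (by fun_prop)] at this
  exact this

theorem variance_of_map_eq_gaussianReal {Z : Ω → ℝ} (hZ : Measurable Z) {v : NNReal}
    (h : P.map Z = gaussianReal 0 v) : Var[Z; P] = v := by
  have := variance_id_gaussianReal (μ := 0) (v := v)
  rw [← h, variance_map (by fun_prop) hZ.aemeasurable] at this
  exact this

end GaussianCriterion

/-- A star-scale covariance with profile `κ`, density `w` of scales, and cutoff `τ`. -/
structure IsStarKernel {V : Type*} [NormedAddCommGroup V] [NormedSpace ℝ V] (K₀ : V → V → ℝ)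
    (κ : V → ℝ) (w τ : ℝ → ℝ) (K : ℝ → V → V → ℝ) : Prop where
  eq : ∀ t x y, K t x y = K₀ x y + ∫ s in Ioc 0 (τ t), w s * κ (exp s • (x - y))
  cont₀ : Continuous fun p : V × V => K₀ p.1 p.2
  posdef₀ : ∀ (n : ℕ) (c : Fin n → ℝ) (p : Fin n → V), 0 ≤ ∑ i, ∑ j, c i * c j * K₀ (p i) (p j)
  posdef : ∀ (n : ℕ) (c : Fin n → ℝ) (p : Fin n → V), 0 ≤ ∑ i, ∑ j, c i * c j * κ (p i - p j)
  profile_zero : κ 0 = 1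
  profile_neg : ∀ x, κ (-x) = κ x
  profile_eq_zero : ∀ x, 1 ≤ ‖x‖ → κ x = 0
  lipschitz : ∃ L, LipschitzWith L κ
  cont_density : Continuous w
  density_nonneg : ∀ s, 0 ≤ s → 0 ≤ w s
  density_le : ∀ s, 0 ≤ s → w s ≤ 1
  cutoff_zero : τ 0 = 0
  le_cutoff : ∀ t, 0 ≤ t → t ≤ τ t
  cutoff_le : ∃ b, ∀ t, 0 ≤ t → τ t ≤ t + b
  integral_density : ∀ t, 0 ≤ t → ∫ s in Ioc 0 (τ t), w s = t

namespace IsStarKernel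

variable {V : Type*} [NormedAddCommGroup V] [NormedSpace ℝ V] {K₀ : V → V → ℝ}
    {κ : V → ℝ} {w τ : ℝ → ℝ} {K : ℝ → V → V → ℝ}

theorem integrableOn (h : IsStarKernel K₀ κ w τ K) (a : ℝ) (x : V) :
    IntegrableOn (fun s => w s * κ (exp s • x)) (Ioc 0 a) := by
  obtain ⟨L, hL⟩ := h.lipschitz
  have hc : Continuous fun s => w s * κ (exp s • x) :=
    h.cont_density.mul (hL.continuous.comp (by fun_prop))
  exact (hc.continuousOn.integrableOn_compact isCompact_Icc).mono_set Ioc_subset_Icc_self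

theorem diag (h : IsStarKernel K₀ κ w τ K) {t : ℝ} (ht : 0 ≤ t) (x : V) : K t x x = K₀ x x + t := by
  rw [h.eq]
  simp only [sub_self, smul_zero, h.profile_zero, mul_one]
  rw [h.integral_density t ht]

theorem zero (h : IsStarKernel K₀ κ w τ K) (x y : V) : K 0 x y = K₀ x y := by
  rw [h.eq, h.cutoff_zero]
  simp

theorem range (h : IsStarKernel K₀ κ w τ K) {s t : ℝ} (hs : 0 ≤ s) (hst : s ≤ t) {x y : V}
    (hxy : exp (-s) ≤ ‖x - y‖) : K t x y = K s x y := by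
  have key : ∀ a, s ≤ a → ∫ r in Ioc 0 a, w r * κ (exp r • (x - y)) =
      ∫ r in Ioc 0 s, w r * κ (exp r • (x - y)) := by
    intro a ha
    refine setIntegral_eq_of_subset_of_forall_sdiff_eq_zero measurableSet_Ioc
      (Set.Ioc_subset_Ioc_right ha) fun r hr => ?_
    have hrs : s ≤ r := by
      by_contra hcon
      exact hr.2 ⟨hr.1.1, (not_le.1 hcon).le⟩
    rw [h.profile_eq_zero, mul_zero]
    rw [norm_smul, norm_of_nonneg (exp_pos r).le]
    calc (1 : ℝ) = exp s * exp (-s) := by rw [← exp_add]; simp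
      _ ≤ _ := by gcongr
  rw [h.eq, h.eq, key _ (hst.trans (h.le_cutoff t (hs.trans hst))), key _ (h.le_cutoff s hs)]

theorem swap (h : IsStarKernel K₀ κ w τ K) (t : ℝ) (x y : V) :
    K t y x - K₀ y x = K t x y - K₀ x y := by
  rw [h.eq, h.eq, add_sub_cancel_left, add_sub_cancel_left]
  refine integral_congr_ae (Eventually.of_forall fun s => ?_)
  show w s * _ = w s * _
  rw [← neg_sub x y, smul_neg, h.profile_neg]

theorem quad_nonneg (h : IsStarKernel K₀ κ w τ K) (t : ℝ) (n : ℕ) (c : Fin n → ℝ)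
    (p : Fin n → V) : 0 ≤ ∑ i, ∑ j, c i * c j * K t (p i) (p j) := by
  have e : ∑ i, ∑ j, c i * c j * K t (p i) (p j) = ∑ i, ∑ j, c i * c j * K₀ (p i) (p j) +
      ∫ s in Ioc 0 (τ t), ∑ i, ∑ j, c i * c j * (w s * κ (exp s • (p i - p j))) := by
    rw [integral_finsetSum]
    · rw [← Finset.sum_add_distrib]
      refine Finset.sum_congr rfl fun i _ => ?_
      rw [integral_finsetSum]
      · rw [← Finset.sum_add_distrib]
        refine Finset.sum_congr rfl fun j _ => ?_
        rw [integral_const_mul, h.eq, mul_add]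
      · exact fun j _ => (h.integrableOn _ _).const_mul _
    · exact fun i _ => integrable_finsetSum _ fun j _ => (h.integrableOn _ _).const_mul _
  rw [e]
  refine add_nonneg (h.posdef₀ n c p) (setIntegral_nonneg measurableSet_Ioc fun s hs => ?_)
  have e2 : ∑ i, ∑ j, c i * c j * (w s * κ (exp s • (p i - p j))) =
      w s * ∑ i, ∑ j, c i * c j * κ (exp s • p i - exp s • p j) := by
    simp only [Finset.mul_sum]
    refine Finset.sum_congr rfl fun i _ => Finset.sum_congr rfl fun j _ => ?_
    rw [smul_sub]
    ring
  rw [e2]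
  exact mul_nonneg (h.density_nonneg s hs.1.le) (h.posdef n c _)

theorem exists_modulus (h : IsStarKernel K₀ κ w τ K) : ∃ C, 0 < C ∧ ∀ t x y, 0 ≤ t →
    t - (K t x y - K₀ x y) ≤ C * (exp t * ‖x - y‖) := by
  obtain ⟨L, hL⟩ := h.lipschitz
  obtain ⟨b, hb⟩ := h.cutoff_le
  refine ⟨(L + 1) * exp b, by positivity, fun t x y ht => ?_⟩
  have hτ : 0 ≤ τ t := ht.trans (h.le_cutoff t ht)
  have hw : IntegrableOn w (Ioc 0 (τ t)) :=
    (h.cont_density.continuousOn.integrableOn_compact isCompact_Icc).mono_set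
      Ioc_subset_Icc_self
  have h1 : t - (K t x y - K₀ x y) =
      ∫ s in Ioc 0 (τ t), (w s - w s * κ (exp s • (x - y))) := by
    rw [integral_sub hw (h.integrableOn _ _), h.integral_density t ht, h.eq]
    ring
  have hi : IntegrableOn (fun s => (L : ℝ) * (exp s * ‖x - y‖)) (Ioc 0 (τ t)) :=
    ((by fun_prop : Continuous fun s => (L : ℝ) * (exp s * ‖x - y‖)).continuousOn.integrableOn_compact
      isCompact_Icc).mono_set Ioc_subset_Icc_self
  have h2 : ∫ s in Ioc 0 (τ t), (w s - w s * κ (exp s • (x - y))) ≤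
      ∫ s in Ioc 0 (τ t), (L : ℝ) * (exp s * ‖x - y‖) := by
    refine setIntegral_mono_on (hw.sub (h.integrableOn _ _)) hi measurableSet_Ioc fun s hs => ?_
    have h3 : 1 - κ (exp s • (x - y)) ≤ L * (exp s * ‖x - y‖) := by
      have := hL.dist_le_mul 0 (exp s • (x - y))
      rw [h.profile_zero, dist_zero_left, norm_smul, norm_of_nonneg (exp_pos s).le] at this
      exact (le_abs_self _).trans this
    have h4 : 0 ≤ (L : ℝ) * (exp s * ‖x - y‖) := by positivity
    have := mul_le_mul_of_nonneg_left h3 (h.density_nonneg s hs.1.le)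
    have := mul_le_mul_of_nonneg_right (h.density_le s hs.1.le) h4
    linarith
  have h5 : ∫ s in Ioc 0 (τ t), (L : ℝ) * (exp s * ‖x - y‖) =
      L * ((exp (τ t) - 1) * ‖x - y‖) := by
    rw [integral_const_mul, integral_mul_const, ← intervalIntegral.integral_of_le hτ,
      integral_exp, exp_zero]
  have h6 : exp (τ t) ≤ exp b * exp t := by
    rw [← exp_add]
    exact exp_le_exp.2 (by linarith [hb t ht])
  rw [h1]
  refine h2.trans ?_
  rw [h5]
  calc (L : ℝ) * ((exp (τ t) - 1) * ‖x - y‖) ≤ (L + 1) * ((exp b * exp t) * ‖x - y‖) := by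
        have h7 : exp (τ t) - 1 ≤ exp b * exp t := by linarith
        have h8 : 0 ≤ exp b * exp t * ‖x - y‖ := by positivity
        have := mul_le_mul_of_nonneg_left (mul_le_mul_of_nonneg_right h7 (norm_nonneg (x - y)))
          L.coe_nonneg
        linarith
    _ = _ := by ring

variable {Ω : Type*} {mΩ : MeasurableSpace Ω} {P : Measure Ω} {X : ℝ → V → Ω → ℝ}

theorem cov_eq [IsProbabilityMeasure P] (h : IsStarKernel K₀ κ w τ K)
    (hX_meas : ∀ t x, Measurable (X t x))
    (hX_gauss : ∀ (n : ℕ) (c : Fin n → ℝ) (ts : Fin n → ℝ) (xs : Fin n → V), (∀ i, 0 ≤ ts i) →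
      P.map (fun ω => ∑ i, c i * X (ts i) (xs i) ω) = gaussianReal 0
        (toNNReal (∑ i, ∑ j, c i * c j * K (min (ts i) (ts j)) (xs i) (xs j))))
    {s t : ℝ} (x y : V) (hs : 0 ≤ s) (hst : s ≤ t) :
    cov[X s x, X t y; P] = (K s x y + K s y x) / 2 := by
  have ht := hs.trans hst
  have h1 : ∀ r z, 0 ≤ r → P.map (X r z) = gaussianReal 0 (toNNReal (K r z z)) := by
    intro r z hr
    have := hX_gauss 1 (fun _ => 1) (fun _ => r) (fun _ => z) fun _ => hr
    simpa using this
  have h2 : P.map (X s x + X t y) = gaussianReal 0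
      (toNNReal (K s x x + K s x y + (K s y x + K t y y))) := by
    have := hX_gauss 2 (fun _ => 1) ![s, t] ![x, y] fun i => by fin_cases i <;> assumption
    simp only [Fin.sum_univ_two, one_mul, Matrix.cons_val_zero, Matrix.cons_val_one, min_self,
      min_eq_left hst, min_eq_right hst] at this
    exact this
  have n0 : ∀ r z, 0 ≤ K r z z := by
    intro r z
    have := h.quad_nonneg r 1 (fun _ => 1) (fun _ => z)
    simpa using this
  have n2 : 0 ≤ K s x x + K s x y + (K s y x + K t y y) := by
    have := h.quad_nonneg s 2 (fun _ => 1) ![x, y]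
    simp only [Fin.sum_univ_two, one_mul, Matrix.cons_val_zero, Matrix.cons_val_one] at this
    have d1 := h.diag hs y
    have d2 := h.diag ht y
    linarith
  have mx := hX_meas s x
  have my := hX_meas t y
  have hv := variance_add (memLp_two_of_map_eq_gaussianReal mx (h1 s x hs))
    (memLp_two_of_map_eq_gaussianReal my (h1 t y ht))
  rw [variance_of_map_eq_gaussianReal mx (h1 s x hs),
    variance_of_map_eq_gaussianReal my (h1 t y ht),
    variance_of_map_eq_gaussianReal (mx.add my) h2, coe_toNNReal _ (n0 _ _),
    coe_toNNReal _ (n0 _ _), coe_toNNReal _ n2] at hv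
  linarith

/-- A field with a star-scale covariance. -/
theorem isStarField [IsProbabilityMeasure P] (h : IsStarKernel K₀ κ w τ K)
    (hX_meas : ∀ t x, Measurable (X t x)) (hX_cont : ∀ ω, Continuous fun p : ℝ × V => X p.1 p.2 ω)
    (hX_gauss : ∀ (n : ℕ) (c : Fin n → ℝ) (ts : Fin n → ℝ) (xs : Fin n → V), (∀ i, 0 ≤ ts i) →
      P.map (fun ω => ∑ i, c i * X (ts i) (xs i) ω) = gaussianReal 0
        (toNNReal (∑ i, ∑ j, c i * c j * K (min (ts i) (ts j)) (xs i) (xs j)))) :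
    IsStarField X (fun t x y => (K t x y + K t y x) / 2) P where
  gauss := isGaussianProcess_of_map_sum (fun p => hX_meas _ _) fun n c ts =>
    ⟨_, hX_gauss n c (fun i => (ts i).1) (fun i => (ts i).2) fun i => (ts i).1.coe_nonneg⟩
  mean s x hs := by
    have := hX_gauss 1 (fun _ => 1) (fun _ => s) (fun _ => x) fun _ => hs
    exact integral_of_map_eq_gaussianReal (hX_meas s x) (by simpa using this)
  cov s t x y hs ht := by
    rcases le_total s t with hst | hst
    · rw [min_eq_left hst, h.cov_eq hX_meas hX_gauss x y hs hst]
    · rw [min_eq_right hst, covariance_comm, h.cov_eq hX_meas hX_gauss y x ht hst, add_comm]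
  meas := hX_meas
  cont := hX_cont
  diag t x ht := by
    rw [h.diag ht, h.diag le_rfl]
    ring
  range s t x y hs hst hxy := by
    rw [h.range hs hst hxy, h.range hs hst (by rwa [norm_sub_rev])]

end IsStarKernel

section Gauge

variable {ρ : ℝ → ℝ}

theorem ConcaveOn.le_add_of_zero (hc : ConcaveOn ℝ (Ici 0) ρ) (h0 : ρ 0 = 0) {s v : ℝ}
    (hs : 0 ≤ s) (hsv : s ≤ v) : ρ v ≤ ρ s + ρ (v - s) := by
  rcases (hs.trans hsv).eq_or_lt with hv | hv
  · have : s = 0 := le_antisymm (hsv.trans_eq hv.symm) hs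
    rw [this, h0, sub_zero, zero_add]
  · have key : ∀ x, 0 ≤ x → x ≤ v → x / v * ρ v ≤ ρ x := by
      intro x hx hxv
      have h1 : 0 ≤ 1 - x / v := sub_nonneg.2 ((div_le_one hv).2 hxv)
      have := hc.2 (Set.self_mem_Ici (a := (0 : ℝ))) (mem_Ici.2 hv.le) h1
        (div_nonneg hx hv.le) (by ring)
      simpa [h0, div_mul_cancel₀ _ hv.ne'] using this
    have h1 := key s hs hsv
    have h2 := key (v - s) (by linarith) (by linarith)
    have : s / v * ρ v + (v - s) / v * ρ v = ρ v := by
      field_simp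
      ring
    linarith

theorem summable_dyadic_of_lintegral (hm : MonotoneOn ρ (Ici 0)) (hn : ∀ u, 0 ≤ u → 0 ≤ ρ u)
    (hi : ∫⁻ u in Ici (1 : ℝ), ofReal (ρ u * u ^ (-(3 : ℝ) / 2)) < ⊤) :
    Summable fun j : ℕ => 2 * ρ (2 ^ (j + 1)) / √(2 ^ j) := by
  set I : ℕ → Set ℝ := fun j => Ico (2 ^ (j + 1)) (2 ^ (j + 1 + 1)) with hI
  have hmono : Monotone fun j : ℕ => (2 : ℝ) ^ (j + 1) :=
    fun a b hab => pow_le_pow_right₀ one_le_two (by omega)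
  have hdisj : Pairwise (Function.onFun Disjoint I) := hmono.pairwise_disjoint_on_Ico_succ
  have hterm : ∀ j : ℕ, ofReal (2 * ρ (2 ^ (j + 1)) / √(2 ^ j)) ≤
      8 * ∫⁻ u in I j, ofReal (ρ u * u ^ (-(3 : ℝ) / 2)) := by
    intro j
    have hp : (0 : ℝ) < 2 ^ j := by positivity
    have hc : ∀ u ∈ I j, ofReal (ρ (2 ^ (j + 1)) *
        ((2 : ℝ) ^ (j + 1 + 1)) ^ (-(3 : ℝ) / 2)) ≤
        ofReal (ρ u * u ^ (-(3 : ℝ) / 2)) := by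
      intro u hu
      have hu0 : (0 : ℝ) < u := lt_of_lt_of_le (by positivity) hu.1
      refine ofReal_le_ofReal (mul_le_mul
        (hm (mem_Ici.2 (by positivity)) (mem_Ici.2 hu0.le) hu.1)
        (rpow_le_rpow_of_nonpos hu0 hu.2.le (by norm_num)) (by positivity) (hn u hu0.le))
    have h1 := setLIntegral_mono' (μ := volume) measurableSet_Ico hc
    rw [setLIntegral_const, volume_Ico] at h1
    refine le_trans (le_of_eq ?_) (mul_le_mul_right h1 8)
    rw [← ofReal_mul (mul_nonneg (hn _ (by positivity)) (by positivity)),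
      show (8 : ENNReal) = ofReal 8 by norm_num, ← ofReal_mul (by norm_num)]
    congr 1
    have e1 : ((2 : ℝ) ^ (j + 1 + 1)) ^ (-(3 : ℝ) / 2) = 1 / (8 * (2 ^ j * √(2 ^ j))) := by
      have : (2 : ℝ) ^ (j + 1 + 1) = 2 ^ j * 4 := by ring
      rw [this, mul_rpow hp.le (by norm_num), neg_div, rpow_neg hp.le, rpow_neg (by norm_num),
        show (3 : ℝ) / 2 = 1 + 1 / 2 by norm_num, rpow_add hp, rpow_add (by norm_num), rpow_one,
        rpow_one, ← sqrt_eq_rpow, ← sqrt_eq_rpow, show (4 : ℝ) = 2 ^ 2 by norm_num,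
        sqrt_sq (by norm_num)]
      have := sqrt_pos.2 hp
      field_simp
      norm_num
    have hs := sqrt_pos.2 hp
    rw [e1, show (2 : ℝ) ^ (j + 1 + 1) - 2 ^ (j + 1) = 2 * 2 ^ j by ring]
    field_simp
  have hsum : ∑' j : ℕ, ofReal (2 * ρ (2 ^ (j + 1)) / √(2 ^ j)) ≠ ⊤ := by
    refine ne_top_of_le_ne_top ?_ (ENNReal.tsum_le_tsum hterm)
    rw [ENNReal.tsum_mul_left, ← lintegral_iUnion (fun j => measurableSet_Ico) hdisj]
    refine ENNReal.mul_ne_top (by norm_num) (ne_top_of_le_ne_top hi.ne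
      (lintegral_mono_set (Set.iUnion_subset fun j u hu => ?_)))
    exact (one_le_pow₀ one_le_two).trans hu.1
  refine (ENNReal.summable_toReal hsum).congr fun j => ?_
  rw [toReal_ofReal]
  have := hn (2 ^ (j + 1)) (by positivity)
  positivity

theorem exists_le_add_sub (hm : MonotoneOn ρ (Ici 0)) (hc : ConcaveOn ℝ (Ici 0) ρ)
    (hn : ∀ u, 0 ≤ u → 0 ≤ ρ u) (h0 : ρ 0 = 0)
    (hs : Summable fun j : ℕ => 2 * ρ (2 ^ (j + 1)) / √(2 ^ j)) :
    ∃ C, 0 ≤ C ∧ ∀ s v, 0 ≤ s → s ≤ v → ρ v ≤ ρ s + (v - s) + C := by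
  obtain ⟨B, hB⟩ := hs.tendsto_atTop_zero.bddAbove_range
  have hB' : ∀ j : ℕ, 2 * ρ (2 ^ (j + 1)) / √(2 ^ j) ≤ B := fun j => hB ⟨j, rfl⟩
  have h1 := hn 1 zero_le_one
  have lin : ∀ u, 0 ≤ u → ρ u ≤ u + (B ^ 2 + ρ 1) := by
    intro u hu
    rcases le_or_gt u 1 with hu1 | hu1
    · have := hm (mem_Ici.2 hu) (mem_Ici.2 zero_le_one) hu1
      nlinarith [sq_nonneg B]
    · obtain ⟨j, hj1, hj2⟩ := exists_nat_pow_near hu1.le (one_lt_two (α := ℝ))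
      have h2 := hm (mem_Ici.2 hu) (mem_Ici.2 (by positivity)) hj2.le
      have hp : (0 : ℝ) < √(2 ^ j) := sqrt_pos.2 (by positivity)
      have h3 := (div_le_iff₀ hp).1 (hB' j)
      have h4 : √((2 : ℝ) ^ j) ^ 2 ≤ u := by rwa [sq_sqrt (by positivity)]
      nlinarith [sq_nonneg (B - √(2 ^ j)), sq_nonneg B]
  refine ⟨B ^ 2 + ρ 1, by positivity, fun s v hs0 hsv => ?_⟩
  have := lin (v - s) (by linarith)
  have := hc.le_add_of_zero h0 hs0 hsv
  linarith

theorem exists_le_mul_exp (hn : ∀ u, 0 ≤ u → 0 ≤ ρ u)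
    (hl : ∃ u₀ : ℝ, ∀ u, u₀ ≤ u → u ^ ((1 : ℝ) / 4) ≤ ρ u) :
    ∃ C, ∀ s, 1 ≤ s → s ≤ C * exp (ρ s) := by
  obtain ⟨u₀, hu₀⟩ := hl
  refine ⟨24 + |u₀|, fun s hs => ?_⟩
  have hs0 : 0 ≤ s := by linarith
  have he := exp_pos (ρ s)
  have he1 := one_le_exp (hn s hs0)
  have ha := abs_nonneg u₀
  rcases le_total u₀ s with h | h
  · have h1 := hu₀ s h
    have h2 := pow_div_factorial_le_exp (s ^ ((1 : ℝ) / 4)) (by positivity) 4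
    have h3 : (s ^ ((1 : ℝ) / 4)) ^ 4 = s := by
      rw [← rpow_natCast, ← rpow_mul hs0]
      norm_num
    rw [h3, show ((Nat.factorial 4 : ℕ) : ℝ) = 24 by norm_num [Nat.factorial],
      div_le_iff₀ (by norm_num)] at h2
    have := exp_le_exp.2 h1
    nlinarith
  · have := h.trans (le_abs_self u₀)
    nlinarith

/-- The corridor between a logarithmic barrier and twice a gauge. -/
theorem isCorridor_logBar {q a : ℝ} (hq : 0 ≤ q) (ha : 0 ≤ a) (hm : MonotoneOn ρ (Ici 0))
    (hc : ConcaveOn ℝ (Ici 0) ρ) (hn : ∀ u, 0 ≤ u → 0 ≤ ρ u)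
    (hs : Summable fun j : ℕ => 2 * ρ (2 ^ (j + 1)) / √(2 ^ j)) :
    IsCorridor (logBar q a) (fun s => 2 * ρ (max s 1)) (a * log 2) where
  upper := isBarrier_logBar hq ha
  cont := by
    have h1 : ContinuousOn ρ (Ioi 0) :=
      (hc.subset Set.Ioi_subset_Ici_self (convex_Ioi 0)).continuousOn isOpen_Ioi
    refine (h1.comp_continuous (by fun_prop) fun s => ?_).const_mul 2
    exact lt_of_lt_of_le one_pos (le_max_right s 1)
  mono s _ t _ hst := by
    have h := fun s : ℝ => zero_le_one.trans (le_max_right s 1)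
    have := hm (mem_Ici.2 (h s)) (mem_Ici.2 (h t)) (max_le_max_right 1 hst)
    show 2 * _ ≤ 2 * _
    linarith
  nonneg s _ := mul_nonneg zero_le_two (hn _ (zero_le_one.trans (le_max_right s 1)))
  summable := by
    refine ((summable_logBar_div (q := q) (a := a)).add hs).congr fun j => ?_
    have h1 : (1 : ℝ) ≤ 2 ^ (j + 1) := one_le_pow₀ one_le_two
    rw [max_eq_left h1, ← add_div]

end Gauge

section Density

variable {η₁ η₂ : ℝ}

theorem setIntegral_one_sub_mul_exp (hη₂ : η₂ ≠ 0) {a : ℝ} (ha : 0 ≤ a) :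
    ∫ s in Ioc 0 a, (1 - η₁ * exp (-η₂ * s)) = a - η₁ / η₂ * (1 - exp (-η₂ * a)) := by
  have hd : ∀ s : ℝ, HasDerivAt (fun s => s - η₁ / η₂ * (1 - exp (-η₂ * s)))
      (1 - η₁ * exp (-η₂ * s)) s := by
    intro s
    have h1 : HasDerivAt (fun s => exp (-η₂ * s)) (exp (-η₂ * s) * (-η₂)) s := by
      simpa using ((hasDerivAt_id s).const_mul (-η₂)).exp
    refine ((hasDerivAt_id s).sub ((h1.const_sub 1).const_mul (η₁ / η₂))).congr_deriv ?_
    field_simp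
  rw [← intervalIntegral.integral_of_le ha,
    intervalIntegral.integral_eq_sub_of_hasDerivAt (fun s _ => hd s)
      (Continuous.intervalIntegrable (by fun_prop) _ _)]
  simp

theorem IsStarKernel.of_exp_density {V : Type*} [NormedAddCommGroup V] [NormedSpace ℝ V]
    {K₀ : V → V → ℝ} {κ : V → ℝ} {τ : ℝ → ℝ} {K : ℝ → V → V → ℝ}
    (hη₁ : η₁ ∈ Icc (0 : ℝ) 1) (hη₂ : 0 < η₂)
    (hτ : ∀ t, 0 ≤ t → 0 ≤ τ t ∧ τ t - (η₁ / η₂) * (1 - exp (-η₂ * τ t)) = t)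
    (hK : ∀ t x y, K t x y = K₀ x y +
      ∫ s in Ioc (0 : ℝ) (τ t), (1 - η₁ * exp (-η₂ * s)) * κ (exp s • (x - y)))
    (hK₀ : Continuous fun p : V × V => K₀ p.1 p.2)
    (hK₀_pos : ∀ (n : ℕ) (c : Fin n → ℝ) (p : Fin n → V), 0 ≤ ∑ i, ∑ j, c i * c j * K₀ (p i) (p j))
    (hκ_pos : ∀ (n : ℕ) (c : Fin n → ℝ) (p : Fin n → V), 0 ≤ ∑ i, ∑ j, c i * c j * κ (p i - p j))
    (h0 : κ 0 = 1) (hneg : ∀ x, κ (-x) = κ x) (h1 : ∀ x, 1 ≤ ‖x‖ → κ x = 0)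
    (hlip : ∃ L, LipschitzWith L κ) : IsStarKernel K₀ κ (fun s => 1 - η₁ * exp (-η₂ * s)) τ K := by
  have hexp : ∀ s, 0 ≤ s → exp (-η₂ * s) ≤ 1 := fun s hs => exp_le_one_iff.2 (by nlinarith)
  have hη : 0 ≤ η₁ / η₂ := div_nonneg hη₁.1 hη₂.le
  refine ⟨hK, hK₀, hK₀_pos, hκ_pos, h0, hneg, h1, hlip, by fun_prop, fun s hs => ?_,
    fun s _ => ?_, ?_, fun t ht => ?_, ⟨η₁ / η₂, fun t ht => ?_⟩, fun t ht => ?_⟩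
  · have := mul_le_mul hη₁.2 (hexp s hs) (exp_pos _).le zero_le_one
    linarith
  · have := mul_nonneg hη₁.1 (exp_pos (-η₂ * s)).le
    linarith
  · obtain ⟨ha, hb⟩ := hτ 0 le_rfl
    by_contra hne
    have hpos := lt_of_le_of_ne ha (Ne.symm hne)
    have h2 := add_one_lt_exp (mul_ne_zero (neg_ne_zero.2 hη₂.ne') hpos.ne')
    have h3 : 0 ≤ 1 - exp (-η₂ * τ 0) := sub_nonneg.2 (hexp _ ha)
    have h4 : η₁ / η₂ * (1 - exp (-η₂ * τ 0)) ≤ 1 / η₂ * (1 - exp (-η₂ * τ 0)) := by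
      gcongr
      exact hη₁.2
    have h5 : 1 / η₂ * (1 - exp (-η₂ * τ 0)) < 1 / η₂ * (η₂ * τ 0) := by
      gcongr
      linarith
    rw [← mul_assoc, one_div_mul_cancel hη₂.ne', one_mul] at h5
    linarith
  · obtain ⟨ha, hb⟩ := hτ t ht
    have := mul_nonneg hη (sub_nonneg.2 (hexp _ ha))
    linarith
  · obtain ⟨ha, hb⟩ := hτ t ht
    have := mul_nonneg hη (exp_pos (-η₂ * τ t)).le
    linarith
  · obtain ⟨ha, hb⟩ := hτ t ht
    rw [setIntegral_one_sub_mul_exp hη₂.ne' ha, hb]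

theorem continuous_of_holder {V : Type*} [NormedAddCommGroup V] {K₀ : V → V → ℝ}
    (h : ∃ C β : ℝ, 0 < β ∧ β ≤ 1 ∧ ∀ x y x' y',
      |K₀ x y - K₀ x' y'| ≤ C * (‖x - x'‖ + ‖y - y'‖) ^ β) :
    Continuous fun p : V × V => K₀ p.1 p.2 := by
  obtain ⟨C, β, hβ, -, hC⟩ := h
  refine continuous_iff_continuousAt.2 fun p => tendsto_iff_dist_tendsto_zero.2 ?_
  have h1 : Continuous fun q : V × V => C * (‖q.1 - p.1‖ + ‖q.2 - p.2‖) ^ β :=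
    ((by fun_prop : Continuous fun q : V × V => ‖q.1 - p.1‖ + ‖q.2 - p.2‖).rpow_const
      fun _ => Or.inr hβ.le).const_mul C
  refine squeeze_zero (fun _ => dist_nonneg) (fun q => hC q.1 q.2 p.1 p.2) ?_
  simpa [zero_rpow hβ.ne'] using h1.tendsto p

end Density

section Energy

variable {d : ℕ}

/-- Two-point bound for the kept weights in terms of the gauge energy kernel. -/
theorem IsStarField.exists_near_bound {Ω : Type*} {mΩ : MeasurableSpace Ω} {P : Measure Ω}
    {X : ℝ → EuclideanSpace ℝ (Fin d) → Ω → ℝ}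
    {k : ℝ → EuclideanSpace ℝ (Fin d) → EuclideanSpace ℝ (Fin d) → ℝ} {γ κ₀ : ℝ} {ρ : ℝ → ℝ}
    (hX : IsStarField X k P) (hγ : 7 / 5 ≤ γ) (hγd : γ ^ 2 = 2 * d) (hd : 1 ≤ d)
    (hm : MonotoneOn ρ (Ici 0)) (hc : ConcaveOn ℝ (Ici 0) ρ)
    (hn : ∀ u, 0 ≤ u → 0 ≤ ρ u) (h0 : ρ 0 = 0)
    (hs : Summable fun j : ℕ => 2 * ρ (2 ^ (j + 1)) / √(2 ^ j))
    (hl : ∃ u₀ : ℝ, ∀ u, u₀ ≤ u → u ^ ((1 : ℝ) / 4) ≤ ρ u) :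
    ∃ B : ENNReal, B ≠ ⊤ ∧ ∀ q a : ℝ, 0 ≤ q → 0 ≤ a → ∀ u t, 1 ≤ u → u ≤ t →
      ∀ p : EuclideanSpace ℝ (Fin d) × EuclideanSpace ℝ (Fin d), p.1 ≠ p.2 → k 0 p.1 p.2 ≤ κ₀ →
      ‖p.1 - p.2‖ ≤ exp (-u) → ofReal (π * t / 2) *
        ∫⁻ ω, keptWt γ X k (logBar q a) (fun s => -(2 * ρ (max s 1))) u t p.1 ω *
          keptWt γ X k (logBar q a) (fun s => -(2 * ρ (max s 1))) u t p.2 ω ∂P ≤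
      B * ofReal (indicator {q : EuclideanSpace ℝ (Fin d) × EuclideanSpace ℝ (Fin d) |
        ‖q.1 - q.2‖ ≤ 1} (fun q => ‖q.1 - q.2‖ ^ (-(d : ℝ)) *
          exp (-ρ (log (1 / ‖q.1 - q.2‖)))) p) := by
  obtain ⟨C₂, hC₂, hadd⟩ := exists_le_add_sub hm hc hn h0 hs
  obtain ⟨C₁, hC₁⟩ := exists_le_mul_exp hn hl
  have hd' : (1 : ℝ) ≤ d := by exact_mod_cast hd
  refine ⟨ofReal ((50 + π * C₁ * exp C₂) * exp (γ ^ 2 * κ₀)), ofReal_ne_top,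
    fun q a hq ha u t hu hut p hp hkp hpu => ?_⟩
  have hC := isCorridor_logBar hq ha hm hc hn hs
  have hr : 0 < ‖p.1 - p.2‖ := norm_pos_iff.2 (sub_ne_zero.2 hp)
  have hv : u ≤ -log ‖p.1 - p.2‖ := le_neg_of_le_neg ((log_le_iff_le_exp hr).2 hpu)
  have hC₁0 : 0 ≤ C₁ := by
    by_contra hcon
    have h2 := hC₁ 1 le_rfl
    have := mul_neg_of_neg_of_pos (not_le.1 hcon) (exp_pos (ρ 1))
    linarith
  refine (hX.lintegral_keptWt_mul_le hγ hC.upper.cont hC.cont (fun s hs => hC.nonneg s hs) hn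
    (fun s hs => by rw [max_eq_left hs]) hC₁ hC₂ (fun s v hs hsv => ?_) hu hut hv
    (by rw [neg_neg, exp_log hr])).trans ?_
  · have h1 := hadd s v (by linarith) hsv
    have h2 : v - s ≤ γ ^ 2 / 2 * (v - s) := by
      rw [hγd]
      nlinarith
    linarith
  · rw [← ofReal_mul (by positivity)]
    refine ofReal_le_ofReal ?_
    have hp1 : p ∈ {q : EuclideanSpace ℝ (Fin d) × EuclideanSpace ℝ (Fin d) |
        ‖q.1 - q.2‖ ≤ 1} := hpu.trans (exp_le_one_iff.2 (by linarith))
    rw [indicator_of_mem hp1, one_div, log_inv, rpow_def_of_pos hr, ← exp_add, mul_assoc _ (exp _),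
      ← exp_add]
    refine mul_le_mul_of_nonneg_left (exp_le_exp.2 ?_) (by positivity)
    rw [hγd]
    have := mul_le_mul_of_nonneg_left hkp (by positivity : (0 : ℝ) ≤ 2 * d)
    linarith

theorem ae_fst_ne_snd {V : Type*} [NormedAddCommGroup V] [MeasurableSpace V] [BorelSpace V]
    [SecondCountableTopology V] (ν : Measure V) [IsFiniteMeasure ν] [NullSingletonClass ν] :
    ∀ᵐ p ∂(ν.prod ν), p.1 ≠ p.2 := by
  have hm : MeasurableSet {p : V × V | p.1 = p.2} :=
    measurableSet_eq_fun measurable_fst measurable_snd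
  rw [ae_iff]
  simp only [ne_eq, not_not]
  rw [Measure.measure_prod_null hm]
  refine Eventually.of_forall fun x => ?_
  have : Prod.mk x ⁻¹' {p : V × V | p.1 = p.2} = {x} := by
    ext y
    simp [eq_comm]
  show ν _ = 0
  rw [this, measure_singleton]

end Energy

/-- **Convergence of the critical martingale.**  For every bounded Borel set `E`,
`√(πt/2)·M_t(E)` converges in probability, as `t → ∞`, to `D̄_∞(E) := limsup_{t→∞} D_t(E)`. -/
theorem critical_martingale_convergence
    (d : ℕ) (hd : 1 ≤ d)
    (κ : EuclideanSpace ℝ (Fin d) → ℝ)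
    (hκ_smooth : ContDiff ℝ (⊤ : ℕ∞) κ) (hκ_supp : HasCompactSupport κ)
    (κt : ℝ → ℝ) (hκ_rad : ∀ x, κ x = κt ‖x‖)
    (hκt_nonneg : ∀ r, 0 ≤ r → 0 ≤ κt r) (hκt_zero : κt 0 = 1)
    (hκt_one : ∀ r, 1 ≤ r → κt r = 0)
    (hκ_posdef : ∀ (n : ℕ) (c : Fin n → ℝ) (p : Fin n → EuclideanSpace ℝ (Fin d)),
      0 ≤ ∑ i, ∑ j, c i * c j * κ (p i - p j))
    (η₁ η₂ : ℝ) (hη₁ : η₁ ∈ Set.Icc (0 : ℝ) 1) (hη₂ : 0 < η₂)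
    (K₀ : EuclideanSpace ℝ (Fin d) → EuclideanSpace ℝ (Fin d) → ℝ)
    (hK₀_posdef : ∀ (n : ℕ) (c : Fin n → ℝ) (p : Fin n → EuclideanSpace ℝ (Fin d)),
      0 ≤ ∑ i, ∑ j, c i * c j * K₀ (p i) (p j))
    (hK₀_holder : ∃ C β : ℝ, 0 < β ∧ β ≤ 1 ∧ ∀ x y x' y',
      |K₀ x y - K₀ x' y'| ≤ C * (‖x - x'‖ + ‖y - y'‖) ^ β)
    (tprime : ℝ → ℝ)
    (htprime : ∀ t, 0 ≤ t → 0 ≤ tprime t ∧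
      tprime t - (η₁ / η₂) * (1 - Real.exp (-η₂ * tprime t)) = t)
    (K : ℝ → EuclideanSpace ℝ (Fin d) → EuclideanSpace ℝ (Fin d) → ℝ)
    (hK : ∀ t x y, K t x y = K₀ x y +
      ∫ s in Set.Ioc (0 : ℝ) (tprime t),
        (1 - η₁ * Real.exp (-η₂ * s)) * κ (Real.exp s • (x - y)))
    {Ω : Type*} [MeasurableSpace Ω] (P : Measure Ω) [IsProbabilityMeasure P]
    (X : ℝ → EuclideanSpace ℝ (Fin d) → Ω → ℝ)
    (hX_meas : ∀ t x, Measurable (X t x))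
    (hX_cont : ∀ ω, Continuous fun p : ℝ × EuclideanSpace ℝ (Fin d) => X p.1 p.2 ω)
    (hX_gauss : ∀ (n : ℕ) (c : Fin n → ℝ) (ts : Fin n → ℝ)
        (xs : Fin n → EuclideanSpace ℝ (Fin d)), (∀ i, 0 ≤ ts i) →
      P.map (fun ω => ∑ i, c i * X (ts i) (xs i) ω) =
        gaussianReal 0
          (Real.toNNReal (∑ i, ∑ j, c i * c j * K (min (ts i) (ts j)) (xs i) (xs j))))
    (ρ : ℝ → ℝ)
    (hρ_mono : MonotoneOn ρ (Set.Ici 0))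
    (hρ_concave : ConcaveOn ℝ (Set.Ici 0) ρ)
    (hρ_nonneg : ∀ u, 0 ≤ u → 0 ≤ ρ u) (hρ_zero : ρ 0 = 0)
    (hρ_int : ∫⁻ u in Set.Ici (1 : ℝ), ENNReal.ofReal (ρ u * u ^ (-(3 : ℝ) / 2)) < ⊤)
    (hρ_large : ∃ u₀ : ℝ, ∀ u, u₀ ≤ u → u ^ ((1 : ℝ) / 4) ≤ ρ u)
    (μ : Measure (EuclideanSpace ℝ (Fin d))) [IsLocallyFiniteMeasure μ]
    (hμ : ∀ Kc : Set (EuclideanSpace ℝ (Fin d)), IsCompact Kc →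
      ∫⁻ p in Kc ×ˢ Kc,
          ENNReal.ofReal
            (Set.indicator {q : EuclideanSpace ℝ (Fin d) × EuclideanSpace ℝ (Fin d) |
                ‖q.1 - q.2‖ ≤ 1}
              (fun q => ‖q.1 - q.2‖ ^ (-(d : ℝ)) *
                Real.exp (-ρ (Real.log (1 / ‖q.1 - q.2‖)))) p)
          ∂(μ.prod μ) < ⊤)
    (E : Set (EuclideanSpace ℝ (Fin d)))
    (hE_meas : MeasurableSet E) (hE_bdd : Bornology.IsBounded E)
    (M : ℝ → Ω → ℝ)
    (hM : ∀ t ω, M t ω = ∫ x in E,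
      Real.exp (Real.sqrt (2 * d) * X t x ω - d * K t x x) ∂μ)
    (D : ℝ → Ω → ℝ)
    (hD : ∀ t ω, D t ω = ∫ x in E,
      (Real.sqrt (2 * d) * K t x x - X t x ω) *
        Real.exp (Real.sqrt (2 * d) * X t x ω - d * K t x x) ∂μ) :
    TendstoInMeasure P
      (fun t ω => Real.sqrt (π * t / 2) * M t ω)
      atTop
      (fun ω => limsup (fun t => D t ω) atTop) := by
  have hκ_rad0 : ∀ x, 1 ≤ ‖x‖ → κ x = 0 := fun x hx => by rw [hκ_rad, hκt_one _ hx]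
  have hS : IsStarKernel K₀ κ (fun s => 1 - η₁ * exp (-η₂ * s)) tprime K :=
    IsStarKernel.of_exp_density hη₁ hη₂ htprime hK (continuous_of_holder hK₀_holder) hK₀_posdef
      hκ_posdef (by rw [hκ_rad, norm_zero, hκt_zero])
      (fun x => by rw [hκ_rad, hκ_rad, norm_neg]) hκ_rad0
      (hκ_smooth.lipschitzWith_of_hasCompactSupport hκ_supp (by simp))
  have hX := hS.isStarField hX_meas hX_cont hX_gauss
  set k : ℝ → EuclideanSpace ℝ (Fin d) → EuclideanSpace ℝ (Fin d) → ℝ :=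
    fun t x y => (K t x y + K t y x) / 2 with hk
  have hk0 : ∀ x y, k 0 x y = (K₀ x y + K₀ y x) / 2 := fun x y => by
    simp only [hk, hS.zero]
  have hkdiag : ∀ x, k 0 x x = K₀ x x := fun x => by rw [hk0]; ring
  have hkc : Continuous fun p : EuclideanSpace ℝ (Fin d) × EuclideanSpace ℝ (Fin d) =>
      k 0 p.1 p.2 := by
    simp only [hk0]
    exact (hS.cont₀.add (hS.cont₀.comp continuous_swap)).div_const 2
  have hd' : (1 : ℝ) ≤ d := by exact_mod_cast hd
  set γ : ℝ := √(2 * d) with hγdef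
  have hγd : γ ^ 2 = 2 * d := sq_sqrt (by positivity)
  have hγ : 7 / 5 ≤ γ := le_sqrt_of_sq_le (by linarith)
  have hγ0 : 0 < γ := by linarith
  obtain ⟨R, hR⟩ := hE_bdd.subset_closedBall 0
  set Kc : Set (EuclideanSpace ℝ (Fin d)) := Metric.closedBall 0 (max R 0) with hKc
  have hKcomp : IsCompact Kc := isCompact_closedBall 0 _
  have hEK : E ⊆ Kc := hR.trans (Metric.closedBall_subset_closedBall (le_max_left R 0))
  set ν := μ.restrict E with hνdef
  have hνK : ν ≤ μ.restrict Kc := Measure.restrict_mono hEK le_rfl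
  have : IsFiniteMeasure (μ.restrict Kc) := ⟨by
    rw [Measure.restrict_apply_univ]
    exact hKcomp.measure_lt_top⟩
  have : IsFiniteMeasure ν := isFiniteMeasure_of_le _ hνK
  have hνmem : ∀ᵐ x ∂ν, x ∈ Kc := (ae_restrict_mem hE_meas).mono fun x hx => hEK hx
  set ν' := ν.restrict {x | ν {x} ≠ 0}ᶜ with hν'
  have : NullSingletonClass ν' := nullSingletonClass_restrict_compl ν
  have hν'mem : ∀ᵐ x ∂ν', x ∈ Kc := ae_restrict_of_ae hνmem
  obtain ⟨κ₀, hκ₀⟩ := ((hKcomp.prod hKcomp).image hkc).bddAbove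
  have hprod : ∀ᵐ p ∂(ν'.prod ν'), k 0 p.1 p.2 ≤ κ₀ := by
    filter_upwards [Measure.quasiMeasurePreserving_fst.ae hν'mem,
      Measure.quasiMeasurePreserving_snd.ae hν'mem] with p h1 h2
    exact hκ₀ ⟨p, ⟨h1, h2⟩, rfl⟩
  have hsum := summable_dyadic_of_lintegral hρ_mono hρ_nonneg hρ_int
  obtain ⟨B, hB, hnear⟩ := hX.exists_near_bound (κ₀ := κ₀) hγ hγd hd hρ_mono hρ_concave hρ_nonneg
    hρ_zero hsum hρ_large
  have hfin : ∫⁻ p, B * ofReal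
      (indicator {q : EuclideanSpace ℝ (Fin d) × EuclideanSpace ℝ (Fin d) | ‖q.1 - q.2‖ ≤ 1}
        (fun q => ‖q.1 - q.2‖ ^ (-(d : ℝ)) * exp (-ρ (log (1 / ‖q.1 - q.2‖)))) p)
      ∂(ν'.prod ν') ≠ ⊤ := by
    rw [lintegral_const_mul' _ _ hB]
    refine ENNReal.mul_ne_top hB (ne_top_of_le_ne_top (hμ Kc hKcomp).ne ?_)
    rw [← Measure.prod_restrict]
    have hle : ν' ≤ μ.restrict Kc := Measure.restrict_le_self.trans hνK
    exact lintegral_mono' (Measure.prod_mono hle hle) le_rfl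
  have hnear' : ∀ q a : ℝ, 0 ≤ q → 0 ≤ a → ∀ u t, 1 ≤ u → u ≤ t → ∀ᵐ p ∂(ν'.prod ν'),
      ‖p.1 - p.2‖ ≤ exp (-u) → _ := fun q a hq ha u t hu hut => by
    filter_upwards [ae_fst_ne_snd ν', hprod] with p h1 h2 h3
    exact hnear q a hq ha u t hu hut p h1 h2 h3
  have hcor := fun (q a : ℝ) (hq : 0 ≤ q) (ha : 0 ≤ a) =>
    isCorridor_logBar hq ha hρ_mono hρ_concave hρ_nonneg hsum
  obtain ⟨C, hC, hmod⟩ := hS.exists_modulus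
  have hmod' : ∀ t x y, 0 ≤ t → t - (k t x y - k 0 x y) ≤ C * (exp t * ‖x - y‖) := by
    intro t x y ht
    have h1 := hmod t x y ht
    have h2 := hS.swap t x y
    rw [hk0]
    show t - ((K t x y + K t y x) / 2 - _) ≤ _
    linarith
  obtain ⟨A, hA, hnet⟩ := exists_euclidean_net d (le_max_right R 0)
  have haγ : (d : ℝ) + 2 ≤ γ * ((d + 2) / γ) := (mul_div_cancel₀ _ hγ0.ne').ge
  have hex := hX.tendsto_measure_exceed (Kc := Kc) hC hγ0 hγd haγ hmod' hA fun h h0 h1 => by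
    obtain ⟨G, hG1, hG2⟩ := hnet h h0 h1
    exact ⟨G, hG1, fun x hx => hG2 x (mem_closedBall_zero_iff.1 hx)⟩
  have hwt : ∀ t, 0 ≤ t → ∀ x ω, exp (γ * X t x ω - d * K t x x) = expWt γ X k t x ω := by
    intro t ht x ω
    rw [expWt, hkdiag, hS.diag ht, hγd]
    congr 2
    ring
  have hMt : ∀ t, 0 ≤ t → ∀ ω, M t ω = totMass γ X k ν t ω := fun t ht ω => by
    rw [hM, totMass]
    exact integral_congr_ae (Eventually.of_forall fun x => hwt t ht x ω)
  have hDt : ∀ᶠ t in atTop, ∀ ω, D t ω =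
      ∫ x, (γ * (k 0 x x + t) - X t x ω) * expWt γ X k t x ω ∂ν := by
    filter_upwards [eventually_ge_atTop 0] with t ht ω
    rw [hD]
    refine integral_congr_ae (Eventually.of_forall fun x => ?_)
    show _ * _ = _ * _
    rw [hwt t ht, hkdiag, hS.diag ht]
  refine tendstoInMeasure_of_forall_exists fun δ hδ => ?_
  obtain ⟨q, hq, hq1⟩ := ((hex.eventually (ge_mem_nhds (pos_iff_ne_zero.2 hδ))).and
    (eventually_ge_atTop 1)).exists
  refine ⟨(toMeasurable P {ω | ∃ x ∈ Kc, ∃ t, 0 ≤ t ∧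
    q + (d + 2) / γ * log (1 + t) < rel γ X x t ω})ᶜ, ?_, fun ε hε => ?_⟩
  · rw [compl_compl, measure_toMeasurable]
    exact hq
  · have hcon := hX.tendsto_measure_totMass_sub_limsup (ν := ν) (Kc := Kc)
      (a := (d + 2) / γ) (hkc.comp (continuous_id.prodMk continuous_id)) hγ0 hKcomp hνmem hq1
      (by positivity) (measurableSet_toMeasurable P {ω | ∃ x ∈ Kc, ∃ t, 0 ≤ t ∧
        q + (d + 2) / γ * log (1 + t) < rel γ X x t ω}).compl (fun ω hω x hx t ht => ?_)
      (fun q a hq ha ε hε => hX.eventually_close hγ0.le (hcor q a hq ha) hprod hfin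
        (hnear' q a hq ha) hε)
      (fun q a hq ha ε hε => hX.eventually_close_derivMass hγ0.le (hcor q a hq ha) hprod hfin
        (hnear' q a hq ha) hε) hDt hε
    · refine hcon.congr' ?_
      filter_upwards [eventually_ge_atTop 0] with t ht
      simp only [hMt t ht]
    · by_contra hcon
      rw [not_le, logBar, abs_of_nonneg ht] at hcon
      exact hω (subset_toMeasurable P _ ⟨x, hx, t, ht, hcon⟩)
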